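/- Let c_n denote the number of congruence subgroups of SL_2(ℤ) of index at most n. Then the limit as n → ∞ of (log c_n) / ((log n)^2 / log log n) exists and equals (3 − 2√2)/4. -/

import Mathlib

open Filter

/-- `H` is a congruence subgroup of `SL_d(ℤ)`: it contains the kernel of the
reduction homomorphism `SL_d(ℤ) → SL_d(ℤ/mℤ)` for some integer `m ≥ 1`. -/
def IsCongruenceSubgroup {d : ℕ} (H : Subgroup (Matrix.SpecialLinearGroup (Fin d) ℤ)) : Prop :=
  ∃ m : ℕ, 1 ≤ m ∧
    (Matrix.SpecialLinearGroup.map (n := Fin d) (Int.castRingHom (ZMod m))).ker ≤ H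

/-- The number of congruence subgroups of `SL_d(ℤ)` of index at most `n`. -/
noncomputable def congCount (d n : ℕ) : ℕ :=
  Nat.card {H : Subgroup (Matrix.SpecialLinearGroup (Fin d) ℤ) //
    IsCongruenceSubgroup H ∧ H.index ≤ n}

set_option linter.all false

namespace CG

abbrev SL2 (R : Type*) [CommRing R] := Matrix.SpecialLinearGroup (Fin 2) R

variable {R : Type*} [CommRing R]

def e12 (x : R) : SL2 R := ⟨!![1, x; 0, 1], by simp [Matrix.det_fin_two]⟩
def e21 (x : R) : SL2 R := ⟨!![1, 0; x, 1], by simp [Matrix.det_fin_two]⟩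
def wmat : SL2 R := ⟨!![0, 1; -1, 0], by simp [Matrix.det_fin_two]⟩

lemma sl_mul (A B : SL2 R) (i j : Fin 2) : (A * B) i j = A i 0 * B 0 j + A i 1 * B 1 j := by
  rw [Matrix.SpecialLinearGroup.coe_mul, Matrix.mul_apply, Fin.sum_univ_two]

@[simp] lemma e12_00 (x : R) : e12 x 0 0 = 1 := rfl
@[simp] lemma e12_01 (x : R) : e12 x 0 1 = x := rfl
@[simp] lemma e12_10 (x : R) : e12 x 1 0 = 0 := rfl
@[simp] lemma e12_11 (x : R) : e12 x 1 1 = 1 := rfl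
@[simp] lemma e21_00 (x : R) : e21 x 0 0 = 1 := rfl
@[simp] lemma e21_01 (x : R) : e21 x 0 1 = 0 := rfl
@[simp] lemma e21_10 (x : R) : e21 x 1 0 = x := rfl
@[simp] lemma e21_11 (x : R) : e21 x 1 1 = 1 := rfl
@[simp] lemma wmat_00 : (wmat : SL2 R) 0 0 = 0 := rfl
@[simp] lemma wmat_01 : (wmat : SL2 R) 0 1 = 1 := rfl
@[simp] lemma wmat_10 : (wmat : SL2 R) 1 0 = -1 := rfl
@[simp] lemma wmat_11 : (wmat : SL2 R) 1 1 = 0 := rfl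

lemma sl_ext {A B : SL2 R} (h00 : A 0 0 = B 0 0) (h01 : A 0 1 = B 0 1) (h10 : A 1 0 = B 1 0)
    (h11 : A 1 1 = B 1 1) : A = B := by
  ext i j; fin_cases i <;> fin_cases j <;> assumption

lemma sl_det (A : SL2 R) : A 0 0 * A 1 1 - A 0 1 * A 1 0 = 1 := by
  have := A.2; rwa [Matrix.det_fin_two] at this

lemma sl_ext' {A B : SL2 R} (hu : IsUnit (A 0 0)) (h00 : A 0 0 = B 0 0) (h01 : A 0 1 = B 0 1)
    (h10 : A 1 0 = B 1 0) : A = B := by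
  refine sl_ext h00 h01 h10 (hu.mul_left_cancel ?_)
  have h1 := sl_det A
  have h2 := sl_det B
  rw [← h00, ← h01, ← h10] at h2
  linear_combination h1 - h2

lemma e12_add (x y : R) : e12 (x + y) = e12 x * e12 y := by
  apply sl_ext <;> simp [sl_mul, add_comm]

lemma e12_zero : e12 (0 : R) = 1 := by
  ext i j; fin_cases i <;> fin_cases j <;> simp [e12]

lemma e12_pow (x : R) (n : ℕ) : e12 x ^ n = e12 (n * x) := by
  induction n with
  | zero => simp [e12_zero]
  | succ n ih => rw [pow_succ, ih, ← e12_add]; push_cast; ring_nf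

lemma e21_eq (x : R) : e21 x = wmat * e12 (-x) * wmat⁻¹ := by
  rw [eq_mul_inv_iff_mul_eq]
  apply sl_ext <;> simp [sl_mul]

/-- U1 -/
lemma mem_of_elem_mem [IsLocalRing R] (D : Subgroup (SL2 R)) (c : R)
    (H12 : ∀ (y : R), e12 (c * y) ∈ D) (H21 : ∀ (y : R), e21 (c * y) ∈ D)
    (HM : ∀ (y : R), e12 1 * e21 (c * y) * (e12 1)⁻¹ ∈ D) (x : SL2 R)
    (h00 : c ∣ x 0 0 - 1) (h01 : c ∣ x 0 1) (h10 : c ∣ x 1 0) : x ∈ D := by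
  have key : ∀ x : SL2 R, c ∣ x 0 0 - 1 → c ∣ x 0 1 → c ∣ x 1 0 → IsUnit (x 0 0) → x ∈ D := by
    intro x h00 h01 h10 hu
    obtain ⟨a1, ha⟩ := h00
    obtain ⟨b1, hb⟩ := h01
    obtain ⟨c1, hc⟩ := h10
    obtain ⟨u, hu⟩ := hu
    have hM := HM a1
    have ha' : x 0 0 = 1 + c * a1 := by rw [← ha]; ring
    set v : R := ((u⁻¹ : Rˣ) : R) with hv
    have huv : x 0 0 * v = 1 := by rw [← hu, hv]; simp
    have heq : x = e21 (c * ((c1 - a1) * v)) * (e12 1 * e21 (c * a1) * (e12 1)⁻¹)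
        * e12 (c * ((b1 + a1) * v)) := by
      have hi : (e12 (1 : R))⁻¹ = e12 (-1) := by
        rw [inv_eq_iff_mul_eq_one, ← e12_add]; simp [e12_zero]
      rw [hi]
      rw [ha'] at huv
      apply sl_ext' ⟨u, hu⟩ <;> simp [sl_mul]
      · linear_combination ha'
      · linear_combination hb - (c*(b1+a1)) * huv
      · linear_combination hc - (c*(c1-a1)) * huv
    rw [heq]
    refine D.mul_mem (D.mul_mem ?_ hM) (H12 _)
    exact H21 _
  by_cases hu : IsUnit (x 0 0)
  · exact key x h00 h01 h10 hu
  have hcu : IsUnit c := by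
    by_contra hc
    obtain ⟨a1, ha⟩ := h00
    have : x 0 0 = 1 + c * a1 := by rw [← ha]; ring
    apply hu
    rcases IsLocalRing.isUnit_or_isUnit_of_add_one (a := x 0 0) (b := - (c * a1)) (by rw [this]; ring) with h | h
    · exact h
    · exact absurd (isUnit_of_mul_isUnit_left (by simpa using h)) hc
  have hc1 : IsUnit (x 1 0) := by
    have hdet := sl_det x
    rcases IsLocalRing.isUnit_or_isUnit_of_add_one (a := x 0 0 * x 1 1) (b := - (x 0 1 * x 1 0)) (by linear_combination hdet) with h | h
    · exact absurd (isUnit_of_mul_isUnit_left h) hu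
    · exact isUnit_of_mul_isUnit_right (x := x 0 1) (by simpa using h)
  have hu' : IsUnit (x 0 0 + x 1 0) := by
    by_contra hn
    have := IsLocalRing.nonunits_add hn (b := - x 0 0) (by simpa using hu)
    apply this; convert hc1 using 1; ring
  have : e12 1 * x ∈ D := by
    apply key
    · exact hcu.dvd
    · exact hcu.dvd
    · exact hcu.dvd
    · convert hu' using 1
      simp [sl_mul]
  have h1 : e12 (1 : R) ∈ D := by
    obtain ⟨u, hu⟩ := hcu
    have := H12 ((u⁻¹ : Rˣ) : R)
    rw [← hu] at this; simpa using this
  exact (D.mul_mem_cancel_left h1).1 this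

lemma mem_of_conj_mem [IsLocalRing R] (D : Subgroup (SL2 R)) (c : R)
    (h : ∀ (g : SL2 R) (y : R), g * e12 (c * y) * g⁻¹ ∈ D) (x : SL2 R)
    (h00 : c ∣ x 0 0 - 1) (h01 : c ∣ x 0 1) (h10 : c ∣ x 1 0) : x ∈ D := by
  have H21 : ∀ (g : SL2 R) (y : R), g * e21 (c * y) * g⁻¹ ∈ D := fun g y => by
    have := h (g * wmat) (-y)
    rw [e21_eq]
    convert this using 1
    simp only [mul_neg, mul_inv_rev]
    group
  exact mem_of_elem_mem D c (fun y => by simpa using h 1 y) (fun y => by simpa using H21 1 y)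
    (H21 _) x h00 h01 h10

end CG

namespace CG

instance localRing_zmod (p k : ℕ) [hp : Fact p.Prime] [hk : NeZero k] : IsLocalRing (ZMod (p ^ k)) := by
  haveI : Fact (1 < p ^ k) := ⟨Nat.one_lt_pow hk.out hp.out.one_lt⟩
  refine IsLocalRing.of_isUnit_or_isUnit_one_sub_self fun a => ?_
  by_cases h : p ∣ a.val
  · right
    rw [← ZMod.natCast_zmod_val (1 - a), ZMod.isUnit_iff_coprime]
    refine Nat.Coprime.pow_right _ (Nat.Coprime.symm ((Nat.Prime.coprime_iff_not_dvd hp.out).2 ?_))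
    intro h2
    have : ((p : ℕ) : ZMod (p^k)) ∣ 1 := by
      have e : (1 : ZMod (p^k)) = ((1 - a).val : ZMod (p^k)) + (a.val : ZMod (p^k)) := by simp
      rw [e]; exact dvd_add (Nat.cast_dvd_cast h2) (Nat.cast_dvd_cast h)
    have := isUnit_of_dvd_one this
    rw [ZMod.isUnit_iff_coprime] at this
    have h3 := Nat.Coprime.coprime_dvd_right (dvd_pow_self p hk.out) this
    simp at h3
    exact hp.out.one_lt.ne' h3
  · left
    rw [← ZMod.natCast_zmod_val a, ZMod.isUnit_iff_coprime]
    exact Nat.Coprime.pow_right _ (Nat.Coprime.symm ((Nat.Prime.coprime_iff_not_dvd hp.out).2 h))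

lemma conj_pow {G : Type*} [Group G] (g x : G) (n : ℕ) : g * x ^ n * g⁻¹ = (g * x * g⁻¹) ^ n := by
  simp [_root_.conj_pow]

/-- U2 -/
lemma conj_mem_of_index {p k : ℕ} [hp : Fact p.Prime] (C : Subgroup (SL2 (ZMod (p ^ k)))) (j : ℕ)
    (hC : C.index ≠ 0) (h : C.index < p ^ (j + 1)) (g : SL2 (ZMod (p ^ k))) (y : ZMod (p ^ k)) :
    g * e12 ((p : ZMod (p ^ k)) ^ j * y) * g⁻¹ ∈ C := by
  haveI : NeZero (p ^ k) := ⟨pow_ne_zero _ hp.out.ne_zero⟩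
  set u := g * e12 (1 : ZMod (p^k)) * g⁻¹ with hu
  have hupow : ∀ n : ℕ, u ^ n = g * e12 (n : ZMod (p^k)) * g⁻¹ := by
    intro n; rw [hu, ← conj_pow, e12_pow, mul_one]
  have huo : u ^ (p ^ k) = 1 := by rw [hupow]; simp [e12_zero]
  obtain ⟨m, hm0, hm, hmem⟩ := Subgroup.exists_pow_mem_of_index_ne_zero hC u
  have h1 : u ^ (Nat.gcd m (p ^ k)) ∈ C := by
    have hz : u ^ ((Nat.gcd m (p ^ k) : ℕ) : ℤ) ∈ C := by
      rw [Nat.gcd_eq_gcd_ab, zpow_add, zpow_mul, zpow_mul]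
      simp only [zpow_natCast, huo, one_zpow, mul_one]
      exact C.zpow_mem hmem _
    simpa using hz
  obtain ⟨i, hik, hi⟩ := (Nat.dvd_prime_pow hp.out).1 (Nat.gcd_dvd_right m (p ^ k))
  rw [hi] at h1
  have hij : i ≤ j := by
    have h2 : p ^ i ≤ m := hi ▸ Nat.gcd_le_left _ hm0
    have := (Nat.pow_lt_pow_iff_right hp.out.one_lt).1 (h2.trans_lt (hm.trans_lt h))
    omega
  have h3 : u ^ (p ^ j * y.val) ∈ C := by
    obtain ⟨t, rfl⟩ := Nat.exists_eq_add_of_le hij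
    rw [pow_add, mul_assoc, pow_mul]
    exact C.pow_mem h1 _
  rw [hupow] at h3
  simpa using h3

/-- red -/
def red (p k : ℕ) [NeZero k] : SL2 (ZMod (p ^ k)) →* SL2 (ZMod p) :=
  Matrix.SpecialLinearGroup.map (ZMod.castHom (dvd_pow_self p (NeZero.ne k)) (ZMod p))

lemma one_add_pow_aux {A : Type*} [Ring A] (y : A) (n : ℕ) :
    ∃ f : A, (1 + y) ^ n = 1 + n * y + y ^ 2 * f := by
  induction n with
  | zero => exact ⟨0, by simp⟩
  | succ n ih =>
    obtain ⟨f, hf⟩ := ih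
    refine ⟨n + f * (1 + y), ?_⟩
    rw [pow_succ, hf]
    have : y ^ 2 * (n : A) = n * y ^ 2 := (Nat.cast_commute n (y^2)).symm.eq
    rw [mul_add (y^2), this]; push_cast; noncomm_ring

lemma pow_p_congr {A : Type*} [Ring A] (p i : ℕ) (hi : 1 ≤ i) (x N : A)
    (hx : x = 1 + (p : A) ^ i * N) : ∃ N', x ^ p = 1 + (p : A) ^ (i + 1) * N' := by
  obtain ⟨f, hf⟩ := one_add_pow_aux ((p : A) ^ i * N) p
  have hc : N * (p : A) ^ i = (p : A) ^ i * N := ((Nat.cast_commute p N).pow_left i).symm.eq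
  refine ⟨N + (p : A) ^ (i - 1) * N ^ 2 * f, ?_⟩
  rw [hx, hf, sq, sq, mul_add]
  obtain ⟨t, rfl⟩ := Nat.exists_eq_add_of_le hi
  rw [add_assoc]; congr 1
  congr 1
  · rw [← mul_assoc, ← pow_succ']
  · rw [mul_assoc ((p:A)^(1+t)), ← mul_assoc N, hc]
    simp only [← mul_assoc, ← pow_add]
    congr 4; omega

lemma pow_p_pow {A : Type*} [Ring A] (p i : ℕ) (x N : A)
    (hx : x = 1 + (p : A) * N) : ∃ N', x ^ (p ^ i) = 1 + (p : A) ^ (i + 1) * N' := by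
  induction i with
  | zero => exact ⟨N, by simpa using hx⟩
  | succ i ih =>
    obtain ⟨N', h⟩ := ih
    rw [pow_succ, pow_mul]
    exact pow_p_congr p (i+1) (by omega) _ N' h

lemma zmod_dvd_of_cast {p k : ℕ} [hp : Fact p.Prime] [hk : NeZero k] (a : ZMod (p ^ k))
    (h : ZMod.castHom (dvd_pow_self p (NeZero.ne k)) (ZMod p) a = 0) : (p : ZMod (p ^ k)) ∣ a := by
  haveI : NeZero (p ^ k) := ⟨pow_ne_zero _ hp.out.ne_zero⟩
  rw [← ZMod.natCast_zmod_val a] at h ⊢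
  rw [map_natCast, ZMod.natCast_eq_zero_iff] at h
  exact Nat.cast_dvd_cast h

lemma red_ker_form {p k : ℕ} [hp : Fact p.Prime] [hk : NeZero k] (x : SL2 (ZMod (p ^ k)))
    (h : red p k x = 1) : ∃ N : Matrix (Fin 2) (Fin 2) (ZMod (p ^ k)), x.1 = 1 + (p : Matrix (Fin 2) (Fin 2) (ZMod (p ^ k))) * N := by
  have : ∀ i j, ∃ n, x i j - (1 : Matrix (Fin 2) (Fin 2) (ZMod (p ^ k))) i j = (p : ZMod (p ^ k)) * n := by
    intro i j
    apply zmod_dvd_of_cast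
    have h2 := congrArg (fun y : SL2 (ZMod p) => y i j) h
    simp only [red, Matrix.SpecialLinearGroup.map_apply_coe, RingHom.mapMatrix_apply, Matrix.map_apply] at h2
    rw [map_sub, h2]
    fin_cases i <;> fin_cases j <;> simp only [Matrix.SpecialLinearGroup.coe_one, Matrix.one_apply] <;> simp [-ZMod.castHom_apply]
  choose N hN using this
  refine ⟨N, ?_⟩
  ext i j
  have e : ((p : Matrix (Fin 2) (Fin 2) (ZMod (p ^ k))) * Matrix.of N) i j = p * N i j := by
    rw [← nsmul_eq_mul, Matrix.smul_apply, nsmul_eq_mul]; rfl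
  rw [Matrix.add_apply]
  refine Eq.trans ?_ (congrArg _ e.symm)
  rw [← hN]; ring

lemma red_ker_pow {p k : ℕ} [hp : Fact p.Prime] [hk : NeZero k] (x : SL2 (ZMod (p ^ k)))
    (h : red p k x = 1) : x ^ (p ^ k) = 1 := by
  obtain ⟨N, hN⟩ := red_ker_form x h
  obtain ⟨N', h'⟩ := pow_p_pow p k x.1 N hN
  apply Subtype.ext
  rw [Matrix.SpecialLinearGroup.coe_pow, h', pow_succ]
  have : (p : Matrix (Fin 2) (Fin 2) (ZMod (p ^ k))) ^ k = 0 := by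
    rw [← Nat.cast_pow]
    exact CharP.cast_eq_zero _ _
  rw [this]; simp

lemma card_SL2_mul (p : ℕ) [hp : Fact p.Prime] : Nat.card (SL2 (ZMod p)) = p * (p ^ 2 - 1) := by
  have h1 := Matrix.card_GL_field (𝔽 := ZMod p) 2
  have hk : Nat.card (SL2 (ZMod p)) = Nat.card (Matrix.GeneralLinearGroup.det (n := Fin 2) (R := ZMod p)).ker := by
    refine Nat.card_congr (Equiv.ofBijective (fun x => ⟨Matrix.SpecialLinearGroup.toGL x, ?_⟩) ⟨?_, ?_⟩)
    · rw [MonoidHom.mem_ker]; exact Matrix.SpecialLinearGroup.coeToGL_det x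
    · intro x y h; exact Matrix.SpecialLinearGroup.toGL_injective (congrArg Subtype.val h)
    · rintro ⟨y, hy⟩
      rw [MonoidHom.mem_ker] at hy
      refine ⟨⟨y.1, by simpa using congrArg Units.val hy⟩, ?_⟩
      apply Subtype.ext; ext i j; rfl
  have hr : (Matrix.GeneralLinearGroup.det (n := Fin 2) (R := ZMod p)).ker.index = p - 1 := by
    rw [Subgroup.index_ker, MonoidHom.range_eq_top.2, Subgroup.card_top, Nat.card_units, Nat.card_zmod]
    intro u
    refine ⟨Matrix.GeneralLinearGroup.mk' !![(u : ZMod p), 0; 0, 1] ?_, ?_⟩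
    · simpa using u.invertible
    · ext; simp [Matrix.det_fin_two]
  have h2 := Subgroup.card_mul_index (Matrix.GeneralLinearGroup.det (n := Fin 2) (R := ZMod p)).ker
  rw [← hk, hr, h1] at h2
  simp [-Nat.card_eq_fintype_card, Fin.prod_univ_two, ZMod.card] at h2
  have hp1 := hp.out.one_lt
  refine Nat.eq_of_mul_eq_mul_right (Nat.sub_pos_of_lt hp1) (h2.trans ?_)
  have : p ^ 2 - p = p * (p - 1) := by rw [mul_tsub, mul_one, sq]
  rw [this]; ring

lemma sl_pow_eq_one {p k : ℕ} [hp : Fact p.Prime] [hk : NeZero k] (x : SL2 (ZMod (p ^ k))) :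
    x ^ ((p * (p ^ 2 - 1)) * p ^ k) = 1 := by
  rw [pow_mul, ]
  apply red_ker_pow
  rw [map_pow, ← card_SL2_mul p, pow_card_eq_one']

end CG

namespace CG

section prod
variable {ι : Type*} [Fintype ι] [LinearOrder ι] {G : ι → Type*} [∀ i, Group (G i)]

/-- elements of `H` supported on `s` -/
def supp (H : Subgroup (∀ i, G i)) (s : Finset ι) : Subgroup (∀ i, G i) where
  carrier := {h | h ∈ H ∧ ∀ i, i ∉ s → h i = 1}
  mul_mem' := fun {a b} ha hb => ⟨H.mul_mem ha.1 hb.1, fun i hi => by simp [ha.2 i hi, hb.2 i hi]⟩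
  one_mem' := ⟨H.one_mem, fun _ _ => rfl⟩
  inv_mem' := fun {a} ha => ⟨H.inv_mem ha.1, fun i hi => by simp [ha.2 i hi]⟩

lemma mem_supp {H : Subgroup (∀ i, G i)} {s : Finset ι} {h : ∀ i, G i} :
    h ∈ supp H s ↔ h ∈ H ∧ ∀ i, i ∉ s → h i = 1 := Iff.rfl

def cS (H : Subgroup (∀ i, G i)) (i : ι) : Subgroup (G i) :=
  (supp H (Finset.univ.filter (· ≤ i))).map (Pi.evalMonoidHom G i)

def aS (H : Subgroup (∀ i, G i)) (i : ι) : Subgroup (G i) := H.map (Pi.evalMonoidHom G i)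

def dS (H : Subgroup (∀ i, G i)) (i : ι) : Subgroup (G i) := H.comap (MonoidHom.mulSingle G i)

lemma mem_cS {H : Subgroup (∀ i, G i)} {i : ι} {x : G i} :
    x ∈ cS H i ↔ ∃ h ∈ H, (∀ j, i < j → h j = 1) ∧ h i = x := by
  simp [cS, mem_supp, and_assoc]

lemma mem_aS {H : Subgroup (∀ i, G i)} {i : ι} {x : G i} :
    x ∈ aS H i ↔ ∃ h ∈ H, h i = x := by
  simp [aS]

lemma mem_dS {H : Subgroup (∀ i, G i)} {i : ι} {x : G i} :
    x ∈ dS H i ↔ Pi.mulSingle i x ∈ H := Iff.rfl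

lemma mem_dS' {H : Subgroup (∀ i, G i)} {i : ι} {x : G i} :
    x ∈ dS H i ↔ ∃ h ∈ H, h i = x ∧ ∀ j, j ≠ i → h j = 1 := by
  rw [mem_dS]
  constructor
  · intro h; exact ⟨_, h, by simp, fun j hj => by simp [hj]⟩
  · rintro ⟨h, hh, rfl, h2⟩
    convert hh
    funext j
    by_cases hj : j = i
    · subst hj; simp
    · simp [hj, h2 j hj]

lemma cS_le_aS (H : Subgroup (∀ i, G i)) (i : ι) : cS H i ≤ aS H i := by
  intro x hx
  obtain ⟨h, hh, _, e⟩ := mem_cS.1 hx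
  exact mem_aS.2 ⟨h, hh, e⟩

lemma dS_le_cS (H : Subgroup (∀ i, G i)) (i : ι) : dS H i ≤ cS H i := by
  intro x hx
  exact mem_cS.2 ⟨_, mem_dS.1 hx, fun j hj => by simp [Pi.mulSingle_eq_of_ne hj.ne'], by simp⟩

/-- `C_i` is normalised by `A_i`. -/
lemma cS_normal (H : Subgroup (∀ i, G i)) (i : ι) {x g : G i} (hx : x ∈ cS H i) (hg : g ∈ aS H i) :
    g * x * g⁻¹ ∈ cS H i := by
  obtain ⟨h, hh, h1, rfl⟩ := mem_cS.1 hx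
  obtain ⟨k, hk, rfl⟩ := mem_aS.1 hg
  exact mem_cS.2 ⟨k * h * k⁻¹, H.mul_mem (H.mul_mem hk hh) (H.inv_mem hk), fun j hj => by simp [h1 j hj], rfl⟩

lemma card_supp [∀ i, Finite (G i)] (H : Subgroup (∀ i, G i)) (s : Finset ι)
    (hs : ∀ i ∈ s, ∀ j, j ≤ i → j ∈ s) : Nat.card (supp H s) = ∏ i ∈ s, Nat.card (cS H i) := by
  induction s using Finset.induction_on_max with
  | empty =>
    rw [Finset.prod_empty, Nat.card_eq_one_iff_unique]
    refine ⟨⟨fun a b => ?_⟩, ⟨1⟩⟩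
    ext i
    rw [(mem_supp.1 a.2).2 i (by simp), (mem_supp.1 b.2).2 i (by simp)]
  | insert a s ha ih =>
    have hna : a ∉ s := fun h => lt_irrefl _ (ha a h)
    have hs' : Finset.univ.filter (· ≤ a) = insert a s := by
      ext j
      simp only [Finset.mem_filter, Finset.mem_univ, true_and, Finset.mem_insert]
      constructor
      · intro h
        simpa using hs a (by simp) j h
      · rintro (h | h)
        · exact h.le
        · exact (ha j h).le
    rw [Finset.prod_insert hna, ← ih]
    · let f : supp H (insert a s) →* G a := (Pi.evalMonoidHom G a).comp (supp H (insert a s)).subtype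
      have h1 := Subgroup.card_mul_index f.ker
      rw [Subgroup.index_ker] at h1
      have h2 : f.range = cS H a := by
        rw [cS, hs']
        ext x; simp [f, MonoidHom.mem_range]
      have h3 : Nat.card f.ker = Nat.card (supp H s) := by
        refine Nat.card_congr (Equiv.ofBijective (fun x => ⟨x.1.1, ?_⟩) ⟨?_, ?_⟩)
        · refine ⟨x.1.2.1, fun i hi => ?_⟩
          by_cases h : i = a
          · subst h; exact x.2
          · exact x.1.2.2 i (by simp [h, hi])
        · intro x y h
          apply Subtype.ext; apply Subtype.ext
          have := Subtype.ext_iff.1 h; exact this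
        · rintro ⟨x, hx⟩
          refine ⟨⟨⟨x, hx.1, fun i hi => hx.2 i (by simp at hi; tauto)⟩, hx.2 a hna⟩, rfl⟩
      rw [h2, h3] at h1
      rw [← h1, mul_comm]
    · intro i hi j hj
      have := hs i (by simp [hi]) j hj
      rcases Finset.mem_insert.1 this with h | h
      · subst h; exact absurd (ha i hi) (not_lt.2 hj)
      · exact h

lemma card_eq_prod [∀ i, Finite (G i)] (H : Subgroup (∀ i, G i)) :
    Nat.card H = ∏ i, Nat.card (cS H i) := by
  rw [← card_supp H Finset.univ (by simp)]
  congr 2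
  ext x; simp [mem_supp]

lemma index_eq_prod [∀ i, Finite (G i)] (H : Subgroup (∀ i, G i)) :
    H.index = ∏ i, (cS H i).index := by
  have h1 := H.card_mul_index
  rw [Nat.card_pi, card_eq_prod] at h1
  have h2 : ∏ i, Nat.card (cS H i) * (cS H i).index = ∏ i, Nat.card (G i) :=
    Finset.prod_congr rfl fun i _ => (cS H i).card_mul_index
  rw [Finset.prod_mul_distrib] at h2
  exact Nat.eq_of_mul_eq_mul_left (Finset.prod_pos fun i _ => Nat.card_pos) (h1.trans h2.symm)

end prod
end CG

namespace CG

/-- a finite set of primes -/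
class PSet (S : Finset ℕ) : Prop where
  prime : ∀ p ∈ S, p.Prime

abbrev GS (S : Finset ℕ) (k : ℕ → ℕ) := ∀ p : S, SL2 (ZMod (p.1 ^ k p.1))

variable {S : Finset ℕ} [hS : PSet S] {k : ℕ → ℕ} [hk : ∀ p, NeZero (k p)]

instance fact_pset (p : S) : Fact p.1.Prime := ⟨hS.prime p.1 p.2⟩
instance neZero_pset (p : S) (n : ℕ) : NeZero (p.1 ^ n) := ⟨pow_ne_zero _ (hS.prime p.1 p.2).ne_zero⟩

def eps (p : ℕ) : ℕ := if p = 3 then 1 else 0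

def NN (k : ℕ → ℕ) (p : ℕ) : ℕ := ∏ r ∈ (Finset.range p).filter Nat.Prime, (r * (r ^ 2 - 1)) * r ^ k r

lemma NN_prop (k : ℕ → ℕ) (p : ℕ) (hp : p.Prime) : ∃ M t, p ^ eps p * M = NN k p * t ∧ Nat.Coprime M p := by
  by_cases h3 : p = 3
  · subst h3
    refine ⟨2 * 2 ^ k 2, 1, ?_, ?_⟩
    · have : (Finset.range 3).filter Nat.Prime = {2} := by decide
      rw [NN, this, Finset.prod_singleton]; simp [eps]; ring
    · apply Nat.Coprime.mul_left (by norm_num) (Nat.Coprime.pow_left _ (by norm_num))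
  · refine ⟨NN k p, 1, by simp [eps, h3], ?_⟩
    apply Nat.Coprime.prod_left
    intro r hr
    simp only [Finset.mem_filter, Finset.mem_range] at hr
    have hrp : Nat.Coprime r p := (Nat.coprime_primes hr.2 hp).2 hr.1.ne
    refine Nat.Coprime.mul_left (Nat.Coprime.mul_left hrp ?_) (Nat.Coprime.pow_left _ hrp)
    rw [Nat.coprime_comm, Nat.Prime.coprime_iff_not_dvd hp]
    have e : r ^ 2 - 1 = (r + 1) * (r - 1) := by have := Nat.sq_sub_sq r 1; simpa using this
    rw [e, hp.dvd_mul]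
    have h2 := hr.2.two_le
    rintro (h | h)
    · have := Nat.le_of_dvd (by omega) h
      have hpe : p = r + 1 := by omega
      have : r = 2 := by
        by_contra hne
        have ho := hr.2.odd_of_ne_two hne
        have : Even p := by rw [hpe]; exact ho.add_one
        have := (Nat.Prime.even_iff hp).1 this
        omega
      omega
    · have := Nat.le_of_dvd (by omega) h
      omega

lemma transfer (H : Subgroup (GS S k)) (p : S) (j : ℕ)
    (hj : ∀ (g : SL2 (ZMod (p.1 ^ k p.1))) y, g * e12 ((p.1 : ZMod (p.1 ^ k p.1)) ^ j * y) * g⁻¹ ∈ cS H p)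
    (g : SL2 (ZMod (p.1 ^ k p.1))) (y) :
    g * e12 ((p.1 : ZMod (p.1 ^ k p.1)) ^ (j + eps p) * y) * g⁻¹ ∈ dS H p := by
  obtain ⟨M, t, hMt, hM⟩ := NN_prop k p.1 (Fact.out)
  have hMu : IsUnit (M : ZMod (p.1 ^ k p.1)) := by
    rw [ZMod.isUnit_iff_coprime]; exact hM.pow_right _
  obtain ⟨u, hu⟩ := hMu
  have hj' := hj g (t * ((u⁻¹ : (ZMod (p.1 ^ k p.1))ˣ) : ZMod (p.1 ^ k p.1)) * y)
  obtain ⟨h, hh, h1, h2⟩ := mem_cS.1 hj'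
  rw [mem_dS']
  refine ⟨h ^ (NN k p.1), H.pow_mem hh _, ?_, fun r hrp => ?_⟩
  swap
  rcases lt_or_gt_of_ne hrp with hr | hr
  · have : (r.1 * (r.1 ^ 2 - 1)) * r.1 ^ k r.1 ∣ NN k p.1 := by
      apply Finset.dvd_prod_of_mem (fun r => (r * (r ^ 2 - 1)) * r ^ k r)
      simp only [Finset.mem_filter, Finset.mem_range]
      exact ⟨hr, Fact.out⟩
    obtain ⟨c, hc⟩ := this
    rw [Pi.pow_apply, hc, pow_mul, sl_pow_eq_one, one_pow]
  · rw [Pi.pow_apply, h1 r hr, one_pow]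
  · rw [Pi.pow_apply, h2, ← conj_pow, e12_pow]
    congr 3
    have e : (p.1 : ZMod (p.1 ^ k p.1)) ^ eps p * M = NN k p.1 * t := by exact_mod_cast congrArg (Nat.cast : ℕ → ZMod (p.1 ^ k p.1)) hMt
    rw [← hu] at e
    have e2 : (p.1 : ZMod (p.1 ^ k p.1)) ^ eps p = NN k p.1 * t * ((u⁻¹ : (ZMod (p.1 ^ k p.1))ˣ) : ZMod (p.1 ^ k p.1)) := by
      rw [← e, mul_assoc]; simp
    rw [pow_add, e2]; ring

/-- if index of `C_p` is `< p^(j+1)` then `D_p` contains the principal congruence subgroup of level `p^(j+eps)`. -/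
lemma dS_mem (H : Subgroup (GS S k)) (p : S) (j : ℕ) (hj : (cS H p).index < p.1 ^ (j + 1))
    (x : SL2 (ZMod (p.1 ^ k p.1))) (h00 : (p.1 : ZMod (p.1 ^ k p.1)) ^ (j + eps p) ∣ x 0 0 - 1)
    (h01 : (p.1 : ZMod (p.1 ^ k p.1)) ^ (j + eps p) ∣ x 0 1)
    (h10 : (p.1 : ZMod (p.1 ^ k p.1)) ^ (j + eps p) ∣ x 1 0) : x ∈ dS H p := by
  refine mem_of_conj_mem _ _ (transfer H p j fun g y => ?_) x h00 h01 h10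
  exact conj_mem_of_index _ j Subgroup.index_ne_zero_of_finite hj g y

lemma eq_top_of_index_lt {p k : ℕ} [hp : Fact p.Prime] [NeZero k] (C : Subgroup (SL2 (ZMod (p ^ k))))
    (h : C.index < p) : C = ⊤ := by
  haveI : NeZero (p ^ k) := ⟨pow_ne_zero _ hp.out.ne_zero⟩
  rw [eq_top_iff]
  intro x _
  refine mem_of_conj_mem C 1 (fun g y => ?_) x (one_dvd _) (one_dvd _) (one_dvd _)
  simpa using conj_mem_of_index C 0 Subgroup.index_ne_zero_of_finite (by simpa using h) g y

lemma dvd_index_of_normal {p k : ℕ} [hp : Fact p.Prime] [NeZero k] (C : Subgroup (SL2 (ZMod (p ^ k))))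
    (hn : C.Normal) (h : C ≠ ⊤) : p ∣ C.index := by
  haveI : NeZero (p ^ k) := ⟨pow_ne_zero _ hp.out.ne_zero⟩
  by_contra hnd
  apply h
  rw [eq_top_iff]
  intro x _
  refine mem_of_conj_mem C 1 (fun g y => hn.conj_mem _ ?_ g) x (one_dvd _) (one_dvd _) (one_dvd _)
  rw [one_mul]
  have h1 : e12 y ^ (p ^ k) = 1 := by rw [e12_pow]; simp [e12_zero]
  have hcop : Nat.Coprime (p ^ k) C.index := Nat.Coprime.pow_left _ ((Nat.Prime.coprime_iff_not_dvd hp.out).2 hnd)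
  rw [← QuotientGroup.eq_one_iff, ← orderOf_eq_one_iff]
  apply Nat.eq_one_of_dvd_coprimes hcop
  · apply orderOf_dvd_of_pow_eq_one
    rw [← QuotientGroup.mk_pow, h1, QuotientGroup.mk_one]
  · rw [Subgroup.index]; exact orderOf_dvd_natCard _

/-- no full factor -/
def NoFull (H : Subgroup (GS S k)) : Prop := ∀ p : S, dS H p ≠ ⊤

lemma cS_ne_top (H : Subgroup (GS S k)) (hH : NoFull H) (p : S) (h3 : p.1 ≠ 3) : cS H p ≠ ⊤ := by
  intro h
  apply hH p
  rw [eq_top_iff]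
  intro x _
  have : eps p.1 = 0 := by simp [eps, h3]
  apply dS_mem H p 0 <;> simp [this, h]
  exact (Fact.out : p.1.Prime).one_lt

end CG

namespace CG
variable {S : Finset ℕ} [hS : PSet S] {k : ℕ → ℕ} [hk : ∀ p, NeZero (k p)]

def phi (S : Finset ℕ) (k : ℕ → ℕ) : SL2 ℤ →* GS S k :=
  Pi.monoidHom fun p => Matrix.SpecialLinearGroup.map (Int.castRingHom (ZMod (p.1 ^ k p.1)))

lemma phi_apply (x : SL2 ℤ) (p : S) (i j : Fin 2) : (phi S k x p) i j = ((x i j : ℤ) : ZMod (p.1 ^ k p.1)) := by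
  rfl

lemma phi_e12 (t : ℤ) (p : S) : phi S k (e12 t) p = e12 (t : ZMod (p.1 ^ k p.1)) := by
  apply sl_ext <;> simp only [phi_apply] <;> simp
lemma phi_e21 (t : ℤ) (p : S) : phi S k (e21 t) p = e21 (t : ZMod (p.1 ^ k p.1)) := by
  apply sl_ext <;> simp only [phi_apply] <;> simp
lemma e21_zero {R : Type*} [CommRing R] : e21 (0 : R) = 1 := by
  apply sl_ext <;> simp

lemma crt (p : S) (y : ZMod (p.1 ^ k p.1)) : ∃ t : ℤ, (t : ZMod (p.1 ^ k p.1)) = y ∧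
    ∀ r : S, r ≠ p → (t : ZMod (r.1 ^ k r.1)) = 0 := by
  set Q : ℕ := ∏ r ∈ S.erase p.1, r ^ k r with hQ
  have hc : Nat.Coprime Q (p.1 ^ k p.1) := by
    apply Nat.Coprime.prod_left
    intro r hr
    rw [Finset.mem_erase] at hr
    exact Nat.Coprime.pow _ _ ((Nat.coprime_primes (hS.prime r hr.2) (hS.prime _ p.2)).2 hr.1)
  have hu : IsUnit (Q : ZMod (p.1 ^ k p.1)) := by rwa [ZMod.isUnit_iff_coprime]
  obtain ⟨u, hu⟩ := hu
  refine ⟨Q * ((((u⁻¹ : (ZMod (p.1 ^ k p.1))ˣ) : ZMod (p.1 ^ k p.1)) * y).val : ℤ), ?_, ?_⟩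
  · push_cast
    rw [ZMod.natCast_zmod_val, ← hu]; simp
  · intro r hr
    have : (Q : ZMod (r.1 ^ k r.1)) = 0 := by
      rw [ZMod.natCast_eq_zero_iff]
      exact Finset.dvd_prod_of_mem (fun r => r ^ k r) (Finset.mem_erase.2 ⟨fun h => hr (Subtype.ext h), r.2⟩)
    push_cast
    rw [this, zero_mul]

lemma mem_of_dS {H : Subgroup (GS S k)} (x : GS S k) (h : ∀ p, x p ∈ dS H p) : x ∈ H := by
  classical
  apply Subgroup.pi_mem_of_mulSingle_mem
  intro p
  have := mem_dS.1 (h p)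
  convert this

lemma phi_surj : Function.Surjective (phi S k) := by
  intro x
  have : x ∈ (phi S k).range := by
    apply mem_of_dS
    intro p
    refine mem_of_elem_mem _ 1 ?_ ?_ ?_ _ (one_dvd _) (one_dvd _) (one_dvd _)
    all_goals intro y
    all_goals
      obtain ⟨t, ht, ht2⟩ := crt p (1 * y)
      rw [mem_dS']
    · exact ⟨phi S k (e12 t), ⟨_, rfl⟩, by rw [phi_e12, ht], fun r hr => by rw [phi_e12, ht2 r hr, e12_zero]⟩
    · exact ⟨phi S k (e21 t), ⟨_, rfl⟩, by rw [phi_e21, ht], fun r hr => by rw [phi_e21, ht2 r hr, e21_zero]⟩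
    · refine ⟨phi S k (e12 1 * e21 t * (e12 1)⁻¹), ⟨_, rfl⟩, ?_, fun r hr => ?_⟩
      all_goals simp only [map_mul, map_inv, Pi.mul_apply, Pi.inv_apply, phi_e12, phi_e21, Int.cast_one]
      · rw [ht]
      · rw [ht2 r hr, e21_zero]; simp
  exact this

/-- exponent function attached to `m` -/
def kk (m : ℕ) (p : ℕ) : ℕ := max 1 (m.factorization p)
instance kk_ne (m p : ℕ) : NeZero (kk m p) := ⟨by unfold kk; omega⟩
instance pset_pf (m : ℕ) : PSet m.primeFactors := ⟨fun p hp => Nat.prime_of_mem_primeFactors hp⟩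

def Gam (m : ℕ) : Subgroup (SL2 ℤ) := (Matrix.SpecialLinearGroup.map (n := Fin 2) (Int.castRingHom (ZMod m))).ker

lemma mem_Gam {m : ℕ} {x : SL2 ℤ} : x ∈ Gam m ↔ ∀ i j, (m : ℤ) ∣ x i j - (1 : SL2 ℤ) i j := by
  rw [Gam, MonoidHom.mem_ker, Matrix.SpecialLinearGroup.ext_iff]
  refine forall_congr' fun i => forall_congr' fun j => ?_
  rw [← ZMod.intCast_zmod_eq_zero_iff_dvd, Int.cast_sub, sub_eq_zero]
  have : ((1 : SL2 (ZMod m)) i j) = (((1 : SL2 ℤ) i j : ℤ) : ZMod m) := by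
    fin_cases i <;> fin_cases j <;> simp
  rw [this]; rfl

lemma prod_kk (m : ℕ) (hm : m ≠ 0) : ∏ p ∈ m.primeFactors, p ^ kk m p = m := by
  conv_rhs => rw [← Nat.prod_factorization_pow_eq_self hm]
  rw [Finsupp.prod, Nat.support_factorization]
  refine Finset.prod_congr rfl fun p hp => ?_
  rw [kk, max_eq_right]
  exact Nat.one_le_iff_ne_zero.2 (Finsupp.mem_support_iff.1 (by simpa using hp))

lemma phi_eq_one {x : SL2 ℤ} {p : S} : phi S k x p = 1 ↔ ∀ i j, ((p.1 ^ k p.1 : ℕ) : ℤ) ∣ x i j - (1 : SL2 ℤ) i j :=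
  mem_Gam (m := p.1 ^ k p.1)

lemma ker_phi (m : ℕ) (hm : m ≠ 0) : (phi m.primeFactors (kk m)).ker = Gam m := by
  ext x
  rw [MonoidHom.mem_ker, funext_iff, mem_Gam]
  simp only [Pi.one_apply, phi_eq_one]
  constructor
  · intro h i j
    conv_lhs => rw [← prod_kk m hm]
    rw [Nat.cast_prod]
    apply Finset.prod_dvd_of_coprime
    · intro p hp q hq hpq
      simp only [Function.onFun]
      rw [Nat.isCoprime_iff_coprime]
      exact Nat.Coprime.pow _ _ ((Nat.coprime_primes (Nat.prime_of_mem_primeFactors hp) (Nat.prime_of_mem_primeFactors hq)).2 hpq)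
    · intro p hp
      exact h ⟨p, hp⟩ i j
  · intro h p i j
    refine dvd_trans ?_ (h i j)
    rw [Int.natCast_dvd_natCast]
    conv_rhs => rw [← prod_kk m hm]
    exact Finset.dvd_prod_of_mem (fun r => r ^ kk m r) p.2

/-- U3 -/
lemma level (H : Subgroup (SL2 ℤ)) (hH : ∃ m : ℕ, 1 ≤ m ∧ Gam m ≤ H) :
    ∃ m : ℕ, 1 ≤ m ∧ ∃ K : Subgroup (GS m.primeFactors (kk m)), NoFull K ∧ H = K.comap (phi _ _) ∧
      K.index = H.index ∧ m ≤ 3 * H.index := by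
  classical
  set m := Nat.find hH with hmdef
  obtain ⟨hm1, hmH⟩ := Nat.find_spec hH
  have hmin : ∀ m', 1 ≤ m' → Gam m' ≤ H → m ≤ m' := fun m' h1 h2 => Nat.find_min' hH ⟨h1, h2⟩
  rw [← hmdef] at hm1 hmH
  have hm0 : m ≠ 0 := by omega
  set f := phi m.primeFactors (kk m) with hf
  have hcomap : (H.map f).comap f = H := by
    rw [Subgroup.comap_map_eq, ker_phi m hm0]; exact sup_eq_left.2 hmH
  have hmem : ∀ x, f x ∈ H.map f → x ∈ H := fun x hx => by rw [← hcomap]; exact hx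
  have hidx : (H.map f).index = H.index := by
    conv_rhs => rw [← hcomap]
    rw [Subgroup.index_comap_of_surjective _ phi_surj]
  refine ⟨m, hm1, H.map f, ?_, hcomap.symm, hidx, ?_⟩
  · intro p hp
    have hpk : p.1 ^ kk m p.1 ∣ m := by
      conv_rhs => rw [← prod_kk m hm0]
      exact Finset.dvd_prod_of_mem (fun r => r ^ kk m r) p.2
    obtain ⟨c, hc⟩ := hpk
    have hpp : 1 < p.1 ^ kk m p.1 := Nat.one_lt_pow (NeZero.ne _) (Fact.out : p.1.Prime).one_lt
    have hc0 : 1 ≤ c := by rcases Nat.eq_zero_or_pos c with h | h; (· simp [h] at hc; omega); exact h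
    have hle := hmin c hc0 fun x hx => by
      apply hmem
      apply mem_of_dS
      intro r
      by_cases hr : r = p
      · subst hr; rw [hp]; trivial
      · have : f x r = 1 := by
          rw [hf, phi_eq_one]
          intro i j
          refine dvd_trans ?_ (mem_Gam.1 hx i j)
          rw [Int.natCast_dvd_natCast]
          have h1 : r.1 ^ kk m r.1 ∣ p.1 ^ kk m p.1 * c := by
            rw [← hc]
            conv_rhs => rw [← prod_kk m hm0]
            exact Finset.dvd_prod_of_mem (fun r => r ^ kk m r) r.2
          refine Nat.Coprime.dvd_of_dvd_mul_left (Nat.Coprime.pow _ _ ((Nat.coprime_primes Fact.out Fact.out).2 ?_)) h1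
          exact fun h => hr (Subtype.ext h)
        rw [this]; exact one_mem _
    nlinarith
  · set j : m.primeFactors → ℕ := fun p => Nat.log p.1 (cS (H.map f) p).index with hj
    have hle := hmin (∏ p : m.primeFactors, p.1 ^ (j p + eps p.1))
      (Nat.succ_le_of_lt (Finset.prod_pos fun (p : m.primeFactors) _ => pow_pos (Fact.out : p.1.Prime).pos _)) fun x hx => by
      apply hmem
      apply mem_of_dS
      intro p
      have hd : ∀ i l, (p.1 : ZMod (p.1 ^ kk m p.1)) ^ (j p + eps p.1) ∣ (f x p) i l - ((1 : SL2 ℤ) i l : ℤ) := by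
        intro i l
        have h1 := (mem_Gam.1 hx i l)
        have h2 : ((p.1 ^ (j p + eps p.1) : ℕ) : ℤ) ∣ x i l - (1 : SL2 ℤ) i l :=
          dvd_trans (Int.natCast_dvd_natCast.2 (Finset.dvd_prod_of_mem (fun p : m.primeFactors => p.1 ^ (j p + eps p.1)) (Finset.mem_univ p))) h1
        rw [hf, phi_apply]
        have := map_dvd (Int.castRingHom (ZMod (p.1 ^ kk m p.1))) h2
        simpa using this
      apply dS_mem (H.map f) p (j p) (Nat.lt_pow_succ_log_self (Fact.out : p.1.Prime).one_lt _)
      · simpa using hd 0 0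
      · simpa using hd 0 1
      · simpa using hd 1 0
    refine hle.trans ?_
    simp only [pow_add]
    rw [Finset.prod_mul_distrib, mul_comm, ← hidx, index_eq_prod]
    refine Nat.mul_le_mul ?_ (Finset.prod_le_prod' fun p _ => Nat.pow_log_le_self _ Subgroup.index_ne_zero_of_finite)
    have : ∀ p : m.primeFactors, p.1 ^ eps p.1 = if p.1 = 3 then 3 else 1 := by
      intro p; unfold eps; split_ifs with h <;> simp [h]
    rw [Finset.prod_congr rfl fun p _ => this p, Finset.prod_coe_sort m.primeFactors (fun p => if p = 3 then 3 else 1), Finset.prod_ite_eq']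
    split_ifs <;> omega

end CG

namespace CG
variable {F : Type*} [Field F]

def tr (x : SL2 F) : F := x 0 0 + x 1 1

/-- regular semisimple -/
def Reg (z : SL2 F) : Prop := tr z ^ 2 ≠ 4

def Scal (z : SL2 F) : Prop := z 0 1 = 0 ∧ z 1 0 = 0 ∧ z 0 0 = z 1 1

lemma Reg.not_scal {z : SL2 F} (h : Reg z) : ¬ Scal z := by
  rintro ⟨h1, h2, h3⟩
  apply h
  have := sl_det z
  rw [h1, h3] at this
  rw [tr, h3]; linear_combination 4 * this

/-- `y = a + b z` -/
def Lin (y z : SL2 F) (a b : F) : Prop :=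
  y 0 0 = a + b * z 0 0 ∧ y 0 1 = b * z 0 1 ∧ y 1 0 = b * z 1 0 ∧ y 1 1 = a + b * z 1 1

lemma comm_eqs {y z : SL2 F} (h : y * z = z * y) : y 0 1 * z 1 0 = z 0 1 * y 1 0 ∧
    y 0 0 * z 0 1 + y 0 1 * z 1 1 = z 0 0 * y 0 1 + z 0 1 * y 1 1 ∧
    y 1 0 * z 0 0 + y 1 1 * z 1 0 = z 1 0 * y 0 0 + z 1 1 * y 1 0 := by
  have h00 := congrArg (fun x : SL2 F => x 0 0) h
  have h01 := congrArg (fun x : SL2 F => x 0 1) h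
  have h10 := congrArg (fun x : SL2 F => x 1 0) h
  simp only [sl_mul] at h00 h01 h10
  refine ⟨by linear_combination h00, h01, h10⟩

lemma exists_lin {y z : SL2 F} (hz : ¬ Scal z) (h : y * z = z * y) : ∃ a b, Lin y z a b := by
  obtain ⟨h1, h2, h3⟩ := comm_eqs h
  by_cases h01 : z 0 1 = 0
  · by_cases h10 : z 1 0 = 0
    · have hd : z 0 0 - z 1 1 ≠ 0 := fun h' => hz ⟨h01, h10, sub_eq_zero.1 h'⟩
      refine ⟨y 0 0 - (y 0 0 - y 1 1) / (z 0 0 - z 1 1) * z 0 0, (y 0 0 - y 1 1) / (z 0 0 - z 1 1), by ring, ?_, ?_, ?_⟩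
      · rw [h01] at h2 ⊢
        have : (z 0 0 - z 1 1) * y 0 1 = 0 := by linear_combination -h2
        simpa [hd] using this
      · rw [h10] at h3 ⊢
        have : (z 0 0 - z 1 1) * y 1 0 = 0 := by linear_combination h3
        simpa [hd] using this
      · field_simp; ring
    · refine ⟨y 0 0 - y 1 0 / z 1 0 * z 0 0, y 1 0 / z 1 0, by ring, ?_, by field_simp, ?_⟩
      · field_simp; linear_combination h1
      · field_simp; linear_combination h3
  · refine ⟨y 0 0 - y 0 1 / z 0 1 * z 0 0, y 0 1 / z 0 1, by ring, by field_simp, ?_, ?_⟩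
    · field_simp; linear_combination -h1
    · field_simp; linear_combination -h2

lemma Lin.disc {y z : SL2 F} {a b : F} (h : Lin y z a b) : tr y ^ 2 - 4 = b ^ 2 * (tr z ^ 2 - 4) := by
  obtain ⟨h1, h2, h3, h4⟩ := h
  have d1 := sl_det y
  have d2 := sl_det z
  unfold tr
  rw [h1, h2, h3, h4] at *
  linear_combination 4 * d1 - 4 * b^2 * d2

lemma Lin.b_ne {y z : SL2 F} {a b : F} (h : Lin y z a b) (hy : ¬ Scal y) : b ≠ 0 := by
  rintro rfl
  obtain ⟨h1, h2, h3, h4⟩ := h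
  exact hy ⟨by simpa using h2, by simpa using h3, by simp [h1, h4]⟩

lemma Lin.comm {y z : SL2 F} {a b : F} (h : Lin y z a b) : y * z = z * y := by
  obtain ⟨h1, h2, h3, h4⟩ := h
  apply sl_ext <;> simp only [sl_mul, h1, h2, h3, h4] <;> ring

lemma Lin.symm {y z : SL2 F} {a b : F} (h : Lin y z a b) (hb : b ≠ 0) : Lin z y (-a / b) (1 / b) := by
  obtain ⟨h1, h2, h3, h4⟩ := h
  refine ⟨?_, ?_, ?_, ?_⟩ <;> simp only [h1, h2, h3, h4] <;> field_simp <;> ring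

/-- commuting is transitive through nonscalar elements -/
lemma comm_trans {x y z : SL2 F} (hy : ¬ Scal y) (hxy : x * y = y * x) (hyz : z * y = y * z) : x * z = z * x := by
  obtain ⟨a, b, h⟩ := exists_lin hy hxy
  obtain ⟨c, d, h'⟩ := exists_lin hy hyz
  obtain ⟨h1, h2, h3, h4⟩ := h
  obtain ⟨h1', h2', h3', h4'⟩ := h'
  apply sl_ext <;> simp only [sl_mul, h1, h2, h3, h4, h1', h2', h3', h4'] <;> ring

lemma reg_of_comm {y z : SL2 F} (hz : Reg z) (hy : ¬ Scal y) (h : y * z = z * y) : Reg y := by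
  obtain ⟨a, b, hl⟩ := exists_lin hz.not_scal h
  intro h4
  have := hl.disc
  rw [h4, sub_self] at this
  rcases mul_eq_zero.1 this.symm with h | h
  · exact hl.b_ne hy (by simpa using h)
  · exact hz (sub_eq_zero.1 h)

lemma Lin.mul {x y z : SL2 F} {a b c d : F} (h : Lin x z a b) (h' : Lin y z c d) :
    Lin (x * y) z (a * c - b * d) (a * d + b * c + b * d * tr z) := by
  obtain ⟨h1, h2, h3, h4⟩ := h
  obtain ⟨h1', h2', h3', h4'⟩ := h'
  have d2 := sl_det z
  unfold tr
  refine ⟨?_, ?_, ?_, ?_⟩ <;> simp only [sl_mul, h1, h2, h3, h4, h1', h2', h3', h4']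
  · linear_combination -b*d*d2
  · ring
  · ring
  · linear_combination -b*d*d2

lemma lin_self (z : SL2 F) : Lin z z 0 1 := ⟨by ring, by ring, by ring, by ring⟩

/-- the eigenvalue character -/
lemma exists_chi (z : SL2 F) (hz : Reg z) : ∃ (f : Subgroup.centralizer {z} →* AlgebraicClosure F),
    Function.Injective f ∧ ∀ y : Subgroup.centralizer {z}, f y + f y⁻¹ = algebraMap F _ (tr y.1) := by
  classical
  set ι := algebraMap F (AlgebraicClosure F) with hι
  obtain ⟨μ, hμ⟩ := IsAlgClosed.exists_root
    (Polynomial.C (1 : AlgebraicClosure F) * Polynomial.X ^ 2 + Polynomial.C (- ι (tr z)) * Polynomial.X + Polynomial.C 1)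
    (by rw [Polynomial.degree_quadratic one_ne_zero]; decide)
  have hμ' : μ ^ 2 - ι (tr z) * μ + 1 = 0 := by
    have := Polynomial.IsRoot.def.1 hμ
    simp at this
    linear_combination this
  have hne : 2 * μ - ι (tr z) ≠ 0 := by
    intro h
    apply hz
    apply ι.injective
    rw [map_pow]; simp only [map_ofNat]
    linear_combination ((2 * μ - ι (tr z))) * h - 4 * hμ'
  have hL : ∀ y : Subgroup.centralizer {z}, ∃ a b, Lin y.1 z a b := fun y =>
    exists_lin hz.not_scal (by have := Subgroup.mem_centralizer_iff.1 y.2 z rfl; exact this.symm)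
  let g : SL2 F → AlgebraicClosure F := fun y => (ι (tr (y * z)) - (ι (tr z) - μ) * ι (tr y)) / (2 * μ - ι (tr z))
  have hg : ∀ y a b, Lin y z a b → g y = ι a + ι b * μ := by
    intro y a b h
    simp only [g]
    rw [div_eq_iff hne]
    have h1 := h.mul (lin_self z)
    have t1 : tr (y * z) = a * tr z + b * tr z ^ 2 - 2 * b := by
      unfold tr; rw [h1.1, h1.2.2.2]; unfold tr; ring
    have t2 : tr y = 2 * a + b * tr z := by
      unfold tr; rw [h.1, h.2.2.2]; ring
    rw [t1, t2]
    simp only [map_sub, map_add, map_mul, map_pow, map_ofNat]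
    linear_combination (-2 * ι b) * hμ'
  have hone : g 1 = 1 := by
    rw [hg 1 1 0 ⟨by simp, by simp, by simp, by simp⟩]; simp
  have hmul : ∀ x y : Subgroup.centralizer {z}, g (x.1 * y.1) = g x.1 * g y.1 := by
    intro x y
    obtain ⟨a, b, h⟩ := hL x
    obtain ⟨c, d, h'⟩ := hL y
    rw [hg _ _ _ h, hg _ _ _ h', hg _ _ _ (h.mul h')]
    simp only [map_sub, map_add, map_mul]
    linear_combination (- ι b * ι d) * hμ'
  have htr : ∀ y : Subgroup.centralizer {z}, g y.1 + g (y.1⁻¹) = ι (tr y.1) := by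
    intro y
    obtain ⟨a, b, h⟩ := hL y
    have h' : Lin (y.1⁻¹) z (a + b * tr z) (-b) := by
      obtain ⟨h1, h2, h3, h4⟩ := h
      have e := Matrix.SpecialLinearGroup.SL2_inv_expl y.1
      rw [e]
      refine ⟨?_, ?_, ?_, ?_⟩ <;> simp [h1, h2, h3, h4, tr] <;> ring
    rw [hg _ _ _ h, hg _ _ _ h']
    have t2 : tr y.1 = 2 * a + b * tr z := by
      unfold tr; rw [h.1, h.2.2.2]; ring
    rw [t2]
    simp only [map_sub, map_add, map_mul, map_neg, map_ofNat]
    ring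
  let f : Subgroup.centralizer {z} →* AlgebraicClosure F := ⟨⟨fun y => g y.1, hone⟩, hmul⟩
  refine ⟨f, ?_, htr⟩
  rw [injective_iff_map_eq_one]
  intro y hy
  have hy1 : g y.1 = 1 := hy
  have hy2 : g (y.1⁻¹) = 1 := by
    have := hmul y y⁻¹
    rw [hy1, Subgroup.coe_inv, mul_inv_cancel, hone, one_mul] at this
    exact this.symm
  have h3 := htr y
  rw [hy1, hy2] at h3
  have ht : tr y.1 = 2 := by apply ι.injective; rw [← h3, map_ofNat]; norm_num
  obtain ⟨a, b, h⟩ := hL y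
  have hd := h.disc
  rw [ht] at hd
  have hb : b = 0 := by
    have : b ^ 2 * (tr z ^ 2 - 4) = 0 := by rw [← hd]; norm_num
    rcases mul_eq_zero.1 this with h | h
    · simpa using h
    · exact absurd (sub_eq_zero.1 h) hz
  rw [hg _ _ _ h, hb, map_zero, zero_mul, add_zero] at hy1
  have ha : a = 1 := by apply ι.injective; rw [hy1, map_one]
  obtain ⟨h1, h2, h3, h4⟩ := h
  apply Subtype.ext
  apply sl_ext <;> simp [h1, h2, h3, h4, hb, ha]

lemma centralizer_cyclic [Finite F] (z : SL2 F) (hz : Reg z) : IsCyclic (Subgroup.centralizer {z}) := by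
  obtain ⟨f, hf, _⟩ := exists_chi z hz
  exact isCyclic_of_subgroup_isDomain f hf

lemma eq_or_inv {y z : SL2 F} (hz : Reg z) (h : y * z = z * y) (ht : tr y = tr z) : y = z ∨ y = z⁻¹ := by
  obtain ⟨f, hf, hf2⟩ := exists_chi z hz
  let y' : Subgroup.centralizer {z} := ⟨y, by rw [Subgroup.mem_centralizer_iff]; rintro _ rfl; exact h.symm⟩
  let z' : Subgroup.centralizer {z} := ⟨z, by rw [Subgroup.mem_centralizer_iff]; rintro _ rfl; rfl⟩
  have h1 := hf2 y'
  have h2 := hf2 z'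
  have e : tr y'.1 = tr z'.1 := ht
  rw [e, ← h2] at h1
  have hy : f y' * f y'⁻¹ = 1 := by rw [← map_mul]; simp
  have hz' : f z' * f z'⁻¹ = 1 := by rw [← map_mul]; simp
  have : (f y' - f z') * (f y' - f z'⁻¹) = 0 := by linear_combination f y' * h1 - hy + hz'
  rcases mul_eq_zero.1 this with h | h
  · left; exact congrArg Subtype.val (hf (sub_eq_zero.1 h))
  · right; exact congrArg Subtype.val (hf (sub_eq_zero.1 h))

/-- powers of non-regular elements -/
lemma pow_of_not_reg {p : ℕ} [hp : Fact p.Prime] [CharP F p] (x : SL2 F) (h : ¬ Reg x) :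
    Scal (x ^ p) := by
  have h4 : tr x ^ 2 = 4 := by simpa [Reg] using h
  have hc : (tr x - 2) * (tr x + 2) = 0 := by linear_combination h4
  have key : ∃ e : F, tr x = 2 * e ∧ e ^ 2 = 1 := by
    rcases mul_eq_zero.1 hc with h | h
    · exact ⟨1, by linear_combination h, by ring⟩
    · exact ⟨-1, by linear_combination h, by ring⟩
  obtain ⟨e, he, he2⟩ := key
  have hd := sl_det x
  unfold tr at he
  have hnil : (x.1 - Matrix.scalar (Fin 2) e) ^ 2 = 0 := by
    rw [sq]
    ext i j
    fin_cases i <;> fin_cases j <;> simp [Matrix.mul_apply, Fin.sum_univ_two]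
    · linear_combination (x 0 0) * he - hd + he2
    · linear_combination (x 0 1) * he
    · linear_combination (x 1 0) * he
    · linear_combination (x 1 1) * he - hd + he2
  have hcomm : Commute (x.1 - Matrix.scalar (Fin 2) e) (Matrix.scalar (Fin 2) e) := by
    apply Commute.symm
    exact Matrix.scalar_commute e (fun r => mul_comm _ _) _
  haveI : CharP (Matrix (Fin 2) (Fin 2) F) p := inferInstance
  have hp2 : (x ^ p).1 = Matrix.scalar (Fin 2) (e ^ p) := by
    rw [Matrix.SpecialLinearGroup.coe_pow]
    have : x.1 = (x.1 - Matrix.scalar (Fin 2) e) + Matrix.scalar (Fin 2) e := by simp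
    rw [this, add_pow_char_of_commute _ hcomm]
    rw [← Nat.sub_add_cancel hp.out.two_le, pow_add, hnil, Nat.sub_add_cancel hp.out.two_le, mul_zero, zero_add, map_pow]
  refine ⟨?_, ?_, ?_⟩ <;> rw [hp2] <;> simp

end CG

namespace CG

/-- `Y0` is a cyclic subgroup of index at most two in `Y` -/
def QC {X : Type*} [Group X] (Y Y0 : Subgroup X) : Prop :=
  Y0 ≤ Y ∧ IsCyclic Y0 ∧ ∀ x ∈ Y, ∀ y ∈ Y, x ∉ Y0 → y ∉ Y0 → x * y ∈ Y0

section
variable {X : Type*} [Group X] {Y Y0 : Subgroup X}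
lemma QC.conj (h : QC Y Y0) {x y : X} (hx : x ∈ Y) (hy : y ∈ Y0) : x * y * x⁻¹ ∈ Y0 := by
  by_cases hx0 : x ∈ Y0
  · exact Y0.mul_mem (Y0.mul_mem hx0 hy) (Y0.inv_mem hx0)
  · refine h.2.2 _ (Y.mul_mem hx (h.1 hy)) _ (Y.inv_mem hx) ?_ ?_
    · intro h'; exact hx0 ((Y0.mul_mem_cancel_right hy).1 h')
    · simpa using hx0

lemma QC.sq (h : QC Y Y0) {x : X} (hx : x ∈ Y) : x * x ∈ Y0 := by
  by_cases hx0 : x ∈ Y0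
  · exact Y0.mul_mem hx0 hx0
  · exact h.2.2 _ hx _ hx hx0 hx0

lemma QC.gen (h : QC Y Y0) : ∃ a b, Y = Subgroup.closure {a, b} := by
  obtain ⟨h1, ⟨⟨g, hg⟩⟩, h3⟩ := h
  have hY0 : Y0 ≤ Subgroup.closure {g.1} := by
    intro y hy
    obtain ⟨n, hn⟩ := Subgroup.mem_zpowers_iff.1 (hg ⟨y, hy⟩)
    have : g.1 ^ n = y := by simpa using congrArg Subtype.val hn
    rw [← this]
    exact Subgroup.zpow_mem _ (Subgroup.subset_closure (Set.mem_singleton _)) n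
  by_cases hx : ∃ x ∈ Y, x ∉ Y0
  · obtain ⟨x, hx, hx0⟩ := hx
    refine ⟨g.1, x, le_antisymm ?_ ?_⟩
    · have hc : Y0 ≤ Subgroup.closure {g.1, x} := hY0.trans (Subgroup.closure_mono (by simp))
      intro y hy
      by_cases hy0 : y ∈ Y0
      · exact hc hy0
      · have hx' : x⁻¹ ∉ Y0 := by simpa using hx0
        have := hc (h3 y hy x⁻¹ (Y.inv_mem hx) hy0 hx')
        have hxm : x ∈ Subgroup.closure {g.1, x} := Subgroup.subset_closure (by simp)
        exact ((Subgroup.mul_mem_cancel_right _ (Subgroup.inv_mem _ hxm)).1 this)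
    · rw [Subgroup.closure_le]
      rintro y (rfl | rfl)
      · exact h1 g.2
      · exact hx
  · push Not at hx
    refine ⟨g.1, g.1, le_antisymm ?_ ?_⟩
    · intro y hy; simpa using hY0 (hx y hy)
    · rw [Subgroup.closure_le]
      rintro y (rfl | rfl) <;> exact h1 g.2
end

variable {F : Type*} [Field F]

lemma scal_iff {z : SL2 F} : Scal z ↔ z ∈ Subgroup.center (SL2 F) := by
  rw [Matrix.SpecialLinearGroup.mem_center_iff]
  constructor
  · rintro ⟨h1, h2, h3⟩
    have := sl_det z
    refine ⟨z 0 0, ?_, ?_⟩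
    · rw [h1, ← h3] at this; simp only [Fintype.card_fin]; linear_combination this
    · ext i j
      fin_cases i <;> fin_cases j <;> simp [h1, h2, h3]
  · rintro ⟨r, -, h⟩
    refine ⟨?_, ?_, ?_⟩ <;> rw [← h] <;> simp

lemma Scal.sq {z : SL2 F} (h : Scal z) : z ^ 2 = 1 := by
  obtain ⟨h1, h2, h3⟩ := h
  have := sl_det z
  rw [h1, ← h3] at this
  rw [_root_.sq]
  apply sl_ext <;> simp [sl_mul, h1, h2, ← h3] <;> linear_combination this

lemma Scal.entry {z : SL2 F} (h : Scal z) : z = 1 ∨ z = -1 := by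
  obtain ⟨h1, h2, h3⟩ := h
  have hd := sl_det z
  rw [h1, ← h3] at hd
  have : (z 0 0 - 1) * (z 0 0 + 1) = 0 := by linear_combination hd
  rcases mul_eq_zero.1 this with h | h
  · left; apply sl_ext <;> simp [h1, h2, ← h3] <;> linear_combination h
  · right; apply sl_ext <;> simp [h1, h2, ← h3] <;> linear_combination h

lemma coprime_pow_one {X : Type*} [Group X] {x : X} {a b : ℕ} (h : Nat.Coprime a b) (h1 : x ^ a = 1) (h2 : x ^ b = 1) : x = 1 := by
  have := Nat.dvd_gcd (orderOf_dvd_of_pow_eq_one h1) (orderOf_dvd_of_pow_eq_one h2)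
  rw [h] at this
  exact orderOf_eq_one_iff.1 (Nat.dvd_one.1 this)

/-- odd Sylow -/
lemma cyclic_of_odd [Finite F] {p q : ℕ} [hp : Fact p.Prime] [CharP F p] [hq : Fact q.Prime] (hpq : q ≠ p) (hq2 : q ≠ 2)
    (Y : Subgroup (SL2 F)) (hY : IsPGroup q Y) :
    Y = ⊥ ∨ ∃ z ∈ Y, Reg z ∧ Y ≤ Subgroup.centralizer {z} := by
  rcases Y.bot_or_nontrivial with h | h
  · exact Or.inl h
  right
  haveI := hY.center_nontrivial
  obtain ⟨z, hz⟩ := exists_ne (1 : Subgroup.center Y)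
  have hz1 : z.1.1 ≠ 1 := fun h' => hz (Subtype.ext (Subtype.ext h'))
  obtain ⟨n, hn⟩ := hY z.1
  have hn' : z.1.1 ^ (q ^ n) = 1 := congrArg Subtype.val hn
  have hc2 : Nat.Coprime q 2 := (Nat.coprime_primes hq.out Nat.prime_two).2 hq2
  have hcp : Nat.Coprime q p := (Nat.coprime_primes hq.out hp.out).2 hpq
  refine ⟨z.1.1, z.1.2, ?_, ?_⟩
  · by_contra hr
    have h1 := (pow_of_not_reg (p := p) _ hr).sq
    rw [← pow_mul] at h1
    exact hz1 (coprime_pow_one (Nat.Coprime.pow_left n (hcp.mul_right hc2)) hn' h1)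
  · intro y hy
    rw [Subgroup.mem_centralizer_iff]
    rintro _ rfl
    exact (congrArg Subtype.val (Subgroup.mem_center_iff.1 z.2 ⟨y, hy⟩)).symm

lemma mem_centralizer_singleton {X : Type*} [Group X] {x z : X} : x ∈ Subgroup.centralizer {z} ↔ x * z = z * x := by
  rw [Subgroup.mem_centralizer_iff]
  constructor
  · intro h; exact (h z rfl).symm
  · rintro h _ rfl; exact h.symm

lemma isCyclic_of_le {X : Type*} [Group X] {A B : Subgroup X} (h : A ≤ B) (hB : IsCyclic B) : IsCyclic A :=
  isCyclic_of_injective (Subgroup.inclusion h) (Subgroup.inclusion_injective h)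

lemma qc_of_two [Finite F] {p : ℕ} [hp : Fact p.Prime] [CharP F p] (hp2 : p ≠ 2)
    (Y : Subgroup (SL2 F)) (hY : IsPGroup 2 Y) : ∃ Y0, QC Y Y0 := by
  by_cases hs : ∀ y ∈ Y, Scal y
  · refine ⟨⊥, bot_le, inferInstance, ?_⟩
    intro x hx y hy hx0 hy0
    have h1 : x = -1 := ((hs x hx).entry).resolve_left (by simpa using hx0)
    have h2 : y = -1 := ((hs y hy).entry).resolve_left (by simpa using hy0)
    rw [h1, h2, Subgroup.mem_bot]
    apply sl_ext <;> simp [sl_mul]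
  · push Not at hs
    obtain ⟨y0, hy0, hys⟩ := hs
    let N := (Subgroup.center (SL2 F)).subgroupOf Y
    haveI : Nontrivial (Y ⧸ N) := by
      refine ⟨⟨((⟨y0, hy0⟩ : Y) : Y ⧸ N), 1, ?_⟩⟩
      rw [Ne, QuotientGroup.eq_one_iff]
      rw [Subgroup.mem_subgroupOf]
      exact fun h => hys (scal_iff.2 h)
    haveI := (hY.to_quotient N).center_nontrivial
    obtain ⟨z', hz'⟩ := exists_ne (1 : Subgroup.center (Y ⧸ N))
    obtain ⟨z, hz⟩ := QuotientGroup.mk_surjective z'.1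
    have hzs : ¬ Scal z.1 := by
      intro h
      apply hz'
      apply Subtype.ext
      rw [← hz]
      show ((z : Y ⧸ N)) = 1
      rw [QuotientGroup.eq_one_iff, Subgroup.mem_subgroupOf]
      exact scal_iff.1 h
    have hcom : ∀ y ∈ Y, Scal ((y * z.1)⁻¹ * (z.1 * y)) := by
      intro y hy
      have h1 := Subgroup.mem_center_iff.1 z'.2 ((⟨y, hy⟩ : Y) : Y ⧸ N)
      rw [← hz, ← QuotientGroup.mk_mul, ← QuotientGroup.mk_mul, QuotientGroup.eq, Subgroup.mem_subgroupOf] at h1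
      exact scal_iff.2 h1
    have hreg : Reg z.1 := by
      by_contra hr
      have h1 := (pow_of_not_reg (p := p) _ hr)
      obtain ⟨n, hn⟩ := hY z
      have hn' : z.1 ^ (2 ^ n) = 1 := congrArg Subtype.val hn
      have hc : Nat.Coprime (2 ^ n) p := Nat.Coprime.pow_left n ((Nat.coprime_primes Nat.prime_two hp.out).2 (Ne.symm hp2))
      have : z.1 ∈ Subgroup.zpowers (z.1 ^ p) := by
        rw [mem_zpowers_pow_iff]
        exact (Nat.Coprime.coprime_dvd_left (orderOf_dvd_of_pow_eq_one hn') hc).symm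
      apply hzs
      rw [scal_iff] at h1 ⊢
      exact (Subgroup.zpowers_le.2 h1) this
    refine ⟨Y ⊓ Subgroup.centralizer {z.1}, inf_le_left, isCyclic_of_le inf_le_right (centralizer_cyclic _ hreg), ?_⟩
    have key : ∀ x ∈ Y, x ∉ Y ⊓ Subgroup.centralizer {z.1} → z.1 * x = x * z.1 * (-1) := by
      intro x hx hx'
      rcases (hcom x hx).entry with h | h
      · exfalso; apply hx'
        refine ⟨hx, mem_centralizer_singleton.2 ?_⟩
        exact inv_mul_eq_one.1 h
      · exact inv_mul_eq_iff_eq_mul.1 h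
    intro x hx y hy hx0 hy0
    refine ⟨Y.mul_mem hx hy, mem_centralizer_singleton.2 ?_⟩
    have h1 := key x hx hx0
    have h2 := key y hy hy0
    have h2' : y * z.1 = z.1 * y * (-1) := by rw [h2]; simp
    rw [mul_assoc, h2', ← mul_assoc, ← mul_assoc, ← mul_assoc, h1]; simp

lemma qc_field [Finite F] {p q : ℕ} [hp : Fact p.Prime] [CharP F p] [hq : Fact q.Prime] (hpq : q ≠ p)
    (Y : Subgroup (SL2 F)) (hY : IsPGroup q Y) : ∃ Y0, QC Y Y0 ∧ (q ≠ 2 → Y0 = Y) := by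
  by_cases h2 : q = 2
  · subst h2
    obtain ⟨Y0, h⟩ := qc_of_two (p := p) (Ne.symm hpq) Y hY
    exact ⟨Y0, h, fun h => absurd rfl h⟩
  · refine ⟨Y, ⟨le_rfl, ?_, fun x hx y hy h _ => absurd hx h⟩, fun _ => rfl⟩
    rcases cyclic_of_odd hpq h2 Y hY with h | ⟨z, -, hz, h⟩
    · subst h; infer_instance
    · exact isCyclic_of_le h (centralizer_cyclic _ hz)

lemma red_inj_on {p k q : ℕ} [hp : Fact p.Prime] [hq : Fact q.Prime] [NeZero k] (hpq : q ≠ p)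
    (Y : Subgroup (SL2 (ZMod (p ^ k)))) (hY : IsPGroup q Y) {x y : SL2 (ZMod (p ^ k))} (hx : x ∈ Y) (hy : y ∈ Y)
    (h : red p k x = red p k y) : x = y := by
  have h1 : red p k (x * y⁻¹) = 1 := by rw [map_mul, h, ← map_mul]; simp
  have h2 := red_ker_pow _ h1
  obtain ⟨n, hn⟩ := hY ⟨x * y⁻¹, Y.mul_mem hx (Y.inv_mem hy)⟩
  have hn' : (x * y⁻¹) ^ (q ^ n) = 1 := congrArg Subtype.val hn
  exact mul_inv_eq_one.1 (coprime_pow_one (Nat.Coprime.pow _ _ ((Nat.coprime_primes hq.out hp.out).2 hpq)) hn' h2)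

/-- U4 -/
lemma qc_zmod {p k q : ℕ} [hp : Fact p.Prime] [hq : Fact q.Prime] [NeZero k] (hpq : q ≠ p)
    (Y : Subgroup (SL2 (ZMod (p ^ k)))) (hY : IsPGroup q Y) :
    (∃ Y0, QC Y Y0 ∧ (q ≠ 2 → Y0 = Y)) ∧ Nat.card Y ∣ p ^ 2 - 1 := by
  have hinj := fun x hx y hy h => red_inj_on hpq Y hY (x := x) (y := y) hx hy h
  have hmap : IsPGroup q (Y.map (red p k)) := hY.map _
  haveI : Finite (SL2 (ZMod (p ^ k))) := inferInstance
  constructor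
  · obtain ⟨Z, hZ, hZ2⟩ := qc_field (p := p) hpq (Y.map (red p k)) hmap
    refine ⟨Y ⊓ Z.comap (red p k), ⟨inf_le_left, ?_, ?_⟩, ?_⟩
    · haveI := hZ.2.1
      refine isCyclic_of_injective (((red p k).comp (Subgroup.subtype (Y ⊓ Z.comap (red p k)))).codRestrict Z (fun x => (Subgroup.mem_inf.1 x.2).2)) ?_
      intro x y h
      exact Subtype.ext (hinj x.1 x.2.1 y.1 y.2.1 (congrArg Subtype.val h))
    · intro x hx y hy hx0 hy0
      refine ⟨Y.mul_mem hx hy, ?_⟩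
      show red p k (x * y) ∈ Z
      rw [map_mul]
      apply hZ.2.2 _ (Subgroup.mem_map_of_mem _ hx) _ (Subgroup.mem_map_of_mem _ hy)
      · exact fun h => hx0 ⟨hx, h⟩
      · exact fun h => hy0 ⟨hy, h⟩
    · intro h
      rw [hZ2 h]
      exact inf_eq_left.2 (fun y hy => Subgroup.mem_map_of_mem _ hy)
  · have h1 : Nat.card Y = Nat.card (Y.map (red p k)) := by
      refine Nat.card_congr (Equiv.ofBijective (fun y => ⟨red p k y.1, Subgroup.mem_map_of_mem _ y.2⟩) ⟨?_, ?_⟩)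
      · intro x y h; exact Subtype.ext (hinj _ x.2 _ y.2 (congrArg Subtype.val h))
      · rintro ⟨_, y, hy, rfl⟩; exact ⟨⟨y, hy⟩, rfl⟩
    rw [h1]
    have h2 := Subgroup.card_subgroup_dvd_card (Y.map (red p k))
    rw [card_SL2_mul] at h2
    obtain ⟨n, hn⟩ := hmap.exists_card_eq
    rw [hn] at h2 ⊢
    exact Nat.Coprime.dvd_of_dvd_mul_left (Nat.Coprime.pow_left n ((Nat.coprime_primes hq.out hp.out).2 hpq)) h2

end CG

namespace CG

def Gen {X : Type*} [Group X] (J : Subgroup X) (r : ℕ) : Prop :=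
  ∃ s : Finset X, s.card ≤ r ∧ Subgroup.closure (s : Set X) = J

variable {F : Type*} [Field F] [Fintype F]

open Classical in
noncomputable def Af (A : Subgroup (SL2 F)) : Finset (SL2 F) := Finset.univ.filter (· ∈ A)
open Classical in
noncomputable def Cf (A : Subgroup (SL2 F)) (z : SL2 F) : Finset (SL2 F) := Finset.univ.filter (fun x => x ∈ A ∧ x * z = z * x)
open Classical in
noncomputable def Of (A : Subgroup (SL2 F)) (z : SL2 F) : Finset (SL2 F) :=
  Finset.univ.filter (fun w => w ∈ A ∧ ¬ Scal w ∧ ∃ g ∈ A, w * (g * z * g⁻¹) = (g * z * g⁻¹) * w)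

lemma mem_Af {A : Subgroup (SL2 F)} {x} : x ∈ Af A ↔ x ∈ A := by simp [Af]
lemma mem_Cf {A : Subgroup (SL2 F)} {z x} : x ∈ Cf A z ↔ x ∈ A ∧ x * z = z * x := by simp [Cf]
lemma mem_Of {A : Subgroup (SL2 F)} {z w} : w ∈ Of A z ↔ w ∈ A ∧ ¬ Scal w ∧ ∃ g ∈ A, w * (g * z * g⁻¹) = (g * z * g⁻¹) * w := by simp [Of]

lemma tr_conj (g x : SL2 F) : tr (g * x * g⁻¹) = tr x := by
  have h1 : tr (g * x * g⁻¹) = (g.1 * x.1 * (g⁻¹).1).trace := by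
    rw [Matrix.trace_fin_two]; rfl
  have h2 : tr x = x.1.trace := by rw [Matrix.trace_fin_two]; rfl
  rw [h1, h2, Matrix.trace_mul_comm, ← mul_assoc, ← Matrix.SpecialLinearGroup.coe_mul, inv_mul_cancel]; simp

lemma Reg.conj {z : SL2 F} (h : Reg z) (g : SL2 F) : Reg (g * z * g⁻¹) := by
  unfold Reg at *; rwa [tr_conj]

lemma conj_comm {X : Type*} [Group X] {g x y : X} : (g * x * g⁻¹) * (g * y * g⁻¹) = (g * y * g⁻¹) * (g * x * g⁻¹) ↔ x * y = y * x := by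
  constructor
  · intro h
    have h1 : g * (x * y) * g⁻¹ = g * (y * x) * g⁻¹ := by
      calc g * (x * y) * g⁻¹ = (g * x * g⁻¹) * (g * y * g⁻¹) := by group
        _ = _ := h
        _ = _ := by group
    simpa using h1
  · intro h
    calc _ = g * (x * y) * g⁻¹ := by group
      _ = g * (y * x) * g⁻¹ := by rw [h]
      _ = _ := by group

open Classical in
lemma fib_aux (A : Subgroup (SL2 F)) (z x b : SL2 F) (hz : ¬ Scal z) (hx : x * z = z * x) (hxs : ¬ Scal x) :
    ((Af A).filter (fun g => g * x * g⁻¹ = b)).card ≤ (Cf A z).card := by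
  rcases ((Af A).filter (fun g => g * x * g⁻¹ = b)).eq_empty_or_nonempty with h | ⟨g0, h0⟩
  · rw [h]; simp
  rw [Finset.mem_filter, mem_Af] at h0
  apply Finset.card_le_card_of_injOn (fun g => g0⁻¹ * g)
  · intro g hg
    simp only [Finset.coe_filter, Set.mem_setOf_eq, mem_Af] at hg
    simp only [Finset.mem_coe, mem_Cf]
    refine ⟨A.mul_mem (A.inv_mem h0.1) hg.1, ?_⟩
    apply comm_trans hxs _ hx.symm
    have : g * x * g⁻¹ = g0 * x * g0⁻¹ := by rw [hg.2, h0.2]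
    have h2 : g * x = g0 * x * g0⁻¹ * g := by rw [← this]; group
    rw [mul_assoc, h2]; group
  · intro a _ b _ h; simpa using h

open Classical in
lemma card_Of (A : Subgroup (SL2 F)) (z : SL2 F) (hz : Reg z) (hzA : z ∈ A) : (Af A).card ≤ 6 * (Of A z).card := by
  set D := (Cf A z).filter (fun x => ¬ Scal x) with hD
  have hDC : (Cf A z).card ≤ 3 * D.card := by
    have h1 : (Cf A z) ⊆ D ∪ {1, -1} := by
      intro x hx
      by_cases hs : Scal x
      · rcases hs.entry with h | h <;> simp [h]
      · simp [hD, hs, hx]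
    have h2 : z ∈ D := by simp [hD, mem_Cf, hzA, hz.not_scal]
    have h3 := (Finset.card_le_card h1).trans (Finset.card_union_le _ _)
    have h4 : ({1, -1} : Finset (SL2 F)).card ≤ 2 := Finset.card_le_two
    have h5 : 1 ≤ D.card := Finset.card_pos.2 ⟨z, h2⟩
    omega
  have hmaps : ∀ a ∈ (Af A) ×ˢ D, a.1 * a.2 * a.1⁻¹ ∈ Of A z := by
    rintro ⟨g, x⟩ h
    simp only [Finset.mem_product, mem_Af, hD, Finset.mem_filter, mem_Cf] at h
    obtain ⟨hg, ⟨hx, hxz⟩, hs⟩ := h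
    rw [mem_Of]
    refine ⟨A.mul_mem (A.mul_mem hg hx) (A.inv_mem hg), ?_, g, hg, conj_comm.2 hxz⟩
    exact ((reg_of_comm hz hs hxz).conj g).not_scal
  have hfib : ∀ b ∈ Of A z, (((Af A) ×ˢ D).filter (fun a => a.1 * a.2 * a.1⁻¹ = b)).card ≤ 2 * (Cf A z).card := by
    intro b _
    rcases (((Af A) ×ˢ D).filter (fun a => a.1 * a.2 * a.1⁻¹ = b)).eq_empty_or_nonempty with h | ⟨⟨g0, x0⟩, h0⟩
    · rw [h]; simp
    simp only [Finset.mem_filter, Finset.mem_product, mem_Af, hD, mem_Cf] at h0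
    obtain ⟨⟨hg0, ⟨hx0, hx0z⟩, hx0s⟩, hb⟩ := h0
    have hr0 := reg_of_comm hz hx0s hx0z
    have hsub : ((Af A) ×ˢ D).filter (fun a => a.1 * a.2 * a.1⁻¹ = b) ⊆
        (((Af A).filter (fun g => g * x0 * g⁻¹ = b)) ×ˢ {x0}) ∪ (((Af A).filter (fun g => g * x0⁻¹ * g⁻¹ = b)) ×ˢ {x0⁻¹}) := by
      rintro ⟨g, x⟩ h
      simp only [Finset.mem_filter, Finset.mem_product, mem_Af, hD, mem_Cf] at h
      obtain ⟨⟨hg, ⟨hx, hxz⟩, hxs⟩, hgb⟩ := h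
      have hcx : x * x0 = x0 * x := comm_trans hz.not_scal hxz hx0z
      have htr : tr x = tr x0 := by rw [← tr_conj g x, ← tr_conj g0 x0, hgb, hb]
      rcases eq_or_inv hr0 hcx htr with h | h
      · subst h
        simp [mem_Af, hg, hgb]
      · subst h
        simp only [Finset.mem_union, Finset.mem_product, Finset.mem_filter, mem_Af, Finset.mem_singleton]
        right; simpa using ⟨hg, hgb⟩
    have hi : x0⁻¹ * z = z * x0⁻¹ := by
      rw [inv_mul_eq_iff_eq_mul, ← mul_assoc, hx0z, mul_assoc, mul_inv_cancel, mul_one]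
    have his : ¬ Scal x0⁻¹ := by
      intro h; apply hx0s; rw [scal_iff] at h ⊢; simpa using h
    refine (Finset.card_le_card hsub).trans ((Finset.card_union_le _ _).trans ?_)
    rw [Finset.card_product, Finset.card_product, Finset.card_singleton, Finset.card_singleton, mul_one, mul_one, two_mul]
    exact add_le_add (fib_aux A z x0 b hz.not_scal hx0z hx0s) (fib_aux A z x0⁻¹ b hz.not_scal hi his)
  have := Finset.card_le_mul_card_image_of_maps_to hmaps _ hfib
  rw [Finset.card_product] at this
  have hpos : 0 < (Cf A z).card := Finset.card_pos.2 ⟨z, by simp [mem_Cf, hzA]⟩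
  apply Nat.le_of_mul_le_mul_right _ hpos
  calc (Af A).card * (Cf A z).card ≤ (Af A).card * (3 * D.card) := Nat.mul_le_mul_left _ hDC
    _ = 3 * ((Af A).card * D.card) := by ring
    _ ≤ 3 * (2 * (Cf A z).card * (Of A z).card) := Nat.mul_le_mul_left _ this
    _ = _ := by ring

open Classical in
/-- a family of at most 6 regular elements representing all centralizers up to conjugacy -/
lemma exists_reps (A : Subgroup (SL2 F)) : ∃ T : Finset (SL2 F), T.card ≤ 6 ∧ (∀ z ∈ T, z ∈ A ∧ Reg z) ∧
    ∀ y ∈ A, Reg y → ∃ z ∈ T, ∃ g ∈ A, (g * y * g⁻¹) * z = z * (g * y * g⁻¹) := by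
  set P := ((Finset.univ : Finset (SL2 F)).powerset).filter (fun T : Finset (SL2 F) => (∀ z ∈ T, z ∈ A ∧ Reg z) ∧
    (T : Set (SL2 F)).PairwiseDisjoint (Of A)) with hP
  obtain ⟨T, hT, hmax⟩ := P.exists_max_image (fun T => T.card) ⟨∅, by simp [hP]⟩
  rw [hP, Finset.mem_filter] at hT
  obtain ⟨-, hT1, hT2⟩ := hT
  have hA : 0 < (Af A).card := Finset.card_pos.2 ⟨1, mem_Af.2 A.one_mem⟩
  refine ⟨T, ?_, hT1, ?_⟩
  · have h1 : (T.biUnion (Of A)).card ≤ (Af A).card := by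
      apply Finset.card_le_card
      intro w hw
      obtain ⟨z, hz, hw⟩ := Finset.mem_biUnion.1 hw
      exact mem_Af.2 (mem_Of.1 hw).1
    rw [Finset.card_biUnion (fun x hx y hy h => hT2 hx hy h)] at h1
    have h2 : T.card * (Af A).card ≤ 6 * ∑ z ∈ T, (Of A z).card := by
      rw [Finset.mul_sum, ← smul_eq_mul, ← Finset.sum_const]
      exact Finset.sum_le_sum (fun z hz => card_Of A z (hT1 z hz).2 (hT1 z hz).1)
    exact Nat.le_of_mul_le_mul_right (h2.trans (Nat.mul_le_mul_left 6 h1)) hA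
  · intro y hy hyr
    by_contra hcon
    push Not at hcon
    have hdis : ∀ z ∈ T, Disjoint (Of A y) (Of A z) := by
      intro z hz
      rw [Finset.disjoint_left]
      intro w hw1 hw2
      obtain ⟨hwA, hws, g, hg, hgc⟩ := mem_Of.1 hw1
      obtain ⟨-, -, g', hg', hgc'⟩ := mem_Of.1 hw2
      have h1 := comm_trans hws hgc.symm hgc'.symm
      apply hcon z hz (g'⁻¹ * g) (A.mul_mem (A.inv_mem hg') hg)
      have e1 : g * y * g⁻¹ = g' * (g'⁻¹ * g * y * (g'⁻¹ * g)⁻¹) * g'⁻¹ := by group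
      rw [e1] at h1
      exact conj_comm.1 h1
    have hyT : y ∉ T := by
      intro h
      apply hcon y h 1 A.one_mem
      simp
    have := hmax (insert y T) (by
      rw [hP, Finset.mem_filter]
      refine ⟨by simp, ?_, ?_⟩
      · intro z hz
        rcases Finset.mem_insert.1 hz with h | h
        · subst h; exact ⟨hy, hyr⟩
        · exact hT1 z h
      · rw [Finset.coe_insert]
        apply hT2.insert
        intro z hz _
        exact hdis z hz)
    simp only [Finset.card_insert_of_notMem hyT] at this
    omega

open Classical in
lemma gen_field {p : ℕ} [hp : Fact p.Prime] (A : Subgroup (SL2 (ZMod p))) : Gen A 9 := by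
  haveI : Finite A := inferInstance
  obtain ⟨T, hT6, hT1, hT2⟩ := exists_reps A
  -- generators of centralizers
  have hc : ∀ z : SL2 (ZMod p), ∃ c ∈ A, Reg z → A ⊓ Subgroup.centralizer {z} ≤ Subgroup.zpowers c := by
    intro z
    by_cases hz : Reg z
    · obtain ⟨⟨c, hc⟩⟩ := isCyclic_of_le (A := A ⊓ Subgroup.centralizer {z}) inf_le_right (centralizer_cyclic z hz)
      refine ⟨c.1, c.2.1, fun _ y hy => ?_⟩
      obtain ⟨n, hn⟩ := Subgroup.mem_zpowers_iff.1 (hc ⟨y, hy⟩)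
      exact Subgroup.mem_zpowers_iff.2 ⟨n, by simpa using congrArg Subtype.val hn⟩
    · exact ⟨1, A.one_mem, fun h => absurd h hz⟩
  choose c hcA hcz using hc
  -- Sylow p
  let Pp : Sylow p A := default
  let Pp' := Pp.1.map A.subtype
  have hPp : IsPGroup p Pp' := Pp.2.map _
  obtain ⟨a, haA, ha⟩ : ∃ a ∈ A, Pp' ≤ Subgroup.zpowers a := by
    have hcyc : IsCyclic Pp' := by
      apply isCyclic_of_card_dvd_prime (p := p)
      obtain ⟨n, hn⟩ := hPp.exists_card_eq
      have h2 := Subgroup.card_subgroup_dvd_card Pp'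
      rw [card_SL2_mul, hn] at h2
      rw [hn]
      have hp2 : Nat.Coprime p (p ^ 2 - 1) := by
        have : p ^ 2 = (p ^ 2 - 1) + 1 := (Nat.sub_add_cancel (Nat.one_le_pow _ _ hp.out.pos)).symm
        rw [Nat.Prime.coprime_iff_not_dvd hp.out]
        intro h
        have h3 : p ∣ 1 := (Nat.dvd_add_right h).1 (this ▸ dvd_pow_self p two_ne_zero)
        exact hp.out.one_lt.ne' (Nat.dvd_one.1 h3)
      exact Nat.Coprime.dvd_of_dvd_mul_right (Nat.Coprime.pow_left n hp2) h2
    obtain ⟨⟨a, ha⟩⟩ := hcyc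
    refine ⟨a.1, ?_, fun y hy => ?_⟩
    · obtain ⟨x, -, hx⟩ := a.2
      rw [← hx]; exact x.2
    · obtain ⟨n, hn⟩ := Subgroup.mem_zpowers_iff.1 (ha ⟨y, hy⟩)
      exact Subgroup.mem_zpowers_iff.2 ⟨n, by simpa using congrArg Subtype.val hn⟩
  -- Sylow 2
  let P2 : Sylow 2 A := default
  let P2' := P2.1.map A.subtype
  obtain ⟨b1, b2, hb1, hb2, hb⟩ : ∃ b1 b2, b1 ∈ A ∧ b2 ∈ A ∧ (p ≠ 2 → P2' ≤ Subgroup.closure {b1, b2}) := by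
    by_cases h2 : p = 2
    · exact ⟨1, 1, A.one_mem, A.one_mem, fun h => absurd h2 h⟩
    · obtain ⟨Y0, hY0⟩ := qc_of_two (p := p) h2 P2' (P2.2.map _)
      obtain ⟨b1, b2, hb⟩ := hY0.gen
      have hle : P2' ≤ A := by
        rintro _ ⟨x, -, rfl⟩; exact x.2
      have hs : ({b1, b2} : Set _) ⊆ A := by
        intro x hx; apply hle; rw [hb]; exact Subgroup.subset_closure hx
      exact ⟨b1, b2, hs (by simp), hs (by simp), fun _ => hb.le⟩
  set s : Finset (SL2 (ZMod p)) := T.image c ∪ {a, b1, b2} with hs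
  refine ⟨s, ?_, ?_⟩
  · refine (Finset.card_union_le _ _).trans ?_
    have := Finset.card_image_le (s := T) (f := c)
    have h3 : ({a, b1, b2} : Finset (SL2 (ZMod p))).card ≤ 3 := Finset.card_le_three
    omega
  · set B := Subgroup.closure (s : Set (SL2 (ZMod p))) with hB
    have hBA : B ≤ A := by
      rw [hB, Subgroup.closure_le]
      intro x hx
      simp only [hs, Finset.coe_union, Finset.coe_image, Set.mem_union, Set.mem_image, Finset.mem_coe, Finset.mem_insert, Finset.mem_singleton] at hx
      rcases hx with ⟨z, -, rfl⟩ | h | h | h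
      · exact hcA z
      all_goals subst h; assumption
    have hsB : ∀ x ∈ s, x ∈ B := fun x hx => Subgroup.subset_closure hx
    have hdvd : Nat.card A ∣ Nat.card B := by
      rw [Nat.dvd_iff_prime_pow_dvd_dvd]
      intro q k hq hk
      haveI : Fact q.Prime := ⟨hq⟩
      by_cases hqp : q = p
      · subst hqp
        refine (Pp.pow_dvd_card_of_pow_dvd_card hk).trans ?_
        have e : Nat.card Pp = Nat.card Pp' := by
          exact (Subgroup.card_map_of_injective A.subtype_injective).symm
        rw [e]
        apply Subgroup.card_dvd_of_le
        exact ha.trans (Subgroup.zpowers_le.2 (hsB _ (by simp [hs])))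
      by_cases hq2 : q = 2
      · subst hq2
        refine (P2.pow_dvd_card_of_pow_dvd_card hk).trans ?_
        have e : Nat.card P2 = Nat.card P2' := by
          exact (Subgroup.card_map_of_injective A.subtype_injective).symm
        rw [e]
        apply Subgroup.card_dvd_of_le
        refine (hb (Ne.symm hqp)).trans ?_
        rw [Subgroup.closure_le]
        rintro x (rfl | rfl) <;> exact hsB _ (by simp [hs])
      · obtain ⟨K, hK⟩ := Sylow.exists_subgroup_card_pow_prime q hk
        have hKe : Nat.card (K.map A.subtype) = q ^ k := by
          rw [Subgroup.card_map_of_injective A.subtype_injective, hK]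
        have hKp : IsPGroup q (K.map A.subtype) := IsPGroup.of_card hKe
        have hKA : K.map A.subtype ≤ A := by
          rintro _ ⟨x, -, rfl⟩; exact x.2
        rw [← hKe]
        rcases cyclic_of_odd (p := p) hqp hq2 _ hKp with h | ⟨y, hy, hyr, hyK⟩
        · rw [h]; simp
        · obtain ⟨z, hzT, g, hg, hgz⟩ := hT2 y (hKA hy) hyr
          have e : Nat.card (K.map A.subtype) = Nat.card ((K.map A.subtype).map (MulAut.conj g).toMonoidHom) :=
            (Subgroup.card_map_of_injective (MulAut.conj g).injective).symm
          rw [e]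
          apply Subgroup.card_dvd_of_le
          rintro _ ⟨x, hx, rfl⟩
          have hx2 : x * y = y * x := mem_centralizer_singleton.1 (hyK hx)
          have hx3 : (g * x * g⁻¹) ∈ A ⊓ Subgroup.centralizer {z} := by
            refine ⟨A.mul_mem (A.mul_mem hg (hKA hx)) (A.inv_mem hg), mem_centralizer_singleton.2 ?_⟩
            exact comm_trans (hyr.conj g).not_scal (conj_comm.2 hx2) hgz.symm
          have := hcz z (hT1 z hzT).2 hx3
          exact (Subgroup.zpowers_le.2 (hsB (c z) (by simp only [hs, Finset.mem_union, Finset.mem_image]; exact Or.inl ⟨z, hzT, rfl⟩))) this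
    exact Subgroup.eq_of_le_of_card_ge hBA (Nat.le_of_dvd Nat.card_pos hdvd)

end CG

namespace CG

lemma Gen.mono {X : Type*} [Group X] {J : Subgroup X} {r r' : ℕ} (h : Gen J r) (hr : r ≤ r') : Gen J r' := by
  obtain ⟨s, h1, h2⟩ := h; exact ⟨s, h1.trans hr, h2⟩

open Classical in
/-- `J` generated by `s` together with `L` -/
lemma Gen.ext {X X' : Type*} [Group X] [Group X'] (f : X →* X') {J : Subgroup X} {r1 r2 : ℕ} (h1 : Gen (J.map f) r1)
    (h2 : Gen (J ⊓ f.ker) r2) : Gen J (r1 + r2) := by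
  obtain ⟨s, hs, hs'⟩ := h1
  obtain ⟨t, ht, ht'⟩ := h2
  have hl : ∀ y : X', ∃ x ∈ J, y ∈ J.map f → f x = y := by
    intro y
    by_cases hy : y ∈ J.map f
    · obtain ⟨x, hx, rfl⟩ := hy; exact ⟨x, hx, fun _ => rfl⟩
    · exact ⟨1, J.one_mem, fun h => absurd h hy⟩
  choose l hl1 hl2 using hl
  refine ⟨s.image l ∪ t, (Finset.card_union_le _ _).trans (add_le_add (Finset.card_image_le.trans hs) ht), ?_⟩
  set B := Subgroup.closure ((s.image l ∪ t : Finset X) : Set X) with hB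
  have hker : J ⊓ f.ker ≤ B := by
    rw [← ht']; apply Subgroup.closure_mono; simp
  apply le_antisymm
  · rw [hB, Subgroup.closure_le]
    intro x hx
    simp only [Finset.coe_union, Finset.coe_image, Set.mem_union, Set.mem_image, Finset.mem_coe] at hx
    rcases hx with ⟨y, -, rfl⟩ | hx
    · exact hl1 y
    · have : x ∈ J ⊓ f.ker := by rw [← ht']; exact Subgroup.subset_closure hx
      exact this.1
  · have hm : J.map f ≤ B.map f := by
      rw [← hs', Subgroup.closure_le]
      intro y hy
      refine ⟨l y, Subgroup.subset_closure (by simp only [Finset.coe_union, Finset.coe_image]; exact Or.inl ⟨y, hy, rfl⟩), ?_⟩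
      exact hl2 y (by rw [← hs']; exact Subgroup.subset_closure hy)
    intro x hx
    obtain ⟨b, hb, hbx⟩ := hm (Subgroup.mem_map_of_mem f hx)
    have hbJ : b ∈ J := by
      have : B ≤ J := by
        rw [hB, Subgroup.closure_le]
        intro x hx
        simp only [Finset.coe_union, Finset.coe_image, Set.mem_union, Set.mem_image, Finset.mem_coe] at hx
        rcases hx with ⟨y, -, rfl⟩ | hx
        · exact hl1 y
        · have : x ∈ J ⊓ f.ker := by rw [← ht']; exact Subgroup.subset_closure hx
          exact this.1
      exact this hb
    have : b⁻¹ * x ∈ B := hker ⟨J.mul_mem (J.inv_mem hbJ) hx, by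
      show f (b⁻¹ * x) = 1
      rw [map_mul, map_inv, hbx, inv_mul_cancel]⟩
    simpa using B.mul_mem hb this

section
variable {p k : ℕ} [hp : Fact p.Prime] [hk : NeZero k]

abbrev MM (p k : ℕ) := Matrix (Fin 2) (Fin 2) (ZMod (p ^ k))

noncomputable def cc (p k : ℕ) [hk : NeZero k] : MM p k →+* Matrix (Fin 2) (Fin 2) (ZMod p) :=
  (ZMod.castHom (dvd_pow_self p (NeZero.ne k)) (ZMod p)).mapMatrix

lemma cc_eq {N N' : MM p k} (h : cc p k N = cc p k N') : ∃ M : MM p k, N = N' + (p : MM p k) * M := by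
  have : ∀ i j, ∃ n, N i j - N' i j = (p : ZMod (p ^ k)) * n := by
    intro i j
    apply zmod_dvd_of_cast
    have h2 := congrFun (congrFun h i) j
    simp only [cc, RingHom.mapMatrix_apply, Matrix.map_apply] at h2
    rw [map_sub, h2, sub_self]
  choose M hM using this
  refine ⟨Matrix.of M, ?_⟩
  ext i j
  have e : ((p : MM p k) * Matrix.of M) i j = p * M i j := by
    rw [← nsmul_eq_mul, Matrix.smul_apply, nsmul_eq_mul]; rfl
  rw [Matrix.add_apply, e, ← hM]; ring

lemma cc_p (M : MM p k) : cc p k ((p : MM p k) * M) = 0 := by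
  rw [map_mul, map_natCast]
  have : ((p : ℕ) : Matrix (Fin 2) (Fin 2) (ZMod p)) = 0 := CharP.cast_eq_zero _ p
  rw [this, zero_mul]

lemma cc_surj : Function.Surjective (cc p k) := by
  intro v
  have := fun i j => ZMod.castHom_surjective (dvd_pow_self p (NeZero.ne k)) (v i j)
  choose f hf using this
  exact ⟨Matrix.of f, by ext i j; exact hf i j⟩

/-- leading terms at level `i` -/
noncomputable def VV (i : ℕ) (hi : 1 ≤ i) (K : Subgroup (SL2 (ZMod (p ^ k)))) : AddSubgroup (Matrix (Fin 2) (Fin 2) (ZMod p)) :=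
  have hz : (0 : Matrix (Fin 2) (Fin 2) (ZMod p)) ∈ {v | ∃ x ∈ K, ∃ N : MM p k, x.1 = 1 + (p : MM p k) ^ i * N ∧ cc p k N = v} := ⟨1, K.one_mem, 0, by simp, by simp⟩
  have ha : ∀ {v w}, v ∈ {v | ∃ x ∈ K, ∃ N : MM p k, x.1 = 1 + (p : MM p k) ^ i * N ∧ cc p k N = v} → w ∈ {v | ∃ x ∈ K, ∃ N : MM p k, x.1 = 1 + (p : MM p k) ^ i * N ∧ cc p k N = v} →
      v + w ∈ {v | ∃ x ∈ K, ∃ N : MM p k, x.1 = 1 + (p : MM p k) ^ i * N ∧ cc p k N = v} := by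
    rintro _ _ ⟨x, hx, N, hN, rfl⟩ ⟨y, hy, M, hM, rfl⟩
    refine ⟨x * y, K.mul_mem hx hy, N + M + (p : MM p k) * ((p : MM p k) ^ (i - 1) * (N * M)), ?_, ?_⟩
    · have e : (p : MM p k) ^ i = p * p ^ (i - 1) := by rw [← pow_succ']; congr 1; omega
      have c : N * (p : MM p k) ^ i = p ^ i * N := ((Nat.cast_commute p N).pow_left i).symm.eq
      have e2 : (p : MM p k) ^ i * N * ((p : MM p k) ^ i * M) = p ^ i * (p * (p ^ (i - 1) * (N * M))) := by
        calc _ = (p : MM p k) ^ i * (N * p ^ i) * M := by simp only [mul_assoc]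
          _ = (p : MM p k) ^ i * (p ^ i * N) * M := by rw [c]
          _ = (p : MM p k) ^ i * ((p * p ^ (i-1)) * N) * M := by rw [← e]
          _ = _ := by simp only [mul_assoc]
      rw [Matrix.SpecialLinearGroup.coe_mul, hN, hM, mul_add, mul_add, ← e2]
      simp only [add_mul, mul_add, one_mul, mul_one]
      abel
    · rw [map_add, map_add, cc_p, add_zero]
  { carrier := {v | ∃ x ∈ K, ∃ N : MM p k, x.1 = 1 + (p : MM p k) ^ i * N ∧ cc p k N = v}
    zero_mem' := hz
    add_mem' := ha
    neg_mem' := by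
      intro v hv
      have hn : ∀ n : ℕ, n • v ∈ {v | ∃ x ∈ K, ∃ N : MM p k, x.1 = 1 + (p : MM p k) ^ i * N ∧ cc p k N = v} := by
        intro n
        induction n with
        | zero => rw [zero_smul]; exact hz
        | succ n ih => rw [succ_nsmul]; exact ha ih hv
      have : -v = (p - 1) • v := by
        have h1 : p • v = 0 := by
          rw [nsmul_eq_mul, CharP.cast_eq_zero (Matrix (Fin 2) (Fin 2) (ZMod p)) p, zero_mul]
        rw [neg_eq_iff_add_eq_zero, ← succ_nsmul', Nat.sub_add_cancel hp.out.pos, h1]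
      rw [this]; exact hn _ }

lemma mem_VV {i : ℕ} {hi : 1 ≤ i} {K : Subgroup (SL2 (ZMod (p ^ k)))} {v} : v ∈ VV i hi K ↔
    ∃ x ∈ K, ∃ N : MM p k, x.1 = 1 + (p : MM p k) ^ i * N ∧ cc p k N = v := Iff.rfl

lemma VV_mono {i : ℕ} {hi : 1 ≤ i} {K L : Subgroup (SL2 (ZMod (p ^ k)))} (h : K ≤ L) : VV i hi K ≤ VV i hi L := by
  rintro v ⟨x, hx, h'⟩; exact ⟨x, h hx, h'⟩

lemma VV_succ {i : ℕ} (hi : 1 ≤ i) (hi2 : 2 ≤ i) (K : Subgroup (SL2 (ZMod (p ^ k)))) : VV i hi K ≤ VV (i + 1) (by omega) K := by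
  rintro v ⟨x, hx, N, hN, hv⟩
  obtain ⟨f, hf⟩ := one_add_pow_aux ((p : MM p k) ^ i * N) p
  refine ⟨x ^ p, K.pow_mem hx p, N + p * (p ^ (i - 2) * (N ^ 2 * f)), ?_, ?_⟩
  · rw [Matrix.SpecialLinearGroup.coe_pow, hN, hf, mul_add]
    have c : Commute ((p : MM p k) ^ i) N := (Nat.cast_commute p N).pow_left i
    rw [c.mul_pow, ← pow_mul, add_assoc]
    congr 1
    congr 1
    · rw [← mul_assoc, pow_succ']
    · rw [show i * 2 = (i + 1) + (1 + (i - 2)) by omega, pow_add, pow_add _ 1 (i - 2), pow_one]; simp only [mul_assoc]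
  · rw [map_add, cc_p, add_zero, hv]

/-- membership in the `i`-th congruence kernel -/
def InG (i : ℕ) (x : SL2 (ZMod (p ^ k))) : Prop := ∃ N : MM p k, x.1 = 1 + (p : MM p k) ^ i * N

lemma card_mat : Nat.card (Matrix (Fin 2) (Fin 2) (ZMod p)) = p ^ 4 := by
  rw [Matrix, Nat.card_eq_fintype_card]; simp [ZMod.card]; ring

lemma card_lt_mul {V W : AddSubgroup (Matrix (Fin 2) (Fin 2) (ZMod p))} (h : V < W) : p * Nat.card V ≤ Nat.card W := by
  have h1 : V.relIndex W * Nat.card V = Nat.card W := by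
    have h0 := AddSubgroup.index_mul_card (V.addSubgroupOf W)
    rw [← h0, AddSubgroup.relIndex]
    congr 1
    exact (Nat.card_congr (AddSubgroup.addSubgroupOfEquivOfLe h.le).toEquiv).symm
  have h2 : V.relIndex W ≠ 1 := by
    rw [Ne, AddSubgroup.relIndex_eq_one]; exact not_le_of_gt h
  have h3 : V.relIndex W ∣ p ^ 4 := by
    rw [← card_mat]
    exact (Dvd.intro _ h1).trans (AddSubgroup.card_addSubgroup_dvd_card W)
  rw [← h1]
  apply Nat.mul_le_mul_right
  obtain ⟨j, hj, e⟩ := (Nat.dvd_prime_pow hp.out).1 h3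
  rw [e]
  apply Nat.le_self_pow
  rintro rfl
  exact h2 (by simpa using e)

open Classical in
/-- one step of the filtration -/
lemma step_aux {i : ℕ} (hi : 1 ≤ i) (J : Subgroup (SL2 (ZMod (p ^ k)))) (T : Finset (SL2 (ZMod (p ^ k))))
    (hTJ : ∀ t ∈ T, t ∈ J) (hT : p ^ T.card ≤ Nat.card (VV i hi (Subgroup.closure (T : Set (SL2 (ZMod (p ^ k)))))))
    (hcov : ∀ x ∈ J, ∃ t ∈ Subgroup.closure (T : Set (SL2 (ZMod (p ^ k)))), InG i (t⁻¹ * x)) :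
    ∃ T' : Finset (SL2 (ZMod (p ^ k))), (∀ t ∈ T', t ∈ J) ∧ p ^ T'.card ≤ Nat.card (VV i hi (Subgroup.closure (T' : Set (SL2 (ZMod (p ^ k)))))) ∧
      (∀ x ∈ J, ∃ t ∈ Subgroup.closure (T' : Set (SL2 (ZMod (p ^ k)))), InG (i + 1) (t⁻¹ * x)) := by
  haveI : NeZero (p ^ k) := ⟨pow_ne_zero _ hp.out.ne_zero⟩
  set P := ((Finset.univ : Finset (SL2 (ZMod (p ^ k)))).powerset).filter (fun T : Finset (SL2 (ZMod (p ^ k))) => (∀ t ∈ T, t ∈ J) ∧ p ^ T.card ≤ Nat.card (VV i hi (Subgroup.closure (T : Set (SL2 (ZMod (p ^ k)))))) ∧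
      (∀ x ∈ J, ∃ t ∈ Subgroup.closure (T : Set (SL2 (ZMod (p ^ k)))), InG i (t⁻¹ * x))) with hP
  obtain ⟨T', hT', hmax⟩ := P.exists_max_image (fun T => T.card) ⟨T, by
    rw [hP, Finset.mem_filter]; exact ⟨by simp, hTJ, hT, hcov⟩⟩
  rw [hP, Finset.mem_filter] at hT'
  obtain ⟨-, h1, h2, h3⟩ := hT'
  set B := Subgroup.closure (T' : Set (SL2 (ZMod (p ^ k)))) with hB
  have hBJ : B ≤ J := by rw [hB, Subgroup.closure_le]; exact h1
  refine ⟨T', h1, h2, ?_⟩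
  have hV : VV i hi J ≤ VV i hi B := by
    by_contra hcon
    obtain ⟨v, hvJ, hvB⟩ := SetLike.not_le_iff_exists.1 hcon
    obtain ⟨y, hy, N, hN, hv⟩ := mem_VV.1 hvJ
    have hyB : y ∉ B := fun h => hvB ⟨y, h, N, hN, hv⟩
    have hyT : y ∉ T' := fun h => hyB (Subgroup.subset_closure h)
    have hBi : B ≤ Subgroup.closure ((insert y T' : Finset _) : Set (SL2 (ZMod (p ^ k)))) :=
      Subgroup.closure_mono (by simp)
    have hlt : VV i hi B < VV i hi (Subgroup.closure ((insert y T' : Finset _) : Set (SL2 (ZMod (p ^ k))))) := by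
      refine lt_of_le_of_ne (VV_mono hBi) ?_
      intro h
      apply hvB
      rw [h]
      exact ⟨y, Subgroup.subset_closure (by simp), N, hN, hv⟩
    have := hmax (insert y T') (by
      rw [hP, Finset.mem_filter]
      refine ⟨by simp, ?_, ?_, ?_⟩
      · intro t ht
        rcases Finset.mem_insert.1 ht with h | h
        · subst h; exact hy
        · exact h1 t h
      · rw [Finset.card_insert_of_notMem hyT, pow_succ']
        exact (Nat.mul_le_mul_left _ h2).trans (card_lt_mul hlt)
      · intro x hx
        obtain ⟨t, ht, h⟩ := h3 x hx
        exact ⟨t, hBi ht, h⟩)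
    simp only [Finset.card_insert_of_notMem hyT] at this
    omega
  intro x hx
  obtain ⟨t, ht, N, hN⟩ := h3 x hx
  obtain ⟨y, hy, N', hN', hv⟩ := mem_VV.1 (hV ⟨t⁻¹ * x, J.mul_mem (J.inv_mem (hBJ ht)) hx, N, hN, rfl⟩)
  obtain ⟨M, hM⟩ := cc_eq hv.symm
  refine ⟨t * y, B.mul_mem ht hy, (y⁻¹).1 * M, ?_⟩
  have e1 : (t * y)⁻¹ * x = y⁻¹ * (t⁻¹ * x) := by group
  have e2 : (y⁻¹).1 * y.1 = 1 := by rw [← Matrix.SpecialLinearGroup.coe_mul, inv_mul_cancel]; rfl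
  have c : (y⁻¹).1 * (p : MM p k) ^ (i + 1) = p ^ (i + 1) * (y⁻¹).1 := ((Nat.cast_commute p (y⁻¹).1).pow_left (i+1)).symm.eq
  rw [e1, Matrix.SpecialLinearGroup.coe_mul, hN, hM]
  calc (y⁻¹).1 * (1 + (p : MM p k) ^ i * (N' + p * M)) = (y⁻¹).1 * ((1 + (p : MM p k) ^ i * N') + p ^ (i + 1) * M) := by
        rw [mul_add ((p : MM p k) ^ i), ← mul_assoc ((p : MM p k) ^ i), ← pow_succ, add_assoc]
    _ = (y⁻¹).1 * (y.1 + p ^ (i + 1) * M) := by rw [hN']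
    _ = _ := by rw [mul_add, e2, ← mul_assoc, c, mul_assoc]

lemma card_le_four {V : AddSubgroup (Matrix (Fin 2) (Fin 2) (ZMod p))} {n : ℕ} (h : p ^ n ≤ Nat.card V) : n ≤ 4 := by
  have h2 : Nat.card V ≤ p ^ 4 := by
    rw [← card_mat (p := p)]; exact Nat.le_of_dvd Nat.card_pos (AddSubgroup.card_addSubgroup_dvd_card V)
  exact (Nat.pow_le_pow_iff_right hp.out.one_lt).1 (h.trans h2)

lemma InG_one {i : ℕ} : InG i (1 : SL2 (ZMod (p ^ k))) := ⟨0, by simp⟩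

lemma gen_level_two (J : Subgroup (SL2 (ZMod (p ^ k)))) (hJ : ∀ x ∈ J, InG 2 x) : Gen J 4 := by
  have key : ∀ i (hi : 2 ≤ i), ∃ T : Finset (SL2 (ZMod (p ^ k))), (∀ t ∈ T, t ∈ J) ∧ p ^ T.card ≤ Nat.card (VV i (by omega) (Subgroup.closure (T : Set (SL2 (ZMod (p ^ k)))))) ∧
      (∀ x ∈ J, ∃ t ∈ Subgroup.closure (T : Set (SL2 (ZMod (p ^ k)))), InG i (t⁻¹ * x)) := by
    intro i hi
    induction i, hi using Nat.le_induction with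
    | base =>
      refine ⟨∅, by simp, ?_, ?_⟩
      · rw [Finset.card_empty, pow_zero]; exact Nat.card_pos
      · intro x hx; exact ⟨1, Subgroup.one_mem _, by simpa using hJ x hx⟩
    | succ i hi ih =>
      obtain ⟨T, h1, h2, h3⟩ := ih
      obtain ⟨T', h1', h2', h3'⟩ := step_aux (by omega) J T h1 h2 h3
      exact ⟨T', h1', h2'.trans (AddSubgroup.card_le_of_le (VV_succ (by omega) hi _)), h3'⟩
  obtain ⟨T, h1, h2, h3⟩ := key (k + 2) (by omega)
  refine ⟨T, card_le_four h2, le_antisymm (by rw [Subgroup.closure_le]; exact h1) ?_⟩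
  intro x hx
  obtain ⟨t, ht, N, hN⟩ := h3 x hx
  have h0 : (p : MM p k) ^ (k + 2) = 0 := by
    rw [pow_add, ← Nat.cast_pow, CharP.cast_eq_zero (MM p k) (p ^ k), zero_mul]
  rw [h0, zero_mul, add_zero] at hN
  have : t⁻¹ * x = 1 := Subtype.ext hN
  rw [inv_mul_eq_one] at this
  rwa [← this]

/-- the level two kernel -/
def G2 (J : Subgroup (SL2 (ZMod (p ^ k)))) : Subgroup (SL2 (ZMod (p ^ k))) where
  carrier := {x | x ∈ J ∧ InG 2 x}
  one_mem' := ⟨J.one_mem, InG_one⟩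
  mul_mem' := by
    rintro x y ⟨hx, N, hN⟩ ⟨hy, M, hM⟩
    refine ⟨J.mul_mem hx hy, N + M + N * (p : MM p k) ^ 2 * M, ?_⟩
    rw [Matrix.SpecialLinearGroup.coe_mul, hN, hM]
    noncomm_ring
  inv_mem' := by
    rintro x ⟨hx, N, hN⟩
    refine ⟨J.inv_mem hx, - N * (x⁻¹).1, ?_⟩
    have e2 : x.1 * (x⁻¹).1 = 1 := by rw [← Matrix.SpecialLinearGroup.coe_mul, mul_inv_cancel]; rfl
    have : (x⁻¹).1 = 1 - (x.1 - 1) * (x⁻¹).1 := by rw [sub_mul, e2]; simp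
    have e3 : x.1 - 1 = (p : MM p k) ^ 2 * N := by rw [hN]; simp
    rw [e3] at this
    refine this.trans ?_
    simp only [neg_mul, mul_neg, ← mul_assoc, sub_eq_add_neg]

open Classical in
lemma gen_level_one (J : Subgroup (SL2 (ZMod (p ^ k)))) (hJ : ∀ x ∈ J, InG 1 x) : Gen J 8 := by
  obtain ⟨T, h1, h2, h3⟩ := step_aux (i := 1) le_rfl J ∅ (by simp) (by rw [Finset.card_empty, pow_zero]; exact Nat.card_pos)
    (fun x hx => ⟨1, Subgroup.one_mem _, by simpa using hJ x hx⟩)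
  obtain ⟨S, hS, hS'⟩ := gen_level_two (G2 J) (fun x hx => hx.2)
  refine ⟨T ∪ S, (Finset.card_union_le _ _).trans (add_le_add (card_le_four h2) hS), le_antisymm ?_ ?_⟩
  · rw [Subgroup.closure_le]
    intro x hx
    rcases Finset.mem_union.1 hx with h | h
    · exact h1 x h
    · have : x ∈ G2 J := by rw [← hS']; exact Subgroup.subset_closure h
      exact this.1
  · intro x hx
    obtain ⟨t, ht, h⟩ := h3 x hx
    have hTJ : Subgroup.closure (T : Set (SL2 (ZMod (p ^ k)))) ≤ J := by rw [Subgroup.closure_le]; exact h1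
    have hm : t⁻¹ * x ∈ G2 J := ⟨J.mul_mem (J.inv_mem (hTJ ht)) hx, h⟩
    rw [← hS'] at hm
    have e : x = t * (t⁻¹ * x) := by group
    rw [e]
    exact Subgroup.mul_mem _ (Subgroup.closure_mono (by simp) ht) (Subgroup.closure_mono (by simp) hm)

/-- rank bound -/
lemma gen_zmod (J : Subgroup (SL2 (ZMod (p ^ k)))) : Gen J 17 := by
  have h1 : Gen (J.map (red p k)) 9 := gen_field _
  have h2 : Gen (J ⊓ (red p k).ker) 8 := by
    apply gen_level_one
    intro x hx
    obtain ⟨N, hN⟩ := red_ker_form x hx.2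
    exact ⟨N, by rw [pow_one]; exact hN⟩
  exact Gen.ext _ h1 h2
end
end CG

namespace CG

open Classical in
/-- many generating tuples -/
lemma tuple_aux {q u : ℕ} [hq : Fact q.Prime] {P : Type*} [CommGroup P] [Finite P] 
    (Φ : Subgroup P) (hΦ : Φ.index = q ^ u) (t : ℕ) (ht : t ≤ u) :
    (Nat.card P) ^ t ≤ 2 ^ t * Nat.card {f : Fin t → P // (Φ ⊔ Subgroup.closure (Set.range f)).index * q ^ t ≤ q ^ u} := by
  induction t with
  | zero =>
    have : Nonempty {f : Fin 0 → P // (Φ ⊔ Subgroup.closure (Set.range f)).index * q ^ 0 ≤ q ^ u} := by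
      refine ⟨⟨Fin.elim0, ?_⟩⟩
      rw [pow_zero, mul_one, ← hΦ]
      exact Nat.le_of_dvd (Nat.pos_of_ne_zero Subgroup.index_ne_zero_of_finite) (Subgroup.index_dvd_of_le le_sup_left)
    have := Nat.card_pos (α := {f : Fin 0 → P // (Φ ⊔ Subgroup.closure (Set.range f)).index * q ^ 0 ≤ q ^ u})
    rw [pow_zero, pow_zero, one_mul]; exact this
  | succ t ih =>
    have ih := ih (by omega)
    set A := {f : Fin t → P // (Φ ⊔ Subgroup.closure (Set.range f)).index * q ^ t ≤ q ^ u} with hA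
    set A' := {f : Fin (t+1) → P // (Φ ⊔ Subgroup.closure (Set.range f)).index * q ^ (t+1) ≤ q ^ u} with hA'
    let Gd : A → Set P := fun f => {x | (Φ ⊔ Subgroup.closure (Set.range f.1)) = ⊤ ∨ x ∉ (Φ ⊔ Subgroup.closure (Set.range f.1))}
    have hGd : ∀ f : A, Nat.card P ≤ 2 * Nat.card (Gd f) := by
      intro f
      by_cases h : (Φ ⊔ Subgroup.closure (Set.range f.1)) = ⊤
      · have : Gd f = Set.univ := by ext x; simp [Gd, h]
        rw [this, Nat.card_coe_set_eq, Set.ncard_univ]; omega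
      · set B := (Φ ⊔ Subgroup.closure (Set.range f.1)) with hB
        have e : Gd f = (B : Set P)ᶜ := by ext x; simp [Gd, ← hB, h]
        rw [e, Nat.card_coe_set_eq]
        have h1 := Set.ncard_add_ncard_compl (B : Set P)
        have h2 : Nat.card B * B.index = Nat.card P := Subgroup.card_mul_index B
        have h3 : B.index ≠ 1 := fun h' => h (Subgroup.index_eq_one.1 h')
        have h4 : B.index ≠ 0 := Subgroup.index_ne_zero_of_finite
        have h5 : (B : Set P).ncard = Nat.card B := (Nat.card_coe_set_eq _).symm
        have h6 : Nat.card B * 2 ≤ Nat.card P := by rw [← h2]; exact Nat.mul_le_mul_left _ (by omega)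
        omega
    have hinj : Nat.card (Σ f : A, Gd f) ≤ Nat.card A' := by
      refine Nat.card_le_card_of_injective (fun y : (Σ f : A, Gd f) => (⟨Fin.cons y.2.1 y.1.1, ?_⟩ : A')) ?_
      · obtain ⟨f, x, hx⟩ := y
        simp only
        set B := (Φ ⊔ Subgroup.closure (Set.range f.1)) with hB
        set B' := (Φ ⊔ Subgroup.closure (Set.range (Fin.cons x f.1 : Fin (t+1) → P))) with hB'
        have hBB : B ≤ B' := by
          apply sup_le_sup_left
          apply Subgroup.closure_mono
          rw [Fin.range_cons]; exact Set.subset_insert _ _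
        have hxB : x ∈ B' := by
          apply (le_sup_right : _ ≤ B')
          exact Subgroup.subset_closure ⟨0, by simp⟩
        by_cases h : B = ⊤
        · have : B' = ⊤ := top_le_iff.1 (h ▸ hBB)
          rw [this, Subgroup.index_top, one_mul]
          exact Nat.pow_le_pow_right hq.out.pos ht
        · have hxn : x ∉ B := hx.resolve_left h
          have h1 := Subgroup.relIndex_mul_index hBB
          have h2 : B.relIndex B' ≠ 1 := by
            rw [Ne, Subgroup.relIndex_eq_one]; exact fun h' => hxn (h' hxB)
          have h3 : B.relIndex B' ∣ q ^ u := by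
            rw [← hΦ]
            exact (Dvd.intro _ h1).trans (Subgroup.index_dvd_of_le le_sup_left)
          obtain ⟨j, hj, e⟩ := (Nat.dvd_prime_pow hq.out).1 h3
          have h4 : q ≤ B.relIndex B' := by
            rw [e]; apply Nat.le_self_pow
            rintro rfl; exact h2 (by simpa using e)
          calc B'.index * q ^ (t + 1) = (q * B'.index) * q ^ t := by ring
            _ ≤ (B.relIndex B' * B'.index) * q ^ t := Nat.mul_le_mul_right _ (Nat.mul_le_mul_right _ h4)
            _ = B.index * q ^ t := by rw [h1]
            _ ≤ q ^ u := f.2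
      · rintro ⟨f, x⟩ ⟨g, y⟩ h
        have h0 := congrArg Subtype.val h
        simp only at h0
        obtain ⟨h1, h2⟩ := Fin.cons_inj.1 h0
        have : f = g := Subtype.ext h2
        subst this
        congr 1
        exact Subtype.ext h1
    haveI : Fintype A := Fintype.ofFinite _
    rw [Nat.card_sigma] at hinj
    calc Nat.card P ^ (t + 1) = Nat.card P ^ t * Nat.card P := pow_succ _ _
      _ ≤ (2 ^ t * Nat.card A) * Nat.card P := Nat.mul_le_mul_right _ ih
      _ = 2 ^ t * ∑ f : A, Nat.card P := by rw [Finset.sum_const, Finset.card_univ, Nat.card_eq_fintype_card, smul_eq_mul]; ring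
      _ ≤ 2 ^ t * ∑ f : A, 2 * Nat.card (Gd f) := Nat.mul_le_mul_left _ (Finset.sum_le_sum fun f _ => hGd f)
      _ = 2 ^ (t + 1) * ∑ f : A, Nat.card (Gd f) := by rw [← Finset.mul_sum]; ring
      _ ≤ 2 ^ (t + 1) * Nat.card A' := Nat.mul_le_mul_left _ hinj

lemma frattini {q : ℕ} [hq : Fact q.Prime] {P : Type*} [CommGroup P] [Finite P] (hP : IsPGroup q P) (C : Subgroup P)
    (h : (powMonoidHom q : P →* P).range ⊔ C = ⊤) : C = ⊤ := by
  have key : ∀ n (x : P), ∃ y, ∃ c ∈ C, x = y ^ (q ^ n) * c := by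
    intro n
    induction n with
    | zero => intro x; exact ⟨x, 1, C.one_mem, by simp⟩
    | succ n ih =>
      intro x
      obtain ⟨y, c, hc, rfl⟩ := ih x
      have : y ∈ (powMonoidHom q : P →* P).range ⊔ C := by rw [h]; trivial
      obtain ⟨_, ⟨z, rfl⟩, c', hc', rfl⟩ := Subgroup.mem_sup.1 this
      refine ⟨z, c' ^ (q ^ n) * c, C.mul_mem (C.pow_mem hc' _) hc, ?_⟩
      rw [mul_pow, powMonoidHom_apply, ← pow_mul, pow_succ', mul_assoc]
  rw [eq_top_iff]
  intro x _
  obtain ⟨n, hn⟩ := hP.exists_card_eq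
  obtain ⟨y, c, hc, rfl⟩ := key n x
  rw [← hn, pow_card_eq_one', one_mul]; exact hc

lemma tuple_count {q u : ℕ} [hq : Fact q.Prime] {P : Type*} [CommGroup P] [Finite P] (hP : IsPGroup q P)
    (hu : (powMonoidHom q : P →* P).range.index = q ^ u) :
    (Nat.card P) ^ u ≤ 2 ^ u * Nat.card {f : Fin u → P // Subgroup.closure (Set.range f) = ⊤} := by
  refine (tuple_aux _ hu u le_rfl).trans (Nat.mul_le_mul_left _ ?_)
  refine Nat.card_le_card_of_injective (fun f => ⟨f.1, ?_⟩) ?_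
  · apply frattini hP
    rw [← Subgroup.index_eq_one]
    have h1 := f.2
    have h2 : ((powMonoidHom q : P →* P).range ⊔ Subgroup.closure (Set.range f.1)).index ≠ 0 := Subgroup.index_ne_zero_of_finite
    have h3 : 0 < q ^ u := pow_pos hq.out.pos _
    have : ((powMonoidHom q : P →* P).range ⊔ Subgroup.closure (Set.range f.1)).index ≤ 1 :=
      Nat.le_of_mul_le_mul_right (by simpa using h1) h3
    omega
  · intro f g h; exact Subtype.ext (Subtype.mk.inj h)

variable {X : Type*} [CommGroup X] [Finite X] {q : ℕ} [hq : Fact q.Prime]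

/-- `P^q` -/
def pw (q : ℕ) (P : Subgroup X) : Subgroup X := P.map (powMonoidHom q)

/-- `P[q]` -/
def tors (q : ℕ) (P : Subgroup X) : Subgroup X := P ⊓ (powMonoidHom q : X →* X).ker

lemma card_pw (P : Subgroup X) : Nat.card P = Nat.card (pw q P) * Nat.card (tors q P) := by
  have h := Subgroup.card_mul_index ((powMonoidHom q : X →* X).comp P.subtype).ker
  rw [Subgroup.index_ker] at h
  have e1 : ((powMonoidHom q : X →* X).comp P.subtype).range = pw q P := by
    rw [MonoidHom.range_comp, Subgroup.range_subtype]; rfl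
  have e2 : Nat.card ((powMonoidHom q : X →* X).comp P.subtype).ker = Nat.card (tors q P) := by
    refine Nat.card_congr (Equiv.ofBijective (fun x => ⟨x.1.1, x.1.2, x.2⟩) ⟨?_, ?_⟩)
    · intro x y h; exact Subtype.ext (Subtype.ext (Subtype.mk.inj h))
    · rintro ⟨x, h1, h2⟩; exact ⟨⟨⟨x, h1⟩, h2⟩, rfl⟩
  rw [e1, e2] at h
  rw [← h, mul_comm]

lemma tors_mono {P E : Subgroup X} (h : P ≤ E) : tors q P ≤ tors q E := inf_le_inf_right _ h
lemma pw_mono {P E : Subgroup X} (h : P ≤ E) : pw q P ≤ pw q E := Subgroup.map_mono h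

open Classical in
/-- number of `P ≤ E` with given `P^q` and order -/
lemma count_fiber (hX : IsPGroup q X) (E R : Subgroup X) (u : ℕ) :
    Nat.card {P : Subgroup X // P ≤ E ∧ pw q P = R ∧ Nat.card P = Nat.card R * q ^ u} * q ^ (u * u) ≤ 
      2 ^ u * (Nat.card (tors q E)) ^ u := by
  set PP := {P : Subgroup X // P ≤ E ∧ pw q P = R ∧ Nat.card P = Nat.card R * q ^ u} with hPP
  haveI : Fintype PP := Fintype.ofFinite _
  -- the set of admissible elements
  let R' : Subgroup X := E ⊓ R.comap (powMonoidHom q)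
  have hR' : Nat.card R' ≤ Nat.card R * Nat.card (tors q E) := by
    rw [card_pw (q := q) R']
    apply Nat.mul_le_mul
    · apply Subgroup.card_le_of_le
      rintro _ ⟨x, hx, rfl⟩
      exact hx.2
    · apply Subgroup.card_le_of_le
      exact tors_mono inf_le_left
  let tup : PP → Type _ := fun P => {f : Fin u → P.1 // Subgroup.closure (Set.range f) = ⊤}
  have htup : ∀ P : PP, (Nat.card R * q ^ u) ^ u ≤ 2 ^ u * Nat.card (tup P) := by
    intro P
    have hind : (powMonoidHom q : P.1 →* P.1).range.index = q ^ u := by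
      have h1 := Subgroup.card_mul_index (powMonoidHom q : P.1 →* P.1).range
      have h2 : Nat.card (powMonoidHom q : P.1 →* P.1).range = Nat.card R := by
        refine Eq.trans ?_ (congrArg (fun Z : Subgroup X => Nat.card Z) P.2.2.1)
        refine Nat.card_congr (Equiv.ofBijective (fun x => ⟨x.1.1, ?_⟩) ⟨?_, ?_⟩)
        · obtain ⟨y, hy⟩ := x.2
          exact ⟨y.1, y.2, by rw [← hy]; rfl⟩
        · intro x y h; exact Subtype.ext (Subtype.ext (Subtype.mk.inj h))
        · rintro ⟨_, y, hy, rfl⟩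
          exact ⟨⟨⟨y, hy⟩ ^ q, ⟨⟨y, hy⟩, rfl⟩⟩, rfl⟩
      rw [h2, P.2.2.2] at h1
      exact Nat.eq_of_mul_eq_mul_left Nat.card_pos h1
    have := tuple_count (hX.to_subgroup P.1) hind
    rwa [P.2.2.2] at this
  have hinj : Nat.card (Σ P : PP, tup P) ≤ Nat.card (Fin u → R') := by
    refine Nat.card_le_card_of_injective (fun y : (Σ P : PP, tup P) => fun i => (⟨(y.2.1 i).1, ?_⟩ : R')) ?_
    · refine ⟨y.1.2.1 (y.2.1 i).2, ?_⟩
      show _ ∈ R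
      have : (powMonoidHom q) (y.2.1 i).1 ∈ pw q y.1.1 := ⟨_, (y.2.1 i).2, rfl⟩
      exact y.1.2.2.1.le this
    · rintro ⟨P, f, hf⟩ ⟨Q, g, hg⟩ h
      have h1 : ∀ i, (f i).1 = (g i).1 := fun i => congrArg Subtype.val (congrFun h i)
      have hcl : ∀ (P : Subgroup X) (f : Fin u → P), Subgroup.closure (Set.range f) = ⊤ → P = Subgroup.closure (Set.range fun i => (f i).1) := by
        intro P f hf
        have := congrArg (Subgroup.map P.subtype) hf
        rw [MonoidHom.map_closure, ← MonoidHom.range_eq_map, Subgroup.range_subtype, ← Set.range_comp] at this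
        exact this.symm
      have hPQ : P = Q := by
        apply Subtype.ext
        rw [hcl P.1 f hf, hcl Q.1 g hg]
        congr 2
        funext i; exact h1 i
      subst hPQ
      congr 1
      apply Subtype.ext
      funext i
      exact Subtype.ext (h1 i)
  rw [Nat.card_sigma, Nat.card_fun, Nat.card_fin] at hinj
  have hRpos : 0 < Nat.card R ^ u := pow_pos Nat.card_pos _
  apply Nat.le_of_mul_le_mul_right _ hRpos
  calc Nat.card PP * q ^ (u * u) * Nat.card R ^ u = ∑ P : PP, (Nat.card R * q ^ u) ^ u := by
        rw [Finset.sum_const, Finset.card_univ, Nat.card_eq_fintype_card, smul_eq_mul, mul_pow, ← pow_mul]; ring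
    _ ≤ ∑ P : PP, 2 ^ u * Nat.card (tup P) := Finset.sum_le_sum fun P _ => htup P
    _ = 2 ^ u * ∑ P : PP, Nat.card (tup P) := by rw [Finset.mul_sum]
    _ ≤ 2 ^ u * (Nat.card R') ^ u := Nat.mul_le_mul_left _ hinj
    _ ≤ 2 ^ u * (Nat.card R * Nat.card (tors q E)) ^ u := Nat.mul_le_mul_left _ (Nat.pow_le_pow_left hR' u)
    _ = _ := by rw [mul_pow]; ring

end CG

namespace CG

/-- the constant `3 - 2√2` -/
noncomputable def kap : ℝ := 3 - 2 * Real.sqrt 2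

lemma sqrt2_bounds : (1.414:ℝ) < Real.sqrt 2 ∧ Real.sqrt 2 < 1.415 := by
  constructor
  · apply Real.lt_sqrt_of_sq_lt; norm_num
  · rw [Real.sqrt_lt' (by norm_num)]; norm_num

lemma kap_pos : 0 < kap := by unfold kap; have := sqrt2_bounds; linarith [this.2]
lemma kap_lt_one : kap < 1 := by unfold kap; have := sqrt2_bounds; linarith [this.1]

lemma kap_ineq (u l d : ℝ) (hu : 0 ≤ u) (hul : u ≤ l) (hld : l ≤ d) :
    l * u - u * u - (l - u) * (kap * d) ≤ kap * d * l := by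
  have h1 : kap * l * (2 * l - u) ≤ kap * d * (2 * l - u) := by
    apply mul_le_mul_of_nonneg_right _ (by linarith)
    exact mul_le_mul_of_nonneg_left hld kap_pos.le
  have h2 : u * (l - u) ≤ kap * l * (2 * l - u) := by
    unfold kap
    have h := Real.mul_self_sqrt (show (0:ℝ) ≤ 2 by norm_num)
    have h3 : Real.sqrt 2 * Real.sqrt 2 * (l * l) = 2 * (l * l) := by rw [h]
    nlinarith [sq_nonneg (u - (2 - Real.sqrt 2) * l)]
  nlinarith

variable {X : Type*} [CommGroup X] [Finite X] {q : ℕ} [hq : Fact q.Prime]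

lemma tors_nontrivial (hX : IsPGroup q X) (E : Subgroup X) (h : E ≠ ⊥) : 1 < Nat.card (tors q E) := by
  have hE := hX.to_subgroup E
  have h1 : q ∣ Nat.card E := by
    obtain ⟨n, hn⟩ := hE.exists_card_eq
    rcases Nat.eq_zero_or_pos n with rfl | h0
    · exact absurd (Subgroup.card_eq_one.1 (by simpa using hn)) h
    · rw [hn]; exact dvd_pow_self _ h0.ne'
  obtain ⟨x, hx⟩ := exists_prime_orderOf_dvd_card' q h1
  have hx1 : x ^ q = 1 := by rw [← hx]; exact pow_orderOf_eq_one x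
  have : (⟨x.1, x.2, by simpa using congrArg Subtype.val hx1⟩ : tors q E) ≠ 1 := by
    intro h'
    have : x = 1 := Subtype.ext (by simpa using congrArg Subtype.val h')
    rw [this, orderOf_one] at hx
    exact hq.out.one_lt.ne hx
  haveI : Nontrivial (tors q E) := ⟨_, _, this⟩
  exact Finite.one_lt_card

open Classical in
theorem sub_sum (hX : IsPGroup q X) [Fintype (Subgroup X)] (d : ℕ) (hd : Nat.card (tors q (⊤ : Subgroup X)) ≤ q ^ d) (N : ℕ) :
    ∀ E : Subgroup X, Nat.card E ≤ N → 
    ∑ P ∈ Finset.univ.filter (fun P : Subgroup X => P ≤ E), ((Nat.card P : ℝ) / Nat.card E) ^ (kap * d) ≤ (Nat.card E : ℝ) ^ (kap * d + 2) := by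
  have hq0 : (0:ℝ) < q := by exact_mod_cast hq.out.pos
  have hq1 : (1:ℝ) ≤ q := by exact_mod_cast hq.out.one_lt.le
  have hkd : 0 ≤ kap * d := mul_nonneg kap_pos.le (Nat.cast_nonneg _)
  have hcp : ∀ P : Subgroup X, (0:ℝ) < Nat.card P := fun P => by exact_mod_cast Nat.card_pos
  have htors : ∀ P : Subgroup X, ∃ u, Nat.card (tors q P) = q ^ u := fun P => (hX.to_subgroup _).exists_card_eq
  choose u hu using htors
  induction N with
  | zero => intro E hE; have : 0 < Nat.card E := Nat.card_pos; omega
  | succ N ih =>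
    intro E hE
    by_cases hbot : E = ⊥
    · subst hbot
      have : Finset.univ.filter (fun P : Subgroup X => P ≤ ⊥) = {⊥} := by ext P; simp
      rw [this]; simp
    have ht := tors_nontrivial (q := q) hX E hbot
    have hE' := card_pw (q := q) E
    have hlt : Nat.card (pw q E) ≤ N := by
      have : 0 < Nat.card (pw q E) := Nat.card_pos
      nlinarith
    have IH := ih (pw q E) hlt
    set l := u E with hl
    have hld : l ≤ d := by
      have : q ^ l ≤ q ^ d := by
        rw [← hu]; exact (Subgroup.card_le_of_le (tors_mono le_top)).trans hd
      exact (Nat.pow_le_pow_iff_right hq.out.one_lt).1 this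
    rw [hu] at hE'
    set f : Subgroup X × ℕ → ℝ := fun y => ((Nat.card y.1 * q ^ y.2 : ℝ) / (Nat.card (pw q E) * q ^ l)) ^ (kap * d) with hf
    have e1 : ∀ P : Subgroup X, ((Nat.card P : ℝ) / Nat.card E) ^ (kap * d) = f (pw q P, u P) := by
      intro P
      simp only [hf]
      rw [card_pw (q := q) P, hu, hE']; push_cast; rfl
    have hfac : ∀ R : Subgroup X, ∀ v : ℕ, f (R, v) = ((Nat.card R : ℝ) / Nat.card (pw q E)) ^ (kap * d) * (q:ℝ) ^ (((v:ℝ) - l) * (kap * d)) := by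
      intro R v
      simp only [hf]
      rw [mul_div_mul_comm, Real.mul_rpow (by positivity) (by positivity)]
      congr 1
      rw [Real.rpow_mul hq0.le, Real.rpow_sub hq0, Real.rpow_natCast, Real.rpow_natCast]
    set T := (Finset.univ.filter (fun P : Subgroup X => P ≤ pw q E)) ×ˢ (Finset.range (l+1)) with hT
    have hmap : ∀ P ∈ Finset.univ.filter (fun P : Subgroup X => P ≤ E), (pw q P, u P) ∈ T := by
      intro P hP
      simp only [Finset.mem_filter, Finset.mem_univ, true_and] at hP
      simp only [hT, Finset.mem_product, Finset.mem_filter, Finset.mem_univ, true_and, Finset.mem_range]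
      refine ⟨pw_mono hP, Nat.lt_succ_of_le ?_⟩
      have : q ^ u P ≤ q ^ l := by
        rw [← hu, hl, ← hu]; exact Subgroup.card_le_of_le (tors_mono hP)
      exact (Nat.pow_le_pow_iff_right hq.out.one_lt).1 this
    have hcnt : ∀ R : Subgroup X, ∀ v : ℕ, (((Finset.univ.filter (fun P : Subgroup X => P ≤ E)).filter (fun P => (pw q P, u P) = (R, v))).card : ℝ) ≤ 2 ^ v * (q:ℝ) ^ ((l:ℝ) * v - v * v) := by
      intro R v
      have h1 : ((Finset.univ.filter (fun P : Subgroup X => P ≤ E)).filter (fun P => (pw q P, u P) = (R, v))).card ≤ Nat.card {P : Subgroup X // P ≤ E ∧ pw q P = R ∧ Nat.card P = Nat.card R * q ^ v} := by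
        rw [Nat.card_eq_fintype_card, Fintype.card_subtype]
        apply Finset.card_le_card
        intro P hP
        simp only [Finset.mem_filter, Finset.mem_univ, true_and, Prod.mk.injEq] at hP ⊢
        obtain ⟨h1, h2, h3⟩ := hP
        refine ⟨h1, h2, ?_⟩
        rw [← h2, ← h3, ← hu]; exact card_pw P
      have h2 := count_fiber (q := q) hX E R v
      have h3 : (((Finset.univ.filter (fun P : Subgroup X => P ≤ E)).filter (fun P => (pw q P, u P) = (R, v))).card : ℝ) * (q:ℝ) ^ (v * v) ≤ 2 ^ v * ((q:ℝ) ^ l) ^ v := by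
        have := (Nat.mul_le_mul_right (q ^ (v * v)) h1).trans h2
        rw [hu] at this
        exact_mod_cast this
      rw [Real.rpow_sub hq0, ← mul_div_assoc, le_div_iff₀ (by positivity)]
      calc _ = (((Finset.univ.filter (fun P : Subgroup X => P ≤ E)).filter (fun P => (pw q P, u P) = (R, v))).card : ℝ) * (q:ℝ) ^ (v * v) := by
            congr 1; rw [← Nat.cast_mul, Real.rpow_natCast]
        _ ≤ _ := h3
        _ = _ := by congr 1; rw [← Nat.cast_mul, Real.rpow_natCast, pow_mul]
    calc ∑ P ∈ Finset.univ.filter (fun P : Subgroup X => P ≤ E), ((Nat.card P : ℝ) / Nat.card E) ^ (kap * d)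
        = ∑ y ∈ T, ∑ P ∈ (Finset.univ.filter (fun P : Subgroup X => P ≤ E)).filter (fun P => (pw q P, u P) = y), f (pw q P, u P) := by
          rw [Finset.sum_fiberwise_of_maps_to hmap]
          exact Finset.sum_congr rfl fun P _ => e1 P
      _ = ∑ y ∈ T, (((Finset.univ.filter (fun P : Subgroup X => P ≤ E)).filter (fun P => (pw q P, u P) = y)).card : ℝ) * f y := by
          refine Finset.sum_congr rfl fun y _ => ?_
          rw [← nsmul_eq_mul, ← Finset.sum_const]
          refine Finset.sum_congr rfl fun P hP => ?_
          rw [(Finset.mem_filter.1 hP).2]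
      _ ≤ ∑ y ∈ T, ((Nat.card y.1 : ℝ) / Nat.card (pw q E)) ^ (kap * d) * (2 ^ l * (q:ℝ) ^ (kap * d * l)) := by
          refine Finset.sum_le_sum fun y hy => ?_
          obtain ⟨R, v⟩ := y
          simp only [hT, Finset.mem_product, Finset.mem_filter, Finset.mem_univ, true_and, Finset.mem_range] at hy
          have hvl : v ≤ l := by omega
          rw [hfac]
          calc _ ≤ (2 ^ v * (q:ℝ) ^ ((l:ℝ) * v - v * v)) * (((Nat.card R : ℝ) / Nat.card (pw q E)) ^ (kap * d) * (q:ℝ) ^ (((v:ℝ) - l) * (kap * d))) :=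
                mul_le_mul_of_nonneg_right (hcnt R v) (by positivity)
            _ = ((Nat.card R : ℝ) / Nat.card (pw q E)) ^ (kap * d) * (2 ^ v * (q:ℝ) ^ ((l:ℝ) * v - v * v + ((v:ℝ) - l) * (kap * d))) := by
                rw [Real.rpow_add hq0]; ring
            _ ≤ _ := by
                apply mul_le_mul_of_nonneg_left _ (by positivity)
                apply mul_le_mul
                · exact pow_le_pow_right₀ (by norm_num) hvl
                · apply Real.rpow_le_rpow_of_exponent_le hq1
                  have := kap_ineq v l d (by positivity) (by exact_mod_cast hvl) (by exact_mod_cast hld)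
                  linarith
                · positivity
                · positivity
      _ = (∑ R ∈ Finset.univ.filter (fun P : Subgroup X => P ≤ pw q E), ((Nat.card R : ℝ) / Nat.card (pw q E)) ^ (kap * d)) * ((l + 1) * (2 ^ l * (q:ℝ) ^ (kap * d * l))) := by
          rw [hT, Finset.sum_product, Finset.sum_mul]
          refine Finset.sum_congr rfl fun R _ => ?_
          simp only [Finset.sum_const, Finset.card_range, nsmul_eq_mul]
          push_cast; ring
      _ ≤ (Nat.card (pw q E) : ℝ) ^ (kap * d + 2) * ((q:ℝ) ^ (2 * (l:ℝ)) * (q:ℝ) ^ (kap * d * l)) := by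
          apply mul_le_mul IH _ (by positivity) (by positivity)
          rw [← mul_assoc]
          apply mul_le_mul_of_nonneg_right _ (by positivity)
          have h2 : (2:ℝ) ≤ q := by exact_mod_cast hq.out.two_le
          have h3 : ((l:ℝ) + 1) ≤ 2 ^ l := by exact_mod_cast Nat.lt_two_pow_self (n := l)
          have h4 : (2:ℝ) ^ l ≤ (q:ℝ) ^ l := pow_le_pow_left₀ (by norm_num) h2 l
          rw [two_mul, Real.rpow_add hq0, Real.rpow_natCast]
          exact mul_le_mul (h3.trans h4) h4 (by positivity) (by positivity)
      _ = (Nat.card E : ℝ) ^ (kap * d + 2) := by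
          rw [hE']; push_cast
          rw [Real.mul_rpow (by positivity) (by positivity), ← Real.rpow_natCast (q:ℝ) l, ← Real.rpow_mul hq0.le, ← Real.rpow_add hq0]
          ring_nf

/-- U5': number of subgroups of index at most `c` -/
theorem sub_count (hX : IsPGroup q X) (d : ℕ) (hd : Nat.card (tors q (⊤ : Subgroup X)) ≤ q ^ d) (c : ℝ) (hc : 1 ≤ c) :
    (Nat.card {P : Subgroup X // (P.index : ℝ) ≤ c} : ℝ) ≤ c ^ (kap * d) * (Nat.card X : ℝ) ^ (kap * d + 2) := by
  classical
  haveI : Fintype (Subgroup X) := Fintype.ofFinite _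
  have hkd : 0 ≤ kap * d := mul_nonneg kap_pos.le (Nat.cast_nonneg _)
  have h := sub_sum hX d hd _ ⊤ le_rfl
  have hc0 : 0 < c := by linarith
  have e : Nat.card (⊤ : Subgroup X) = Nat.card X := Subgroup.card_top
  rw [e] at h
  have h1 : (Nat.card {P : Subgroup X // (P.index : ℝ) ≤ c} : ℝ) * (1 / c) ^ (kap * d) ≤ ∑ P ∈ Finset.univ.filter (fun P : Subgroup X => P ≤ ⊤), ((Nat.card P : ℝ) / Nat.card X) ^ (kap * d) := by
    rw [Nat.card_eq_fintype_card, Fintype.card_subtype, ← nsmul_eq_mul, ← Finset.sum_const]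
    calc _ ≤ ∑ P ∈ Finset.univ.filter (fun P : Subgroup X => (P.index : ℝ) ≤ c), ((Nat.card P : ℝ) / Nat.card X) ^ (kap * d) := by
          refine Finset.sum_le_sum fun P hP => ?_
          apply Real.rpow_le_rpow (by positivity) _ hkd
          have h2 : (P.index : ℝ) ≤ c := (Finset.mem_filter.1 hP).2
          rw [← Subgroup.card_mul_index P]; push_cast
          have h3 : (0:ℝ) < P.index := by exact_mod_cast Nat.pos_of_ne_zero Subgroup.index_ne_zero_of_finite
          have h4 : (0:ℝ) < Nat.card P := by exact_mod_cast Nat.card_pos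
          rw [div_mul_cancel_left₀ h4.ne', one_div]
          exact inv_anti₀ h3 h2
      _ ≤ _ := Finset.sum_le_sum_of_subset_of_nonneg (by intro P; simp) (fun _ _ _ => by positivity)
  have h2 := h1.trans h
  rw [one_div, Real.inv_rpow hc0.le, ← div_eq_mul_inv, div_le_iff₀ (by positivity)] at h2
  linarith

end CG

namespace CG

section tup
variable {M : Type*} [CommGroup M] [Finite M]

/-- the twisted tuples -/
def TT {f : ℕ} (σ : Fin f → (M →* M)) (N : Subgroup M) : Subgroup (Fin f → M) where
  carrier := {m | (∀ i, m i ∈ N) ∧ (∀ i, σ i (m i) * m i = 1) ∧ ∀ i j, σ j (m i) * m j = σ i (m j) * m i}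
  one_mem' := by simp [N.one_mem]
  mul_mem' := by
    rintro a b ⟨a1, a2, a3⟩ ⟨b1, b2, b3⟩
    refine ⟨fun i => N.mul_mem (a1 i) (b1 i), fun i => ?_, fun i j => ?_⟩
    · rw [Pi.mul_apply, map_mul, mul_mul_mul_comm, a2, b2, one_mul]
    · simp only [Pi.mul_apply, map_mul]
      rw [mul_mul_mul_comm, a3, b3, mul_mul_mul_comm]
  inv_mem' := by
    rintro a ⟨a1, a2, a3⟩
    refine ⟨fun i => N.inv_mem (a1 i), fun i => ?_, fun i j => ?_⟩
    · rw [Pi.inv_apply, map_inv, ← mul_inv, a2, inv_one]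
    · simp only [Pi.inv_apply, map_inv]
      rw [← mul_inv, a3, mul_inv]

lemma card_mul_le (A B : Subgroup M) : Nat.card A * Nat.card B ≤ Nat.card (A ⊔ B : Subgroup M) * Nat.card (A ⊓ B : Subgroup M) := by
  have h : Nat.card A * Nat.card B = Nat.card (A × B) := (Nat.card_prod _ _).symm
  rw [h, ← Nat.card_prod]
  -- fibres
  have h1 := Subgroup.relIndex_inf_mul_relIndex A B ⊤
  have h2 : (A ⊓ B).relIndex A * Nat.card (A ⊓ B : Subgroup M) = Nat.card A := by
    have := Subgroup.relIndex_mul_relIndex ⊥ (A ⊓ B) A bot_le inf_le_left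
    rw [Subgroup.relIndex_bot_left, Subgroup.relIndex_bot_left] at this
    rw [mul_comm]; exact this
  have h3 : B.relIndex (A ⊔ B) * Nat.card B = Nat.card (A ⊔ B : Subgroup M) := by
    have := Subgroup.relIndex_mul_relIndex ⊥ B (A ⊔ B) bot_le le_sup_right
    rw [Subgroup.relIndex_bot_left, Subgroup.relIndex_bot_left] at this
    rw [mul_comm]; exact this
  have h4 : B.relIndex (A ⊔ B) = B.relIndex A := Subgroup.relIndex_sup_right A B
  rw [Nat.card_prod, Nat.card_prod, ← h3, ← h2, Subgroup.inf_relIndex_left, h4]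
  apply le_of_eq; ring

lemma card_TT {f : ℕ} (σ : Fin f → (M →* M)) (N : Subgroup M) :
    Nat.card (TT σ N) ≤ Nat.card N * Nat.card (tors 2 (⊤ : Subgroup M)) ^ f := by
  induction f generalizing N with
  | zero =>
    have : Nat.card (TT σ N) = 1 := by
      haveI : Subsingleton (TT σ N) := ⟨fun a b => Subtype.ext (funext fun i => i.elim0)⟩
      exact Nat.card_unique
    rw [this, pow_zero, mul_one]; exact Nat.card_pos
  | succ f ih =>
    let A : Subgroup M := N ⊓ (σ 0 * MonoidHom.id M).ker
    let B : Subgroup M := N ⊓ (σ 0 * (MonoidHom.id M)⁻¹).ker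
    have hAB : Nat.card A * Nat.card B ≤ Nat.card N * Nat.card (tors 2 (⊤ : Subgroup M)) := by
      refine (card_mul_le A B).trans (Nat.mul_le_mul ?_ ?_)
      · exact Subgroup.card_le_of_le (sup_le inf_le_left inf_le_left)
      · apply Subgroup.card_le_of_le
        rintro x ⟨⟨_, h1⟩, ⟨_, h2⟩⟩
        refine ⟨trivial, ?_⟩
        have h1 : σ 0 x * x = 1 := h1
        have h2 : σ 0 x * x⁻¹ = 1 := h2
        show x ^ 2 = 1
        have : σ 0 x = x := by rw [← mul_inv_eq_one]; exact h2
        rw [pow_two]; rwa [this] at h1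
    let π : TT σ N →* M := (Pi.evalMonoidHom (fun _ => M) 0).comp (TT σ N).subtype
    have h1 : Nat.card (TT σ N) = Nat.card π.ker * Nat.card π.range := by
      rw [← Subgroup.card_mul_index π.ker, Subgroup.index_ker]
    have h2 : Nat.card π.range ≤ Nat.card A := by
      apply Subgroup.card_le_of_le
      rintro _ ⟨⟨m, hm⟩, rfl⟩
      exact ⟨hm.1 0, hm.2.1 0⟩
    have h3 : Nat.card π.ker ≤ Nat.card (TT (fun i => σ i.succ) B) := by
      refine Nat.card_le_card_of_injective (fun m => ⟨fun i => m.1.1 i.succ, ?_, ?_, ?_⟩) ?_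
      · intro i
        refine ⟨m.1.2.1 _, ?_⟩
        have h0 : m.1.1 0 = 1 := m.2
        have := m.1.2.2.2 i.succ 0
        rw [h0, map_one, mul_one, one_mul] at this
        show σ 0 (m.1.1 i.succ) * (m.1.1 i.succ)⁻¹ = 1
        rw [this]; simp
      · intro i; exact m.1.2.2.1 _
      · intro i j; exact m.1.2.2.2 _ _
      · intro m m' h
        have h := Subtype.mk.inj h
        apply Subtype.ext; apply Subtype.ext; funext i
        refine Fin.cases ?_ (fun i => congrFun h i) i
        have h0 : m.1.1 0 = 1 := m.2
        have h0' : m'.1.1 0 = 1 := m'.2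
        rw [h0, h0']
    calc _ = Nat.card π.ker * Nat.card π.range := h1
      _ ≤ (Nat.card B * Nat.card (tors 2 (⊤ : Subgroup M)) ^ f) * Nat.card A := Nat.mul_le_mul (h3.trans (ih _ B)) h2
      _ = (Nat.card A * Nat.card B) * Nat.card (tors 2 (⊤ : Subgroup M)) ^ f := by ring
      _ ≤ _ := Nat.mul_le_mul_right _ hAB
      _ = _ := by ring
end tup

lemma gens_of_relIndex {G : Type*} [Group G] [Finite G] (P : Subgroup G) (d : ℕ) : ∀ (L : Subgroup G), L ≤ P → L.relIndex P ≤ 2 ^ d →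
    ∃ h : Fin d → G, (∀ i, h i ∈ P) ∧ L ⊔ Subgroup.closure (Set.range h) = P := by
  induction d with
  | zero =>
    intro L hL h
    refine ⟨Fin.elim0, fun i => i.elim0, ?_⟩
    have h0 : L.relIndex P ≠ 0 := Subgroup.index_ne_zero_of_finite
    have : L.relIndex P = 1 := by rw [pow_zero] at h; omega
    have := Subgroup.relIndex_eq_one.1 this
    have e : Set.range (Fin.elim0 : Fin 0 → G) = ∅ := Set.range_eq_empty _
    rw [e, Subgroup.closure_empty, sup_bot_eq]
    exact le_antisymm hL this
  | succ d ih =>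
    intro L hL h
    by_cases hP : P ≤ L
    · refine ⟨fun _ => 1, fun i => P.one_mem, ?_⟩
      apply le_antisymm
      · refine sup_le hL ?_
        rw [Subgroup.closure_le]; rintro _ ⟨i, rfl⟩; exact P.one_mem
      · exact hP.trans le_sup_left
    · obtain ⟨x, hx, hxL⟩ := SetLike.not_le_iff_exists.1 hP
      have h1 : L ⊔ Subgroup.closure {x} ≤ P := sup_le hL (by rw [Subgroup.closure_le]; simpa using hx)
      have h2 := Subgroup.relIndex_mul_relIndex L (L ⊔ Subgroup.closure {x}) P le_sup_left h1
      have h3 : L.relIndex (L ⊔ Subgroup.closure {x}) ≠ 1 := by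
        rw [Ne, Subgroup.relIndex_eq_one]
        intro h'; exact hxL (h' (le_sup_right (a := L) (Subgroup.subset_closure rfl)))
      have h4 : L.relIndex (L ⊔ Subgroup.closure {x}) ≠ 0 := Subgroup.index_ne_zero_of_finite
      obtain ⟨g, hg, e⟩ := ih _ h1 (by
        have : 2 ≤ L.relIndex (L ⊔ Subgroup.closure {x}) := by omega
        rw [pow_succ] at h
        nlinarith)
      refine ⟨Fin.cons x g, ?_, ?_⟩
      · intro i; refine Fin.cases hx hg i
      · rw [Fin.range_cons, Set.insert_eq, Subgroup.closure_union, ← sup_assoc, e]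

end CG

namespace CG

lemma card_tors_quot {R : Type*} [CommGroup R] [Finite R] (R0 : Subgroup R) (q : ℕ) [Fact q.Prime] :
    Nat.card (tors q (⊤ : Subgroup (R ⧸ R0))) ≤ Nat.card (tors q (⊤ : Subgroup R)) := by
  have h1 := card_pw (q := q) (⊤ : Subgroup (R ⧸ R0))
  have h2 := card_pw (q := q) (⊤ : Subgroup R)
  rw [Subgroup.card_top] at h1 h2
  have h3 := Subgroup.card_mul_index R0
  have h4 : pw q (⊤ : Subgroup (R ⧸ R0)) = (pw q (⊤ : Subgroup R)).map (QuotientGroup.mk' R0) := by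
    apply le_antisymm
    · rintro _ ⟨x, -, rfl⟩
      obtain ⟨y, rfl⟩ := QuotientGroup.mk'_surjective R0 x
      exact ⟨y ^ q, ⟨y, trivial, rfl⟩, map_pow _ _ _⟩
    · rintro _ ⟨_, ⟨y, -, rfl⟩, rfl⟩
      exact ⟨QuotientGroup.mk' R0 y, trivial, (map_pow _ _ _).symm⟩
  -- |pw R| ≤ |pw M| * |R0|
  have h5 : Nat.card (pw q (⊤ : Subgroup R)) ≤ Nat.card (pw q (⊤ : Subgroup (R ⧸ R0))) * Nat.card R0 := by
    rw [h4, ← Subgroup.relIndex_ker, QuotientGroup.ker_mk']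
    have := Subgroup.card_mul_index (R0.subgroupOf (pw q (⊤ : Subgroup R)))
    rw [← this, mul_comm]
    apply Nat.mul_le_mul_left
    refine Nat.card_le_card_of_injective (fun x => (⟨x.1.1, x.2⟩ : R0)) ?_
    intro x y h; exact Subtype.ext (Subtype.ext (Subtype.mk.inj h))
  have h6 : Nat.card (R ⧸ R0) = R0.index := rfl
  have p1 : 0 < Nat.card (pw q (⊤ : Subgroup (R ⧸ R0))) := Nat.card_pos
  have p2 : 0 < Nat.card R0 := Nat.card_pos
  apply Nat.le_of_mul_le_mul_left _ (Nat.mul_pos p1 p2)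
  calc _ = (Nat.card (pw q (⊤ : Subgroup (R ⧸ R0))) * Nat.card (tors q (⊤ : Subgroup (R ⧸ R0)))) * Nat.card R0 := by ring
    _ = Nat.card R := by rw [← h1, h6, mul_comm, h3]
    _ = _ := h2
    _ ≤ _ := Nat.mul_le_mul_right _ h5

open Classical in
theorem ext_count {G R : Type*} [Group G] [Finite G] [CommGroup R] [Finite R] (j : R →* G) (hj : Function.Injective j)
    (hsq : ∀ g : G, g * g ∈ j.range) (hcm : ∀ g h : G, (h * g)⁻¹ * (g * h) ∈ j.range) 
    (hn : j.range.Normal) (d : ℕ) (hV : j.range.index ≤ 2 ^ d) (hR : Nat.card (tors 2 (⊤ : Subgroup R)) ≤ 2 ^ d) (c : ℕ) :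
    Nat.card {P : Subgroup G // P.index ≤ c} ≤ c * 4 ^ (d * d) * Nat.card {Q : Subgroup R // Q.index ≤ c} := by
  have hgen : ∀ P : Subgroup G, ∃ h : Fin d → G, (∀ i, h i ∈ P) ∧ (P ⊓ j.range) ⊔ Subgroup.closure (Set.range h) = P := by
    intro P
    apply gens_of_relIndex P d _ inf_le_left
    rw [Subgroup.inf_relIndex_left]
    refine le_trans (Nat.le_of_dvd (Nat.pos_of_ne_zero Subgroup.index_ne_zero_of_finite) ?_) hV
    exact Subgroup.relIndex_dvd_index_of_normal _ _
  choose h hhP hh using hgen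
  haveI : Fintype {P : Subgroup G // P.index ≤ c} := Fintype.ofFinite _
  haveI : Fintype {Q : Subgroup R // Q.index ≤ c} := Fintype.ofFinite _
  haveI : Fintype (G ⧸ j.range) := Fintype.ofFinite _
  have hidx : ∀ P : Subgroup G, (P.comap j).index ≤ P.index := by
    intro P
    rw [Subgroup.index_comap, ← Subgroup.relIndex_top_right]
    exact Subgroup.relIndex_le_of_le_right le_top Subgroup.index_ne_zero_of_finite
  let Ψ : {P : Subgroup G // P.index ≤ c} → {Q : Subgroup R // Q.index ≤ c} × (Fin d → G ⧸ j.range) := fun P =>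
    (⟨P.1.comap j, (hidx P.1).trans P.2⟩, fun i => (h P.1 i : G ⧸ j.range))
  have hfib : ∀ y ∈ (Finset.univ : Finset ({Q : Subgroup R // Q.index ≤ c} × (Fin d → G ⧸ j.range))), ((Finset.univ : Finset {P : Subgroup G // P.index ≤ c}).filter (fun P => Ψ P = y)).card ≤ c * (2 ^ d) ^ d := by
    rintro ⟨⟨R0, hR0⟩, v⟩ -
    set F := ((Finset.univ : Finset {P : Subgroup G // P.index ≤ c}).filter (fun P => Ψ P = (⟨R0, hR0⟩, v))) with hF
    rcases F.eq_empty_or_nonempty with he | ⟨P0, hP0⟩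
    · rw [he]; simp
    have hmem : ∀ P ∈ F, P.1.comap j = R0 ∧ ∀ i, (h P.1 i : G ⧸ j.range) = v i := by
      intro P hP
      have := (Finset.mem_filter.1 hP).2
      simp only [Ψ, Prod.mk.injEq, Subtype.mk.injEq] at this
      exact ⟨this.1, fun i => congrFun this.2 i⟩
    have hin : ∀ P ∈ F, ∀ r, j r ∈ P.1 → r ∈ R0 := by
      intro P hP r hr
      rw [← (hmem P hP).1]; exact hr
    have hout : ∀ P ∈ F, ∀ r ∈ R0, j r ∈ P.1 := by
      intro P hP r hr
      rw [← (hmem P hP).1] at hr; exact hr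
    set g := h P0.1 with hg
    have hgP : ∀ i, g i ∈ P0.1 := hhP P0.1
    have hr : ∀ P : F, ∃ r : Fin d → R, ∀ i, h P.1.1 i = g i * j (r i) := by
      intro P
      have : ∀ i, ∃ r, j r = (g i)⁻¹ * h P.1.1 i := by
        intro i
        have h1 := (hmem P.1 P.2).2 i
        rw [← (hmem P0 hP0).2 i] at h1
        exact QuotientGroup.eq.1 h1.symm
      choose r hr using this
      exact ⟨r, fun i => by rw [hr]; group⟩
    choose r hr using hr
    -- conjugation
    have hconj : ∀ i, ∃ s : R →* R, ∀ x, j (s x) = (g i)⁻¹ * j x * g i := by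
      intro i
      have : ∀ x, ∃ y, j y = (g i)⁻¹ * j x * g i := by
        intro x
        have := hn.conj_mem (j x) ⟨x, rfl⟩ (g i)⁻¹
        rw [inv_inv] at this; exact this
      choose s hs using this
      refine ⟨⟨⟨s, ?_⟩, ?_⟩, hs⟩
      · apply hj; rw [hs]; simp
      · intro x y; apply hj; rw [hs, map_mul, map_mul, hs, hs]; group
    choose s hs using hconj
    have hsR : ∀ i, R0 ≤ R0.comap (s i) := by
      intro i x hx
      apply hin P0 hP0
      rw [hs]
      exact P0.1.mul_mem (P0.1.mul_mem (P0.1.inv_mem (hgP i)) (hout P0 hP0 x hx)) (hgP i)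
    let σ : Fin d → (R ⧸ R0 →* R ⧸ R0) := fun i => QuotientGroup.map R0 R0 (s i) (hsR i)
    have hcomm : ∀ i x, j x * g i = g i * j (s i x) := by intro i x; rw [hs]; group
    have hT : ∀ P : F, (fun i => (r P i : R ⧸ R0)) ∈ TT σ (⊤ : Subgroup (R ⧸ R0)) := by
      intro P
      refine ⟨fun i => trivial, fun i => ?_, fun i k => ?_⟩
      · show ((s i (r P i) * r P i : R) : R ⧸ R0) = 1
        rw [QuotientGroup.eq_one_iff]
        have h1 : h P.1.1 i * h P.1.1 i = g i * g i * j (s i (r P i) * r P i) := by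
          rw [hr, map_mul]
          calc _ = g i * (j (r P i) * g i) * j (r P i) := by group
            _ = _ := by rw [hcomm]; group
        obtain ⟨a, ha⟩ := hsq (g i)
        have ha0 : a ∈ R0 := by
          apply hin P0 hP0; rw [ha]; exact P0.1.mul_mem (hgP i) (hgP i)
        have h2 : a * (s i (r P i) * r P i) ∈ R0 := by
          apply hin P.1 P.2
          rw [map_mul, ha, ← h1]; exact P.1.1.mul_mem (hhP _ i) (hhP _ i)
        exact (R0.mul_mem_cancel_left ha0).1 h2
      · show ((s k (r P i) * r P k : R) : R ⧸ R0) = ((s i (r P k) * r P i : R) : R ⧸ R0)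
        have h1 : ∀ i k, h P.1.1 i * h P.1.1 k = g i * g k * j (s k (r P i) * r P k) := by
          intro i k
          rw [hr, hr, map_mul]
          calc _ = g i * (j (r P i) * g k) * j (r P k) := by group
            _ = _ := by rw [hcomm]; group
        obtain ⟨a, ha⟩ := hcm (g i) (g k)
        have ha0 : a ∈ R0 := by
          apply hin P0 hP0; rw [ha]; exact P0.1.mul_mem (P0.1.inv_mem (P0.1.mul_mem (hgP _) (hgP _))) (P0.1.mul_mem (hgP _) (hgP _))
        have h2 : (s i (r P k) * r P i)⁻¹ * a * (s k (r P i) * r P k) ∈ R0 := by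
          apply hin P.1 P.2
          have : j ((s i (r P k) * r P i)⁻¹ * a * (s k (r P i) * r P k)) = (h P.1.1 k * h P.1.1 i)⁻¹ * (h P.1.1 i * h P.1.1 k) := by
            rw [h1, h1, map_mul, map_mul, map_inv, ha]; group
          rw [this]
          exact P.1.1.mul_mem (P.1.1.inv_mem (P.1.1.mul_mem (hhP _ _) (hhP _ _))) (P.1.1.mul_mem (hhP _ _) (hhP _ _))
        refine (QuotientGroup.eq.2 ?_).symm
        have e : (s i (r P k) * r P i)⁻¹ * a * (s k (r P i) * r P k) = a * ((s i (r P k) * r P i)⁻¹ * (s k (r P i) * r P k)) := by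
          rw [mul_comm _ a, mul_assoc]
        rw [e] at h2
        exact (R0.mul_mem_cancel_left ha0).1 h2
    have hinj : F.card ≤ Nat.card (TT σ (⊤ : Subgroup (R ⧸ R0))) := by
      have hle : ∀ P Q : F, (fun i => (r P i : R ⧸ R0)) = (fun i => (r Q i : R ⧸ R0)) → P.1.1 ≤ Q.1.1 := by
        intro P Q e
        rw [← hh P.1.1]
        apply sup_le
        · rintro _ ⟨hx, ⟨x, rfl⟩⟩
          exact hout Q.1 Q.2 _ (hin P.1 P.2 _ hx)
        · rw [Subgroup.closure_le]
          rintro _ ⟨i, rfl⟩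
          have h1 : (r Q i)⁻¹ * r P i ∈ R0 := QuotientGroup.eq.1 (congrFun e i).symm
          have h2 : h P.1.1 i = h Q.1.1 i * j ((r Q i)⁻¹ * r P i) := by
            rw [hr, hr, map_mul, map_inv]; group
          rw [h2]
          exact Q.1.1.mul_mem (hhP _ i) (hout Q.1 Q.2 _ h1)
      rw [← Nat.card_eq_finsetCard]
      refine Nat.card_le_card_of_injective (fun P : F => (⟨_, hT P⟩ : TT σ (⊤ : Subgroup (R ⧸ R0)))) ?_
      intro P Q e
      have e := Subtype.mk.inj e
      exact Subtype.ext (Subtype.ext (le_antisymm (hle P Q e) (hle Q P e.symm)))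
    refine hinj.trans ((card_TT σ _).trans ?_)
    apply Nat.mul_le_mul
    · rw [Subgroup.card_top]; exact hR0
    · exact Nat.pow_le_pow_left ((card_tors_quot R0 2).trans hR) d
  have := Finset.card_le_mul_card_image_of_maps_to (f := Ψ) (fun P _ => Finset.mem_univ (Ψ P)) _ hfib
  rw [Finset.card_univ, Finset.card_univ, ← Nat.card_eq_fintype_card, ← Nat.card_eq_fintype_card, Nat.card_prod, Nat.card_fun, Nat.card_fin] at this
  refine this.trans ?_
  have hW : Nat.card (G ⧸ j.range) ^ d ≤ (2 ^ d) ^ d := Nat.pow_le_pow_left hV d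
  have e4 : (4:ℕ) ^ (d * d) = (2 ^ d) ^ d * (2 ^ d) ^ d := by
    rw [← mul_pow, ← mul_pow, ← pow_mul]; norm_num
  rw [e4]
  calc _ ≤ c * (2 ^ d) ^ d * (Nat.card {Q : Subgroup R // Q.index ≤ c} * (2 ^ d) ^ d) := Nat.mul_le_mul_left _ (Nat.mul_le_mul_left _ hW)
    _ = _ := by ring
end CG

namespace CG

section
variable {ι : Type*} [Fintype ι] {G : ι → Type*} [∀ i, Group (G i)] [∀ i, Finite (G i)]

/-- the inclusion of a product of subgroups -/
def pinc (Y : ∀ i, Subgroup (G i)) : (∀ i, Y i) →* (∀ i, G i) where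
  toFun f := fun i => (f i).1
  map_one' := rfl
  map_mul' _ _ := rfl

lemma pinc_inj (Y : ∀ i, Subgroup (G i)) : Function.Injective (pinc Y) := by
  intro f g h
  funext i
  exact Subtype.ext (congrFun h i)

/-- counting subgroups of a product through the type-level product -/
lemma pinc_count (Y : ∀ i, Subgroup (G i)) (c : ℕ) :
    Nat.card {P : Subgroup (∀ i, G i) // (∀ x ∈ P, ∀ i, x i ∈ Y i) ∧ ∏ i, Nat.card (Y i) ≤ c * Nat.card P} ≤
      Nat.card {Q : Subgroup (∀ i, Y i) // Q.index ≤ c} := by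
  have hr : ∀ P : Subgroup (∀ i, G i), (∀ x ∈ P, ∀ i, x i ∈ Y i) → (P.comap (pinc Y)).map (pinc Y) = P := by
    intro P hP
    apply Subgroup.map_comap_eq_self
    intro x hx
    exact ⟨fun i => ⟨x i, hP x hx i⟩, rfl⟩
  refine Nat.card_le_card_of_injective (fun P => ⟨P.1.comap (pinc Y), ?_⟩) ?_
  · have h1 := hr P.1 P.2.1
    have h2 : Nat.card (P.1.comap (pinc Y)) = Nat.card P.1 := by
      conv_rhs => rw [← h1]
      exact (Subgroup.card_map_of_injective (pinc_inj Y)).symm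
    have h3 := Subgroup.card_mul_index (P.1.comap (pinc Y))
    rw [Nat.card_pi, h2] at h3
    have h4 := P.2.2
    have h5 := h3.le.trans h4
    rw [mul_comm] at h5
    exact Nat.le_of_mul_le_mul_right h5 Nat.card_pos
  · intro P Q h
    have h := Subtype.mk.inj h
    apply Subtype.ext
    rw [← hr P.1 P.2.1, ← hr Q.1 Q.2.1, h]

lemma tors_pi (q : ℕ) [hq : Fact q.Prime] {C : ι → Type*} [∀ i, CommGroup (C i)] [∀ i, Finite (C i)] (hC : ∀ i, IsCyclic (C i))
    (D : Finset ι) (hD : ∀ i, i ∉ D → Subsingleton (C i)) :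
    Nat.card (tors q (⊤ : Subgroup (∀ i, C i))) ≤ q ^ D.card := by
  classical
  have h1 : Nat.card (tors q (⊤ : Subgroup (∀ i, C i))) ≤ Nat.card (∀ i, {a : C i // a ^ q = 1}) := by
    refine Nat.card_le_card_of_injective (fun x i => ⟨x.1 i, congrFun (show x.1 ^ q = 1 from x.2.2) i⟩) ?_
    intro x y h
    apply Subtype.ext
    funext i
    exact Subtype.mk.inj (congrFun h i)
  rw [Nat.card_pi] at h1
  refine h1.trans ?_
  rw [← Finset.prod_const, ← Finset.prod_subset (Finset.subset_univ D) (fun i _ hi => by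
    haveI := hD i hi
    haveI : Subsingleton {a : C i // a ^ q = 1} := inferInstance
    haveI : Nonempty {a : C i // a ^ q = 1} := ⟨⟨1, one_pow q⟩⟩
    exact Nat.card_unique)]
  refine Finset.prod_le_prod' fun i _ => ?_
  haveI : Fintype (C i) := Fintype.ofFinite _
  rw [Nat.card_eq_fintype_card, Fintype.card_subtype]
  exact IsCyclic.card_pow_eq_one_le hq.out.pos

/-- odd case -/
lemma cyc_count (q : ℕ) [hq : Fact q.Prime] (C : ι → Type*) [∀ i, Group (C i)] [∀ i, Finite (C i)] (hC : ∀ i, IsCyclic (C i))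
    (hp : ∀ i, IsPGroup q (C i)) (D : Finset ι) (hD : ∀ i, i ∉ D → Subsingleton (C i)) (c : ℕ) (hc : 1 ≤ c) :
    (Nat.card {Q : Subgroup (∀ i, C i) // Q.index ≤ c} : ℝ) ≤ (c:ℝ) ^ (kap * D.card) * (∏ i, Nat.card (C i) : ℝ) ^ (kap * D.card + 2) := by
  letI : ∀ i, CommGroup (C i) := fun i => IsCyclic.commGroup
  have hX : IsPGroup q (∀ i, C i) := by
    choose n hn using fun i => (hp i).exists_card_eq
    rw [IsPGroup.iff_card]
    refine ⟨∑ i, n i, ?_⟩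
    rw [Nat.card_pi, ← Finset.prod_pow_eq_pow_sum]
    exact Finset.prod_congr rfl fun i _ => hn i
  have := sub_count (q := q) hX D.card (tors_pi q hC D hD) c (by exact_mod_cast hc)
  rw [Nat.card_pi] at this
  push_cast at this
  simp only [Nat.cast_le] at this
  exact this

open Classical in
/-- the combined count -/
theorem qc_count (q : ℕ) [hq : Fact q.Prime] (Y Y0 : ∀ i, Subgroup (G i)) (hQ : ∀ i, QC (Y i) (Y0 i)) (h2 : ∀ i, q ≠ 2 → Y0 i = Y i)
    (hp : ∀ i, IsPGroup q (Y i)) (D : Finset ι) (hD : ∀ i, i ∉ D → Y i = ⊥) (c : ℕ) (hc : 1 ≤ c) :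
    (Nat.card {P : Subgroup (∀ i, G i) // (∀ x ∈ P, ∀ i, x i ∈ Y i) ∧ ∏ i, Nat.card (Y i) ≤ c * Nat.card P} : ℝ) ≤ 
     (if q = 2 then (c:ℝ) * 4 ^ (D.card * D.card) else 1) * ((c:ℝ) ^ (kap * D.card) * (∏ i, Nat.card (Y i) : ℝ) ^ (kap * D.card + 2)) := by
  have h1 := pinc_count Y c
  refine (show (Nat.card _ : ℝ) ≤ (Nat.card {Q : Subgroup (∀ i, Y i) // Q.index ≤ c} : ℝ) from by exact_mod_cast h1).trans ?_
  by_cases hq2 : q = 2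
  · subst hq2
    rw [if_pos rfl]
    letI : ∀ i, CommGroup (Y0 i) := fun i => haveI := (hQ i).2.1; IsCyclic.commGroup
    let j : (∀ i, Y0 i) →* (∀ i, Y i) := 
      { toFun := fun f i => ⟨(f i).1, (hQ i).1 (f i).2⟩
        map_one' := rfl
        map_mul' := fun _ _ => rfl }
    have hD0 : ∀ i, i ∉ D → Subsingleton (Y0 i) := by
      intro i hi
      have : Y0 i = ⊥ := le_bot_iff.1 (by rw [← hD i hi]; exact (hQ i).1)
      rw [this]; infer_instance
    have hj : Function.Injective j := by
      intro f g h
      funext i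
      exact Subtype.ext (Subtype.mk.inj (congrFun h i))
    have hmem : ∀ f : (∀ i, Y i), f ∈ j.range ↔ ∀ i, (f i).1 ∈ Y0 i := by
      intro f
      constructor
      · rintro ⟨g, rfl⟩ i; exact (g i).2
      · intro h; exact ⟨fun i => ⟨(f i).1, h i⟩, rfl⟩
    have hsq : ∀ g, g * g ∈ j.range := by
      intro g; rw [hmem]; intro i; exact (hQ i).sq (g i).2
    have hn : j.range.Normal := by
      refine ⟨fun f hf g => ?_⟩
      rw [hmem] at hf ⊢
      intro i; exact (hQ i).conj (g i).2 (hf i)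
    have hcm : ∀ g h : (∀ i, Y i), (h * g)⁻¹ * (g * h) ∈ j.range := by
      intro g h
      have e : (h * g)⁻¹ * (g * h) = ((h * g)⁻¹ * (h * g)⁻¹) * (h * (g * g) * h⁻¹) * (h * h) := by group
      rw [e]
      exact j.range.mul_mem (j.range.mul_mem (hsq _) (hn.conj_mem _ (hsq g) h)) (hsq h)
    have hV : j.range.index ≤ 2 ^ D.card := by
      have h3 := Subgroup.card_mul_index j.range
      have h4 : Nat.card j.range = ∏ i, Nat.card (Y0 i) := by
        rw [← Nat.card_pi]
        exact Nat.card_congr (MonoidHom.ofInjective hj).toEquiv.symm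
      rw [h4, Nat.card_pi] at h3
      have h5 : ∀ i, Nat.card (Y i) ≤ (if i ∈ D then 2 else 1) * Nat.card (Y0 i) := by
        intro i
        by_cases hiD : i ∈ D
        swap
        · rw [if_neg hiD, hD i hiD, Subgroup.card_bot, one_mul]; exact Nat.card_pos
        rw [if_pos hiD]
        have h6 : ((Y0 i).subgroupOf (Y i)).index ≤ 2 := by
          by_cases ht : (Y0 i).subgroupOf (Y i) = ⊤
          · rw [ht, Subgroup.index_top]; norm_num
          · obtain ⟨a, ha⟩ : ∃ a : Y i, a ∉ (Y0 i).subgroupOf (Y i) := by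
              by_contra hcon; push Not at hcon
              exact ht (eq_top_iff.2 fun x _ => hcon x)
            apply le_of_eq
            rw [Subgroup.index_eq_two_iff]
            refine ⟨a, fun b => ?_⟩
            have ha' : a.1 ∉ Y0 i := ha
            by_cases hb : b.1 ∈ Y0 i
            · right
              refine ⟨hb, fun hba => ha' ?_⟩
              exact ((Y0 i).mul_mem_cancel_left hb).1 hba
            · left
              exact ⟨(hQ i).2.2 _ b.2 _ a.2 hb ha', hb⟩
        have h7 := Subgroup.card_mul_index ((Y0 i).subgroupOf (Y i))
        have h8 : Nat.card ((Y0 i).subgroupOf (Y i)) = Nat.card (Y0 i) := 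
          Nat.card_congr (Subgroup.subgroupOfEquivOfLe (hQ i).1).toEquiv
        rw [h8] at h7
        rw [← h7, mul_comm]; exact Nat.mul_le_mul_right _ h6
      have h9 : ∏ i, Nat.card (Y i) ≤ 2 ^ D.card * ∏ i, Nat.card (Y0 i) := by
        calc _ ≤ ∏ i, (if i ∈ D then 2 else 1) * Nat.card (Y0 i) := Finset.prod_le_prod' fun i _ => h5 i
          _ = _ := by rw [Finset.prod_mul_distrib, Finset.prod_ite_mem, Finset.univ_inter, Finset.prod_const]
      rw [← h3, mul_comm] at h9
      exact Nat.le_of_mul_le_mul_right h9 (Finset.prod_pos fun i _ => Nat.card_pos)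
    have h3 := ext_count j hj hsq hcm hn (D.card) hV (tors_pi 2 (fun i => (hQ i).2.1) D hD0) c
    have h4 := cyc_count 2 (fun i => Y0 i) (fun i => (hQ i).2.1) (fun i => (hp i).to_le (hQ i).1) D hD0 c hc
    have h5 : (∏ i, Nat.card (Y0 i) : ℝ) ≤ ∏ i, (Nat.card (Y i) : ℝ) := by
      exact_mod_cast Finset.prod_le_prod' fun i _ => Subgroup.card_le_of_le (hQ i).1
    have hk : 0 ≤ kap * D.card + 2 := by have := kap_pos; positivity
    calc (Nat.card {Q : Subgroup (∀ i, Y i) // Q.index ≤ c} : ℝ) ≤ (c * 4 ^ (D.card * D.card)) * Nat.card {Q : Subgroup (∀ i, Y0 i) // Q.index ≤ c} := by exact_mod_cast h3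
      _ ≤ _ := by
        apply mul_le_mul_of_nonneg_left _ (by positivity)
        refine h4.trans ?_
        apply mul_le_mul_of_nonneg_left _ (by positivity)
        exact Real.rpow_le_rpow (by positivity) h5 hk
  · rw [if_neg hq2, one_mul]
    refine cyc_count q (fun i => Y i) (fun i => ?_) hp D (fun i hi => by rw [hD i hi]; infer_instance) c hc
    have := (hQ i).2.1
    rwa [h2 i hq2] at this
end
end CG

namespace CG

/-- subgroups counted at level `m` -/
abbrev LevSub (m n : ℕ) := {K : Subgroup (GS m.primeFactors (kk m)) // NoFull K ∧ K.index ≤ n}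

lemma finite_cong (n : ℕ) : 
    Finite {H : Subgroup (SL2 ℤ) // IsCongruenceSubgroup H ∧ H.index ≤ n} ∧ 
    congCount 2 n ≤ ∑ m ∈ Finset.Icc 1 (3 * n), Nat.card (LevSub m n) := by
  classical
  have key : ∀ H : {H : Subgroup (SL2 ℤ) // IsCongruenceSubgroup H ∧ H.index ≤ n}, 
      ∃ y : (Σ m : Finset.Icc 1 (3 * n), LevSub m.1 n), H.1 = y.2.1.comap (phi _ _) := by
    rintro ⟨H, ⟨hH, hn⟩⟩
    obtain ⟨m, hm, K, hK1, hK2, hK3, hK4⟩ := level H hH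
    refine ⟨⟨⟨m, Finset.mem_Icc.2 ⟨hm, by omega⟩⟩, ⟨K, hK1, by omega⟩⟩, hK2⟩
  choose f hf using key
  have hinj : Function.Injective f := by
    intro H H' h
    apply Subtype.ext
    rw [hf H, hf H', h]
  refine ⟨Finite.of_injective f hinj, ?_⟩
  have h1 : congCount 2 n ≤ Nat.card (Σ m : Finset.Icc 1 (3 * n), LevSub m.1 n) := Nat.card_le_card_of_injective f hinj
  rw [Nat.card_sigma] at h1
  refine h1.trans (le_of_eq ?_)
  exact Finset.sum_coe_sort (Finset.Icc 1 (3 * n)) (fun m => Nat.card (LevSub m n))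

lemma Gen.tuple {X : Type*} [Group X] {J : Subgroup X} {r : ℕ} (h : Gen J r) : ∃ f : Fin r → X, Subgroup.closure (Set.range f) = J := by
  obtain ⟨s, hs, rfl⟩ := h
  classical
  refine ⟨fun i => if h : i.1 < s.card then (s.equivFin.symm ⟨i.1, h⟩).1 else 1, ?_⟩
  apply le_antisymm
  · rw [Subgroup.closure_le]
    rintro _ ⟨i, rfl⟩
    dsimp only
    split_ifs with h
    · exact Subgroup.subset_closure (s.equivFin.symm ⟨i.1, h⟩).2
    · exact Subgroup.one_mem _
  · rw [Subgroup.closure_le]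
    intro x hx
    apply Subgroup.subset_closure
    have hlt := (s.equivFin ⟨x, hx⟩).2
    refine ⟨⟨(s.equivFin ⟨x, hx⟩).1, lt_of_lt_of_le hlt hs⟩, ?_⟩
    dsimp only
    rw [dif_pos hlt]
    simp

section
variable {ι : Type*} [Fintype ι] [LinearOrder ι] {G : ι → Type*} [∀ i, Group (G i)] [∀ i, Finite (G i)]

lemma supp_mono (H : Subgroup (∀ i, G i)) {s t : Finset ι} (h : s ⊆ t) : supp H s ≤ supp H t := by
  intro x hx
  rw [mem_supp] at hx ⊢
  exact ⟨hx.1, fun i hi => hx.2 i (fun h' => hi (h h'))⟩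

lemma supp_insert {r : ℕ} (hr : ∀ i (J : Subgroup (G i)), Gen J r) (H : Subgroup (∀ i, G i)) (s : Finset ι) (a : ι) :
    ∃ f : Fin r → (∀ i, G i), (∀ k, f k ∈ supp H (insert a s)) ∧ supp H (insert a s) = supp H s ⊔ Subgroup.closure (Set.range f) := by
  obtain ⟨g, hg⟩ := (hr a ((supp H (insert a s)).map (Pi.evalMonoidHom G a))).tuple
  have h1 : ∀ k, ∃ x ∈ supp H (insert a s), x a = g k := by
    intro k
    have : g k ∈ (supp H (insert a s)).map (Pi.evalMonoidHom G a) := by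
      rw [← hg]; exact Subgroup.subset_closure ⟨k, rfl⟩
    obtain ⟨x, hx, e⟩ := this
    exact ⟨x, hx, e⟩
  choose f hf hfg using h1
  refine ⟨f, hf, le_antisymm ?_ ?_⟩
  · intro x hx
    have h2 : x a ∈ (Subgroup.closure (Set.range f)).map (Pi.evalMonoidHom G a) := by
      rw [MonoidHom.map_closure, ← Set.range_comp]
      have : (⇑(Pi.evalMonoidHom G a) ∘ f) = g := by funext k; exact hfg k
      rw [this, hg]
      exact ⟨x, hx, rfl⟩
    obtain ⟨y, hy, e⟩ := h2
    have e : y a = x a := e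
    have hy' : y ∈ supp H (insert a s) := by
      refine (Subgroup.closure_le _).2 ?_ hy
      rintro _ ⟨k, rfl⟩; exact hf k
    have hxy : x * y⁻¹ ∈ supp H s := by
      have h3 := mem_supp.1 ((supp H (insert a s)).mul_mem hx ((supp H (insert a s)).inv_mem hy'))
      rw [mem_supp]
      refine ⟨h3.1, fun i hi => ?_⟩
      by_cases hia : i = a
      · subst hia; rw [Pi.mul_apply, Pi.inv_apply, e]; simp
      · exact h3.2 i (by simp [hia, hi])
    have := Subgroup.mul_mem_sup hxy hy
    simpa using this
  · refine sup_le (supp_mono H (Finset.subset_insert _ _)) ?_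
    rw [Subgroup.closure_le]
    rintro _ ⟨k, rfl⟩; exact hf k

lemma supp_gen {r : ℕ} (hr : ∀ i (J : Subgroup (G i)), Gen J r) (H : Subgroup (∀ i, G i)) (s : Finset ι) (u : Finset ι) :
    ∃ f : Fin (r * u.card) → (∀ i, G i), (∀ k, f k ∈ supp H (u ∪ s)) ∧ supp H (u ∪ s) = supp H s ⊔ Subgroup.closure (Set.range f) := by
  induction u using Finset.induction_on with
  | empty =>
    refine ⟨fun _ => 1, fun k => Subgroup.one_mem _, ?_⟩
    rw [Finset.empty_union]
    apply le_antisymm le_sup_left (sup_le le_rfl ?_)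
    rw [Subgroup.closure_le]
    rintro _ ⟨k, rfl⟩; exact Subgroup.one_mem _
  | insert a u ha ih =>
    obtain ⟨f, hf, e⟩ := ih
    obtain ⟨g, hg, e'⟩ := supp_insert hr H (u ∪ s) a
    rw [Finset.insert_union]
    have hcard : r * (insert a u).card = r * u.card + r := by rw [Finset.card_insert_of_notMem ha]; ring
    rw [hcard]
    refine ⟨Fin.append f g, ?_, ?_⟩
    · intro k
      refine Fin.addCases (fun i => ?_) (fun i => ?_) k
      · rw [Fin.append_left]; exact supp_mono H (Finset.subset_insert _ _) (hf i)
      · rw [Fin.append_right]; exact hg i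
    · have hrange : Set.range (Fin.append f g) = Set.range f ∪ Set.range g := by
        ext x; constructor
        · rintro ⟨k, rfl⟩
          refine Fin.addCases (fun i => ?_) (fun i => ?_) k
          · rw [Fin.append_left]; exact Or.inl ⟨i, rfl⟩
          · rw [Fin.append_right]; exact Or.inr ⟨i, rfl⟩
        · rintro (⟨i, rfl⟩ | ⟨i, rfl⟩)
          · exact ⟨Fin.castAdd _ i, Fin.append_left _ _ _⟩
          · exact ⟨Fin.natAdd _ i, Fin.append_right _ _ _⟩
      rw [hrange, Subgroup.closure_union, ← sup_assoc, ← e, e']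

lemma supp_univ (H : Subgroup (∀ i, G i)) : supp H Finset.univ = H := by
  ext x; rw [mem_supp]; simp

/-- reduction to the small part -/
lemma split_count {r : ℕ} (hr : ∀ i (J : Subgroup (G i)), Gen J r) (T : Finset ι) (Φ : Subgroup (∀ i, G i) → Prop) :
    Nat.card {H : Subgroup (∀ i, G i) // Φ H} ≤ 
      Nat.card {K : Subgroup (∀ i, G i) // ∃ H, Φ H ∧ K = supp H T} * (Nat.card (∀ i, G i)) ^ (r * Tᶜ.card) := by
  have h : ∀ H : {H : Subgroup (∀ i, G i) // Φ H}, ∃ f : Fin (r * Tᶜ.card) → (∀ i, G i), H.1 = supp H.1 T ⊔ Subgroup.closure (Set.range f) := by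
    intro H
    obtain ⟨f, -, e⟩ := supp_gen hr H.1 T Tᶜ
    have : Tᶜ ∪ T = Finset.univ := by rw [Finset.union_comm]; exact Finset.union_compl T
    rw [this, supp_univ] at e
    exact ⟨f, e⟩
  choose f hf using h
  have : Nat.card (Fin (r * Tᶜ.card) → (∀ i, G i)) = (Nat.card (∀ i, G i)) ^ (r * Tᶜ.card) := by
    rw [Nat.card_fun, Nat.card_fin]
  rw [← this, ← Nat.card_prod]
  refine Nat.card_le_card_of_injective (fun H => (⟨supp H.1 T, H.1, H.2, rfl⟩, f H)) ?_
  intro H H' h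
  have h1 : supp H.1 T = supp H'.1 T := Subtype.mk.inj (congrArg Prod.fst h)
  have h2 : f H = f H' := congrArg Prod.snd h
  apply Subtype.ext
  rw [hf H, hf H', h1, h2]

end
end CG

namespace CG

section
variable {ι : Type*} [Fintype ι] [LinearOrder ι] {G : ι → Type*} [∀ i, Group (G i)] [∀ i, Finite (G i)]

lemma cS_mono {H K : Subgroup (∀ i, G i)} (h : K ≤ H) (i : ι) : cS K i ≤ cS H i := by
  rintro _ ⟨x, hx, rfl⟩
  exact ⟨x, ⟨h (mem_supp.1 hx).1, (mem_supp.1 hx).2⟩, rfl⟩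

lemma supp_le (H : Subgroup (∀ i, G i)) (T : Finset ι) : supp H T ≤ H := fun x hx => (mem_supp.1 hx).1

lemma aS_supp (H : Subgroup (∀ i, G i)) (T : Finset ι) (i : ι) (hi : i ∉ T) : aS (supp H T) i = ⊥ := by
  rw [eq_bot_iff]
  rintro _ ⟨x, hx, rfl⟩
  exact (mem_supp.1 hx).2 i hi

lemma cS_top_supp (T : Finset ι) (i : ι) (hi : i ∈ T) : cS (supp (⊤ : Subgroup (∀ i, G i)) T) i = ⊤ := by
  rw [eq_top_iff]
  intro x _
  refine ⟨Pi.mulSingle i x, ⟨⟨trivial, fun j hj => ?_⟩, fun j hj => ?_⟩, by simp⟩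
  · rw [Pi.mulSingle_eq_of_ne]; rintro rfl; exact hj hi
  · rw [Pi.mulSingle_eq_of_ne]; rintro rfl; simp at hj

lemma card_triv (K : Subgroup (∀ i, G i)) (T : Finset ι) (hT : ∀ i, i ∉ T → aS K i = ⊥) :
    Nat.card K = ∏ i ∈ T, Nat.card (cS K i) := by
  rw [card_eq_prod K]
  symm
  apply Finset.prod_subset (Finset.subset_univ T)
  intro i _ hi
  have : cS K i = ⊥ := le_bot_iff.1 ((cS_le_aS K i).trans (hT i hi).le)
  rw [this, Subgroup.card_bot]

lemma card_supp_top (T : Finset ι) : Nat.card (supp (⊤ : Subgroup (∀ i, G i)) T) = ∏ i ∈ T, Nat.card (G i) := by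
  rw [card_triv _ T (aS_supp _ T)]
  refine Finset.prod_congr rfl fun i hi => ?_
  rw [cS_top_supp T i hi, Subgroup.card_top]

lemma index_supp (H : Subgroup (∀ i, G i)) (T : Finset ι) : ∏ i ∈ T, (cS (supp H T) i).index ≤ H.index := by
  set W := supp (⊤ : Subgroup (∀ i, G i)) T with hW
  have h1 : supp H T = H ⊓ W := by
    ext x; rw [Subgroup.mem_inf, mem_supp, hW, mem_supp]; simp
  have h2 : H.relIndex W ≤ H.index := by
    rw [← Subgroup.relIndex_top_right H]
    exact Subgroup.relIndex_le_of_le_right le_top Subgroup.index_ne_zero_of_finite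
  have h3 : Nat.card (supp H T) * H.relIndex W = Nat.card W := by
    have := Subgroup.relIndex_mul_relIndex ⊥ (H ⊓ W) W bot_le inf_le_right
    rw [Subgroup.relIndex_bot_left, Subgroup.relIndex_bot_left, Subgroup.inf_relIndex_right] at this
    rw [h1]; exact this
  rw [hW, card_supp_top, card_triv _ T (aS_supp H T)] at h3
  have h4 : (∏ i ∈ T, Nat.card (cS (supp H T) i)) * ∏ i ∈ T, (cS (supp H T) i).index = ∏ i ∈ T, Nat.card (G i) := by
    rw [← Finset.prod_mul_distrib]
    exact Finset.prod_congr rfl fun i _ => Subgroup.card_mul_index _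
  rw [← h4] at h3
  have h5 := Nat.eq_of_mul_eq_mul_left (Finset.prod_pos fun i _ => Nat.card_pos) h3
  rw [← h5]; exact h2

lemma card_supp_union (H : Subgroup (∀ i, G i)) (s u : Finset ι) (M : ℕ) (hM : ∀ i ∈ u, Nat.card (G i) ≤ M) :
    Nat.card (supp H (u ∪ s)) ≤ M ^ u.card * Nat.card (supp H s) := by
  induction u using Finset.induction_on with
  | empty => simp
  | insert a u ha ih =>
    have ih := ih fun i hi => hM i (Finset.mem_insert_of_mem hi)
    rw [Finset.insert_union, Finset.card_insert_of_notMem ha]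
    let π : supp H (insert a (u ∪ s)) →* G a := (Pi.evalMonoidHom G a).comp (Subgroup.subtype _)
    have h1 := Subgroup.card_mul_index π.ker
    rw [Subgroup.index_ker] at h1
    have h2 : Nat.card π.range ≤ M := (Subgroup.card_le_card_group _).trans (hM a (Finset.mem_insert_self _ _))
    have h3 : Nat.card π.ker ≤ Nat.card (supp H (u ∪ s)) := by
      refine Nat.card_le_card_of_injective (fun x => ⟨x.1.1, ?_⟩) ?_
      · have hx := mem_supp.1 x.1.2
        rw [mem_supp]
        refine ⟨hx.1, fun i hi => ?_⟩
        by_cases hia : i = a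
        · subst hia; exact x.2
        · exact hx.2 i (by simp only [Finset.mem_insert, hia, false_or]; exact hi)
      · intro x y h; exact Subtype.ext (Subtype.ext (Subtype.mk.inj h))
    rw [← h1, pow_succ]
    calc _ ≤ Nat.card (supp H (u ∪ s)) * M := Nat.mul_le_mul h3 h2
      _ ≤ (M ^ u.card * Nat.card (supp H s)) * M := Nat.mul_le_mul_right _ ih
      _ = _ := by ring
end

/-- the `q`-part of `a` -/
def op (q a : ℕ) : ℕ := q ^ a.factorization q

lemma op_pos {q a : ℕ} (hq : q.Prime) : 0 < op q a := pow_pos hq.pos _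
lemma op_dvd (q a : ℕ) : op q a ∣ a := Nat.ordProj_dvd a q
lemma op_mul {q a b : ℕ} (ha : a ≠ 0) (hb : b ≠ 0) : op q (a * b) = op q a * op q b := by
  rw [op, Nat.factorization_mul ha hb, Finsupp.add_apply, pow_add]; rfl
lemma op_prod {ι : Type*} {q : ℕ} (s : Finset ι) (f : ι → ℕ) (h : ∀ i ∈ s, f i ≠ 0) : op q (∏ i ∈ s, f i) = ∏ i ∈ s, op q (f i) := by
  classical
  induction s using Finset.induction_on with
  | empty => simp [op]
  | insert a s ha ih =>
    rw [Finset.prod_insert ha, Finset.prod_insert ha, op_mul (h a (by simp)) (Finset.prod_ne_zero_iff.2 fun i hi => h i (by simp [hi])), ih fun i hi => h i (by simp [hi])]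
lemma op_eq_one {q a : ℕ} (h : ¬ q ∣ a) : op q a = 1 := by
  rw [op, Nat.factorization_eq_zero_of_not_dvd h, pow_zero]
lemma op_coprime {q r a b : ℕ} (hq : q.Prime) (hr : r.Prime) (h : q ≠ r) : Nat.Coprime (op q a) (op r b) :=
  Nat.Coprime.pow _ _ ((Nat.coprime_primes hq hr).2 h)
lemma prod_op_dvd {a b : ℕ} (Q : Finset ℕ) (hQ : ∀ q ∈ Q, q.Prime) (h : ∀ q ∈ Q, op q a ∣ b) : ∏ q ∈ Q, op q a ∣ b := by
  apply Finset.prod_dvd_of_isRelPrime _ h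
  intro q hq r hr hne
  exact Nat.coprime_iff_isRelPrime.1 (op_coprime (hQ q hq) (hQ r hr) hne)

end CG

namespace CG

section
variable {ι : Type*} [Fintype ι] [LinearOrder ι] {G : ι → Type*} [∀ i, Group (G i)] [∀ i, Finite (G i)]

/-- the analytic bound for the number of `q`-subgroups -/
noncomputable def qbd (q d c s : ℕ) : ℝ :=
  (if q = 2 then (c:ℝ) * 4 ^ (d * d) else 1) * ((c:ℝ) ^ (kap * d) * (s : ℝ) ^ (kap * d + 2))

lemma qbd_nonneg (q d c s : ℕ) : 0 ≤ qbd q d c s := by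
  unfold qbd; split_ifs <;> positivity

lemma qbot {X' : Type*} [Group X'] : QC (⊥ : Subgroup X') ⊥ := by
  refine ⟨le_rfl, inferInstance, fun x hx y hy _ _ => Subgroup.mul_mem _ hx hy⟩

/-- subgroup generated by the code at a place in `D` -/
def ycode (D : Finset ι) (w : ∀ i : D, G i × G i) (i : ι) : Subgroup (G i) :=
  if h : i ∈ D then Subgroup.closure {(w ⟨i, h⟩).1, (w ⟨i, h⟩).2} else ⊥

theorem perq_count {r : ℕ} (hr : ∀ i (J : Subgroup (G i)), Gen J r) (q : ℕ) [hq : Fact q.Prime] (u D : Finset ι)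
    (hu : u.card ≤ 1) (hqc : ∀ i ∈ D, ∀ Y : Subgroup (G i), IsPGroup q Y → ∃ Y0, QC Y Y0 ∧ (q ≠ 2 → Y0 = Y))
    (M : ℕ) (hM1 : 1 ≤ M) (hM : ∀ i ∈ u ∪ D, Nat.card (G i) ≤ M) (a : ι → ℕ) (x : ℕ) (hx : 1 ≤ x) :
    (Nat.card {P : Subgroup (∀ i, G i) // (∀ g ∈ P, ∀ i, i ∉ u ∪ D → g i = 1) ∧
        (∀ i ∈ D, ∃ Y : Subgroup (G i), IsPGroup q Y ∧ Nat.card Y = a i ∧ ∀ g ∈ P, g i ∈ Y) ∧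
        ∏ i ∈ D, a i ≤ x * Nat.card P} : ℝ) ≤
      (M : ℝ) ^ (r * (u ∪ D).card + 2 * D.card) * qbd q D.card (x * M) (∏ i ∈ D, a i) := by
  classical
  set E := u ∪ D with hE
  let V : (∀ i : D, G i × G i) → Prop := fun w => ∀ i ∈ D, IsPGroup q (ycode D w i) ∧ Nat.card (ycode D w i) = a i
  let W := (∀ i : D, G i × G i) × (Fin (r * u.card) → supp (⊤ : Subgroup (∀ i, G i)) E)
  let F : W → Type _ := fun w => {P : Subgroup (∀ i, G i) // V w.1 ∧ ((∀ g ∈ P, ∀ i, g i ∈ ycode D w.1 i) ∧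
    ∏ i, Nat.card (ycode D w.1 i) ≤ (x * M) * Nat.card P)}
  have hFc : ∀ w, (Nat.card (F w) : ℝ) ≤ qbd q D.card (x * M) (∏ i ∈ D, a i) := by
    intro w
    by_cases hV : V w.1
    · have hb : ∀ i, i ∉ D → ycode D w.1 i = ⊥ := fun i hi => by simp [ycode, hi]
      have hprod : ∏ i, Nat.card (ycode D w.1 i) = ∏ i ∈ D, a i := by
        rw [← Finset.prod_subset (Finset.subset_univ D)]
        · exact Finset.prod_congr rfl fun i hi => (hV i hi).2
        · intro i _ hi; rw [hb i hi, Subgroup.card_bot]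
      have hex : ∀ i, ∃ Y0, QC (ycode D w.1 i) Y0 ∧ (q ≠ 2 → Y0 = ycode D w.1 i) := by
        intro i
        by_cases hi : i ∈ D
        · exact hqc i hi _ (hV i hi).1
        · rw [hb i hi]; exact ⟨⊥, qbot, fun _ => rfl⟩
      choose Y0 hY0 hY2 using hex
      have key := qc_count q (ycode D w.1) Y0 hY0 hY2 (fun i => by
        by_cases hi : i ∈ D
        · exact (hV i hi).1
        · rw [hb i hi]; exact IsPGroup.of_bot) D hb (x * M) (Nat.mul_pos hx hM1)
      have : (∏ i, (Nat.card (ycode D w.1 i) : ℝ)) = ((∏ i ∈ D, a i : ℕ) : ℝ) := by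
        rw [← hprod]; push_cast; rfl
      rw [this] at key
      unfold qbd
      refine le_trans ?_ key
      norm_cast
      refine Nat.card_le_card_of_injective (fun P : F w => ⟨P.1, P.2.2⟩) ?_
      intro P Q h; exact Subtype.ext (Subtype.mk.inj h)
    · have : IsEmpty (F w) := ⟨fun P => hV P.2.1⟩
      rw [Nat.card_of_isEmpty]; simpa using qbd_nonneg _ _ _ _
  have hW : Nat.card W ≤ M ^ (r * E.card + 2 * D.card) := by
    have h1 : Nat.card (∀ i : D, G i × G i) ≤ M ^ (2 * D.card) := by
      rw [Nat.card_pi]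
      calc ∏ i : D, Nat.card (G i × G i) ≤ ∏ i : D, M ^ 2 := by
            apply Finset.prod_le_prod' 
            intro i _
            rw [Nat.card_prod, sq]
            have := hM i (Finset.mem_union_right _ i.2)
            exact Nat.mul_le_mul this this
        _ = _ := by simp [pow_mul]
    have h2 : Nat.card (Fin (r * u.card) → supp (⊤ : Subgroup (∀ i, G i)) E) ≤ M ^ (r * E.card) := by
      rw [Nat.card_fun, Nat.card_fin, card_supp_top]
      calc _ ≤ (M ^ E.card) ^ (r * u.card) := Nat.pow_le_pow_left (Finset.prod_le_pow_card _ _ _ fun i hi => hM i hi) _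
        _ = M ^ (E.card * (r * u.card)) := (pow_mul _ _ _).symm
        _ ≤ _ := by
          apply Nat.pow_le_pow_right hM1
          nlinarith [Nat.zero_le (r * E.card)]
    rw [Nat.card_prod, pow_add, mul_comm]
    exact Nat.mul_le_mul h2 h1
  haveI : Finite W := inferInstance
  haveI : ∀ w, Finite (F w) := fun w => inferInstance
  have hsig : (Nat.card (Σ w, F w) : ℝ) ≤ (M : ℝ) ^ (r * E.card + 2 * D.card) * qbd q D.card (x * M) (∏ i ∈ D, a i) := by
    haveI : Fintype W := Fintype.ofFinite _
    rw [Nat.card_sigma]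
    push_cast
    calc ∑ w, (Nat.card (F w) : ℝ) ≤ ∑ w : W, qbd q D.card (x * M) (∏ i ∈ D, a i) := Finset.sum_le_sum fun w _ => hFc w
      _ = (Nat.card W : ℝ) * qbd q D.card (x * M) (∏ i ∈ D, a i) := by
        rw [Finset.sum_const, nsmul_eq_mul, Finset.card_univ, Nat.card_eq_fintype_card]
      _ ≤ _ := by
        apply mul_le_mul_of_nonneg_right _ (qbd_nonneg _ _ _ _)
        exact_mod_cast hW
  refine le_trans ?_ hsig
  norm_cast
  -- recover `P`
  let rec_ : (Σ w, F w) → Subgroup (∀ i, G i) := fun z => z.2.1 ⊔ Subgroup.closure (Set.range fun k => (z.1.2 k).1)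
  have hex : ∀ P : {P : Subgroup (∀ i, G i) // (∀ g ∈ P, ∀ i, i ∉ u ∪ D → g i = 1) ∧
        (∀ i ∈ D, ∃ Y : Subgroup (G i), IsPGroup q Y ∧ Nat.card Y = a i ∧ ∀ g ∈ P, g i ∈ Y) ∧
        ∏ i ∈ D, a i ≤ x * Nat.card P}, ∃ z, rec_ z = P.1 := by
    rintro ⟨P, h1, h2, h3⟩
    have hPE : supp P (u ∪ D) = P := le_antisymm (supp_le _ _) fun g hg => ⟨hg, fun i hi => h1 g hg i hi⟩
    obtain ⟨f, hf, hfe⟩ := supp_gen hr P D u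
    have hw : ∀ i : D, ∃ w : G i × G i, IsPGroup q (Subgroup.closure {w.1, w.2}) ∧ Nat.card (Subgroup.closure {w.1, w.2}) = a i ∧ ∀ g ∈ P, g i ∈ Subgroup.closure {w.1, w.2} := by
      intro i
      obtain ⟨Y, hY1, hY2, hY3⟩ := h2 i i.2
      obtain ⟨Y0, hY0, -⟩ := hqc i i.2 Y hY1
      obtain ⟨b, c, rfl⟩ := hY0.gen
      exact ⟨(b, c), hY1, hY2, hY3⟩
    choose w hw1 hw2 hw3 using hw
    have hV : V w := by
      intro i hi
      rw [show ycode D w i = _ from dif_pos hi]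
      exact ⟨hw1 ⟨i, hi⟩, hw2 ⟨i, hi⟩⟩
    have hprod : ∏ i, Nat.card (ycode D w i) = ∏ i ∈ D, a i := by
        rw [← Finset.prod_subset (Finset.subset_univ D)]
        · exact Finset.prod_congr rfl fun i hi => (hV i hi).2
        · intro i _ hi; simp [ycode, hi]
    refine ⟨⟨(w, fun k => ⟨f k, ⟨trivial, (mem_supp.1 (hf k)).2⟩⟩), ⟨supp P D, hV, ?_, ?_⟩⟩, ?_⟩
    · intro g hg i
      by_cases hi : i ∈ D
      · rw [show ycode D w i = _ from dif_pos hi]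
        exact hw3 ⟨i, hi⟩ g (mem_supp.1 hg).1
      · simp only [ycode, hi, dif_neg, not_false_eq_true, Subgroup.mem_bot]
        exact (mem_supp.1 hg).2 i hi
    · rw [hprod]
      have h4 := card_supp_union P D u M fun i hi => hM i (Finset.mem_union_left _ hi)
      rw [hPE] at h4
      calc _ ≤ x * Nat.card P := h3
        _ ≤ x * (M * Nat.card (supp P D)) := by
          apply Nat.mul_le_mul_left
          apply h4.trans
          apply Nat.mul_le_mul_right
          calc M ^ u.card ≤ M ^ 1 := Nat.pow_le_pow_right hM1 hu
            _ = M := pow_one M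
        _ = _ := by ring
    · show supp P D ⊔ Subgroup.closure (Set.range f) = P
      rw [← hfe, hPE]
  choose z hz using hex
  exact Nat.card_le_card_of_injective z fun P Q h => Subtype.ext (by rw [← hz P, ← hz Q, h])
end

end CG

namespace CG

section
variable {S : Finset ℕ} [hS : PSet S] {k : ℕ → ℕ} [hk : ∀ p, NeZero (k p)]

/-- places where `q` divides the profile -/
def EQ (α : S → ℕ) (q : ℕ) : Finset S := Finset.univ.filter fun p => q ∣ α p
def DQ (α : S → ℕ) (q : ℕ) : Finset S := Finset.univ.filter fun p => q ∣ α p ∧ p.1 ≠ q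
def UQ (α : S → ℕ) (q : ℕ) : Finset S := Finset.univ.filter fun p => q ∣ α p ∧ p.1 = q

lemma UQ_union {inst : DecidableEq S} (α : S → ℕ) (q : ℕ) : @Union.union _ (@Finset.instUnion _ inst) (UQ α q) (DQ α q) = EQ α q := by
  ext p; simp only [UQ, DQ, EQ, Finset.mem_union, Finset.mem_filter, Finset.mem_univ, true_and]; tauto

lemma UQ_card (α : S → ℕ) (q : ℕ) : (UQ α q).card ≤ 1 := by
  rw [Finset.card_le_one]
  intro a ha b hb
  simp only [UQ, Finset.mem_filter, Finset.mem_univ, true_and] at ha hb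
  exact Subtype.ext (ha.2.trans hb.2.symm)

def xQ (α β : S → ℕ) (q : ℕ) : ℕ := ∏ p ∈ DQ α q, op q (α p / β p)
def sQ (α : S → ℕ) (q : ℕ) : ℕ := ∏ p ∈ DQ α q, op q (α p)

/-- subgroups trivial outside `T` with a given profile -/
def KSet (k : ℕ → ℕ) (T : Finset S) (α β : S → ℕ) (K : Subgroup (GS S k)) : Prop :=
  (∀ p, p ∉ T → aS K p = ⊥) ∧ ∀ p, Nat.card (aS K p) = α p ∧ Nat.card (cS K p) = β p

/-- the conditions on Sylow subgroups -/
def PCond (k : ℕ → ℕ) (α β : S → ℕ) (q : ℕ) (P : Subgroup (GS S k)) : Prop :=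
  (∀ g ∈ P, ∀ i, i ∉ UQ α q ∪ DQ α q → g i = 1) ∧
        (∀ i ∈ DQ α q, ∃ Y : Subgroup (SL2 (ZMod (i.1 ^ k i.1))), IsPGroup q Y ∧ Nat.card Y = op q (α i) ∧ ∀ g ∈ P, g i ∈ Y) ∧
        ∏ i ∈ DQ α q, op q (α i) ≤ xQ α β q * Nat.card P

lemma sylow_cond {T : Finset S} {α β : S → ℕ} {K : Subgroup (GS S k)} (hK : KSet k T α β K) (q : ℕ) (hq : q.Prime) :
    ∃ P : Subgroup (GS S k), P ≤ K ∧ Nat.card P = op q (Nat.card K) ∧ PCond k α β q P := by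
  haveI : Fact q.Prime := ⟨hq⟩
  obtain ⟨P0⟩ : Nonempty (Sylow q K) := inferInstance
  have hα : ∀ p, α p ≠ 0 := fun p => by rw [← (hK.2 p).1]; exact Nat.card_pos.ne'
  have hβ : ∀ p, β p ≠ 0 := fun p => by rw [← (hK.2 p).2]; exact Nat.card_pos.ne'
  have hβα : ∀ p, β p ∣ α p := fun p => by
    rw [← (hK.2 p).1, ← (hK.2 p).2]; exact Subgroup.card_dvd_of_le (cS_le_aS K p)
  set P := (P0 : Subgroup K).map K.subtype with hP
  have hPK : P ≤ K := Subgroup.map_subtype_le _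
  have hPq : IsPGroup q P := P0.2.map _
  have hcard : Nat.card P = op q (Nat.card K) := by
    rw [hP, Subgroup.card_map_of_injective (Subgroup.subtype_injective K), op, Sylow.card_eq_multiplicity]
  refine ⟨P, hPK, hcard, ?_, ?_, ?_⟩
  · intro g hg i hi
    rw [UQ_union] at hi
    simp only [EQ, Finset.mem_filter, Finset.mem_univ, true_and] at hi
    have h1 : g i ∈ aS P i := ⟨g, hg, rfl⟩
    have h2 : IsPGroup q (aS P i) := hPq.map _
    have h3 : Nat.card (aS P i) ∣ α i := by
      rw [← (hK.2 i).1]; exact Subgroup.card_dvd_of_le (Subgroup.map_mono hPK)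
    obtain ⟨n, hn⟩ := IsPGroup.iff_card.1 h2
    rcases Nat.eq_zero_or_pos n with rfl | hn0
    · rw [pow_zero, Subgroup.card_eq_one] at hn
      rw [hn] at h1; exact h1
    · exact absurd ((dvd_pow_self q hn0.ne').trans (hn ▸ h3)) hi
  · intro i hi
    set A := aS K i with hA
    have h2 : IsPGroup q ((aS P i).subgroupOf A) := (hPq.map (Pi.evalMonoidHom _ i)).comap_of_injective _ (Subgroup.subtype_injective A)
    obtain ⟨Q, hQ⟩ := h2.exists_le_sylow
    refine ⟨(Q : Subgroup A).map A.subtype, Q.2.map _, ?_, ?_⟩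
    · rw [Subgroup.card_map_of_injective (Subgroup.subtype_injective A), Sylow.card_eq_multiplicity, (hK.2 i).1, op]
    · intro g hg
      have hgA : g i ∈ A := ⟨g, hPK hg, rfl⟩
      exact ⟨⟨g i, hgA⟩, hQ (show g i ∈ aS P i from ⟨g, hg, rfl⟩), rfl⟩
  · rw [hcard, card_eq_prod K, op_prod _ _ fun i _ => Nat.card_pos.ne', xQ]
    have h1 : ∏ i ∈ DQ α q, op q (β i) ≤ ∏ i, op q (Nat.card (cS K i)) := by
      calc ∏ i ∈ DQ α q, op q (β i) = ∏ i ∈ DQ α q, op q (Nat.card (cS K i)) := Finset.prod_congr rfl fun i _ => by rw [(hK.2 i).2]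
        _ ≤ _ := Finset.prod_le_prod_of_subset_of_one_le' (Finset.subset_univ _) fun i _ _ => op_pos hq
    refine le_trans (le_of_eq ?_) (Nat.mul_le_mul_left _ h1)
    rw [← Finset.prod_mul_distrib]
    refine Finset.prod_congr rfl fun i _ => ?_
    rw [← op_mul _ (hβ i), Nat.div_mul_cancel (hβα i)]
    exact (Nat.div_pos (Nat.le_of_dvd (Nat.pos_of_ne_zero (hα i)) (hβα i)) (Nat.pos_of_ne_zero (hβ i))).ne'

theorem kset_count (T : Finset S) (α β : S → ℕ) (M : ℕ) (hM1 : 1 ≤ M) (hM : ∀ p ∈ T, Nat.card (SL2 (ZMod (p.1 ^ k p.1))) ≤ M) 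
    (hT : ∀ p, p ∉ T → α p = 1)
    (Qs : Finset ℕ) (hQs : ∀ q ∈ Qs, q.Prime) (hQ : ∀ p ∈ T, ∀ q, q.Prime → q ∣ Nat.card (SL2 (ZMod (p.1 ^ k p.1))) → q ∈ Qs) :
    (Nat.card {K : Subgroup (GS S k) // KSet k T α β K} : ℝ) ≤
      ∏ q ∈ Qs, ((M : ℝ) ^ (17 * (EQ α q).card + 2 * (DQ α q).card) * qbd q (DQ α q).card (xQ α β q * M) (sQ α q)) := by
  classical
  have h1 : ∀ q ∈ Qs, (Nat.card {P : Subgroup (GS S k) // PCond k α β q P} : ℝ) ≤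
      (M : ℝ) ^ (17 * (EQ α q).card + 2 * (DQ α q).card) * qbd q (DQ α q).card (xQ α β q * M) (sQ α q) := by
    intro q hq
    haveI : Fact q.Prime := ⟨hQs q hq⟩
    have := perq_count (G := fun p : S => SL2 (ZMod (p.1 ^ k p.1))) (r := 17) (fun i J => gen_zmod J) q (UQ α q) (DQ α q) (UQ_card α q) (by
      intro i hi Y hY
      have : i.1 ≠ q := by simp only [DQ, Finset.mem_filter] at hi; exact hi.2.2
      exact (qc_zmod this.symm Y hY).1) M hM1 (by
        intro i hi
        rw [UQ_union, EQ, Finset.mem_filter] at hi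
        apply hM
        by_contra h
        have := hT i h
        rw [this] at hi
        exact (hQs q hq).one_lt.ne' (Nat.dvd_one.1 hi.2)) (fun i => op q (α i)) (xQ α β q) (Nat.pos_of_ne_zero (Finset.prod_ne_zero_iff.2 fun i _ => (op_pos (hQs q hq)).ne'))
    rw [show sQ α q = ∏ i ∈ DQ α q, op q (α i) from rfl]
    simp only [UQ_union] at this
    simp only [PCond, UQ_union]
    exact this
  have hch : ∀ K : {K : Subgroup (GS S k) // KSet k T α β K}, ∀ q : Qs, ∃ P : Subgroup (GS S k), P ≤ K.1 ∧ Nat.card P = op q (Nat.card K.1) ∧ PCond k α β q P :=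
    fun K q => sylow_cond K.2 q.1 (hQs q.1 q.2)
  choose P hP1 hP2 hP3 using hch
  have hsup : ∀ K, ⨆ q, P K q = K.1 := by
    intro K
    have hle : ⨆ q, P K q ≤ K.1 := iSup_le fun q => hP1 K q
    refine Subgroup.eq_of_le_of_card_ge hle ?_
    apply Nat.le_of_dvd Nat.card_pos
    have e : Nat.card K.1 = ∏ q ∈ (Nat.card K.1).primeFactors, op q (Nat.card K.1) := by
      conv_lhs => rw [← Nat.factorization_prod_pow_eq_self (Nat.card_pos (α := K.1)).ne']
      rfl
    rw [e]
    apply prod_op_dvd _ fun q hq => Nat.prime_of_mem_primeFactors hq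
    intro q hq
    have hqp := Nat.prime_of_mem_primeFactors hq
    have hqd := Nat.dvd_of_mem_primeFactors hq
    have hqQ : q ∈ Qs := by
      rw [card_triv K.1 T K.2.1, hqp.prime.dvd_finset_prod_iff] at hqd
      obtain ⟨p, hp, hpq⟩ := hqd
      exact hQ p hp q hqp (hpq.trans (Subgroup.card_subgroup_dvd_card _))
    rw [← hP2 K ⟨q, hqQ⟩]
    exact Subgroup.card_dvd_of_le (le_iSup _ _)
  have h2 : Nat.card {K : Subgroup (GS S k) // KSet k T α β K} ≤ Nat.card (∀ q : Qs, {P : Subgroup (GS S k) // PCond k α β q.1 P}) := by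
    refine Nat.card_le_card_of_injective (fun K q => ⟨P K q, hP3 K q⟩) ?_
    intro K L h
    apply Subtype.ext
    rw [← hsup K, ← hsup L]
    congr 1
    funext q
    exact Subtype.mk.inj (congrFun h q)
  calc (Nat.card {K : Subgroup (GS S k) // KSet k T α β K} : ℝ) ≤ (Nat.card (∀ q : Qs, {P : Subgroup (GS S k) // PCond k α β q.1 P}) : ℝ) := by exact_mod_cast h2
    _ = ∏ q ∈ Qs, (Nat.card {P : Subgroup (GS S k) // PCond k α β q P} : ℝ) := by
      rw [Nat.card_pi]; push_cast
      rw [← Finset.prod_attach Qs]; rfl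
    _ ≤ _ := Finset.prod_le_prod (fun q _ => Nat.cast_nonneg _) h1
end

end CG

namespace CG

section
variable {S : Finset ℕ} [hS : PSet S] {k : ℕ → ℕ} [hk : ∀ p, NeZero (k p)]

/-- numerical constraints on a profile -/
structure Prof (T : Finset S) (Qs : Finset ℕ) (α β : S → ℕ) (n : ℕ) : Prop where
  pos : ∀ p, 1 ≤ α p
  dvd : ∀ p, β p ∣ α p
  triv : ∀ p, p ∉ T → α p = 1
  opd : ∀ p, ∀ q : ℕ, q.Prime → q ≠ p.1 → op q (α p) ∣ p.1 ^ 2 - 1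
  ind : (∏ p ∈ T, p.1) * ∏ q ∈ Qs, xQ α β q ≤ 3 * n

lemma numer (H : Subgroup (GS S k)) (hH : NoFull H) (T : Finset S) (n : ℕ) (hn : H.index ≤ n) (Qs : Finset ℕ) (hQs : ∀ q ∈ Qs, q.Prime)
    (α β : S → ℕ) (hK : KSet k T α β (supp H T)) : Prof T Qs α β n := by
  classical
  set K := supp H T with hKd
  have hα : ∀ p, 1 ≤ α p := fun p => by rw [← (hK.2 p).1]; exact Nat.card_pos
  have hβ : ∀ p, 1 ≤ β p := fun p => by rw [← (hK.2 p).2]; exact Nat.card_pos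
  have hβα : ∀ p, β p ∣ α p := fun p => by
    rw [← (hK.2 p).1, ← (hK.2 p).2]; exact Subgroup.card_dvd_of_le (cS_le_aS K p)
  have htriv : ∀ p, p ∉ T → α p = 1 := fun p hp => by rw [← (hK.2 p).1, hK.1 p hp, Subgroup.card_bot]
  refine ⟨hα, hβα, htriv, ?_, ?_⟩
  · intro p q hq hqp
    haveI : Fact q.Prime := ⟨hq⟩
    obtain ⟨P0⟩ : Nonempty (Sylow q (aS K p)) := inferInstance
    have h := (qc_zmod hqp ((P0 : Subgroup (aS K p)).map (aS K p).subtype) (P0.2.map _)).2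
    rw [Subgroup.card_map_of_injective (Subgroup.subtype_injective _), Sylow.card_eq_multiplicity, (hK.2 p).1] at h
    exact h
  · let b : S → ℕ := fun p => ∏ q ∈ Qs.filter (· ≠ p.1), op q (α p / β p)
    have hdpos : ∀ p, 0 < α p / β p := fun p => Nat.div_pos (Nat.le_of_dvd (hα p) (hβα p)) (hβ p)
    have hbd : ∀ p, b p ∣ α p / β p := fun p => prod_op_dvd _ (fun q hq => hQs q (Finset.mem_filter.1 hq).1) fun q _ => op_dvd q _
    have hrel : ∀ p : S, (cS K p).index = (aS K p).index * (α p / β p) := by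
      intro p
      have h1 := Subgroup.card_mul_index (cS K p)
      have h2 := Subgroup.card_mul_index (aS K p)
      rw [(hK.2 p).2] at h1
      rw [(hK.2 p).1] at h2
      obtain ⟨c, hc⟩ := hβα p
      have h3 : α p / β p = c := by rw [hc]; exact Nat.mul_div_cancel_left _ (hβ p)
      rw [h3]
      apply Nat.eq_of_mul_eq_mul_left (hβ p)
      rw [h1, ← h2, hc]; ring
    have hb1 : ∀ p : S, b p ≤ (cS K p).index := by
      intro p
      rw [hrel p]
      calc b p ≤ α p / β p := Nat.le_of_dvd (hdpos p) (hbd p)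
        _ ≤ _ := Nat.le_mul_of_pos_left _ (Nat.pos_of_ne_zero Subgroup.index_ne_zero_of_finite)
    have hb2 : ∀ p : S, p.1 ≠ 3 → p.1 * b p ≤ (cS K p).index := by
      intro p h3
      have hne : cS K p ≠ ⊤ := by
        intro h
        apply cS_ne_top H hH p h3
        rw [eq_top_iff, ← h]
        exact cS_mono (supp_le H T) p
      by_cases hA : aS K p = ⊤
      · have hN : (cS K p).Normal := ⟨fun x hx g => cS_normal K p hx (by rw [hA]; trivial)⟩
        have hd : p.1 ∣ (cS K p).index := dvd_index_of_normal _ hN hne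
        have hco : Nat.Coprime p.1 (b p) := by
          apply Nat.Coprime.prod_right
          intro q hq
          rw [Finset.mem_filter] at hq
          exact Nat.Coprime.pow_right _ ((Nat.coprime_primes (hS.prime _ p.2) (hQs q hq.1)).2 hq.2.symm)
        apply Nat.le_of_dvd (Nat.pos_of_ne_zero Subgroup.index_ne_zero_of_finite)
        apply hco.mul_dvd_of_dvd_of_dvd hd
        rw [hrel p]
        exact (hbd p).mul_left _
      · have : p.1 ≤ (aS K p).index := by
          by_contra h
          exact hA (eq_top_of_index_lt _ (by omega))
        rw [hrel p]
        exact Nat.mul_le_mul this (Nat.le_of_dvd (hdpos p) (hbd p))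
    have hsw : ∏ q ∈ Qs, xQ α β q = ∏ p ∈ T, b p := by
      have e1 : ∀ q ∈ Qs, xQ α β q = ∏ p ∈ T, if q ≠ p.1 then op q (α p / β p) else 1 := by
        intro q hq
        rw [xQ, ← Finset.prod_filter]
        apply Finset.prod_subset_one_on_sdiff
        · intro p hp
          simp only [DQ, Finset.mem_filter, Finset.mem_univ, true_and] at hp ⊢
          refine ⟨?_, hp.2.symm⟩
          by_contra h
          rw [htriv p h] at hp
          exact (hQs q hq).one_lt.ne' (Nat.dvd_one.1 hp.1)
        · intro p hp
          simp only [DQ, Finset.mem_sdiff, Finset.mem_filter, Finset.mem_univ, true_and, not_and, not_not] at hp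
          apply op_eq_one
          intro h
          exact hp.1.2 (hp.2 (h.trans (Nat.div_dvd_of_dvd (hβα p)))).symm
        · intros; rfl
      rw [Finset.prod_congr rfl e1, Finset.prod_comm]
      refine Finset.prod_congr rfl fun p _ => ?_
      rw [← Finset.prod_filter]
    rw [hsw, ← Finset.prod_mul_distrib]
    have hi := (index_supp H T).trans hn
    let w : S → ℕ := fun p => if p.1 = 3 then 3 else 1
    have hw : ∏ p ∈ T, w p ≤ 3 := by
      calc ∏ p ∈ T, w p ≤ ∏ p : S, w p := Finset.prod_le_prod_of_subset_of_one_le' (Finset.subset_univ _) fun i _ _ => by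
            simp only [w]; split_ifs <;> norm_num
        _ = ∏ p ∈ S, if p = 3 then 3 else 1 := by
            rw [← Finset.prod_attach S]; rfl
        _ ≤ 3 := by
            rw [Finset.prod_ite_eq']; split_ifs <;> norm_num
    calc ∏ p ∈ T, p.1 * b p ≤ ∏ p ∈ T, w p * (cS K p).index := by
          apply Finset.prod_le_prod' 
          intro p _
          by_cases h3 : p.1 = 3
          · simp only [w, h3, if_true]; exact Nat.mul_le_mul_left _ (hb1 p)
          · simp only [w, h3, if_false, one_mul]; exact hb2 p h3
      _ = (∏ p ∈ T, w p) * ∏ p ∈ T, (cS K p).index := Finset.prod_mul_distrib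
      _ ≤ 3 * n := Nat.mul_le_mul hw hi
end

end CG

namespace CG

lemma card_SL2_le (N : ℕ) [NeZero N] : Nat.card (SL2 (ZMod N)) ≤ N ^ 4 := by
  calc Nat.card (SL2 (ZMod N)) ≤ Nat.card (Matrix (Fin 2) (Fin 2) (ZMod N)) :=
        Nat.card_le_card_of_injective (fun x => x.1) Subtype.val_injective
    _ = N ^ 4 := by
      rw [Matrix, Nat.card_fun, Nat.card_fun, Nat.card_zmod, Nat.card_fin, ← pow_mul]

/-- the places with small local level -/
def TS (m T0 : ℕ) : Finset m.primeFactors := Finset.univ.filter fun p => p.1 ^ kk m p.1 ≤ T0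
def primesLe (M : ℕ) : Finset ℕ := (Finset.Icc 1 M).filter Nat.Prime

/-- product bound for the profile -/
noncomputable def Pbd {S : Finset ℕ} (α β : S → ℕ) (M : ℕ) : ℝ :=
  ∏ q ∈ primesLe M, ((M : ℝ) ^ (17 * (EQ α q).card + 2 * (DQ α q).card) * qbd q (DQ α q).card (xQ α β q * M) (sQ α q))

theorem lev_count (m n T0 : ℕ) (hm : m ≠ 0) (hmn : m ≤ 3 * n) (hT0 : 1 ≤ T0) (B : ℝ) (hB0 : 0 ≤ B)
    (hB : ∀ α β, Prof (TS m T0) (primesLe (T0 ^ 4)) α β n → (∀ p, α p ≤ T0 ^ 4) → Pbd α β (T0 ^ 4) ≤ B) :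
    (Nat.card (LevSub m n) : ℝ) ≤ ((T0 ^ 4 : ℕ) : ℝ) ^ (2 * m.primeFactors.card) * B * (((3 * n) ^ 4 : ℕ) : ℝ) ^ (17 * (TS m T0)ᶜ.card) := by
  classical
  set S := m.primeFactors with hS
  set T := TS m T0 with hT
  set M := T0 ^ 4 with hM
  have hM1 : 1 ≤ M := Nat.one_le_pow _ _ hT0
  have hcT : ∀ p ∈ T, Nat.card (SL2 (ZMod (p.1 ^ kk m p.1))) ≤ M := by
    intro p hp
    simp only [hT, TS, Finset.mem_filter, Finset.mem_univ, true_and] at hp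
    exact (card_SL2_le _).trans (Nat.pow_le_pow_left hp 4)
  have hGS : Nat.card (GS S (kk m)) ≤ (3 * n) ^ 4 := by
    rw [Nat.card_pi]
    calc ∏ p : S, Nat.card (SL2 (ZMod (p.1 ^ kk m p.1))) ≤ ∏ p : S, (p.1 ^ kk m p.1) ^ 4 := Finset.prod_le_prod' fun p _ => card_SL2_le _
      _ = (∏ p : S, p.1 ^ kk m p.1) ^ 4 := Finset.prod_pow _ _ _
      _ = m ^ 4 := by
        congr 1
        conv_rhs => rw [← prod_kk m hm, ← Finset.prod_attach m.primeFactors]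
        rfl
      _ ≤ _ := Nat.pow_le_pow_left hmn 4
  have h1 := split_count (G := fun p : S => SL2 (ZMod (p.1 ^ kk m p.1))) (r := 17) (fun i J => gen_zmod J) T (fun H => NoFull H ∧ H.index ≤ n)
  let Z := {K : Subgroup (GS S (kk m)) // ∃ H, (NoFull H ∧ H.index ≤ n) ∧ K = supp H T}
  have hZ : (Nat.card Z : ℝ) ≤ (M : ℝ) ^ (2 * S.card) * B := by
    let W := (S → Finset.Icc 1 M) × (S → Finset.Icc 1 M)
    let F : W → Type := fun w => {K : Z // KSet (kk m) T (fun p => (w.1 p).1) (fun p => (w.2 p).1) K.1}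
    have hF : ∀ w, (Nat.card (F w) : ℝ) ≤ B := by
      intro w
      by_cases hne : Nonempty (F w)
      · obtain ⟨⟨⟨K, H, ⟨hH1, hH2⟩, rfl⟩, hK⟩⟩ := hne
        have hpr := numer H hH1 T n hH2 (primesLe M) (fun q hq => (Finset.mem_filter.1 hq).2) _ _ hK
        have h2 := hB _ _ hpr (fun p => (Finset.mem_Icc.1 (w.1 p).2).2)
        refine le_trans ?_ h2
        have h3 := kset_count (k := kk m) T (fun p => (w.1 p).1) (fun p => (w.2 p).1) M hM1 hcT hpr.triv (primesLe M) (fun q hq => (Finset.mem_filter.1 hq).2) (by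
          intro p hp q hq hd
          rw [primesLe, Finset.mem_filter, Finset.mem_Icc]
          exact ⟨⟨hq.one_lt.le, (Nat.le_of_dvd Nat.card_pos hd).trans (hcT p hp)⟩, hq⟩)
        refine le_trans ?_ h3
        norm_cast
        refine Nat.card_le_card_of_injective (fun K : F w => ⟨K.1.1, K.2⟩) ?_
        intro P Q h; exact Subtype.ext (Subtype.ext (Subtype.mk.inj h))
      · rw [not_nonempty_iff] at hne
        rw [Nat.card_of_isEmpty]; simpa using hB0
    have hW : Nat.card W = M ^ (2 * S.card) := by
      simp only [W]
      rw [Nat.card_prod, Nat.card_fun, Nat.card_eq_finsetCard, Nat.card_eq_finsetCard, Nat.card_Icc, Nat.add_sub_cancel, ← pow_add, two_mul]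
    have hsig : (Nat.card (Σ w, F w) : ℝ) ≤ (M : ℝ) ^ (2 * S.card) * B := by
      haveI : Fintype W := Fintype.ofFinite _
      rw [Nat.card_sigma]
      push_cast
      calc ∑ w, (Nat.card (F w) : ℝ) ≤ ∑ w : W, B := Finset.sum_le_sum fun w _ => hF w
        _ = (Nat.card W : ℝ) * B := by
          rw [Finset.sum_const, nsmul_eq_mul, Finset.card_univ, Nat.card_eq_fintype_card]
        _ = _ := by rw [hW]; push_cast; rfl
    refine le_trans ?_ hsig
    norm_cast
    have hex : ∀ K : Z, ∃ w : W, KSet (kk m) T (fun p => (w.1 p).1) (fun p => (w.2 p).1) K.1 := by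
      rintro ⟨K, H, ⟨hH1, hH2⟩, rfl⟩
      have hb : ∀ p, Nat.card (aS (supp H T) p) ≤ M := by
        intro p
        by_cases hp : p ∈ T
        · exact (Subgroup.card_le_card_group _).trans (hcT p hp)
        · rw [aS_supp H T p hp, Subgroup.card_bot]; exact hM1
      have hb2 : ∀ p, Nat.card (cS (supp H T) p) ≤ M := fun p => (Subgroup.card_le_of_le (cS_le_aS (supp H T) p)).trans (hb p)
      exact ⟨(fun p => ⟨Nat.card (aS (supp H T) p), Finset.mem_Icc.2 ⟨Nat.card_pos, hb p⟩⟩,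
        fun p => ⟨Nat.card (cS (supp H T) p), Finset.mem_Icc.2 ⟨Nat.card_pos, hb2 p⟩⟩),
        fun p hp => aS_supp H T p hp, fun p => ⟨rfl, rfl⟩⟩
    choose w hw using hex
    refine Nat.card_le_card_of_injective (fun K : Z => (⟨w K, ⟨K, hw K⟩⟩ : Σ w, F w)) ?_
    intro K L h
    exact congrArg (fun z : (Σ w, F w) => z.2.1) h
  calc (Nat.card (LevSub m n) : ℝ) ≤ (Nat.card Z : ℝ) * (Nat.card (GS S (kk m)) : ℝ) ^ (17 * Tᶜ.card) := by exact_mod_cast h1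
    _ ≤ _ := by
      apply mul_le_mul hZ _ (by positivity) ((Nat.cast_nonneg _).trans hZ)
      apply pow_le_pow_left₀ (Nat.cast_nonneg _)
      exact_mod_cast hGS

lemma TS_compl (m T0 : ℕ) (hm : m ≠ 0) : T0 ^ (TS m T0)ᶜ.card ≤ m := by
  calc T0 ^ (TS m T0)ᶜ.card ≤ ∏ p ∈ (TS m T0)ᶜ, p.1 ^ kk m p.1 := by
        apply Finset.pow_card_le_prod
        intro p hp
        simp only [TS, Finset.mem_compl, Finset.mem_filter, Finset.mem_univ, true_and, not_le] at hp
        exact hp.le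
    _ ≤ ∏ p : m.primeFactors, p.1 ^ kk m p.1 := Finset.prod_le_prod_of_subset_of_one_le' (Finset.subset_univ _) fun p _ _ =>
        Nat.one_le_pow _ _ (Nat.prime_of_mem_primeFactors p.2).pos
    _ = m := by
        conv_rhs => rw [← prod_kk m hm, ← Finset.prod_attach m.primeFactors]
        rfl

/-- `r` distinct positive integers have product at least `r!` -/
lemma factorial_le_prod (s : Finset ℕ) (hs : ∀ x ∈ s, 1 ≤ x) : s.card.factorial ≤ ∏ x ∈ s, x := by
  induction s using Finset.induction_on_max with
  | empty => simp
  | insert a s ha ih =>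
    have hna : a ∉ s := fun h => lt_irrefl _ (ha a h)
    rw [Finset.card_insert_of_notMem hna, Finset.prod_insert hna, Nat.factorial_succ]
    apply Nat.mul_le_mul _ (ih fun x hx => hs x (Finset.mem_insert_of_mem hx))
    have : s ⊆ Finset.Ico 1 a := fun x hx => Finset.mem_Ico.2 ⟨hs x (Finset.mem_insert_of_mem hx), ha x hx⟩
    have h2 := Finset.card_le_card this
    have := hs a (Finset.mem_insert_self _ _)
    rw [Nat.card_Ico] at h2; omega

lemma primeFactors_fact (m : ℕ) (hm : m ≠ 0) : m.primeFactors.card.factorial ≤ m :=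
  (factorial_le_prod _ fun x hx => (Nat.prime_of_mem_primeFactors hx).pos).trans
    (Nat.le_of_dvd (Nat.pos_of_ne_zero hm) (Nat.prod_primeFactors_dvd m))

end CG

namespace CG

lemma log_fact (r : ℕ) : (r : ℝ) * (Real.log r - 1) ≤ Real.log (r.factorial) := by
  rcases Nat.eq_zero_or_pos r with rfl | hr
  · simp
  have h := Real.pow_div_factorial_le_exp (r : ℝ) (Nat.cast_nonneg r) r
  have hf : (0:ℝ) < (r.factorial : ℝ) := by exact_mod_cast Nat.factorial_pos r
  rw [div_le_iff₀ hf] at h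
  have h2 := Real.log_le_log (by positivity) h
  rw [Real.log_pow, Real.log_mul (Real.exp_pos _).ne' hf.ne', Real.log_exp] at h2
  linarith

/-- `r! ≤ exp (C lam)` forces `r = o(lam)` -/
lemma fact_small (C η : ℝ) (hη : 0 < η) : ∃ l0 : ℝ, 0 < l0 ∧ ∀ lam : ℝ, l0 ≤ lam → ∀ r : ℕ, Real.log r.factorial ≤ C * lam → (r:ℝ) ≤ η * lam := by
  refine ⟨Real.exp (|C| / η + 2) / η, by positivity, fun lam hl r hr => ?_⟩
  by_contra hc
  push Not at hc
  have hl0 : 0 < lam := lt_of_lt_of_le (by positivity) hl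
  rw [div_le_iff₀ hη] at hl
  have hr1 : Real.exp (|C| / η + 2) ≤ r := by linarith [mul_comm lam η]
  have hr0 : (0:ℝ) < r := lt_of_lt_of_le (Real.exp_pos _) hr1
  have h1 : |C| / η + 2 ≤ Real.log r := by rw [Real.le_log_iff_exp_le hr0]; exact hr1
  have h2 := log_fact r
  have h3 : (η * lam) * (|C| / η + 1) ≤ (r:ℝ) * (Real.log r - 1) := by
    apply mul_le_mul hc.le (by linarith) (by positivity) hr0.le
  have h4 : (η * lam) * (|C| / η + 1) = |C| * lam + η * lam := by field_simp
  have h5 : C * lam ≤ |C| * lam := mul_le_mul_of_nonneg_right (le_abs_self C) hl0.le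
  have : 0 < η * lam := by positivity
  linarith

/-- Rankin bound for smooth numbers -/
lemma smooth_count (Q : Finset ℕ) (hQ : ∀ q ∈ Q, q.Prime) (N : ℕ) (B : Finset ℕ) (hB0 : ∀ m ∈ B, m ≠ 0) (hB1 : ∀ m ∈ B, m < 2 ^ (N + 1))
    (hB2 : ∀ m ∈ B, ∀ q, q.Prime → q ∣ m → q ∈ Q) (z : ℝ) (hz0 : 0 < z) (hz1 : z < 1) :
    (B.card : ℝ) * z ^ N ≤ ((1 - z)⁻¹) ^ Q.card := by
  classical
  have hfac : ∀ m ∈ B, ∏ q ∈ Q, q ^ m.factorization q = m := by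
    intro m hm
    conv_rhs => rw [← Nat.factorization_prod_pow_eq_self (hB0 m hm)]
    rw [Finsupp.prod_of_support_subset _ _ _ (by simp)]
    intro q hq
    rw [Nat.support_factorization] at hq
    exact hB2 m hm q (Nat.prime_of_mem_primeFactors hq) (Nat.dvd_of_mem_primeFactors hq)
  have hsum : ∀ m ∈ B, ∑ q ∈ Q, m.factorization q ≤ N := by
    intro m hm
    have h1 : 2 ^ (∑ q ∈ Q, m.factorization q) ≤ m := by
      conv_rhs => rw [← hfac m hm]
      rw [← Finset.prod_pow_eq_pow_sum]
      exact Finset.prod_le_prod' fun q hq => Nat.pow_le_pow_left (hQ q hq).two_le _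
    have := (Nat.pow_lt_pow_iff_right (by norm_num : 1 < 2)).1 (h1.trans_lt (hB1 m hm))
    omega
  let φ : ℕ → (Q → ℕ) := fun m q => m.factorization q.1
  have hinj : Set.InjOn φ B := by
    intro m hm m' hm' h
    rw [← hfac m hm, ← hfac m' hm']
    refine Finset.prod_congr rfl fun q hq => ?_
    have := congrFun h ⟨q, hq⟩
    simp only [φ] at this
    rw [this]
  calc (B.card : ℝ) * z ^ N = ∑ m ∈ B, z ^ N := by rw [Finset.sum_const, nsmul_eq_mul]
    _ ≤ ∑ m ∈ B, ∏ q : Q, z ^ φ m q := by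
      apply Finset.sum_le_sum
      intro m hm
      have e : ∏ q : Q, z ^ φ m q = z ^ (∑ q ∈ Q, m.factorization q) := by
        rw [← Finset.prod_pow_eq_pow_sum, ← Finset.prod_attach Q]; rfl
      rw [e]
      exact pow_le_pow_of_le_one hz0.le hz1.le (hsum m hm)
    _ = ∑ f ∈ B.image φ, ∏ q : Q, z ^ f q := by
      rw [Finset.sum_image hinj]
    _ ≤ ∑ f ∈ Fintype.piFinset (fun _ : Q => Finset.range (N + 1)), ∏ q : Q, z ^ f q := by
      apply Finset.sum_le_sum_of_subset_of_nonneg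
      · intro f hf
        obtain ⟨m, hm, rfl⟩ := Finset.mem_image.1 hf
        rw [Fintype.mem_piFinset]
        intro q
        rw [Finset.mem_range]
        have := (Finset.single_le_sum (f := fun q => m.factorization q) (fun _ _ => Nat.zero_le _) q.2).trans (hsum m hm)
        simp only [φ]; omega
      · intros; positivity
    _ = ∏ q : Q, ∑ e ∈ Finset.range (N + 1), z ^ e := by
      rw [Finset.prod_univ_sum]
    _ = (∑ e ∈ Finset.range (N + 1), z ^ e) ^ Q.card := by simp
    _ ≤ _ := by
      apply pow_le_pow_left₀ (by positivity)
      rw [geom_sum_eq hz1.ne, ← neg_div_neg_eq, div_eq_mul_inv]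
      have h1 : 0 < 1 - z := by linarith
      rw [neg_sub, neg_sub]
      have : 0 < z ^ (N+1) := by positivity
      have : 0 < (1 - z)⁻¹ := by positivity
      nlinarith

/-- residue class count -/
lemma class_count (F : Finset ℕ) (D : ℕ) (hD : 0 < D) (Y : ℝ) (h : ∀ p ∈ F, ∀ p' ∈ F, p ≡ p' [MOD D]) (hY : ∀ p ∈ F, (p:ℝ) < D * Y) (hY0 : 0 ≤ Y) :
    (F.card : ℝ) ≤ Y + 1 := by
  have h1 : F.card ≤ (Finset.range (⌊Y⌋₊ + 1)).card := by
    refine Finset.card_le_card_of_injOn (fun p => p / D) ?_ ?_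
    · intro p hp
      have : ((p / D : ℕ) : ℝ) ≤ Y := by
        refine Nat.cast_div_le.trans ?_
        rw [div_le_iff₀ (by exact_mod_cast hD)]
        linarith [hY p hp, mul_comm (D:ℝ) Y]
      simp only [Finset.coe_range, Set.mem_Iio]
      have := Nat.le_floor this
      omega
    · intro p hp p' hp' he
      simp only at he
      have hm : p % D = p' % D := h p hp p' hp'
      rw [← Nat.div_add_mod p D, ← Nat.div_add_mod p' D, he, hm]
  rw [Finset.card_range] at h1
  calc (F.card : ℝ) ≤ ((⌊Y⌋₊ + 1 : ℕ) : ℝ) := by exact_mod_cast h1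
    _ ≤ Y + 1 := by push_cast; linarith [Nat.floor_le hY0]

/-- structure of `m ∣ p² - 1` -/
lemma gcd_struct (m p : ℕ) (hp : 2 ≤ p) (hm : m ∣ p ^ 2 - 1) :
    m ≤ 2 * Nat.lcm (Nat.gcd m (p - 1)) (Nat.gcd m (p + 1)) := by
  have e : p ^ 2 - 1 = (p + 1) * (p - 1) := by have := Nat.sq_sub_sq p 1; simpa using this
  have hpos : 0 < p ^ 2 - 1 := by rw [e]; exact Nat.mul_pos (by omega) (by omega)
  have hm0 : 0 < m := Nat.pos_of_dvd_of_pos hm hpos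
  set a := Nat.gcd m (p - 1) with ha
  set b := Nat.gcd m (p + 1) with hb
  have hab : m ∣ a * b := by
    rw [e] at hm
    have := Nat.gcd_mul_right_dvd_mul_gcd m (p+1) (p-1)
    rw [Nat.gcd_eq_left hm] at this
    rw [mul_comm]; exact this
  have hg : Nat.gcd a b ∣ 2 := by
    have h1 : Nat.gcd a b ∣ p - 1 := (Nat.gcd_dvd_left a b).trans (Nat.gcd_dvd_right m _)
    have h2 : Nat.gcd a b ∣ p + 1 := (Nat.gcd_dvd_right a b).trans (Nat.gcd_dvd_right m _)
    have := Nat.dvd_sub h2 h1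
    have e2 : p + 1 - (p - 1) = 2 := by omega
    rwa [e2] at this
  have ha0 : 0 < a := Nat.gcd_pos_of_pos_left _ hm0
  have hb0 : 0 < b := Nat.gcd_pos_of_pos_left _ hm0
  calc m ≤ a * b := Nat.le_of_dvd (Nat.mul_pos ha0 hb0) hab
    _ = Nat.gcd a b * Nat.lcm a b := (Nat.gcd_mul_lcm a b).symm
    _ ≤ _ := Nat.mul_le_mul_right _ (Nat.le_of_dvd (by norm_num) hg)

end CG

namespace CG

open Classical in
lemma exc_fin (Q : Finset ℕ) (N : ℕ) (X : Finset ℕ) (mm : ℕ → ℕ) (Z : ℝ) (hZ : 0 ≤ Z) (h2 : ∀ p ∈ X, 2 ≤ p)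
    (hd : ∀ p ∈ X, mm p ∣ p ^ 2 - 1) (hN : ∀ p ∈ X, p ^ 2 ≤ 2 ^ (N + 1)) (hsm : ∀ p ∈ X, ∀ q, q.Prime → q ∣ mm p → q ∈ Q)
    (hlt : ∀ p ∈ X, (p : ℝ) < mm p * Z) :
    (X.card : ℝ) ≤ (((Finset.range (2 ^ (N + 1))).filter fun m => m ≠ 0 ∧ ∀ q, q.Prime → q ∣ m → q ∈ Q).card : ℝ) ^ 3 * (2 * Z + 1) := by
  set B := (Finset.range (2 ^ (N + 1))).filter fun m => m ≠ 0 ∧ ∀ q, q.Prime → q ∣ m → q ∈ Q with hB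
  have hpos : ∀ p ∈ X, 0 < p ^ 2 - 1 := by
    intro p hp
    have := Nat.pow_le_pow_left (h2 p hp) 2
    omega
  have hm0 : ∀ p ∈ X, 0 < mm p := fun p hp => Nat.pos_of_dvd_of_pos (hd p hp) (hpos p hp)
  have hmB : ∀ p ∈ X, ∀ a, a ∣ mm p → a ∈ B := by
    intro p hp a ha
    have h1 : 0 < a := Nat.pos_of_dvd_of_pos ha (hm0 p hp)
    have h3 := Nat.le_of_dvd (hpos p hp) (ha.trans (hd p hp))
    have h4 := hN p hp
    have h5 := hpos p hp
    rw [hB, Finset.mem_filter, Finset.mem_range]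
    exact ⟨by omega, h1.ne', fun q hq hqa => hsm p hp q hq (hqa.trans ha)⟩
  let φ : ℕ → ℕ × ℕ × ℕ := fun p => (mm p, Nat.gcd (mm p) (p - 1), Nat.gcd (mm p) (p + 1))
  have hmaps : ∀ p ∈ X, φ p ∈ B ×ˢ (B ×ˢ B) := by
    intro p hp
    simp only [φ, Finset.mem_product]
    exact ⟨hmB p hp _ dvd_rfl, hmB p hp _ (Nat.gcd_dvd_left _ _), hmB p hp _ (Nat.gcd_dvd_left _ _)⟩
  have hfib : ∀ w ∈ B ×ˢ (B ×ˢ B), ((X.filter fun p => φ p = w).card : ℝ) ≤ 2 * Z + 1 := by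
    rintro ⟨m, a, b⟩ -
    by_cases hne : (X.filter fun p => φ p = (m, a, b)).Nonempty
    swap
    · rw [Finset.not_nonempty_iff_eq_empty] at hne; rw [hne]; simp; linarith
    obtain ⟨p0, hp0⟩ := hne
    have key : ∀ p ∈ X.filter (fun p => φ p = (m, a, b)), mm p = m ∧ a ∣ p - 1 ∧ b ∣ p + 1 ∧ m ≤ 2 * Nat.lcm a b ∧ 2 ≤ p ∧ p ∈ X := by
      intro p hp
      rw [Finset.mem_filter] at hp
      obtain ⟨hpX, he⟩ := hp
      simp only [φ, Prod.mk.injEq] at he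
      obtain ⟨rfl, rfl, rfl⟩ := he
      exact ⟨rfl, Nat.gcd_dvd_right _ _, Nat.gcd_dvd_right _ _, gcd_struct _ _ (h2 p hpX) (hd p hpX), h2 p hpX, hpX⟩
    obtain ⟨h1, h3, h4, h5, h6, h7⟩ := key p0 hp0
    have hm := hm0 p0 h7
    apply class_count _ (Nat.lcm a b) (by omega)
    · intro p hp p' hp'
      obtain ⟨-, ka, kb, -, k2, -⟩ := key p hp
      obtain ⟨-, ka', kb', -, k2', -⟩ := key p' hp'
      rw [Nat.modEq_iff_dvd]
      have e1 : (a:ℤ) ∣ (p':ℤ) - p := by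
        have i1 : (a:ℤ) ∣ (p:ℤ) - 1 := by have := Int.natCast_dvd_natCast.2 ka; rwa [Nat.cast_sub (by omega), Nat.cast_one] at this
        have i2 : (a:ℤ) ∣ (p':ℤ) - 1 := by have := Int.natCast_dvd_natCast.2 ka'; rwa [Nat.cast_sub (by omega), Nat.cast_one] at this
        have := dvd_sub i2 i1
        rwa [sub_sub_sub_cancel_right] at this
      have e2 : (b:ℤ) ∣ (p':ℤ) - p := by
        have i1 : (b:ℤ) ∣ (p:ℤ) + 1 := by have := Int.natCast_dvd_natCast.2 kb; exact_mod_cast this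
        have i2 : (b:ℤ) ∣ (p':ℤ) + 1 := by have := Int.natCast_dvd_natCast.2 kb'; exact_mod_cast this
        have := dvd_sub i2 i1
        rwa [add_sub_add_right_eq_sub] at this
      have := Int.coe_lcm_dvd e1 e2
      simpa using this
    · intro p hp
      obtain ⟨ke, -, -, -, -, kX⟩ := key p hp
      have := hlt p kX
      rw [ke] at this
      have h5' : (m:ℝ) ≤ 2 * (Nat.lcm a b : ℝ) := by exact_mod_cast h5
      nlinarith
    · positivity
  have h := Finset.card_eq_sum_card_fiberwise hmaps
  have h' : (X.card : ℝ) = ∑ w ∈ B ×ˢ (B ×ˢ B), ((X.filter fun p => φ p = w).card : ℝ) := by exact_mod_cast h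
  rw [h']
  calc _ ≤ ∑ w ∈ B ×ˢ (B ×ˢ B), (2 * Z + 1) := Finset.sum_le_sum hfib
    _ = _ := by
      rw [Finset.sum_const, nsmul_eq_mul, Finset.card_product, Finset.card_product]; push_cast; ring

theorem exc_count (A ε : ℝ) (hA : 0 < A) (hε : 0 < ε) (hε1 : ε < 1) (C : ℝ) : ∃ l0 : ℝ, 1 ≤ l0 ∧ ∀ lam : ℝ, l0 ≤ lam →
    ∀ (Q : Finset ℕ) (hQ : ∀ q ∈ Q, q.Prime) (hQs : ∑ q ∈ Q, Real.log q ≤ C * lam) (X : Finset ℕ) (mm : ℕ → ℕ)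
    (h2 : ∀ p ∈ X, 2 ≤ p) (hd : ∀ p ∈ X, mm p ∣ p ^ 2 - 1) (hN : ∀ p ∈ X, (p:ℝ) ≤ Real.exp (A * lam))
    (hsm : ∀ p ∈ X, ∀ q, q.Prime → q ∣ mm p → q ∈ Q) (hlt : ∀ p ∈ X, (p : ℝ) < mm p * Real.exp ((1 - ε) * lam)),
    (X.card : ℝ) ≤ Real.exp ((1 - ε / 2) * lam) := by
  classical
  set z := Real.exp (-(ε / (300 * A))) with hz
  have hz0 : 0 < z := Real.exp_pos _
  have hz1 : z < 1 := by rw [hz, Real.exp_lt_one_iff]; have : 0 < ε / (300 * A) := by positivity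
                         linarith
  have hw : 0 < 1 - z := by linarith
  set w := Real.log ((1 - z)⁻¹) with hwd
  have hw0 : 0 < w := Real.log_pos (by rw [one_lt_inv₀ hw]; linarith)
  obtain ⟨l1, hl1, hl⟩ := fact_small C (ε / 100 / w) (by positivity)
  refine ⟨max (max l1 1) (max (1 / A) (10 / ε)), (le_max_right _ _).trans (le_max_left _ _), fun lam hlam Q hQ hQs X mm h2 hd hN hsm hlt => ?_⟩
  have b1 : l1 ≤ lam := ((le_max_left _ _).trans (le_max_left _ _)).trans hlam
  have b2 : 1 ≤ lam := ((le_max_right _ _).trans (le_max_left _ _)).trans hlam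
  have b3 : 1 / A ≤ lam := ((le_max_left _ _).trans (le_max_right _ _)).trans hlam
  have b4 : 10 / ε ≤ lam := ((le_max_right _ _).trans (le_max_right _ _)).trans hlam
  rw [div_le_iff₀ hA] at b3
  rw [div_le_iff₀ hε] at b4
  -- size of Q
  have hr : (Q.card : ℝ) ≤ ε / 100 / w * lam := by
    apply hl lam b1
    refine le_trans ?_ hQs
    have := factorial_le_prod Q fun q hq => (hQ q hq).pos
    rw [← Real.log_prod (fun q hq => by exact_mod_cast (hQ q hq).ne_zero)]
    apply Real.log_le_log (by exact_mod_cast Nat.factorial_pos _)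
    have h' : ((Q.card.factorial : ℕ) : ℝ) ≤ ((∏ q ∈ Q, q : ℕ) : ℝ) := Nat.cast_le.2 this
    rw [Nat.cast_prod] at h'
    exact h'
  set N := ⌊3 * A * lam⌋₊ with hNd
  have hNle : (N:ℝ) ≤ 3 * A * lam := Nat.floor_le (by positivity)
  have hNlt : 3 * A * lam < N + 1 := Nat.lt_floor_add_one _
  have hE := exc_fin Q N X mm (Real.exp ((1 - ε) * lam)) (Real.exp_pos _).le h2 hd (by
    intro p hp
    have h := hN p hp
    have : ((p ^ 2 : ℕ) : ℝ) ≤ ((2 ^ (N + 1) : ℕ) : ℝ) := by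
      push_cast
      calc (p:ℝ) ^ 2 ≤ Real.exp (A * lam) ^ 2 := pow_le_pow_left₀ (Nat.cast_nonneg _) h 2
        _ = Real.exp (2 * (A * lam)) := by rw [← Real.exp_nat_mul]; norm_num
        _ ≤ Real.exp (Real.log 2 * (N + 1)) := by
          apply Real.exp_le_exp.2
          have := Real.log_two_gt_d9
          nlinarith
        _ = 2 ^ (N + 1) := by
          rw [← Real.rpow_def_of_pos (by norm_num)]; exact_mod_cast Real.rpow_natCast 2 (N+1)
    exact_mod_cast this) hsm hlt
  set B := (Finset.range (2 ^ (N + 1))).filter fun m => m ≠ 0 ∧ ∀ q, q.Prime → q ∣ m → q ∈ Q with hB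
  have hBc := smooth_count Q hQ N B (fun m hm => (Finset.mem_filter.1 hm).2.1) (fun m hm => Finset.mem_range.1 (Finset.mem_filter.1 hm).1)
    (fun m hm => (Finset.mem_filter.1 hm).2.2) z hz0 hz1
  have hBe : (B.card : ℝ) ≤ Real.exp (ε / 50 * lam) := by
    have e1 : ((1 - z)⁻¹) ^ Q.card = Real.exp (w * Q.card) := by
      rw [← Real.rpow_natCast, Real.rpow_def_of_pos (by positivity)]
    have e2 : z ^ N = Real.exp (-(ε / (300 * A)) * N) := by
      rw [hz, ← Real.exp_nat_mul]; ring_nf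
    rw [e1, e2] at hBc
    have e3 : (B.card : ℝ) ≤ Real.exp (w * Q.card) * Real.exp (ε / (300 * A) * N) := by
      rw [neg_mul, Real.exp_neg] at hBc
      rwa [← div_eq_mul_inv, div_le_iff₀ (Real.exp_pos _)] at hBc
    refine e3.trans ?_
    rw [← Real.exp_add]
    apply Real.exp_le_exp.2
    have f1 : w * Q.card ≤ ε / 100 * lam := by
      calc w * Q.card ≤ w * (ε / 100 / w * lam) := mul_le_mul_of_nonneg_left hr hw0.le
        _ = _ := by field_simp
    have f2 : ε / (300 * A) * N ≤ ε / 100 * lam := by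
      calc ε / (300 * A) * N ≤ ε / (300 * A) * (3 * A * lam) := mul_le_mul_of_nonneg_left hNle (by positivity)
        _ = _ := by field_simp; ring
    linarith
  have h1Z : 1 ≤ Real.exp ((1 - ε) * lam) := by
    rw [Real.one_le_exp_iff]; exact mul_nonneg (by linarith) (by linarith)
  calc (X.card : ℝ) ≤ (B.card : ℝ) ^ 3 * (2 * Real.exp ((1 - ε) * lam) + 1) := hE
    _ ≤ (Real.exp (ε / 50 * lam)) ^ 3 * (Real.exp 2 * Real.exp ((1 - ε) * lam)) := by
      apply mul_le_mul (pow_le_pow_left₀ (Nat.cast_nonneg _) hBe 3) _ (by positivity) (by positivity)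
      have : (3:ℝ) ≤ Real.exp 2 := by have := Real.add_one_le_exp (2:ℝ); linarith
      nlinarith
    _ = Real.exp (3 * (ε / 50 * lam) + (2 + (1 - ε) * lam)) := by
      rw [← Real.exp_nat_mul, ← Real.exp_add, ← Real.exp_add]; norm_num
    _ ≤ _ := by
      apply Real.exp_le_exp.2
      nlinarith

end CG

namespace CG

section
variable {S : Finset ℕ} [hS : PSet S] {T : Finset S} {Qs : Finset ℕ} {α β : S → ℕ} {n : ℕ}

lemma DQ_sub_EQ (α : S → ℕ) (q : ℕ) : DQ α q ⊆ EQ α q := by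
  intro p hp
  simp only [DQ, EQ, Finset.mem_filter] at hp ⊢
  exact ⟨hp.1, hp.2.1⟩

lemma EQ_sub_T (h : Prof T Qs α β n) {q : ℕ} (hq : q.Prime) : EQ α q ⊆ T := by
  intro p hp
  simp only [EQ, Finset.mem_filter] at hp
  by_contra hc
  rw [h.triv p hc] at hp
  exact hq.one_lt.ne' (Nat.dvd_one.1 hp.2)

lemma DQ_sub_T (h : Prof T Qs α β n) {q : ℕ} (hq : q.Prime) : DQ α q ⊆ T := (DQ_sub_EQ α q).trans (EQ_sub_T h hq)

/-- total number of incidences -/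
lemma sum_EQ (h : Prof T Qs α β n) (hQs : ∀ q ∈ Qs, q.Prime) (M : ℕ) (hM : ∀ p, α p ≤ M) :
    (∑ q ∈ Qs, ((EQ α q).card : ℝ)) * Real.log 2 ≤ T.card * Real.log M := by
  classical
  have h1 : ∑ q ∈ Qs, (EQ α q).card = ∑ p ∈ T, (Qs.filter fun q => q ∣ α p).card := by
    have : ∀ q ∈ Qs, (EQ α q).card = ∑ p ∈ T, if q ∣ α p then 1 else 0 := by
      intro q hq
      rw [← Finset.card_filter]
      congr 1
      ext p
      simp only [EQ, Finset.mem_filter, Finset.mem_univ, true_and]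
      refine ⟨fun hd => ⟨EQ_sub_T h (hQs q hq) (by simp [EQ, hd]), hd⟩, fun hd => hd.2⟩
    rw [Finset.sum_congr rfl this, Finset.sum_comm]
    refine Finset.sum_congr rfl fun p _ => ?_
    rw [← Finset.card_filter]
  have h2 : ∀ p ∈ T, ((Qs.filter fun q => q ∣ α p).card : ℝ) * Real.log 2 ≤ Real.log M := by
    intro p hp
    have hb : 2 ^ (Qs.filter fun q => q ∣ α p).card ≤ M := by
      calc 2 ^ (Qs.filter fun q => q ∣ α p).card ≤ ∏ q ∈ Qs.filter (fun q => q ∣ α p), op q (α p) := by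
            apply Finset.pow_card_le_prod
            intro q hq
            rw [Finset.mem_filter] at hq
            have hqp := hQs q hq.1
            have : 1 ≤ (α p).factorization q := (hqp.dvd_iff_one_le_factorization (by have := h.pos p; omega)).1 hq.2
            calc 2 ≤ q ^ 1 := by rw [pow_one]; exact hqp.two_le
              _ ≤ _ := Nat.pow_le_pow_right hqp.pos this
        _ ≤ α p := Nat.le_of_dvd (h.pos p) (prod_op_dvd _ (fun q hq => hQs q (Finset.mem_filter.1 hq).1) fun q _ => op_dvd _ _)
        _ ≤ M := hM p
    rw [← Real.log_pow]
    apply Real.log_le_log (by positivity)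
    exact_mod_cast hb
  calc (∑ q ∈ Qs, ((EQ α q).card : ℝ)) * Real.log 2 = ∑ p ∈ T, ((Qs.filter fun q => q ∣ α p).card : ℝ) * Real.log 2 := by
        rw [← Finset.sum_mul]; congr 1; exact_mod_cast h1
    _ ≤ ∑ p ∈ T, Real.log M := Finset.sum_le_sum h2
    _ = _ := by rw [Finset.sum_const, nsmul_eq_mul]

/-- the part of `α p` supported on `R` -/
def mR (R : Finset ℕ) (α : S → ℕ) (p : S) : ℕ := ∏ q ∈ R.filter (· ≠ p.1), op q (α p)

lemma mR_dvd (h : Prof T Qs α β n) {R : Finset ℕ} (hR : ∀ q ∈ R, q.Prime) (p : S) : mR R α p ∣ p.1 ^ 2 - 1 :=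
  prod_op_dvd _ (fun q hq => hR q (Finset.mem_filter.1 hq).1) fun q hq =>
    h.opd p q (hR q (Finset.mem_filter.1 hq).1) (Finset.mem_filter.1 hq).2

lemma mR_pos {R : Finset ℕ} (hR : ∀ q ∈ R, q.Prime) (p : S) : 0 < mR R α p :=
  Finset.prod_pos fun q hq => op_pos (hR q (Finset.mem_filter.1 hq).1)

lemma mR_smooth {R : Finset ℕ} (hR : ∀ q ∈ R, q.Prime) (p : S) (q : ℕ) (hq : q.Prime) (hd : q ∣ mR R α p) : q ∈ R := by
  rw [mR, hq.prime.dvd_finset_prod_iff] at hd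
  obtain ⟨r, hr, hqr⟩ := hd
  have hrR := (Finset.mem_filter.1 hr).1
  have := (Nat.prime_dvd_prime_iff_eq hq (hR r hrR)).1 (hq.dvd_of_dvd_pow hqr)
  rwa [this]

lemma mR_le (h : Prof T Qs α β n) {R : Finset ℕ} (hR : ∀ q ∈ R, q.Prime) (p : S) : Real.log (mR R α p) ≤ 2 * Real.log p.1 := by
  have hp2 := (hS.prime p.1 p.2).two_le
  have := Nat.pow_le_pow_left hp2 2
  have h1 : mR R α p ≤ p.1 ^ 2 := (Nat.le_of_dvd (by omega) (mR_dvd h hR p)).trans (Nat.sub_le _ _)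
  calc Real.log (mR R α p) ≤ Real.log ((p.1 : ℝ) ^ 2) := Real.log_le_log (by exact_mod_cast mR_pos hR p) (by exact_mod_cast h1)
    _ = _ := by rw [Real.log_pow]; norm_num

lemma sum_sQ (h : Prof T Qs α β n) {R : Finset ℕ} (hR : ∀ q ∈ R, q.Prime) :
    ∑ q ∈ R, Real.log (sQ α q) = ∑ p ∈ T, Real.log (mR R α p) := by
  classical
  have e1 : ∀ q ∈ R, Real.log (sQ α q) = ∑ p ∈ T, if q ≠ p.1 then Real.log (op q (α p)) else 0 := by
    intro q hq
    rw [sQ, Nat.cast_prod, Real.log_prod (fun p _ => by exact_mod_cast (op_pos (hR q hq)).ne'), ← Finset.sum_filter]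
    apply Finset.sum_subset_zero_on_sdiff
    · intro p hp
      rw [Finset.mem_filter]
      exact ⟨DQ_sub_T h (hR q hq) hp, by simp only [DQ, Finset.mem_filter] at hp; exact hp.2.2.symm⟩
    · intro p hp
      simp only [DQ, Finset.mem_sdiff, Finset.mem_filter, Finset.mem_univ, true_and, not_and, not_not] at hp
      rw [op_eq_one]
      · simp
      · intro hd; exact hp.1.2 (hp.2 hd).symm
    · intros; rfl
  rw [Finset.sum_congr rfl e1, Finset.sum_comm]
  refine Finset.sum_congr rfl fun p _ => ?_
  rw [← Finset.sum_filter, mR, Nat.cast_prod, Real.log_prod]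
  intro q hq
  exact_mod_cast (op_pos (hR q (Finset.mem_filter.1 hq).1)).ne'

lemma sQ_pos {q : ℕ} (hq : q.Prime) : 0 < sQ α q := Finset.prod_pos fun _ _ => op_pos hq
lemma xQ_pos {q : ℕ} (hq : q.Prime) : 0 < xQ α β q := Finset.prod_pos fun _ _ => op_pos hq
lemma log_sQ_nonneg {q : ℕ} (hq : q.Prime) : 0 ≤ Real.log (sQ α q) := Real.log_nonneg (by exact_mod_cast (sQ_pos (α := α) hq))
lemma log_xQ_nonneg {q : ℕ} (hq : q.Prime) : 0 ≤ Real.log (xQ α β q) := Real.log_nonneg (by exact_mod_cast (xQ_pos (α := α) (β := β) hq))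

lemma dQ_log (h : Prof T Qs α β n) {q : ℕ} (hq : q.Prime) : ((DQ α q).card : ℝ) * Real.log q ≤ Real.log (sQ α q) := by
  rw [← Real.log_pow]
  apply Real.log_le_log (by have := hq.pos; positivity)
  have : q ^ (DQ α q).card ≤ sQ α q := by
    apply Finset.pow_card_le_prod
    intro p hp
    simp only [DQ, Finset.mem_filter] at hp
    have : 1 ≤ (α p).factorization q := (hq.dvd_iff_one_le_factorization (by have := h.pos p; omega)).1 hp.2.1
    calc q = q ^ 1 := (pow_one q).symm
      _ ≤ _ := Nat.pow_le_pow_right hq.pos this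
  exact_mod_cast this

lemma prof_L (h : Prof T Qs α β n) (hQs : ∀ q ∈ Qs, q.Prime) :
    ∑ p ∈ T, Real.log p.1 + ∑ q ∈ Qs, Real.log (xQ α β q) ≤ Real.log (3 * n) := by
  have hp : ∀ p ∈ T, (p.1 : ℝ) ≠ 0 := fun p _ => by exact_mod_cast (hS.prime p.1 p.2).ne_zero
  have hx : ∀ q ∈ Qs, (xQ α β q : ℝ) ≠ 0 := fun q hq => by exact_mod_cast (xQ_pos (hQs q hq)).ne'
  rw [← Real.log_prod hp, ← Real.log_prod hx, ← Real.log_mul (Finset.prod_ne_zero_iff.2 hp) (Finset.prod_ne_zero_iff.2 hx)]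
  apply Real.log_le_log
  · apply mul_pos
    · exact Finset.prod_pos fun p _ => by exact_mod_cast (hS.prime p.1 p.2).pos
    · exact Finset.prod_pos fun q hq => by exact_mod_cast xQ_pos (hQs q hq)
  · exact_mod_cast h.ind

lemma sum_logp_le (h : Prof T Qs α β n) (hQs : ∀ q ∈ Qs, q.Prime) : ∑ p ∈ T, Real.log p.1 ≤ Real.log (3 * n) := by
  have := prof_L h hQs
  have h2 : 0 ≤ ∑ q ∈ Qs, Real.log (xQ α β q) := Finset.sum_nonneg fun q hq => log_xQ_nonneg (hQs q hq)
  linarith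

lemma sum_sQ_le (h : Prof T Qs α β n) (hQs : ∀ q ∈ Qs, q.Prime) {R : Finset ℕ} (hR : ∀ q ∈ R, q.Prime) :
    ∑ q ∈ R, Real.log (sQ α q) ≤ 2 * Real.log (3 * n) := by
  rw [sum_sQ h hR]
  calc _ ≤ ∑ p ∈ T, 2 * Real.log p.1 := Finset.sum_le_sum fun p _ => mR_le h hR p
    _ ≤ _ := by rw [← Finset.mul_sum]; linarith [sum_logp_le h hQs]

noncomputable def FF (Qs : Finset ℕ) (α β : S → ℕ) : ℝ := ∑ q ∈ Qs, ((DQ α q).card : ℝ) * (Real.log (xQ α β q) + Real.log (sQ α q))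

lemma log_qbd {q d c s : ℕ} (hc : 0 < c) (hs : 0 < s) : Real.log (qbd q d c s) =
    (if q = 2 then Real.log c + d * d * Real.log 4 else 0) + (kap * d * Real.log c + (kap * d + 2) * Real.log s) := by
  have hc' : (0:ℝ) < c := by exact_mod_cast hc
  have hs' : (0:ℝ) < s := by exact_mod_cast hs
  have h1 : (0:ℝ) < (c:ℝ) ^ (kap * d) := Real.rpow_pos_of_pos hc' _
  have h2 : (0:ℝ) < (s:ℝ) ^ (kap * d + 2) := Real.rpow_pos_of_pos hs' _
  unfold qbd
  split_ifs
  · rw [Real.log_mul (by positivity) (by positivity), Real.log_mul hc'.ne' (by positivity), Real.log_pow, Real.log_mul h1.ne' h2.ne', Real.log_rpow hc', Real.log_rpow hs']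
    push_cast; ring
  · rw [one_mul, Real.log_mul h1.ne' h2.ne', Real.log_rpow hc', Real.log_rpow hs']
    ring

lemma Pbd_pos (α β : S → ℕ) {M : ℕ} (hM : 0 < M) : 0 < Pbd α β M := by
  apply Finset.prod_pos
  intro q hq
  have hq := (Finset.mem_filter.1 hq).2
  have h1 : (0:ℝ) < M := by exact_mod_cast hM
  have h2 : (0:ℝ) < (sQ α q : ℝ) := by exact_mod_cast sQ_pos hq
  have h3 : (0:ℝ) < ((xQ α β q * M : ℕ) : ℝ) := by exact_mod_cast Nat.mul_pos (xQ_pos hq) hM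
  unfold qbd
  have := Real.rpow_pos_of_pos h3 (kap * (DQ α q).card)
  have := Real.rpow_pos_of_pos h2 (kap * (DQ α q).card + 2)
  split_ifs <;> positivity

theorem log_Pbd_le {M : ℕ} (hM1 : 1 ≤ M) (h : Prof T (primesLe M) α β n) (hn : 1 ≤ n) (hM : ∀ p, α p ≤ M) :
    Real.log (Pbd α β M) ≤ 40 * T.card * Real.log M ^ 2 + 5 * Real.log (3 * n) + Real.log M + 2 * (T.card : ℝ) ^ 2 + kap * FF (primesLe M) α β := by
  set Qs := primesLe M with hQd
  have hQs : ∀ q ∈ Qs, q.Prime := fun q hq => (Finset.mem_filter.1 hq).2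
  have hM' : (0:ℝ) < M := by exact_mod_cast hM1
  have hlM : 0 ≤ Real.log M := Real.log_nonneg (by exact_mod_cast hM1)
  have hL : 0 ≤ Real.log (3 * n) := Real.log_nonneg (by have : (1:ℝ) ≤ n := by exact_mod_cast hn
                                                        linarith)
  have hk0 := kap_pos
  have hk1 := kap_lt_one
  have hf : ∀ q ∈ Qs, Real.log ((M : ℝ) ^ (17 * (EQ α q).card + 2 * (DQ α q).card) * qbd q (DQ α q).card (xQ α β q * M) (sQ α q)) ≤
      20 * (EQ α q).card * Real.log M + (if q = 2 then Real.log (xQ α β q) + Real.log M + (T.card:ℝ) ^ 2 * 2 else 0)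
      + kap * ((DQ α q).card * (Real.log (xQ α β q) + Real.log (sQ α q))) + 2 * Real.log (sQ α q) := by
    intro q hq
    have hqp := hQs q hq
    have hs := sQ_pos (α := α) hqp
    have hx := xQ_pos (α := α) (β := β) hqp
    have hxr : (0:ℝ) < xQ α β q := by exact_mod_cast hx
    have hcpos : 0 < xQ α β q * M := Nat.mul_pos hx hM1
    have hqne : qbd q (DQ α q).card (xQ α β q * M) (sQ α q) ≠ 0 := by
      have h2 : (0:ℝ) < (sQ α q : ℝ) := by exact_mod_cast hs
      have h3 : (0:ℝ) < ((xQ α β q * M : ℕ) : ℝ) := by exact_mod_cast hcpos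
      have := Real.rpow_pos_of_pos h3 (kap * (DQ α q).card)
      have := Real.rpow_pos_of_pos h2 (kap * (DQ α q).card + 2)
      apply ne_of_gt
      unfold qbd
      split_ifs <;> positivity
    rw [Real.log_mul (by positivity) hqne, log_qbd hcpos hs, Real.log_pow, Nat.cast_mul, Real.log_mul hxr.ne' hM'.ne']
    have hde : ((DQ α q).card : ℝ) ≤ (EQ α q).card := by exact_mod_cast Finset.card_le_card (DQ_sub_EQ α q)
    have hdt : ((DQ α q).card : ℝ) ≤ T.card := by exact_mod_cast Finset.card_le_card (DQ_sub_T h hqp)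
    have hd0 : (0:ℝ) ≤ (DQ α q).card := Nat.cast_nonneg _
    have hlog4 : Real.log 4 ≤ 2 := by
      rw [show (4:ℝ) = 2 ^ 2 by norm_num, Real.log_pow]
      have := Real.log_two_lt_d9
      push_cast; linarith
    have hif : (if q = 2 then Real.log (xQ α β q) + Real.log M + ((DQ α q).card:ℝ) * (DQ α q).card * Real.log 4 else 0) ≤
        (if q = 2 then Real.log (xQ α β q) + Real.log M + (T.card:ℝ) ^ 2 * 2 else 0) := by
      split_ifs
      · have : ((DQ α q).card:ℝ) * (DQ α q).card * Real.log 4 ≤ (T.card:ℝ) ^ 2 * 2 := by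
          rw [sq]
          exact mul_le_mul (mul_le_mul hdt hdt hd0 (Nat.cast_nonneg _)) hlog4 (Real.log_nonneg (by norm_num)) (by positivity)
        linarith
      · exact le_rfl
    have h1 : ((17 * (EQ α q).card + 2 * (DQ α q).card : ℕ) : ℝ) * Real.log M + kap * (DQ α q).card * Real.log M ≤ 20 * (EQ α q).card * Real.log M := by
      rw [← add_mul]
      apply mul_le_mul_of_nonneg_right _ hlM
      push_cast
      nlinarith
    nlinarith
  have hlog : Real.log (Pbd α β M) = ∑ q ∈ Qs, Real.log ((M : ℝ) ^ (17 * (EQ α q).card + 2 * (DQ α q).card) * qbd q (DQ α q).card (xQ α β q * M) (sQ α q)) := by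
    rw [Pbd, Real.log_prod]
    intro q hq h0
    have := Pbd_pos α β hM1
    rw [Pbd] at this
    exact this.ne' (Finset.prod_eq_zero hq h0)
  have hx2 : ∑ q ∈ Qs, (if q = 2 then Real.log (xQ α β q) + Real.log M + (T.card:ℝ) ^ 2 * 2 else 0) ≤ Real.log (3 * n) + Real.log M + (T.card:ℝ) ^ 2 * 2 := by
    rw [Finset.sum_ite_eq']
    split_ifs with h2
    · have h3 := prof_L h hQs
      have h4 : Real.log (xQ α β 2) ≤ ∑ q ∈ Qs, Real.log (xQ α β q) := Finset.single_le_sum (f := fun q => Real.log (xQ α β q)) (fun q hq => log_xQ_nonneg (hQs q hq)) h2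
      have h5 : 0 ≤ ∑ p ∈ T, Real.log p.1 := Finset.sum_nonneg fun p _ => Real.log_nonneg (by exact_mod_cast (hS.prime p.1 p.2).pos)
      linarith
    · positivity
  have hE := sum_EQ h hQs M hM
  have hs := sum_sQ_le h hQs hQs
  have hE' : ∑ q ∈ Qs, ((EQ α q).card : ℝ) ≤ 2 * T.card * Real.log M := by
    have h2 := Real.log_two_gt_d9
    have h0 : (0:ℝ) ≤ ∑ q ∈ Qs, ((EQ α q).card : ℝ) := Finset.sum_nonneg fun _ _ => Nat.cast_nonneg _
    nlinarith
  rw [hlog]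
  calc _ ≤ ∑ q ∈ Qs, (20 * (EQ α q).card * Real.log M + (if q = 2 then Real.log (xQ α β q) + Real.log M + (T.card:ℝ) ^ 2 * 2 else 0)
      + kap * ((DQ α q).card * (Real.log (xQ α β q) + Real.log (sQ α q))) + 2 * Real.log (sQ α q)) := Finset.sum_le_sum hf
    _ = 20 * (∑ q ∈ Qs, ((EQ α q).card:ℝ)) * Real.log M + (∑ q ∈ Qs, (if q = 2 then Real.log (xQ α β q) + Real.log M + (T.card:ℝ) ^ 2 * 2 else 0))
      + kap * FF Qs α β + 2 * ∑ q ∈ Qs, Real.log (sQ α q) := by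
        rw [Finset.sum_add_distrib, Finset.sum_add_distrib, Finset.sum_add_distrib, FF, Finset.mul_sum, Finset.mul_sum, Finset.mul_sum, Finset.sum_mul]
    _ ≤ _ := by nlinarith

end
end CG

namespace CG

lemma t_bound (lam : ℝ) (hl : 10 ≤ lam) (t : ℕ) (ht : Real.log t.factorial ≤ Real.exp lam) : (t:ℝ) ≤ 2 * Real.exp lam / lam := by
  by_contra hc
  push Not at hc
  have h0 : 0 < lam := by linarith
  have hE := Real.exp_pos lam
  have hpos : 0 < 2 * Real.exp lam / lam := by positivity
  have h1 : Real.log (2 * Real.exp lam / lam) ≤ Real.log t := Real.log_le_log hpos hc.le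
  rw [Real.log_div (by positivity) h0.ne', Real.log_mul (by norm_num) hE.ne', Real.log_exp] at h1
  have h2 : Real.log lam ≤ lam / 4 + 1 := by
    have := Real.log_le_sub_one_of_pos (show 0 < lam / 4 by positivity)
    rw [Real.log_div h0.ne' (by norm_num), show (4:ℝ) = 2 ^ 2 by norm_num, Real.log_pow] at this
    have := Real.log_two_lt_d9
    push_cast at *; linarith
  have h3 := Real.log_two_gt_d9
  have h4 := log_fact t
  have h5 : lam / 2 < Real.log t - 1 := by linarith
  have h6 : (2 * Real.exp lam / lam) * (lam / 2) < t * (Real.log t - 1) := by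
    apply mul_lt_mul'' hc h5 hpos.le (by positivity)
  have h7 : (2 * Real.exp lam / lam) * (lam / 2) = Real.exp lam := by field_simp
  linarith

theorem FF_bound (A ε : ℝ) (hA : 0 < A) (hε : 0 < ε) (hε1 : ε < 1) : ∃ l0 : ℝ, 10 ≤ l0 ∧ ∀ lam : ℝ, l0 ≤ lam →
    ∀ (S : Finset ℕ) [hS : PSet S] (T : Finset S) (Qs : Finset ℕ) (hQs : ∀ q ∈ Qs, q.Prime) (α β : S → ℕ) (n : ℕ) (hn : Real.log (3 * n) = Real.exp lam)
     (h : Prof T Qs α β n) (hT : ∀ p ∈ T, (p.1 : ℝ) ≤ Real.exp (A * lam)),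
     (T.card : ℝ) ≤ 2 * Real.exp lam / lam ∧ 
     FF Qs α β ≤ (1 / (4 * (1 - ε)) + 3 * ε) * (Real.exp lam ^ 2 / lam) := by
  classical
  obtain ⟨l1, hl1, hX⟩ := exc_count A ε hA hε hε1 (2 / ε)
  refine ⟨max (max l1 10) (16 * (A + 1) / ε ^ 3), (le_max_right _ _).trans (le_max_left _ _), ?_⟩
  intro lam hlam S hS T Qs hQs α β n hn h hT
  have b1 : l1 ≤ lam := ((le_max_left _ _).trans (le_max_left _ _)).trans hlam
  have b2 : 10 ≤ lam := ((le_max_right _ _).trans (le_max_left _ _)).trans hlam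
  have b3 : 16 * (A + 1) / ε ^ 3 ≤ lam := (le_max_right _ _).trans hlam
  have h0 : 0 < lam := by linarith
  set L := Real.exp lam with hL
  have hL0 : 0 < L := Real.exp_pos _
  -- bound for t
  have ht : (T.card : ℝ) ≤ 2 * L / lam := by
    apply t_bound lam b2
    rw [← hL, ← hn]
    refine le_trans ?_ (sum_logp_le h hQs)
    have hf := factorial_le_prod (T.image Subtype.val) (fun x hx => by
      obtain ⟨p, -, rfl⟩ := Finset.mem_image.1 hx
      exact (hS.prime p.1 p.2).pos)
    rw [Finset.card_image_of_injective _ Subtype.val_injective, Finset.prod_image (fun a _ b _ h => Subtype.ext h)] at hf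
    rw [← Real.log_prod (fun p _ => by exact_mod_cast (hS.prime p.1 p.2).ne_zero)]
    apply Real.log_le_log (by exact_mod_cast Nat.factorial_pos _)
    have h' : ((T.card.factorial : ℕ) : ℝ) ≤ ((∏ p ∈ T, p.1 : ℕ) : ℝ) := Nat.cast_le.2 hf
    rwa [Nat.cast_prod] at h'
  refine ⟨ht, ?_⟩
  set Q := Qs.filter (fun q => ε * L / lam ≤ ((DQ α q).card : ℝ)) with hQ
  have hQp : ∀ q ∈ Q, q.Prime := fun q hq => hQs q (Finset.mem_filter.1 hq).1
  have hQsum : ∑ q ∈ Q, Real.log q ≤ 2 / ε * lam := by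
    have h1 : (ε * L / lam) * ∑ q ∈ Q, Real.log q ≤ 2 * L := by
      rw [Finset.mul_sum]
      calc _ ≤ ∑ q ∈ Q, Real.log (sQ α q) := by
            apply Finset.sum_le_sum
            intro q hq
            refine le_trans ?_ (dQ_log h (hQp q hq))
            exact mul_le_mul_of_nonneg_right (Finset.mem_filter.1 hq).2 (Real.log_natCast_nonneg _)
        _ ≤ 2 * L := by rw [← hn]; exact sum_sQ_le h hQs hQp
    have h2 : ∑ q ∈ Q, Real.log q ≤ 2 * L / (ε * L / lam) := by
      rw [le_div_iff₀ (by positivity)]; linarith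
    refine h2.trans (le_of_eq ?_)
    field_simp
  set XT := T.filter (fun p => (p.1 : ℝ) < mR Q α p * Real.exp ((1 - ε) * lam)) with hXT
  have hXc : (XT.card : ℝ) ≤ Real.exp ((1 - ε / 2) * lam) := by
    have := hX lam b1 Q hQp hQsum (XT.image Subtype.val) (fun p => if hp : p ∈ S then mR Q α ⟨p, hp⟩ else 1) (by
      intro x hx
      obtain ⟨p, -, rfl⟩ := Finset.mem_image.1 hx
      exact (hS.prime p.1 p.2).two_le) (by
      intro x hx
      obtain ⟨p, -, rfl⟩ := Finset.mem_image.1 hx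
      rw [dif_pos p.2]; exact mR_dvd h hQp p) (by
      intro x hx
      obtain ⟨p, hp, rfl⟩ := Finset.mem_image.1 hx
      exact hT p (Finset.mem_filter.1 hp).1) (by
      intro x hx
      obtain ⟨p, hp, rfl⟩ := Finset.mem_image.1 hx
      rw [dif_pos p.2]; exact mR_smooth hQp p) (by
      intro x hx
      obtain ⟨p, hp, rfl⟩ := Finset.mem_image.1 hx
      rw [dif_pos p.2]; exact (Finset.mem_filter.1 hp).2)
    rwa [Finset.card_image_of_injective _ Subtype.val_injective] at this
  have hterm : ∀ p ∈ T, (1 - ε) * lam - (if p ∈ XT then (A + 1) * lam else 0) ≤ Real.log p.1 - Real.log (mR Q α p) := by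
    intro p hp
    have hp0 : (0:ℝ) < p.1 := by exact_mod_cast (hS.prime p.1 p.2).pos
    have hm0 : (0:ℝ) < mR Q α p := by exact_mod_cast mR_pos hQp p
    split_ifs with hx
    · have h1 := mR_le h hQp p
      have h2 : Real.log p.1 ≤ A * lam := by
        rw [Real.log_le_iff_le_exp hp0]; exact hT p hp
      nlinarith
    · simp only [hXT, Finset.mem_filter, hp, true_and, not_lt] at hx
      have := Real.log_le_log (by positivity) hx
      rw [Real.log_mul hm0.ne' (Real.exp_pos _).ne', Real.log_exp] at this
      linarith
  have hsum : (T.card:ℝ) * ((1 - ε) * lam) - XT.card * ((A + 1) * lam) ≤ ∑ p ∈ T, Real.log p.1 - ∑ p ∈ T, Real.log (mR Q α p) := by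
    have := Finset.sum_le_sum hterm
    rw [Finset.sum_sub_distrib, Finset.sum_sub_distrib, ← Finset.sum_filter, Finset.sum_const, Finset.sum_const, nsmul_eq_mul, nsmul_eq_mul] at this
    rwa [Finset.filter_mem_eq_inter, Finset.inter_eq_right.2 (Finset.filter_subset _ _)] at this
  have hd : ∀ q ∈ Qs, ((DQ α q).card : ℝ) ≤ T.card := fun q hq => by exact_mod_cast Finset.card_le_card (DQ_sub_T h (hQs q hq))
  have hF1 : ∑ q ∈ Qs, ((DQ α q).card : ℝ) * Real.log (xQ α β q) ≤ T.card * (L - ∑ p ∈ T, Real.log p.1) := by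
    calc _ ≤ ∑ q ∈ Qs, (T.card : ℝ) * Real.log (xQ α β q) := Finset.sum_le_sum fun q hq => mul_le_mul_of_nonneg_right (hd q hq) (log_xQ_nonneg (hQs q hq))
      _ = T.card * ∑ q ∈ Qs, Real.log (xQ α β q) := by rw [Finset.mul_sum]
      _ ≤ _ := by
        apply mul_le_mul_of_nonneg_left _ (Nat.cast_nonneg _)
        have := prof_L h hQs
        rw [hn] at this; linarith
  have hF2 : ∑ q ∈ Qs, ((DQ α q).card : ℝ) * Real.log (sQ α q) ≤ T.card * ∑ p ∈ T, Real.log (mR Q α p) + (ε * L / lam) * (2 * L) := by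
    rw [← Finset.sum_filter_add_sum_filter_not Qs (fun q => ε * L / lam ≤ ((DQ α q).card : ℝ))]
    apply add_le_add
    · rw [← sum_sQ h hQp, Finset.mul_sum]
      exact Finset.sum_le_sum fun q hq => mul_le_mul_of_nonneg_right (hd q (Finset.mem_filter.1 hq).1) (log_sQ_nonneg (hQp q hq))
    · calc _ ≤ ∑ q ∈ Qs.filter (fun q => ¬ ε * L / lam ≤ ((DQ α q).card : ℝ)), (ε * L / lam) * Real.log (sQ α q) := by
            apply Finset.sum_le_sum
            intro q hq
            rw [Finset.mem_filter] at hq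
            exact mul_le_mul_of_nonneg_right (not_le.1 hq.2).le (log_sQ_nonneg (hQs q hq.1))
        _ ≤ _ := by
            rw [← Finset.mul_sum]
            apply mul_le_mul_of_nonneg_left _ (by positivity)
            rw [← hn]; exact sum_sQ_le h hQs fun q hq => hQs q (Finset.mem_filter.1 hq).1
  have hF : FF Qs α β = ∑ q ∈ Qs, ((DQ α q).card : ℝ) * Real.log (xQ α β q) + ∑ q ∈ Qs, ((DQ α q).card : ℝ) * Real.log (sQ α q) := by
    rw [FF, ← Finset.sum_add_distrib]; exact Finset.sum_congr rfl fun q _ => by ring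
  set t : ℝ := (T.card : ℝ) with htd
  have ht0 : 0 ≤ t := Nat.cast_nonneg _
  have hmain : FF Qs α β ≤ t * L - t ^ 2 * ((1 - ε) * lam) + t * (XT.card * ((A + 1) * lam)) + 2 * ε * (L ^ 2 / lam) := by
    have := mul_le_mul_of_nonneg_left hsum ht0
    have e : (ε * L / lam) * (2 * L) = 2 * ε * (L ^ 2 / lam) := by ring
    rw [hF]
    nlinarith
  have hq1 : t * L - t ^ 2 * ((1 - ε) * lam) ≤ 1 / (4 * (1 - ε)) * (L ^ 2 / lam) := by
    have he : 0 < (1 - ε) * lam := mul_pos (by linarith) h0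
    have e : 1 / (4 * (1 - ε)) * (L ^ 2 / lam) = L ^ 2 / (4 * ((1 - ε) * lam)) := by
      have : (1 - ε) ≠ 0 := by linarith
      field_simp
    rw [e, le_div_iff₀ (by positivity)]
    nlinarith [sq_nonneg (L - 2 * t * ((1 - ε) * lam))]
  have hq2 : t * (XT.card * ((A + 1) * lam)) ≤ ε * (L ^ 2 / lam) := by
    have hx : Real.exp ((1 - ε / 2) * lam) = L / Real.exp (ε / 2 * lam) := by
      rw [hL, ← Real.exp_sub]; ring_nf
    have hy : ε ^ 2 * lam ^ 2 / 8 ≤ Real.exp (ε / 2 * lam) := by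
      have := Real.quadratic_le_exp_of_nonneg (show 0 ≤ ε / 2 * lam by positivity)
      nlinarith [mul_pos hε h0]
    rw [hx] at hXc
    have hz : (XT.card : ℝ) ≤ L * 8 / (ε ^ 2 * lam ^ 2) := by
      refine hXc.trans ?_
      rw [div_le_div_iff₀ (Real.exp_pos _) (by positivity)]
      nlinarith
    rw [div_le_iff₀ (by positivity)] at b3
    calc t * (XT.card * ((A + 1) * lam)) ≤ (2 * L / lam) * ((L * 8 / (ε ^ 2 * lam ^ 2)) * ((A + 1) * lam)) := by
          apply mul_le_mul ht _ (by positivity) (by positivity)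
          exact mul_le_mul_of_nonneg_right hz (by positivity)
      _ = (16 * (A + 1)) * (L ^ 2 / (ε ^ 2 * lam ^ 2)) := by field_simp; ring
      _ ≤ (lam * ε ^ 3) * (L ^ 2 / (ε ^ 2 * lam ^ 2)) := mul_le_mul_of_nonneg_right b3 (by positivity)
      _ = _ := by field_simp
  linarith

end CG

namespace CG

lemma upper_aux (δ A lam E : ℝ) (hδ : 0 < δ) (hA1 : 1 ≤ A) (b10 : 10 ≤ lam) (hE : E = Real.exp lam) (b3 : 144000 * A ^ 2 / δ ≤ lam) :
    5120 * A ^ 2 * E * lam + 6 * E + 8 * A * lam + 32 * A * E ≤ δ / 4 * (E ^ 2 / lam) := by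
  have hE0 : 0 < E := by rw [hE]; exact Real.exp_pos _
  have h0 : 0 < lam := by linarith
  have hE3 : lam ^ 3 / 6 ≤ E := by
    rw [hE]; have := Real.pow_div_factorial_le_exp (x := lam) h0.le 3
    simpa [Nat.factorial] using this
  have hEl : lam ≤ E := by rw [hE]; have := Real.add_one_le_exp lam; linarith
  have hA2 : A ≤ A ^ 2 := by nlinarith
  have g1 : 5120 * A ^ 2 * E * lam + 6 * E + 8 * A * lam + 32 * A * E ≤ 6000 * A ^ 2 * E * lam := by
    have q1 : 10 * E ≤ E * lam := by nlinarith
    have q2 : E * lam ≤ A ^ 2 * (E * lam) := by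
      have : 1 ≤ A ^ 2 := by nlinarith
      have : 0 < E * lam := by positivity
      nlinarith
    have q3 : A * E ≤ A ^ 2 * (E * lam) / 10 := by
      have : A * E ≤ A ^ 2 * E := by gcongr
      have := mul_le_mul_of_nonneg_left q1 (show 0 ≤ A ^ 2 by positivity)
      nlinarith
    have q4 : A * lam ≤ A * E := by gcongr
    nlinarith
  refine g1.trans ?_
  have : δ / 4 * (E ^ 2 / lam) = (δ / 4 * E / lam ^ 2) * (E * lam) := by field_simp
  rw [this]
  have : 6000 * A ^ 2 * E * lam = 6000 * A ^ 2 * (E * lam) := by ring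
  rw [this]
  gcongr
  rw [le_div_iff₀ (by positivity)]
  rw [div_le_iff₀ hδ] at b3
  have := mul_le_mul_of_nonneg_left b3 (show 0 ≤ lam ^ 2 / 24 by positivity)
  have := mul_le_mul_of_nonneg_left hE3 (show 0 ≤ δ / 4 by positivity)
  nlinarith

set_option maxHeartbeats 1000000 in
theorem upper_lam (δ : ℝ) (hδ : 0 < δ) (hδ1 : δ ≤ 1) : ∃ l0 : ℝ, 10 ≤ l0 ∧ ∀ lam : ℝ, l0 ≤ lam → ∀ n : ℕ,
    Real.log (3 * n) = Real.exp lam → Real.log (congCount 2 n) ≤ (kap / 4 + δ) * (Real.exp lam ^ 2 / lam) := by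
  set A : ℝ := 272 / δ with hAd
  have hA1 : 1 ≤ A := by rw [hAd, le_div_iff₀ hδ]; linarith
  set ε : ℝ := δ / 16 with hεd
  have hε : 0 < ε := by positivity
  have hε1 : ε < 1 := by rw [hεd]; linarith
  obtain ⟨l1, hl1, hF⟩ := FF_bound (2 * A) ε (by positivity) hε hε1
  refine ⟨max l1 (max (32 / δ) (144000 * A ^ 2 / δ)), hl1.trans (le_max_left _ _), ?_⟩
  intro lam hlam n hn
  have b1 : l1 ≤ lam := (le_max_left _ _).trans hlam
  have b2 : 32 / δ ≤ lam := ((le_max_left _ _).trans (le_max_right _ _)).trans hlam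
  have b3 : 144000 * A ^ 2 / δ ≤ lam := ((le_max_right _ _).trans (le_max_right _ _)).trans hlam
  have b10 : 10 ≤ lam := hl1.trans b1
  have h0 : 0 < lam := by linarith
  set E := Real.exp lam with hE
  have hE0 : 0 < E := Real.exp_pos _
  have hn1 : 1 ≤ n := by
    rcases Nat.eq_zero_or_pos n with h | h
    · subst h; simp at hn; linarith
    · exact h
  have h3n : (0:ℝ) < 3 * n := by positivity
  set T0 : ℕ := ⌈Real.exp (A * lam)⌉₊ with hT0d
  have hT0l : Real.exp (A * lam) ≤ T0 := Nat.le_ceil _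
  have hAl : 1 ≤ A * lam := by nlinarith
  have hT0u : (T0:ℝ) ≤ Real.exp (2 * A * lam) := by
    have h1 : (T0:ℝ) < Real.exp (A * lam) + 1 := Nat.ceil_lt_add_one (Real.exp_pos _).le
    have h2 : A * lam + 1 ≤ Real.exp (A * lam) := Real.add_one_le_exp _
    have h3 : Real.exp (2 * A * lam) = Real.exp (A * lam) * Real.exp (A * lam) := by rw [← Real.exp_add]; ring_nf
    rw [h3]; nlinarith
  have hT01 : 1 ≤ T0 := by
    have : (0:ℝ) < T0 := (Real.exp_pos _).trans_le hT0l
    exact_mod_cast this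
  have hT0p : (0:ℝ) < T0 := by exact_mod_cast hT01
  have hlT : A * lam ≤ Real.log T0 := (Real.le_log_iff_exp_le hT0p).2 hT0l
  have hlTu : Real.log T0 ≤ 2 * A * lam := (Real.log_le_iff_le_exp hT0p).2 hT0u
  have hM1 : 1 ≤ T0 ^ 4 := Nat.one_le_pow _ _ hT01
  have hlM : Real.log ((T0 ^ 4 : ℕ):ℝ) = 4 * Real.log T0 := by push_cast; rw [Real.log_pow]; push_cast; ring
  set G : ℝ := E ^ 2 / lam with hG
  have hG0 : 0 < G := by positivity
  set BB : ℝ := 5120 * A ^ 2 * E * lam + 5 * E + 8 * A * lam + 8 * E ^ 2 / lam ^ 2 + kap * ((1 / (4 * (1 - ε)) + 3 * ε) * G) with hBB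
  set CC : ℝ := 32 * A * E + BB + 68 / A * G with hCC
  clear_value CC BB G
  have key : ∀ m ∈ Finset.Icc 1 (3 * n), (Nat.card (LevSub m n) : ℝ) ≤ Real.exp CC := by
    intro m hm
    rw [Finset.mem_Icc] at hm
    have hm0 : m ≠ 0 := by omega
    have hmL : Real.log m ≤ E := by
      rw [← hn]
      apply Real.log_le_log (by exact_mod_cast hm.1)
      exact_mod_cast hm.2
    have hs : (m.primeFactors.card : ℝ) ≤ 2 * E / lam := by
      apply t_bound lam b10
      refine le_trans (Real.log_le_log (by exact_mod_cast Nat.factorial_pos _) ?_) hmL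
      exact_mod_cast primeFactors_fact m hm0
    have hc : ((TS m T0)ᶜ.card : ℝ) * (A * lam) ≤ E := by
      have h1 : (((TS m T0)ᶜ.card : ℕ) : ℝ) * Real.log T0 ≤ Real.log m := by
        rw [← Real.log_pow]
        apply Real.log_le_log (by positivity)
        exact_mod_cast TS_compl m T0 hm0
      have h2 : ((TS m T0)ᶜ.card : ℝ) * (A * lam) ≤ (TS m T0)ᶜ.card * Real.log T0 := by gcongr
      linarith
    have := lev_count m n T0 hm0 hm.2 hT01 (Real.exp BB) (Real.exp_pos _).le (by
      intro α β hP hα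
      rw [← Real.log_le_iff_le_exp (Pbd_pos α β hM1)]
      obtain ⟨ht, hFF⟩ := hF lam b1 m.primeFactors (TS m T0) (primesLe (T0 ^ 4)) (fun q hq => (Finset.mem_filter.1 hq).2) α β n hn hP (by
        intro p hp
        have h1 : p.1 ^ kk m p.1 ≤ T0 := (Finset.mem_filter.1 hp).2
        have h2 : p.1 ≤ p.1 ^ kk m p.1 := Nat.le_self_pow (NeZero.ne _) _
        exact le_trans (by exact_mod_cast h2.trans h1) hT0u)
      have hb := log_Pbd_le hM1 hP hn1 hα
      rw [hlM, hn] at hb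
      have hT2 : ((TS m T0).card : ℝ) * (4 * Real.log T0) ^ 2 ≤ (2 * E / lam) * (4 * (2 * A * lam)) ^ 2 := by
        gcongr
      have hT3 : ((TS m T0).card : ℝ) ^ 2 ≤ (2 * E / lam) ^ 2 := by gcongr
      have e1 : (2 * E / lam) * (4 * (2 * A * lam)) ^ 2 = 128 * A ^ 2 * E * lam := by field_simp; ring
      have e2 : (2 * E / lam) ^ 2 = 4 * E ^ 2 / lam ^ 2 := by field_simp; ring
      rw [e1] at hT2; rw [e2] at hT3
      rw [← hE, ← hG] at hFF
      have hk := mul_le_mul_of_nonneg_left hFF kap_pos.le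
      rw [hBB]
      have e3 : 8 * E ^ 2 / lam ^ 2 = 2 * (4 * E ^ 2 / lam ^ 2) := by ring
      rw [e3]
      linarith)
    refine this.trans ?_
    have hT4 : ((T0 ^ 4 : ℕ):ℝ) ^ (2 * m.primeFactors.card) ≤ Real.exp (32 * A * E) := by
      rw [← Real.log_le_iff_le_exp (by positivity), Real.log_pow, hlM]
      push_cast
      have : (m.primeFactors.card : ℝ) * Real.log T0 ≤ (2 * E / lam) * (2 * A * lam) := by gcongr
      have e : (2 * E / lam) * (2 * A * lam) = 4 * A * E := by field_simp; ring
      rw [e] at this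
      nlinarith
    have hT5 : (((3 * n) ^ 4 : ℕ) : ℝ) ^ (17 * (TS m T0)ᶜ.card) ≤ Real.exp (68 / A * G) := by
      rw [← Real.log_le_iff_le_exp (by positivity), Real.log_pow]
      push_cast
      rw [Real.log_pow, hn]
      have e : 68 / A * G = 68 * E * (E / (A * lam)) := by rw [hG]; field_simp
      have : ((TS m T0)ᶜ.card : ℝ) ≤ E / (A * lam) := by rw [le_div_iff₀ (by positivity)]; exact hc
      rw [e]
      have := mul_le_mul_of_nonneg_left this (show 0 ≤ 68 * E by positivity)
      push_cast; linarith
    rw [hCC, Real.exp_add, Real.exp_add]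
    exact mul_le_mul (mul_le_mul hT4 le_rfl (Real.exp_pos _).le (Real.exp_pos _).le) hT5 (by positivity) (by positivity)
  have hcount : (congCount 2 n : ℝ) ≤ Real.exp (E + CC) := by
    have h1 := (finite_cong n).2
    have h2 : (congCount 2 n : ℝ) ≤ ∑ m ∈ Finset.Icc 1 (3 * n), (Nat.card (LevSub m n) : ℝ) := by exact_mod_cast h1
    refine h2.trans ((Finset.sum_le_card_nsmul _ _ _ key).trans ?_)
    rw [nsmul_eq_mul, Real.exp_add E CC, Nat.card_Icc]
    have : Real.exp E = 3 * n := by rw [← hn, Real.exp_log h3n]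
    rw [this]
    push_cast
    simp
  clear key hF
  have hfin : E + CC ≤ (kap / 4 + δ) * G := by
    have hk1 := kap_lt_one
    have hk0 := kap_pos
    have f1 : kap * ((1 / (4 * (1 - ε)) + 3 * ε) * G) ≤ (kap / 4 + δ / 4) * G := by
      have hh : 1 / (4 * (1 - ε)) ≤ 1 / 4 + ε := by
        rw [div_le_iff₀ (by linarith)]; nlinarith
      have : kap * (1 / (4 * (1 - ε)) + 3 * ε) ≤ kap / 4 + δ / 4 := by
        have : kap * (1 / (4 * (1 - ε)) + 3 * ε) ≤ kap * (1 / 4 + ε + 3 * ε) := by gcongr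
        have h4 : kap * (4 * ε) ≤ 1 * (4 * ε) := by gcongr
        have h5 : ε * 16 = δ := by rw [hεd]; ring
        linarith
      rw [← mul_assoc]; gcongr
    have f2 : 68 / A * G = δ / 4 * G := by rw [hAd]; field_simp; norm_num
    have f3 : 8 * E ^ 2 / lam ^ 2 ≤ δ / 4 * G := by
      have : 8 * E ^ 2 / lam ^ 2 = 8 / lam * G := by rw [hG]; field_simp
      rw [this]; refine mul_le_mul_of_nonneg_right ?_ hG0.le
      rw [div_le_iff₀ hδ] at b2
      rw [div_le_iff₀ h0]; linarith
    have f4 := upper_aux δ A lam E hδ hA1 b10 hE b3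
    rw [← hG] at f4
    rw [hCC, hBB]
    linarith
  by_cases hz : congCount 2 n = 0
  · rw [hz]; simp; have := kap_pos; positivity
  · rw [Real.log_le_iff_le_exp (by exact_mod_cast Nat.pos_of_ne_zero hz)]
    exact hcount.trans (Real.exp_le_exp.2 hfin)

end CG

namespace CG

theorem upper_final (δ : ℝ) (hδ : 0 < δ) : ∀ᶠ n : ℕ in atTop,
    Real.log (congCount 2 n) / ((Real.log n) ^ 2 / Real.log (Real.log n)) ≤ kap / 4 + δ := by
  set d := min (δ / 4) 1 with hd
  have hd0 : 0 < d := lt_min (by positivity) one_pos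
  have hd1 : d ≤ 1 := min_le_right _ _
  have hd4 : d ≤ δ / 4 := min_le_left _ _
  obtain ⟨l0, hl0, h⟩ := upper_lam d hd0 hd1
  have hlog : Tendsto (fun n : ℕ => Real.log n) atTop atTop := Real.tendsto_log_atTop.comp tendsto_natCast_atTop_atTop
  have hloglog : Tendsto (fun n : ℕ => Real.log (Real.log n)) atTop atTop := Real.tendsto_log_atTop.comp hlog
  filter_upwards [hloglog.eventually_ge_atTop l0, hlog.eventually_ge_atTop (max 1 (2 * Real.log 3 / d)), eventually_ge_atTop 1] with n h1 h2 h3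
  have hn0 : (0:ℝ) < n := by exact_mod_cast h3
  have hL1 : 1 ≤ Real.log n := (le_max_left _ _).trans h2
  have hL2 : 2 * Real.log 3 / d ≤ Real.log n := (le_max_right _ _).trans h2
  set L := Real.log n with hL
  have hl3 : 0 < Real.log 3 := Real.log_pos (by norm_num)
  have hL3 : Real.log (3 * n) = Real.log 3 + L := by rw [Real.log_mul (by norm_num) hn0.ne']
  have hpos : 0 < Real.log 3 + L := by linarith
  have hll : Real.log L ≤ Real.log (Real.log 3 + L) := Real.log_le_log (by linarith) (by linarith)
  have hk := h (Real.log (Real.log 3 + L)) (h1.trans hll) n (by rw [hL3, Real.exp_log hpos])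
  rw [Real.exp_log hpos] at hk
  have hll0 : 0 < Real.log L := by linarith
  rw [div_le_iff₀ (by positivity)]
  refine hk.trans ?_
  have hkp := kap_pos
  have hk1 := kap_lt_one
  have a1 : (Real.log 3 + L) ^ 2 / Real.log (Real.log 3 + L) ≤ (Real.log 3 + L) ^ 2 / Real.log L := by gcongr
  have a2 : Real.log 3 + L ≤ (1 + d / 2) * L := by
    rw [div_le_iff₀ hd0] at hL2; linarith
  have a3 : (Real.log 3 + L) ^ 2 / Real.log L ≤ ((1 + d / 2) * L) ^ 2 / Real.log L := by gcongr
  have a4 : ((1 + d / 2) * L) ^ 2 / Real.log L = (1 + d / 2) ^ 2 * (L ^ 2 / Real.log L) := by ring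
  rw [a4] at a3
  have hX : 0 < L ^ 2 / Real.log L := by positivity
  calc _ ≤ (kap / 4 + d) * ((1 + d / 2) ^ 2 * (L ^ 2 / Real.log L)) := by gcongr; linarith
    _ = ((kap / 4 + d) * (1 + d / 2) ^ 2) * (L ^ 2 / Real.log L) := by ring
    _ ≤ _ := by
      refine mul_le_mul_of_nonneg_right ?_ hX.le
      have : (1 + d / 2) ^ 2 ≤ 1 + 5 / 4 * d := by nlinarith only [hd0, hd1]
      have : (kap / 4 + d) * (1 + d / 2) ^ 2 ≤ (kap / 4 + d) * (1 + 5 / 4 * d) := by gcongr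
      have : (kap / 4 + d) * (1 + 5 / 4 * d) ≤ kap / 4 + 3 * d := by nlinarith only [hd0, hd1, hk1, hkp]
      linarith

end CG

namespace CG

noncomputable def ee (θ : ℝ) : ℂ := Complex.exp (Complex.I * ((2 * Real.pi * θ : ℝ) : ℂ))

lemma ee_add (a b : ℝ) : ee (a + b) = ee a * ee b := by
  unfold ee; rw [← Complex.exp_add]; push_cast; ring_nf
lemma ee_nat (n : ℕ) (a : ℝ) : ee (n * a) = ee a ^ n := by
  unfold ee; rw [← Complex.exp_nat_mul]; push_cast; ring_nf
lemma ee_int (n : ℤ) : ee n = 1 := by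
  unfold ee; rw [Complex.exp_eq_one_iff]; exact ⟨n, by push_cast; ring⟩
lemma ee_norm (a : ℝ) : ‖ee a‖ = 1 := by
  unfold ee; exact Complex.norm_exp_I_mul_ofReal _
lemma ee_conj (a : ℝ) : (starRingEnd ℂ) (ee a) = ee (-a) := by
  unfold ee; rw [← Complex.exp_conj, map_mul, Complex.conj_I, Complex.conj_ofReal]; push_cast; ring_nf
lemma ee_fract (a : ℝ) : ee (Int.fract a) = ee a := by
  conv_rhs => rw [← Int.floor_add_fract a, ee_add, ee_int, one_mul]

lemma ee_sub_one (t : ℝ) (h0 : 0 < t) (h1 : t < 1) : 4 * min t (1 - t) ≤ ‖ee t - 1‖ := by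
  unfold ee
  rw [Complex.norm_exp_I_mul_ofReal_sub_one, show 2 * Real.pi * t / 2 = Real.pi * t by ring]
  have hpi := Real.pi_pos
  refine le_trans ?_ (Real.le_norm_self _)
  rcases le_total t (1 / 2) with h | h
  · have := Real.mul_le_sin (x := Real.pi * t) (by positivity) (by nlinarith)
    rw [show 2 / Real.pi * (Real.pi * t) = 2 * t by field_simp] at this
    have := min_le_left t (1 - t); linarith
  · have := Real.mul_le_sin (x := Real.pi * (1 - t)) (mul_nonneg hpi.le (by linarith)) (by nlinarith)
    rw [show 2 / Real.pi * (Real.pi * (1 - t)) = 2 * (1 - t) by field_simp, show Real.pi * (1 - t) = Real.pi - Real.pi * t by ring, Real.sin_pi_sub] at this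
    have := min_le_right t (1 - t); linarith

lemma geom_bd (X K : ℕ) (θ : ℝ) (h : 0 < Int.fract θ) :
    ‖∑ n ∈ Finset.Ioc X (X + K), ee (n * θ)‖ ≤ 1 / 2 * (1 / Int.fract θ + 1 / Int.fract (-θ)) := by
  set t := Int.fract θ with ht
  have h1 : t < 1 := Int.fract_lt_one _
  have hneg : Int.fract (-θ) = 1 - t := Int.fract_neg h.ne'
  rw [hneg]
  have hm : 0 < min t (1 - t) := lt_min h (by linarith)
  have hz := ee_sub_one t h h1
  rw [ht, ee_fract, ← ht] at hz
  have hz1 : ee θ ≠ 1 := by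
    intro h'; rw [h'] at hz; simp at hz; linarith [hz]
  have e1 : ∑ n ∈ Finset.Ioc X (X + K), ee (n * θ) = ee θ ^ (X + 1) * ∑ i ∈ Finset.range K, ee θ ^ i := by
    rw [Finset.mul_sum, ← Finset.Ico_add_one_add_one_eq_Ioc, Finset.sum_Ico_eq_sum_range]
    apply Finset.sum_congr (by congr 1; omega)
    intro i _
    rw [ee_nat, ← pow_add]
  rw [e1, geom_sum_eq hz1, norm_mul, norm_pow, ee_norm, one_pow, one_mul, norm_div]
  have e2 : ‖ee θ ^ K - 1‖ ≤ 2 := by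
    refine (norm_sub_le _ _).trans ?_
    rw [norm_pow, ee_norm]; norm_num
  have e3 : ‖ee θ ^ K - 1‖ / ‖ee θ - 1‖ ≤ 2 / (4 * min t (1 - t)) := by gcongr
  refine e3.trans ?_
  have ha : 0 < 1 / t := by positivity
  have hb : 0 < 1 / (1 - t) := one_div_pos.2 (by linarith)
  rcases min_cases t (1 - t) with ⟨h2, _⟩ | ⟨h2, _⟩
  · rw [h2, show 2 / (4 * t) = 1 / 2 * (1 / t) by field_simp; norm_num]; linarith
  · have : 1 - t ≠ 0 := by linarith
    rw [h2, show 2 / (4 * (1 - t)) = 1 / 2 * (1 / (1 - t)) by field_simp; norm_num]; linarith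

lemma harm_bd (D : ℕ) : ∑ j ∈ Finset.Icc 1 D, (1 : ℝ) / j ≤ 1 + Real.log D := by
  have := harmonic_le_one_add_log D
  rw [harmonic_eq_sum_Icc] at this
  push_cast at this
  simpa using this

/-- bucket lemma -/
lemma bucket {ι : Type*} (R : Finset ι) (d : ι → ℝ) (D : ℕ) (hd : ∀ s ∈ R, 1 ≤ D * d s ∧ d s < 1)
    (hsp : ∀ r ∈ R, ∀ s ∈ R, r ≠ s → 1 ≤ D * |d r - d s|) : ∑ s ∈ R, 1 / d s ≤ D * (1 + Real.log D) := by
  classical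
  have hinj : Set.InjOn (fun s => ⌊(D:ℝ) * d s⌋₊) R := by
    intro r hr s hs h
    by_contra hne
    have h1 := hsp r hr s hs hne
    have a1 := Nat.floor_le (show 0 ≤ (D:ℝ) * d r by linarith [(hd r hr).1])
    have a2 := Nat.lt_floor_add_one ((D:ℝ) * d r)
    have a3 := Nat.floor_le (show 0 ≤ (D:ℝ) * d s by linarith [(hd s hs).1])
    have a4 := Nat.lt_floor_add_one ((D:ℝ) * d s)
    simp only at h
    rw [h] at a1 a2
    have : |(D:ℝ) * d r - D * d s| < 1 := by rw [abs_lt]; constructor <;> linarith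
    rw [← mul_sub, abs_mul, Nat.abs_cast] at this
    linarith
  have h1 : ∀ s ∈ R, 1 / d s ≤ D * (1 / (⌊(D:ℝ) * d s⌋₊ : ℝ)) := by
    intro s hs
    have h0 := (hd s hs).1
    have hf1 : 1 ≤ ⌊(D:ℝ) * d s⌋₊ := Nat.le_floor (by simpa using h0)
    have hf : (0:ℝ) < ⌊(D:ℝ) * d s⌋₊ := by exact_mod_cast hf1
    have hD : (0:ℝ) ≤ D := Nat.cast_nonneg _
    have hds : 0 < d s := by
      by_contra hc; push Not at hc; nlinarith
    rw [mul_one_div, div_le_div_iff₀ hds hf, one_mul]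
    exact Nat.floor_le (by linarith)
  refine (Finset.sum_le_sum h1).trans ?_
  rw [← Finset.mul_sum]
  refine mul_le_mul_of_nonneg_left ?_ (Nat.cast_nonneg _)
  rw [← Finset.sum_image (f := fun j : ℕ => (1:ℝ) / j) hinj]
  refine le_trans (Finset.sum_le_sum_of_subset_of_nonneg ?_ ?_) (harm_bd D)
  · intro j hj
    rw [Finset.mem_image] at hj
    obtain ⟨s, hs, rfl⟩ := hj
    rw [Finset.mem_Icc]
    refine ⟨Nat.le_floor (by simpa using (hd s hs).1), ?_⟩
    apply Nat.floor_le_of_le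
    nlinarith [(hd s hs).2, Nat.cast_nonneg (α := ℝ) D]
  · intros; positivity

/-- spaced points -/
theorem ls_gen {ι : Type*} (R : Finset ι) (α : ι → ℝ) (D : ℕ) 
    (hsp : ∀ r ∈ R, ∀ s ∈ R, r ≠ s → ∀ k : ℤ, 1 ≤ D * |α r - α s - k|) (X K : ℕ) (a : ℕ → ℝ) :
    ∑ r ∈ R, ‖∑ n ∈ Finset.Ioc X (X + K), (a n : ℂ) * ee (n * α r)‖ ^ 2 ≤ (K + D * (1 + Real.log D)) * ∑ n ∈ Finset.Ioc X (X + K), a n ^ 2 := by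
  classical
  set I := Finset.Ioc X (X + K) with hI
  set S : ι → ℂ := fun r => ∑ n ∈ I, (a n : ℂ) * ee (n * α r) with hS
  set C : ℝ := K + D * (1 + Real.log D) with hC
  have hfr : ∀ r ∈ R, ∀ s ∈ R, r ≠ s → 1 ≤ D * Int.fract (α r - α s) := by
    intro r hr s hs hne
    have := hsp r hr s hs hne ⌊α r - α s⌋
    rwa [show α r - α s - ⌊α r - α s⌋ = Int.fract (α r - α s) from rfl, abs_of_nonneg (Int.fract_nonneg _)] at this
  have hfp : ∀ r ∈ R, ∀ s ∈ R, r ≠ s → 0 < Int.fract (α r - α s) := by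
    intro r hr s hs hne
    have := hfr r hr s hs hne
    rcases (Int.fract_nonneg (α r - α s)).lt_or_eq with h | h
    · exact h
    · rw [← h] at this; simp at this; linarith
  set g : ι → ι → ℝ := fun r s => if r = s then (K:ℝ) else 1 / 2 * (1 / Int.fract (α r - α s) + 1 / Int.fract (α s - α r)) with hg
  have hgs : ∀ r s, g r s = g s r := by
    intro r s; simp only [hg]
    by_cases h : r = s
    · simp [h]
    · rw [if_neg h, if_neg (Ne.symm h), add_comm]
  have hgb : ∀ r ∈ R, ∀ s ∈ R, ‖∑ n ∈ I, ee (n * (α r - α s))‖ ≤ g r s := by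
    intro r hr s hs
    simp only [hg]
    by_cases h : r = s
    · rw [if_pos h, h]
      refine (norm_sum_le _ _).trans ?_
      simp [ee_norm, hI]
    · rw [if_neg h]
      have := geom_bd X K (α r - α s) (hfp r hr s hs h)
      rwa [neg_sub] at this
  have hg0 : ∀ r ∈ R, ∀ s ∈ R, 0 ≤ g r s := fun r hr s hs => (norm_nonneg _).trans (hgb r hr s hs)
  have hgsum : ∀ r ∈ R, ∑ s ∈ R, g r s ≤ C := by
    intro r hr
    rw [← Finset.add_sum_erase R _ hr]
    have e0 : g r r = K := by simp [hg]
    have e1 : ∑ s ∈ R.erase r, g r s = 1 / 2 * (∑ s ∈ R.erase r, 1 / Int.fract (α r - α s) + ∑ s ∈ R.erase r, 1 / Int.fract (α s - α r)) := by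
      rw [← Finset.sum_add_distrib, Finset.mul_sum]
      apply Finset.sum_congr rfl
      intro s hs
      simp only [hg]; rw [if_neg (Finset.ne_of_mem_erase hs).symm]
    have b1 : ∑ s ∈ R.erase r, 1 / Int.fract (α r - α s) ≤ D * (1 + Real.log D) := by
      apply bucket
      · intro s hs
        exact ⟨hfr r hr s (Finset.mem_of_mem_erase hs) (Finset.ne_of_mem_erase hs).symm, Int.fract_lt_one _⟩
      · intro s hs t ht hne
        have := hsp t (Finset.mem_of_mem_erase ht) s (Finset.mem_of_mem_erase hs) hne.symm (⌊α r - α s⌋ - ⌊α r - α t⌋)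
        rw [show Int.fract (α r - α s) - Int.fract (α r - α t) = α t - α s - ((⌊α r - α s⌋ - ⌊α r - α t⌋ : ℤ) : ℝ) by
          unfold Int.fract; push_cast; ring]
        exact this
    have b2 : ∑ s ∈ R.erase r, 1 / Int.fract (α s - α r) ≤ D * (1 + Real.log D) := by
      apply bucket
      · intro s hs
        exact ⟨hfr s (Finset.mem_of_mem_erase hs) r hr (Finset.ne_of_mem_erase hs), Int.fract_lt_one _⟩
      · intro s hs t ht hne
        have := hsp s (Finset.mem_of_mem_erase hs) t (Finset.mem_of_mem_erase ht) hne (⌊α s - α r⌋ - ⌊α t - α r⌋)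
        rw [show Int.fract (α s - α r) - Int.fract (α t - α r) = α s - α t - ((⌊α s - α r⌋ - ⌊α t - α r⌋ : ℤ) : ℝ) by
          unfold Int.fract; push_cast; ring]
        exact this
    rw [e0, e1, hC]; linarith
  set Z : ℝ := ∑ r ∈ R, ‖S r‖ ^ 2 with hZ
  have hZ0 : 0 ≤ Z := Finset.sum_nonneg fun _ _ => by positivity
  -- dual inequality
  have dual : ∑ n ∈ I, ‖∑ r ∈ R, (starRingEnd ℂ) (S r) * ee (n * α r)‖ ^ 2 ≤ C * Z := by
    have e : (((∑ n ∈ I, ‖∑ r ∈ R, (starRingEnd ℂ) (S r) * ee (n * α r)‖ ^ 2 : ℝ)) : ℂ) =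
        ∑ r ∈ R, ∑ s ∈ R, (starRingEnd ℂ) (S r) * S s * ∑ n ∈ I, ee (n * (α r - α s)) := by
      push_cast
      simp_rw [← Complex.mul_conj', map_sum, map_mul, Complex.conj_conj, ee_conj, Finset.sum_mul_sum, Finset.mul_sum]
      rw [Finset.sum_comm]
      apply Finset.sum_congr rfl; intro r _
      rw [Finset.sum_comm]
      apply Finset.sum_congr rfl; intro s _
      apply Finset.sum_congr rfl; intro n _
      rw [show (n:ℝ) * (α r - α s) = n * α r + -(n * α s) by ring, ee_add]
      ring
    have e2 : (∑ n ∈ I, ‖∑ r ∈ R, (starRingEnd ℂ) (S r) * ee (n * α r)‖ ^ 2 : ℝ) ≤ ∑ r ∈ R, ∑ s ∈ R, ‖S r‖ * ‖S s‖ * g r s := by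
      have h0 : (0:ℝ) ≤ ∑ n ∈ I, ‖∑ r ∈ R, (starRingEnd ℂ) (S r) * ee (n * α r)‖ ^ 2 := Finset.sum_nonneg fun _ _ => by positivity
      rw [← Complex.norm_of_nonneg h0, e]
      refine (norm_sum_le _ _).trans (Finset.sum_le_sum fun r hr => (norm_sum_le _ _).trans (Finset.sum_le_sum fun s hs => ?_))
      rw [norm_mul, norm_mul, RCLike.norm_conj]
      exact mul_le_mul_of_nonneg_left (hgb r hr s hs) (by positivity)
    refine e2.trans ?_
    have e3 : ∑ r ∈ R, ∑ s ∈ R, ‖S r‖ * ‖S s‖ * g r s ≤ ∑ r ∈ R, ∑ s ∈ R, (1 / 2 * (‖S r‖ ^ 2 * g r s) + 1 / 2 * (‖S s‖ ^ 2 * g r s)) := by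
      refine Finset.sum_le_sum fun r hr => Finset.sum_le_sum fun s hs => ?_
      have : ‖S r‖ * ‖S s‖ ≤ 1 / 2 * ‖S r‖ ^ 2 + 1 / 2 * ‖S s‖ ^ 2 := by nlinarith [sq_nonneg (‖S r‖ - ‖S s‖)]
      nlinarith [mul_le_mul_of_nonneg_right this (hg0 r hr s hs)]
    refine e3.trans ?_
    simp_rw [Finset.sum_add_distrib, ← Finset.mul_sum]
    have e4 : ∑ r ∈ R, ‖S r‖ ^ 2 * ∑ s ∈ R, g r s ≤ C * Z := by
      rw [hZ, Finset.mul_sum]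
      refine Finset.sum_le_sum fun r hr => ?_
      rw [mul_comm C]
      exact mul_le_mul_of_nonneg_left (hgsum r hr) (by positivity)
    have e5 : ∑ r ∈ R, ∑ s ∈ R, ‖S s‖ ^ 2 * g r s = ∑ r ∈ R, ‖S r‖ ^ 2 * ∑ s ∈ R, g r s := by
      rw [Finset.sum_comm]
      apply Finset.sum_congr rfl; intro r _
      rw [Finset.mul_sum]
      apply Finset.sum_congr rfl; intro s _
      rw [hgs]
    rw [e5]; linarith
  have hdual0 : 0 ≤ ∑ n ∈ I, ‖∑ r ∈ R, (starRingEnd ℂ) (S r) * ee (n * α r)‖ ^ 2 := Finset.sum_nonneg fun _ _ => by positivity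
  have hA0 : 0 ≤ ∑ n ∈ I, a n ^ 2 := Finset.sum_nonneg fun _ _ => by positivity
  have main : Z ^ 2 ≤ (∑ n ∈ I, a n ^ 2) * ∑ n ∈ I, ‖∑ r ∈ R, (starRingEnd ℂ) (S r) * ee (n * α r)‖ ^ 2 := by
    have e : (Z : ℂ) = ∑ n ∈ I, (a n : ℂ) * ∑ r ∈ R, (starRingEnd ℂ) (S r) * ee (n * α r) := by
      rw [hZ]; push_cast
      simp_rw [← Complex.conj_mul', Finset.mul_sum]
      rw [Finset.sum_comm]
      apply Finset.sum_congr rfl; intro r _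
      conv_lhs => rw [hS]
      simp only []
      rw [Finset.mul_sum]
      apply Finset.sum_congr rfl; intro n _
      ring
    have e2 : Z ≤ ∑ n ∈ I, |a n| * ‖∑ r ∈ R, (starRingEnd ℂ) (S r) * ee (n * α r)‖ := by
      rw [← Complex.norm_of_nonneg hZ0, e]
      refine (norm_sum_le _ _).trans (Finset.sum_le_sum fun n _ => ?_)
      rw [norm_mul, Complex.norm_real, Real.norm_eq_abs]
    have e3 := Finset.sum_mul_sq_le_sq_mul_sq I (fun n => |a n|) (fun n => ‖∑ r ∈ R, (starRingEnd ℂ) (S r) * ee (n * α r)‖)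
    simp only [sq_abs] at e3
    exact (pow_le_pow_left₀ hZ0 e2 2).trans e3
  have : Z ^ 2 ≤ (∑ n ∈ I, a n ^ 2) * (C * Z) := main.trans (mul_le_mul_of_nonneg_left dual hA0)
  rcases hZ0.eq_or_lt with h | h
  · rw [← h]
    by_cases hR : R.Nonempty
    · obtain ⟨r, hr⟩ := hR
      have : 0 ≤ C := (Finset.sum_nonneg fun s hs => hg0 r hr s hs).trans (hgsum r hr)
      positivity
    · refine mul_nonneg ?_ hA0
      rw [hC]
      rcases Nat.eq_zero_or_pos D with h | h
      · subst h; simp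
      · have : 0 ≤ Real.log D := Real.log_nonneg (by exact_mod_cast h)
        positivity
  · nlinarith

theorem large_sieve (Q : ℕ) (Ps : Finset ℕ) (hP : ∀ q ∈ Ps, q.Prime ∧ q ≤ Q) (X K : ℕ) (a : ℕ → ℝ) :
    ∑ q ∈ Ps, ∑ c ∈ Finset.Ico 1 q, ‖∑ n ∈ Finset.Ioc X (X + K), (a n : ℂ) * ee (n * (c / q : ℝ))‖ ^ 2 ≤
      (K + (Q ^ 2 : ℕ) * (1 + Real.log (Q ^ 2 : ℕ))) * ∑ n ∈ Finset.Ioc X (X + K), a n ^ 2 := by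
  classical
  rw [Finset.sum_sigma']
  apply ls_gen _ (fun r : (_ : ℕ) × ℕ => (r.2 / r.1 : ℝ))
  rintro ⟨q, c⟩ hr ⟨q', c'⟩ hs hne k
  simp only [Finset.mem_sigma, Finset.mem_Ico] at hr hs
  obtain ⟨hq, hc1, hc2⟩ := hr
  obtain ⟨hq', hc1', hc2'⟩ := hs
  obtain ⟨hqp, hqQ⟩ := hP q hq
  obtain ⟨hqp', hqQ'⟩ := hP q' hq'
  have h1 : (0:ℝ) < q := by exact_mod_cast hqp.pos
  have h2 : (0:ℝ) < q' := by exact_mod_cast hqp'.pos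
  simp only
  have e : (c:ℝ) / q - c' / q' - k = (((c:ℤ) * q' - c' * q - k * (q * q') : ℤ) : ℝ) / (q * q') := by
    push_cast; field_simp
  have hnz : (c:ℤ) * q' - c' * q - k * (q * q') ≠ 0 := by
    intro h0
    by_cases hqq : q = q'
    · subst hqq
      have h3 : (q:ℤ) * (c - c' - k * q) = 0 := by linear_combination h0
      rcases mul_eq_zero.1 h3 with h | h
      · have := hqp.pos; omega
      · have hk : (c:ℤ) - c' = k * q := by linear_combination h
        have : c = c' := by
          have hk0 : k = 0 := by
            by_contra hk0
            rcases lt_or_gt_of_ne hk0 with h | h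
            · have : k * q ≤ -1 * q := by gcongr; omega
              omega
            · have : 1 * (q:ℤ) ≤ k * q := by gcongr; omega
              omega
          rw [hk0] at hk; omega
        subst this; exact hne rfl
    · have hd : (q:ℤ) ∣ c * q' := ⟨c' + k * q', by linear_combination h0⟩
      have hd' : q ∣ c * q' := by exact_mod_cast hd
      rcases (Nat.Prime.dvd_mul hqp).1 hd' with h | h
      · exact absurd (Nat.le_of_dvd hc1 h) (by omega)
      · exact hqq ((Nat.prime_dvd_prime_iff_eq hqp hqp').1 h)
  rw [e, abs_div, abs_of_pos (mul_pos h1 h2), mul_div_assoc', le_div_iff₀ (mul_pos h1 h2), one_mul]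
  have h3 : (1:ℝ) ≤ |(((c:ℤ) * q' - c' * q - k * (q * q') : ℤ) : ℝ)| := by
    rw [← Int.cast_abs]; exact_mod_cast Int.one_le_abs hnz
  have h4 : (q:ℝ) * q' ≤ (Q ^ 2 : ℕ) := by
    rw [sq]; exact_mod_cast Nat.mul_le_mul hqQ hqQ'
  nlinarith

end CG

namespace CG

noncomputable def Dz (q : ℕ) (z : ZMod q) : ℝ := (if z = 1 then 1 else 0) - (if z = 0 then 0 else 1 / ((q:ℝ) - 1))
noncomputable def DD (q n : ℕ) : ℝ := Dz q (n : ZMod q)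
noncomputable def Ah (q : ℕ) (s : Finset ℕ) (a : ℕ → ℝ) (h : ZMod q) : ℝ := ∑ n ∈ s, if (n : ZMod q) = h then a n else 0

lemma ee_one_iff (t : ℝ) (h : ee t = 1) : Int.fract t = 0 := by
  by_contra h0
  have h1 : 0 < Int.fract t := lt_of_le_of_ne (Int.fract_nonneg _) (Ne.symm h0)
  have h2 := Int.fract_lt_one t
  have := ee_sub_one _ h1 h2
  rw [ee_fract, h, sub_self, norm_zero] at this
  have := lt_min h1 (show 0 < 1 - Int.fract t by linarith)
  linarith

lemma orth (q : ℕ) (hq : 0 < q) (n m : ℕ) : ∑ c ∈ Finset.range q, ee (n * (c / q : ℝ)) * ee (-(m * (c / q : ℝ))) = if (n : ZMod q) = m then (q:ℂ) else 0 := by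
  have hq0 : (q:ℝ) ≠ 0 := by positivity
  have e : ∀ c ∈ Finset.range q, ee (n * (c / q : ℝ)) * ee (-(m * (c / q : ℝ))) = ee (((n:ℝ) - m) / q) ^ c := by
    intro c _
    rw [← ee_add, ← ee_nat]; congr 1; field_simp; ring
  rw [Finset.sum_congr rfl e]
  split_ifs with h
  · have h1 : ee (((n:ℝ) - m) / q) = 1 := by
      have : (q:ℤ) ∣ n - m := by
        apply (ZMod.intCast_zmod_eq_zero_iff_dvd _ q).1; push_cast; rw [h, sub_self]
      obtain ⟨k, hk⟩ := this
      have : ((n:ℝ) - m) / q = (k:ℤ) := by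
        rw [div_eq_iff hq0]
        have : (((n:ℤ) - m : ℤ) : ℝ) = ((q * k : ℤ) : ℝ) := by rw [hk]
        push_cast at this; linarith
      rw [this, ee_int]
    simp [h1]
  · have h1 : ee (((n:ℝ) - m) / q) ≠ 1 := by
      intro h2
      have h3 := ee_one_iff _ h2
      rw [Int.fract_eq_zero_iff] at h3
      obtain ⟨k, hk⟩ := h3
      apply h
      rw [eq_div_iff hq0] at hk
      have : (k * q : ℤ) = (n - m : ℤ) := by exact_mod_cast hk
      have h4 := congrArg (Int.cast : ℤ → ZMod q) this
      push_cast at h4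
      simp at h4
      exact (sub_eq_zero.1 h4.symm)
    rw [geom_sum_eq h1, ← ee_nat]
    have : (q:ℝ) * (((n:ℝ) - m) / q) = ((n - m : ℤ) : ℝ) := by push_cast; field_simp
    rw [this, ee_int]; simp

lemma parseval (q : ℕ) [NeZero q] (s : Finset ℕ) (a : ℕ → ℝ) :
    ∑ c ∈ Finset.range q, ‖∑ n ∈ s, (a n : ℂ) * ee (n * (c / q : ℝ))‖ ^ 2 = q * ∑ h : ZMod q, Ah q s a h ^ 2 := by
  have e1 : ∑ h : ZMod q, Ah q s a h ^ 2 = ∑ n ∈ s, ∑ m ∈ s, if (n : ZMod q) = m then a n * a m else 0 := by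
    simp_rw [Ah, sq, Finset.sum_mul_sum]
    rw [Finset.sum_comm]
    apply Finset.sum_congr rfl; intro n _
    rw [Finset.sum_comm]
    apply Finset.sum_congr rfl; intro m _
    simp only [ite_mul, zero_mul, mul_ite, mul_zero]
    rw [Finset.sum_eq_single (n : ZMod q)]
    · simp [eq_comm]
    · intro b _ hb; rw [if_neg (Ne.symm hb), ite_self]
    · simp
  apply Complex.ofReal_injective
  rw [e1]
  push_cast
  simp_rw [← Complex.mul_conj', map_sum, map_mul, Complex.conj_ofReal, ee_conj, Finset.sum_mul_sum, Finset.mul_sum]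
  rw [Finset.sum_comm]
  apply Finset.sum_congr rfl; intro n _
  rw [Finset.sum_comm]
  apply Finset.sum_congr rfl; intro m _
  have := orth q (NeZero.pos q) n m
  calc _ = ((a n : ℂ) * a m) * ∑ c ∈ Finset.range q, ee (n * (c / q : ℝ)) * ee (-(m * (c / q : ℝ))) := by
        rw [Finset.mul_sum]; apply Finset.sum_congr rfl; intro c _; ring
    _ = _ := by
      rw [this]; split_ifs <;> simp <;> ring

noncomputable def Tb (q : ℕ) [NeZero q] (f : ZMod q → ℝ) : ℝ := ∑ h ∈ Finset.univ.erase (0 : ZMod q), f h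
noncomputable def VQ (q : ℕ) [NeZero q] (f : ZMod q → ℝ) : ℝ := ∑ h ∈ Finset.univ.erase (0 : ZMod q), (f h - Tb q f / (q - 1)) ^ 2

lemma card_erase0 (q : ℕ) [NeZero q] : (((Finset.univ.erase (0 : ZMod q)).card : ℕ) : ℝ) = q - 1 := by
  rw [Finset.card_erase_of_mem (Finset.mem_univ _), Finset.card_univ, ZMod.card, Nat.cast_sub (NeZero.pos q)]; simp

lemma VQ_le (q : ℕ) [NeZero q] (hq : 2 ≤ q) (s : Finset ℕ) (a : ℕ → ℝ) :
    ((q:ℝ) - 1) * VQ q (Ah q s a) ≤ ∑ c ∈ Finset.Ico 1 q, ‖∑ n ∈ s, (a n : ℂ) * ee (n * (c / q : ℝ))‖ ^ 2 := by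
  have hp := parseval q s a
  rw [Finset.range_eq_Ico, Finset.sum_eq_sum_Ico_succ_bot (by omega)] at hp
  have hq1 : (0:ℝ) < q - 1 := by have : (2:ℝ) ≤ q := by exact_mod_cast hq
                                 linarith
  set f := Ah q s a with hf
  set T := Tb q f with hT
  have e0 : ‖∑ n ∈ s, (a n : ℂ) * ee (n * ((0:ℕ) / q : ℝ))‖ ^ 2 = (f 0 + T) ^ 2 := by
    have h1 : ∀ n ∈ s, (a n : ℂ) * ee (n * ((0:ℕ) / q : ℝ)) = ((a n : ℝ) : ℂ) := by
      intro n _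
      have : (n:ℝ) * (((0:ℕ):ℝ) / q) = ((0:ℤ):ℝ) := by simp
      rw [this, ee_int, mul_one]
    rw [Finset.sum_congr rfl h1, ← Complex.ofReal_sum, Complex.norm_real, Real.norm_eq_abs, sq_abs]
    congr 1
    rw [hT, Tb, Finset.add_sum_erase _ _ (Finset.mem_univ _), hf]
    simp_rw [Ah]
    rw [Finset.sum_comm]
    apply Finset.sum_congr rfl; intro n _
    simp
  rw [e0, ← Finset.add_sum_erase _ _ (Finset.mem_univ (0 : ZMod q))] at hp
  have e1 : VQ q f = ∑ h ∈ Finset.univ.erase (0 : ZMod q), f h ^ 2 - T ^ 2 / (q - 1) := by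
    rw [VQ, ← hT]
    have : ∀ h ∈ Finset.univ.erase (0 : ZMod q), (f h - T / (q - 1)) ^ 2 = f h ^ 2 - 2 * (T / (q - 1)) * f h + (T / (q - 1)) ^ 2 := by intros; ring
    rw [Finset.sum_congr rfl this, Finset.sum_add_distrib, Finset.sum_sub_distrib, ← Finset.mul_sum, Finset.sum_const, nsmul_eq_mul, card_erase0]
    rw [show ∑ h ∈ Finset.univ.erase (0 : ZMod q), f h = T from rfl]
    field_simp; ring
  have e2 : 0 ≤ ∑ h ∈ Finset.univ.erase (0 : ZMod q), (f h - f 0) ^ 2 := Finset.sum_nonneg fun _ _ => sq_nonneg _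
  have e3 : ∑ h ∈ Finset.univ.erase (0 : ZMod q), (f h - f 0) ^ 2 = ∑ h ∈ Finset.univ.erase (0 : ZMod q), f h ^ 2 - 2 * f 0 * T + (q - 1) * f 0 ^ 2 := by
    have : ∀ h ∈ Finset.univ.erase (0 : ZMod q), (f h - f 0) ^ 2 = f h ^ 2 - 2 * f 0 * f h + f 0 ^ 2 := by intros; ring
    rw [Finset.sum_congr rfl this, Finset.sum_add_distrib, Finset.sum_sub_distrib, ← Finset.mul_sum, Finset.sum_const, nsmul_eq_mul, card_erase0]
    rfl
  rw [e1]
  have e4 : ((q:ℝ) - 1) * (∑ h ∈ Finset.univ.erase (0 : ZMod q), f h ^ 2 - T ^ 2 / (q - 1)) = ((q:ℝ) - 1) * (∑ h ∈ Finset.univ.erase (0 : ZMod q), f h ^ 2) - T ^ 2 := by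
    field_simp
  rw [e4]
  simp only [zero_add] at hp
  nlinarith

noncomputable def BL (q : ℕ) (s t : Finset ℕ) (a b : ℕ → ℝ) : ℝ := ∑ m ∈ s, ∑ k ∈ t, a m * b k * DD q (m * k)

lemma BL_eq (q : ℕ) [Fact q.Prime] (s t : Finset ℕ) (a b : ℕ → ℝ) :
    BL q s t a b = ∑ h ∈ Finset.univ.erase (0 : ZMod q), (Ah q s a h - Tb q (Ah q s a) / (q - 1)) * (Ah q t b h⁻¹ - Tb q (Ah q t b) / (q - 1)) := by
  have hq2 : (2:ℝ) ≤ q := by exact_mod_cast (Fact.out : q.Prime).two_le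
  have hq1 : (q:ℝ) - 1 ≠ 0 := by linarith
  set E := Finset.univ.erase (0 : ZMod q) with hE
  set f := Ah q s a with hf
  set g := Ah q t b with hg
  have hinv : ∑ h ∈ E, g h⁻¹ = Tb q g := by
    rw [Tb]
    apply Finset.sum_nbij' (fun h => h⁻¹) (fun h => h⁻¹) <;> simp [hE]
  have hR : ∑ h ∈ E, (f h - Tb q f / (q - 1)) * (g h⁻¹ - Tb q g / (q - 1)) = ∑ h ∈ E, f h * g h⁻¹ - Tb q f * Tb q g / (q - 1) := by
    have : ∀ h ∈ E, (f h - Tb q f / (q - 1)) * (g h⁻¹ - Tb q g / (q - 1)) = f h * g h⁻¹ - (Tb q g / (q - 1)) * f h - (Tb q f / (q - 1)) * g h⁻¹ + Tb q f / (q - 1) * (Tb q g / (q - 1)) := by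
      intros; ring
    rw [Finset.sum_congr rfl this, Finset.sum_add_distrib, Finset.sum_sub_distrib, Finset.sum_sub_distrib, ← Finset.mul_sum, ← Finset.mul_sum, hinv, Finset.sum_const, nsmul_eq_mul, card_erase0]
    rw [show ∑ h ∈ E, f h = Tb q f from rfl]
    field_simp; ring
  rw [hR]
  have e1 : ∑ h ∈ E, f h * g h⁻¹ = ∑ m ∈ s, ∑ k ∈ t, a m * b k * (if (m:ZMod q) * k = 1 then 1 else 0) := by
    simp_rw [hf, hg, Ah, Finset.sum_mul_sum]
    rw [Finset.sum_comm]
    apply Finset.sum_congr rfl; intro m _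
    rw [Finset.sum_comm]
    apply Finset.sum_congr rfl; intro k _
    simp only [ite_mul, zero_mul, mul_ite, mul_zero, mul_one]
    by_cases hm : (m : ZMod q) = 0
    · rw [hm, if_neg (by simp)]
      apply Finset.sum_eq_zero
      intro h hh
      have : (0 : ZMod q) ≠ h := (Finset.ne_of_mem_erase hh).symm
      rw [if_neg this]; simp
    · rw [Finset.sum_eq_single (m : ZMod q)]
      · simp only [if_true]
        congr 1
        apply propext; constructor
        · intro h; rw [h, mul_inv_cancel₀ hm]
        · intro h; exact eq_inv_of_mul_eq_one_right h
      · intro h _ hh; rw [if_neg (Ne.symm hh)]; simp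
      · intro h; exact absurd (Finset.mem_erase.2 ⟨hm, Finset.mem_univ _⟩) h
  have e2 : ∀ (s : Finset ℕ) (a : ℕ → ℝ), Tb q (Ah q s a) = ∑ m ∈ s, a m * (if (m : ZMod q) = 0 then 0 else 1) := by
    intro s a
    simp_rw [Tb, Ah]
    rw [Finset.sum_comm]
    apply Finset.sum_congr rfl; intro m _
    by_cases hm : (m : ZMod q) = 0
    · rw [if_pos hm, hm, mul_zero]
      apply Finset.sum_eq_zero
      intro h hh
      rw [if_neg (Finset.ne_of_mem_erase hh).symm]
    · rw [if_neg hm, Finset.sum_eq_single (m : ZMod q)]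
      · simp
      · intro h _ hh; rw [if_neg (Ne.symm hh)]
      · intro h; exact absurd (Finset.mem_erase.2 ⟨hm, Finset.mem_univ _⟩) h
  rw [e1, hf, hg, e2, e2, Finset.sum_mul_sum, Finset.sum_div, ← Finset.sum_sub_distrib, BL]
  apply Finset.sum_congr rfl; intro m _
  rw [Finset.sum_div, ← Finset.sum_sub_distrib]
  apply Finset.sum_congr rfl; intro k _
  simp only [DD, Dz, Nat.cast_mul, mul_eq_zero]
  by_cases hm : (m : ZMod q) = 0 <;> by_cases hk : (k : ZMod q) = 0 <;> simp [hm, hk] <;> split_ifs <;> field_simp <;> ring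

/-- type II estimate -/
theorem typeII (Q : ℕ) (Ps : Finset ℕ) (hP : ∀ q ∈ Ps, q.Prime ∧ q ≤ Q) (Q0 : ℝ) (hQ0 : 0 < Q0) (hQ1 : ∀ q ∈ Ps, Q0 ≤ (q:ℝ) - 1)
    (X K X' K' : ℕ) (a b : ℕ → ℝ) (A B : ℝ) (hA : ∑ n ∈ Finset.Ioc X (X + K), a n ^ 2 ≤ A) (hB : ∑ n ∈ Finset.Ioc X' (X' + K'), b n ^ 2 ≤ B)
    (W : ℝ) (hW : ((Q ^ 2 : ℕ) : ℝ) * (1 + Real.log (Q ^ 2 : ℕ)) ≤ W) :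
    ∑ q ∈ Ps, |BL q (Finset.Ioc X (X + K)) (Finset.Ioc X' (X' + K')) a b| ≤ 1 / Q0 * Real.sqrt (((K + W) * A) * ((K' + W) * B)) := by
  classical
  set s := Finset.Ioc X (X + K)
  set t := Finset.Ioc X' (X' + K')
  have hA0 : 0 ≤ ∑ n ∈ s, a n ^ 2 := Finset.sum_nonneg fun _ _ => sq_nonneg _
  have hB0 : 0 ≤ ∑ n ∈ t, b n ^ 2 := Finset.sum_nonneg fun _ _ => sq_nonneg _
  let v : (Finset ℕ) → (ℕ → ℝ) → ℕ → ℝ := fun s a q => ∑ c ∈ Finset.Ico 1 q, ‖∑ n ∈ s, (a n : ℂ) * ee (n * (c / q : ℝ))‖ ^ 2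
  have hv0 : ∀ s a q, 0 ≤ v s a q := fun s a q => Finset.sum_nonneg fun _ _ => by positivity
  have h1 : ∀ q ∈ Ps, |BL q s t a b| ≤ 1 / Q0 * (Real.sqrt (v s a q) * Real.sqrt (v t b q)) := by
    intro q hq
    have hqp := (hP q hq).1
    haveI : Fact q.Prime := ⟨hqp⟩
    have hq0 := hQ1 q hq
    have hq1 : (0:ℝ) < q - 1 := by linarith
    have hva := VQ_le q hqp.two_le s a
    have hvb := VQ_le q hqp.two_le t b
    have cs := Finset.sum_mul_sq_le_sq_mul_sq (Finset.univ.erase (0 : ZMod q)) (fun h => Ah q s a h - Tb q (Ah q s a) / (q - 1)) (fun h => Ah q t b h⁻¹ - Tb q (Ah q t b) / (q - 1))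
    rw [← BL_eq] at cs
    have hb' : ∑ h ∈ Finset.univ.erase (0 : ZMod q), (Ah q t b h⁻¹ - Tb q (Ah q t b) / (q - 1)) ^ 2 = VQ q (Ah q t b) := by
      rw [VQ]
      apply Finset.sum_nbij' (fun h => h⁻¹) (fun h => h⁻¹) <;> simp
    rw [hb'] at cs
    change BL q s t a b ^ 2 ≤ VQ q (Ah q s a) * VQ q (Ah q t b) at cs
    have g1 : VQ q (Ah q s a) ≤ 1 / Q0 * v s a q := by
      rw [div_mul_eq_mul_div, one_mul, le_div_iff₀ hQ0]
      refine le_trans ?_ hva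
      rw [mul_comm]
      exact mul_le_mul_of_nonneg_right hq0 (Finset.sum_nonneg fun _ _ => sq_nonneg _)
    have g2 : VQ q (Ah q t b) ≤ 1 / Q0 * v t b q := by
      rw [div_mul_eq_mul_div, one_mul, le_div_iff₀ hQ0]
      refine le_trans ?_ hvb
      rw [mul_comm]
      exact mul_le_mul_of_nonneg_right hq0 (Finset.sum_nonneg fun _ _ => sq_nonneg _)
    apply abs_le_of_sq_le_sq
    · refine cs.trans ((mul_le_mul g1 g2 (Finset.sum_nonneg fun _ _ => sq_nonneg _) (by have := hv0 s a q; positivity)).trans (le_of_eq ?_))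
      rw [mul_pow, mul_pow, Real.sq_sqrt (hv0 _ _ _), Real.sq_sqrt (hv0 _ _ _)]; ring
    · positivity
  refine (Finset.sum_le_sum h1).trans ?_
  rw [← Finset.mul_sum]
  refine mul_le_mul_of_nonneg_left ?_ (by positivity)
  apply Real.le_sqrt_of_sq_le
  refine (Finset.sum_mul_sq_le_sq_mul_sq _ _ _).trans ?_
  simp_rw [Real.sq_sqrt (hv0 _ _ _)]
  have l1 := large_sieve Q Ps hP X K a
  have l2 := large_sieve Q Ps hP X' K' b
  have hW0 : 0 ≤ W := by
    refine le_trans ?_ hW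
    refine mul_nonneg (by positivity) ?_
    rcases Nat.eq_zero_or_pos Q with h | h
    · subst h; simp
    · have : 0 ≤ Real.log (Q ^ 2 : ℕ) := Real.log_nonneg (by exact_mod_cast Nat.one_le_pow _ _ h)
      linarith
  have hAA : 0 ≤ A := hA0.trans hA
  have hBB : 0 ≤ B := hB0.trans hB
  apply mul_le_mul
  · refine l1.trans (mul_le_mul (by linarith) hA hA0 (by positivity))
  · refine l2.trans (mul_le_mul (by linarith) hB hB0 (by positivity))
  · exact Finset.sum_nonneg fun q _ => hv0 t b q
  · positivity

end CG

namespace CG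

lemma Dz_subset (q : ℕ) [Fact q.Prime] (Z : Finset (ZMod q)) : |∑ z ∈ Z, Dz q z| ≤ 1 := by
  have hq2 : (2:ℝ) ≤ q := by exact_mod_cast (Fact.out : q.Prime).two_le
  have hq1 : (0:ℝ) < q - 1 := by linarith
  have e : ∑ z ∈ Z, Dz q z = (if (1:ZMod q) ∈ Z then 1 else 0) - ((Z.erase 0).card : ℝ) / (q - 1) := by
    simp_rw [Dz]
    rw [Finset.sum_sub_distrib]
    congr 1
    · rw [Finset.sum_ite_eq']
    · by_cases h0 : (0 : ZMod q) ∈ Z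
      · rw [← Finset.add_sum_erase _ _ h0, if_pos rfl, zero_add]
        have : ∀ z ∈ Z.erase 0, (if z = 0 then (0:ℝ) else 1 / ((q:ℝ) - 1)) = 1 / ((q:ℝ) - 1) := fun z hz => if_neg (Finset.ne_of_mem_erase hz)
        rw [Finset.sum_congr rfl this, Finset.sum_const, nsmul_eq_mul]; ring
      · rw [Finset.erase_eq_of_notMem h0]
        have : ∀ z ∈ Z, (if z = 0 then (0:ℝ) else 1 / ((q:ℝ) - 1)) = 1 / ((q:ℝ) - 1) := fun z hz => if_neg (by rintro rfl; exact h0 hz)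
        rw [Finset.sum_congr rfl this, Finset.sum_const, nsmul_eq_mul]; ring
  have hc : ((Z.erase 0).card : ℝ) / (q - 1) ≤ 1 := by
    rw [div_le_one hq1, ← card_erase0 q]
    exact_mod_cast Finset.card_le_card (Finset.erase_subset_erase _ (Finset.subset_univ _))
  have hc0 : 0 ≤ ((Z.erase 0).card : ℝ) / (q - 1) := by positivity
  rw [e, abs_le]
  split_ifs <;> constructor <;> linarith

lemma Dz_sum (q : ℕ) [Fact q.Prime] : ∑ z : ZMod q, Dz q z = 0 := by
  have hq2 : (2:ℝ) ≤ q := by exact_mod_cast (Fact.out : q.Prime).two_le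
  have hq1 : (q:ℝ) - 1 ≠ 0 := by linarith
  simp_rw [Dz]
  rw [Finset.sum_sub_distrib, Finset.sum_ite_eq' Finset.univ, if_pos (Finset.mem_univ _), ← Finset.add_sum_erase _ _ (Finset.mem_univ (0 : ZMod q)), if_pos rfl, zero_add]
  have : ∀ z ∈ Finset.univ.erase (0:ZMod q), (if z = 0 then (0:ℝ) else 1 / ((q:ℝ) - 1)) = 1 / ((q:ℝ) - 1) := fun z hz => if_neg (Finset.ne_of_mem_erase hz)
  rw [Finset.sum_congr rfl this, Finset.sum_const, nsmul_eq_mul, card_erase0]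
  field_simp; ring

lemma DD_inj (q : ℕ) [Fact q.Prime] (m X n : ℕ) (hm : (m : ZMod q) ≠ 0) (hn : n ≤ q) :
    ∑ k ∈ Finset.range n, DD q (m * (X + k)) = ∑ z ∈ (Finset.range n).image (fun k : ℕ => ((m * (X + k) : ℕ) : ZMod q)), Dz q z := by
  rw [Finset.sum_image]
  · rfl
  · intro i hi j hj h
    simp only [Finset.coe_range, Set.mem_Iio] at hi hj
    simp only [Nat.cast_mul, Nat.cast_add] at h
    have h1 := mul_left_cancel₀ hm h
    have h2 : (i : ZMod q) = j := add_left_cancel h1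
    rw [ZMod.natCast_eq_natCast_iff'] at h2
    rwa [Nat.mod_eq_of_lt (by omega), Nat.mod_eq_of_lt (by omega)] at h2

lemma DD_interval (q : ℕ) [Fact q.Prime] (m : ℕ) (hm : (m : ZMod q) ≠ 0) (n : ℕ) : ∀ X, |∑ k ∈ Finset.range n, DD q (m * (X + k))| ≤ 1 := by
  induction n using Nat.strong_induction_on with
  | _ n ih =>
    intro X
    rcases le_total n q with h | h
    · rw [DD_inj q m X n hm h]; exact Dz_subset q _
    · obtain ⟨r, rfl⟩ := Nat.exists_eq_add_of_le h
      rw [Finset.sum_range_add]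
      have h0 : ∑ k ∈ Finset.range q, DD q (m * (X + k)) = 0 := by
        rw [DD_inj q m X q hm le_rfl, ← Dz_sum q]
        congr 1
        apply Finset.eq_univ_of_card
        rw [Finset.card_image_of_injOn, Finset.card_range, ZMod.card]
        intro i hi j hj h
        simp only [Finset.coe_range, Set.mem_Iio] at hi hj
        simp only [Nat.cast_mul, Nat.cast_add] at h
        have h1 := mul_left_cancel₀ hm h
        have h2 : (i : ZMod q) = j := add_left_cancel h1
        rw [ZMod.natCast_eq_natCast_iff'] at h2
        rwa [Nat.mod_eq_of_lt (by omega), Nat.mod_eq_of_lt (by omega)] at h2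
      rw [h0, zero_add]
      have := ih r (by have := (Fact.out : q.Prime).pos; omega) (X + q)
      simp_rw [← add_assoc]; exact this

lemma DD_Ioc (q : ℕ) [Fact q.Prime] (m : ℕ) (X Y : ℕ) : |∑ k ∈ Finset.Ioc X Y, DD q (m * k)| ≤ 1 := by
  by_cases hm : (m : ZMod q) = 0
  · have : ∀ k ∈ Finset.Ioc X Y, DD q (m * k) = 0 := by
      intro k _; simp [DD, Dz, hm]
    rw [Finset.sum_congr rfl this]; simp
  · rw [← Finset.Ico_add_one_add_one_eq_Ioc, Finset.sum_Ico_eq_sum_range]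
    exact DD_interval q m hm _ _

lemma typeI (q : ℕ) [Fact q.Prime] (m X Y : ℕ) (c : ℕ → ℝ) (hc : ∀ j, 0 ≤ c j) :
    |∑ k ∈ Finset.Ioc X Y, (∑ j ∈ Finset.Icc 1 k, c j) * DD q (m * k)| ≤ ∑ j ∈ Finset.Icc 1 Y, c j := by
  have e : ∑ k ∈ Finset.Ioc X Y, (∑ j ∈ Finset.Icc 1 k, c j) * DD q (m * k) = ∑ j ∈ Finset.Icc 1 Y, c j * ∑ k ∈ Finset.Ioc (max X (j - 1)) Y, DD q (m * k) := by
    simp_rw [Finset.sum_mul, Finset.mul_sum]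
    apply Finset.sum_comm'
    intro k j
    simp only [Finset.mem_Ioc, Finset.mem_Icc]
    omega
  rw [e]
  refine (Finset.abs_sum_le_sum_abs _ _).trans (Finset.sum_le_sum fun j _ => ?_)
  rw [abs_mul, abs_of_nonneg (hc j)]
  exact mul_le_of_le_one_right (hc j) (DD_Ioc q m _ _)

noncomputable def cutI (u : ℝ) (m : ℕ) : ℝ := if u < Real.log m ∧ Real.log m ≤ u + 1 then 1 else 0
noncomputable def ww (Y : ℝ) (n : ℕ) : ℝ := max 0 (1 - |Real.log n - Y - 1|)

lemma cutI_sum (v : ℝ) (N : ℕ) (F : ℕ → ℝ) : ∑ k ∈ Finset.Icc 1 N, cutI v k * F k = ∑ k ∈ Finset.Ioc ⌊Real.exp v⌋₊ (min ⌊Real.exp (v + 1)⌋₊ N), F k := by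
  simp_rw [cutI, ite_mul, one_mul, zero_mul]
  rw [← Finset.sum_filter]
  congr 1
  ext k
  simp only [Finset.mem_filter, Finset.mem_Icc, Finset.mem_Ioc, le_min_iff]
  constructor
  · rintro ⟨⟨h1, h2⟩, h3, h4⟩
    have hk : (0:ℝ) < k := by exact_mod_cast h1
    exact ⟨(Nat.floor_lt (Real.exp_pos _).le).2 ((Real.lt_log_iff_exp_lt hk).1 h3), Nat.le_floor ((Real.log_le_iff_le_exp hk).1 h4), h2⟩
  · rintro ⟨h1, h2, h3⟩
    have hk1 : 1 ≤ k := by omega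
    have hk : (0:ℝ) < k := by exact_mod_cast hk1
    refine ⟨⟨hk1, h3⟩, (Real.lt_log_iff_exp_lt hk).2 ((Nat.floor_lt (Real.exp_pos _).le).1 h1), (Real.log_le_iff_le_exp hk).2 ?_⟩
    exact (Nat.le_floor_iff (Real.exp_pos _).le).1 h2

lemma cut_ind (Y : ℝ) (m k : ℕ) : (fun u => cutI u m * cutI (Y - u) k) =
    Set.indicator (Set.Ico (Real.log m - 1) (Real.log m) ∩ Set.Ioc (Y - Real.log k) (Y - Real.log k + 1)) (fun _ => (1:ℝ)) := by
  funext u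
  simp only [cutI, Set.indicator, Set.mem_inter_iff, Set.mem_Ico, Set.mem_Ioc]
  by_cases h1 : u < Real.log m ∧ Real.log m ≤ u + 1
  · by_cases h2 : Y - u < Real.log k ∧ Real.log k ≤ Y - u + 1
    · rw [if_pos h1, if_pos h2, if_pos]; · norm_num
      obtain ⟨a, b⟩ := h1; obtain ⟨c, d⟩ := h2
      exact ⟨⟨by linarith, a⟩, by linarith, by linarith⟩
    · have hS : ¬ ((Real.log m - 1 ≤ u ∧ u < Real.log m) ∧ Y - Real.log k < u ∧ u ≤ Y - Real.log k + 1) := by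
        rintro ⟨_, c, d⟩
        exact h2 ⟨by linarith, by linarith⟩
      rw [if_neg h2, if_neg hS, mul_zero]
  · have hS : ¬ ((Real.log m - 1 ≤ u ∧ u < Real.log m) ∧ Y - Real.log k < u ∧ u ≤ Y - Real.log k + 1) := by
      rintro ⟨⟨c, d⟩, _⟩
      exact h1 ⟨d, by linarith⟩
    rw [if_neg h1, if_neg hS, zero_mul]

lemma cut_meas (s t : ℝ) : MeasurableSet (Set.Ico (s - 1) s ∩ Set.Ioc t (t + 1)) := measurableSet_Ico.inter measurableSet_Ioc

lemma cut_int (Y : ℝ) (m k : ℕ) (x y : ℝ) : IntervalIntegrable (fun u => cutI u m * cutI (Y - u) k) MeasureTheory.volume x y := by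
  rw [cut_ind]
  apply MeasureTheory.Integrable.intervalIntegrable
  rw [MeasureTheory.integrable_indicator_iff (cut_meas _ _)]
  apply MeasureTheory.integrableOn_const
  · refine ne_of_lt (lt_of_le_of_lt (MeasureTheory.measure_mono Set.inter_subset_left) ?_)
    rw [Real.volume_Ico]; exact ENNReal.ofReal_lt_top
  · simp

lemma sep (Y : ℝ) (m k N : ℕ) (hm : 1 ≤ m) (hmN : m ≤ N) (hk : 1 ≤ k) : ∫ u in (-1:ℝ)..Real.log N, cutI u m * cutI (Y - u) k = ww Y (m * k) := by
  have hm0 : (0:ℝ) < m := by exact_mod_cast hm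
  have hk0 : (0:ℝ) < k := by exact_mod_cast hk
  have hs0 : 0 ≤ Real.log m := Real.log_nonneg (by exact_mod_cast hm)
  have hsN : Real.log m ≤ Real.log N := Real.log_le_log hm0 (by exact_mod_cast hmN)
  rw [cut_ind, intervalIntegral.integral_of_le (by linarith), MeasureTheory.setIntegral_indicator (cut_meas _ _), MeasureTheory.setIntegral_const, smul_eq_mul, mul_one]
  have hw : ww Y (m * k) = max 0 (min (Real.log m) (Y - Real.log k + 1) - max (Real.log m - 1) (Y - Real.log k)) := by
    rw [ww, Nat.cast_mul, Real.log_mul hm0.ne' hk0.ne']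
    congr 1
    rcases le_total (Real.log m) (Y - Real.log k + 1) with h | h
    · rw [min_eq_left h, max_eq_right (by linarith), abs_of_nonpos (by linarith)]; ring
    · rw [min_eq_right h, max_eq_left (by linarith), abs_of_nonneg (by linarith)]; ring
  rw [hw]
  set s := Real.log m
  set t := Y - Real.log k
  set a := max (s - 1) t with ha
  set b := min s (t + 1) with hb
  have hle : MeasureTheory.volume (Set.Ioc (-1) (Real.log N) ∩ (Set.Ico (s - 1) s ∩ Set.Ioc t (t + 1))) ≤ ENNReal.ofReal (b - a) := by
    rw [← Real.volume_Icc]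
    apply MeasureTheory.measure_mono
    rintro u ⟨_, ⟨h1, h2⟩, h3, h4⟩
    exact ⟨max_le h1 h3.le, le_min h2.le h4⟩
  have hge : ENNReal.ofReal (b - a) ≤ MeasureTheory.volume (Set.Ioc (-1) (Real.log N) ∩ (Set.Ico (s - 1) s ∩ Set.Ioc t (t + 1))) := by
    rw [← Real.volume_Ioo]
    apply MeasureTheory.measure_mono
    rintro u ⟨h1, h2⟩
    rw [ha, max_lt_iff] at h1
    rw [hb, lt_min_iff] at h2
    exact ⟨⟨by linarith, by linarith⟩, ⟨h1.1.le, h2.1⟩, h1.2, h2.2.le⟩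
  rw [MeasureTheory.measureReal_def, le_antisymm hle hge, ENNReal.toReal_ofReal', max_comm]

noncomputable def Bu (Y : ℝ) (N q : ℕ) (u : ℝ) (a b : ℕ → ℝ) : ℝ :=
  ∑ m ∈ Finset.Icc 1 N, cutI u m * (a m * ∑ k ∈ Finset.Icc 1 N, cutI (Y - u) k * (b k * DD q (m * k)))

noncomputable def Dl (Y : ℝ) (N q : ℕ) (f : ℕ → ℝ) : ℝ := ∑ n ∈ Finset.Icc 1 N, f n * (ww Y n * DD q n)

lemma ww_zero (Y : ℝ) (N n : ℕ) (hN : Y + 2 ≤ Real.log N) (hN0 : 0 < N) (hn : N < n) : ww Y n = 0 := by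
  have : Real.log N ≤ Real.log n := Real.log_le_log (by exact_mod_cast hN0) (by exact_mod_cast hn.le)
  rw [ww, max_eq_left]
  rw [abs_of_nonneg (by linarith)]; linarith

lemma conv_sum (a b : ArithmeticFunction ℝ) (N : ℕ) (F : ℕ → ℝ) (hF : ∀ n, N < n → F n = 0) :
    ∑ n ∈ Finset.Icc 1 N, (a * b) n * F n = ∑ m ∈ Finset.Icc 1 N, ∑ k ∈ Finset.Icc 1 N, a m * b k * F (m * k) := by
  classical
  rw [← Finset.sum_product']
  have h1 : ∑ x ∈ Finset.Icc 1 N ×ˢ Finset.Icc 1 N, a x.1 * b x.2 * F (x.1 * x.2) = ∑ x ∈ (Finset.Icc 1 N ×ˢ Finset.Icc 1 N).filter (fun x => x.1 * x.2 ≤ N), a x.1 * b x.2 * F (x.1 * x.2) := by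
    rw [Finset.sum_filter]
    apply Finset.sum_congr rfl
    intro x _
    split_ifs with h
    · rfl
    · rw [hF _ (by omega), mul_zero]
  rw [h1, ← Finset.sum_fiberwise_of_maps_to (g := fun x : ℕ × ℕ => x.1 * x.2) (t := Finset.Icc 1 N)]
  · apply Finset.sum_congr rfl
    intro n hn
    rw [Finset.mem_Icc] at hn
    rw [ArithmeticFunction.mul_apply, Finset.sum_mul]
    have : ((Finset.Icc 1 N ×ˢ Finset.Icc 1 N).filter (fun x => x.1 * x.2 ≤ N)).filter (fun x => x.1 * x.2 = n) = n.divisorsAntidiagonal := by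
      ext ⟨i, j⟩
      simp only [Finset.mem_filter, Finset.mem_product, Finset.mem_Icc, Nat.mem_divisorsAntidiagonal]
      constructor
      · rintro ⟨⟨_, _⟩, h⟩; exact ⟨h, by omega⟩
      · rintro ⟨h, h0⟩
        have hi : i ≠ 0 := by rintro rfl; simp at h; omega
        have hj : j ≠ 0 := by rintro rfl; simp at h; omega
        have hi' : i ≤ i * j := Nat.le_mul_of_pos_right _ (by omega)
        have hj' : j ≤ i * j := Nat.le_mul_of_pos_left _ (by omega)
        refine ⟨⟨⟨⟨by omega, by omega⟩, by omega, by omega⟩, by omega⟩, h⟩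
    rw [this]
    apply Finset.sum_congr rfl
    intro x hx
    rw [(Nat.mem_divisorsAntidiagonal.1 hx).1]
  · intro x hx
    simp only [Finset.mem_filter, Finset.mem_product, Finset.mem_Icc] at hx
    rw [Finset.mem_Icc]
    exact ⟨Nat.mul_pos hx.1.1.1 hx.1.2.1, hx.2⟩

lemma Dl_eq (Y : ℝ) (N q : ℕ) (hN : Y + 2 ≤ Real.log N) (hN0 : 0 < N) (a b : ArithmeticFunction ℝ) :
    IntervalIntegrable (fun u => Bu Y N q u a b) MeasureTheory.volume (-1) (Real.log N) ∧ Dl Y N q (a * b : ArithmeticFunction ℝ) = ∫ u in (-1:ℝ)..Real.log N, Bu Y N q u a b := by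
  have e : (fun u => Bu Y N q u a b) = fun u => ∑ m ∈ Finset.Icc 1 N, ∑ k ∈ Finset.Icc 1 N, (a m * b k * DD q (m * k)) * (cutI u m * cutI (Y - u) k) := by
    funext u
    rw [Bu]
    apply Finset.sum_congr rfl; intro m _
    rw [Finset.mul_sum, Finset.mul_sum]
    apply Finset.sum_congr rfl; intro k _
    ring
  have h_itg : ∀ m ∈ Finset.Icc 1 N, ∀ k ∈ Finset.Icc 1 N, IntervalIntegrable (fun u => (a m * b k * DD q (m * k)) * (cutI u m * cutI (Y - u) k)) MeasureTheory.volume (-1) (Real.log N) :=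
    fun m _ k _ => (cut_int Y m k _ _).const_mul _
  have hint2 : ∀ m ∈ Finset.Icc 1 N, IntervalIntegrable (fun u => ∑ k ∈ Finset.Icc 1 N, (a m * b k * DD q (m * k)) * (cutI u m * cutI (Y - u) k)) MeasureTheory.volume (-1) (Real.log N) := by
    intro m hm
    have := IntervalIntegrable.sum (Finset.Icc 1 N) (f := fun k u => (a m * b k * DD q (m * k)) * (cutI u m * cutI (Y - u) k)) (h_itg m hm)
    simpa only [Finset.sum_fn] using this
  constructor
  · rw [e]
    have := IntervalIntegrable.sum (Finset.Icc 1 N) (f := fun m u => ∑ k ∈ Finset.Icc 1 N, (a m * b k * DD q (m * k)) * (cutI u m * cutI (Y - u) k)) hint2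
    simpa only [Finset.sum_fn] using this
  · rw [e, intervalIntegral.integral_finset_sum hint2, Dl, conv_sum a b N]
    · apply Finset.sum_congr rfl; intro m hm
      rw [intervalIntegral.integral_finset_sum (h_itg m hm)]
      apply Finset.sum_congr rfl; intro k hk
      rw [Finset.mem_Icc] at hm hk
      rw [intervalIntegral.integral_const_mul, sep Y m k N hm.1 hm.2 hk.1]
      ring
    · intro n hn
      rw [ww_zero Y N n hN hN0 hn, zero_mul]

theorem Dl_bound (Y : ℝ) (N : ℕ) (hN : Y + 2 ≤ Real.log N) (hN0 : 0 < N) (a b : ArithmeticFunction ℝ) (Ps : Finset ℕ) (E : ℝ)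
    (hE : ∀ u, ∑ q ∈ Ps, |Bu Y N q u a b| ≤ E) : ∑ q ∈ Ps, |Dl Y N q (a * b : ArithmeticFunction ℝ)| ≤ E * (Real.log N + 1) := by
  have hN1 : 0 ≤ Real.log N := Real.log_nonneg (by exact_mod_cast hN0)
  set D : ℕ → ℝ := fun q => Dl Y N q (a * b : ArithmeticFunction ℝ) with hD
  have e : ∑ q ∈ Ps, |D q| = ∫ u in (-1:ℝ)..Real.log N, ∑ q ∈ Ps, (SignType.sign (D q) : ℝ) * Bu Y N q u a b := by
    rw [intervalIntegral.integral_finset_sum]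
    · apply Finset.sum_congr rfl; intro q _
      rw [intervalIntegral.integral_const_mul, ← (Dl_eq Y N q hN hN0 a b).2]
      exact (sign_mul_self (D q)).symm
    · intro q _; exact (Dl_eq Y N q hN hN0 a b).1.const_mul _
  have h1 := intervalIntegral.norm_integral_le_of_norm_le_const (a := (-1:ℝ)) (b := Real.log N) (C := E) (f := fun u => ∑ q ∈ Ps, (SignType.sign (D q) : ℝ) * Bu Y N q u a b) (by
    intro u _
    refine (norm_sum_le _ _).trans (le_trans (Finset.sum_le_sum fun q _ => ?_) (hE u))
    rw [norm_mul, Real.norm_eq_abs, Real.norm_eq_abs]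
    refine mul_le_of_le_one_left (abs_nonneg _) ?_
    rcases SignType.sign (D q) with _ | _ | _ <;> simp)
  rw [← e, sub_neg_eq_add, abs_of_nonneg (by linarith : 0 ≤ Real.log N + 1)] at h1
  exact (Real.le_norm_self _).trans h1

end CG

namespace CG

noncomputable def lo (V : ℕ) (f : ArithmeticFunction ℝ) : ArithmeticFunction ℝ := ⟨fun n => if n ≤ V then f n else 0, by simp⟩
noncomputable def hi (V : ℕ) (f : ArithmeticFunction ℝ) : ArithmeticFunction ℝ := ⟨fun n => if n ≤ V then 0 else f n, by simp⟩
noncomputable def muR : ArithmeticFunction ℝ := (ArithmeticFunction.moebius : ArithmeticFunction ℝ)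
noncomputable def zR : ArithmeticFunction ℝ := (ArithmeticFunction.zeta : ArithmeticFunction ℝ)
noncomputable def LaR : ArithmeticFunction ℝ := ArithmeticFunction.vonMangoldt

lemma lo_apply (V : ℕ) (f : ArithmeticFunction ℝ) (n : ℕ) : lo V f n = if n ≤ V then f n else 0 := rfl
lemma hi_apply (V : ℕ) (f : ArithmeticFunction ℝ) (n : ℕ) : hi V f n = if n ≤ V then 0 else f n := rfl

lemma lo_add_hi (V : ℕ) (f : ArithmeticFunction ℝ) : lo V f + hi V f = f := by
  ext n
  rw [ArithmeticFunction.add_apply, lo_apply, hi_apply]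
  split_ifs <;> simp

lemma vaughan (U : ℕ) : hi U LaR = lo U muR * ArithmeticFunction.log - (lo U muR * lo U LaR) * zR + hi U muR * (hi U LaR * zR) := by
  have h1 : ArithmeticFunction.log = (lo U LaR + hi U LaR) * zR := by
    rw [lo_add_hi, LaR, zR, ArithmeticFunction.vonMangoldt_mul_zeta]
  have h2 : (lo U muR + hi U muR) * zR = 1 := by
    rw [lo_add_hi, muR, zR, ArithmeticFunction.coe_moebius_mul_coe_zeta]
  rw [h1]
  calc hi U LaR = ((lo U muR + hi U muR) * zR) * hi U LaR := by rw [h2, one_mul]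
    _ = _ := by ring

lemma muR_abs (n : ℕ) : |muR n| ≤ 1 := by
  rw [muR, ArithmeticFunction.intCoe_apply]
  have := @ArithmeticFunction.abs_moebius_le_one n
  rw [← Int.cast_abs]; exact_mod_cast this

lemma LaR_nonneg (n : ℕ) : 0 ≤ LaR n := ArithmeticFunction.vonMangoldt_nonneg

lemma zR_apply (n : ℕ) (hn : n ≠ 0) : zR n = 1 := by
  simp [zR, ArithmeticFunction.zeta_apply, hn]

lemma LaR_conv (n : ℕ) : ∑ x ∈ n.divisorsAntidiagonal, LaR x.2 = Real.log n := by
  rw [Nat.sum_divisorsAntidiagonal' (f := fun i j => LaR j)]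
  exact ArithmeticFunction.vonMangoldt_sum

lemma LaR_conv' (n : ℕ) : ∑ x ∈ n.divisorsAntidiagonal, LaR x.1 = Real.log n := by
  rw [Nat.sum_divisorsAntidiagonal (f := fun i j => LaR i)]
  exact ArithmeticFunction.vonMangoldt_sum

lemma a2_abs (U n : ℕ) : |(lo U muR * lo U LaR) n| ≤ Real.log n := by
  rw [ArithmeticFunction.mul_apply, ← LaR_conv n]
  refine (Finset.abs_sum_le_sum_abs _ _).trans (Finset.sum_le_sum fun x _ => ?_)
  rw [abs_mul, lo_apply, lo_apply]
  have h1 := muR_abs x.1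
  have h2 := LaR_nonneg x.2
  have h3 : |if x.1 ≤ U then muR x.1 else 0| ≤ 1 := by split_ifs <;> simp [h1]
  have h4 : |if x.2 ≤ U then LaR x.2 else 0| ≤ LaR x.2 := by
    split_ifs
    · rw [abs_of_nonneg h2]
    · simpa using h2
  calc _ ≤ 1 * LaR x.2 := mul_le_mul h3 h4 (abs_nonneg _) zero_le_one
    _ = _ := one_mul _

lemma a2_supp (U n : ℕ) (hn : U ^ 2 < n) : (lo U muR * lo U LaR) n = 0 := by
  rw [ArithmeticFunction.mul_apply]
  apply Finset.sum_eq_zero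
  intro x hx
  have hx1 := (Nat.mem_divisorsAntidiagonal.1 hx).1
  rw [lo_apply, lo_apply]
  by_cases h1 : x.1 ≤ U
  · by_cases h2 : x.2 ≤ U
    · exfalso
      have := Nat.mul_le_mul h1 h2
      rw [hx1] at this; nlinarith
    · rw [if_neg h2, mul_zero]
  · rw [if_neg h1, zero_mul]

lemma b2_abs (U n : ℕ) : |(hi U LaR * zR) n| ≤ Real.log n := by
  rw [ArithmeticFunction.mul_apply, ← LaR_conv' n]
  refine (Finset.abs_sum_le_sum_abs _ _).trans (Finset.sum_le_sum fun x hx => ?_)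
  have hx1 := Nat.mem_divisorsAntidiagonal.1 hx
  have hx2 : x.2 ≠ 0 := by rintro h; rw [h, mul_zero] at hx1; exact hx1.2 hx1.1.symm
  rw [zR_apply _ hx2, mul_one, hi_apply]
  have h2 := LaR_nonneg x.1
  split_ifs
  · simpa using h2
  · rw [abs_of_nonneg h2]

lemma b2_supp (U n : ℕ) (hn : n ≤ U) : (hi U LaR * zR) n = 0 := by
  rw [ArithmeticFunction.mul_apply]
  apply Finset.sum_eq_zero
  intro x hx
  have hx1 := Nat.mem_divisorsAntidiagonal.1 hx
  have : x.1 ≤ n := Nat.le_of_dvd (Nat.pos_of_ne_zero hx1.2) ⟨x.2, hx1.1.symm⟩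
  rw [hi_apply, if_pos (this.trans hn), zero_mul]

lemma cutI_abs (u : ℝ) (m : ℕ) : |cutI u m| ≤ 1 := by rw [cutI]; split_ifs <;> simp

lemma Bu_one (Y : ℝ) (N q : ℕ) [Fact q.Prime] (u : ℝ) (a b c : ℕ → ℝ) (M : ℕ) (A C : ℝ) (hA0 : 0 ≤ A) (ha : ∀ m, m ≤ N → |a m| ≤ A) (ha0 : ∀ m, M < m → a m = 0)
    (hc : ∀ j, 0 ≤ c j) (hb : ∀ k, 1 ≤ k → b k = ∑ j ∈ Finset.Icc 1 k, c j) (hC : ∑ j ∈ Finset.Icc 1 N, c j ≤ C) : |Bu Y N q u a b| ≤ M * (A * C) := by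
  have hC0 : 0 ≤ C := (Finset.sum_nonneg fun j _ => hc j).trans hC
  rw [Bu]
  have h1 : ∀ m ∈ Finset.Icc 1 N, |cutI u m * (a m * ∑ k ∈ Finset.Icc 1 N, cutI (Y - u) k * (b k * DD q (m * k)))| ≤ if m ∈ Finset.Icc 1 M then A * C else 0 := by
    intro m hm
    rw [Finset.mem_Icc] at hm
    split_ifs with h
    · rw [abs_mul, abs_mul]
      have hin : |∑ k ∈ Finset.Icc 1 N, cutI (Y - u) k * (b k * DD q (m * k))| ≤ C := by
        rw [cutI_sum]
        set T := min ⌊Real.exp (Y - u + 1)⌋₊ N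
        have e : ∑ k ∈ Finset.Ioc ⌊Real.exp (Y - u)⌋₊ T, b k * DD q (m * k) = ∑ k ∈ Finset.Ioc ⌊Real.exp (Y - u)⌋₊ T, (∑ j ∈ Finset.Icc 1 k, c j) * DD q (m * k) := by
          apply Finset.sum_congr rfl; intro k hk
          rw [hb k (by rw [Finset.mem_Ioc] at hk; omega)]
        rw [e]
        refine (typeI q m _ T c hc).trans (le_trans ?_ hC)
        exact Finset.sum_le_sum_of_subset_of_nonneg (Finset.Icc_subset_Icc_right (min_le_right _ _)) (fun j _ _ => hc j)
      calc _ ≤ 1 * (A * C) := mul_le_mul (cutI_abs u m) (mul_le_mul (ha m hm.2) hin (abs_nonneg _) hA0) (by positivity) zero_le_one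
        _ = _ := one_mul _
    · rw [Finset.mem_Icc] at h
      rw [ha0 m (by omega)]; simp
  refine (Finset.abs_sum_le_sum_abs _ _).trans ((Finset.sum_le_sum h1).trans ?_)
  rw [← Finset.sum_filter, Finset.sum_const, nsmul_eq_mul]
  apply mul_le_mul_of_nonneg_right _ (by positivity)
  have : ((Finset.Icc 1 N).filter (fun m => m ∈ Finset.Icc 1 M)).card ≤ (Finset.Icc 1 M).card := Finset.card_le_card (fun m hm => (Finset.mem_filter.1 hm).2)
  rw [Nat.card_Icc, Nat.add_sub_cancel] at this
  exact_mod_cast this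

lemma log_tele (k : ℕ) (hk : 1 ≤ k) : Real.log k = ∑ j ∈ Finset.Icc 1 k, (Real.log j - Real.log (j - 1 : ℕ)) := by
  induction k, hk using Nat.le_induction with
  | base => simp
  | succ k hk ih =>
    rw [Finset.sum_Icc_succ_top (by omega), ← ih]; simp

lemma log_diff_nonneg (j : ℕ) : 0 ≤ Real.log j - Real.log (j - 1 : ℕ) := by
  rcases Nat.lt_or_ge 1 j with h | h
  · have : Real.log (j - 1 : ℕ) ≤ Real.log j := Real.log_le_log (by exact_mod_cast (by omega : 0 < j - 1)) (by exact_mod_cast Nat.sub_le _ _)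
    linarith
  · interval_cases j <;> simp

lemma one_tele (k : ℕ) (hk : 1 ≤ k) : (1:ℝ) = ∑ j ∈ Finset.Icc 1 k, (if j = 1 then (1:ℝ) else 0) := by
  rw [Finset.sum_ite_eq', if_pos (Finset.mem_Icc.2 ⟨le_rfl, hk⟩)]

lemma sum_sq_Ioc (X K : ℕ) (a : ℕ → ℝ) (A : ℝ) (h : ∀ n ∈ Finset.Ioc X (X + K), |a n| ≤ A) : ∑ n ∈ Finset.Ioc X (X + K), a n ^ 2 ≤ K * A ^ 2 := by
  calc _ ≤ ∑ n ∈ Finset.Ioc X (X + K), A ^ 2 := Finset.sum_le_sum fun n hn => by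
        rw [← sq_abs]; exact pow_le_pow_left₀ (abs_nonneg _) (h n hn) 2
    _ = _ := by rw [Finset.sum_const, Nat.card_Ioc, nsmul_eq_mul]; simp

lemma Ioc_sub (X T : ℕ) : Finset.Ioc X T = Finset.Ioc X (X + (T - X)) := by
  ext n; simp only [Finset.mem_Ioc]; omega

lemma Bu_two (N U Q : ℕ) (hN : 0 < N) (hU : 0 < U) (Ps : Finset ℕ) (hP : ∀ q ∈ Ps, q.Prime ∧ q ≤ Q) (Q0 : ℝ) (hQ0 : 0 < Q0) (hQ1 : ∀ q ∈ Ps, Q0 ≤ (q:ℝ) - 1)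
    (W : ℝ) (hW0 : 0 ≤ W) (hW : ((Q ^ 2 : ℕ) : ℝ) * (1 + Real.log (Q ^ 2 : ℕ)) ≤ W) (u : ℝ) :
    ∑ q ∈ Ps, |Bu (Real.log N - 2) N q u (hi U muR) (hi U LaR * zR : ArithmeticFunction ℝ)| ≤ 1 / Q0 * Real.sqrt ((N + 2 * W * N / U + W ^ 2) * N * (Real.log N) ^ 2) := by
  set Y := Real.log N - 2 with hY
  have hN' : (0:ℝ) < N := by exact_mod_cast hN
  have hU' : (0:ℝ) < U := by exact_mod_cast hU
  have hl0 : 0 ≤ Real.log N := Real.log_nonneg (by exact_mod_cast hN)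
  set M := Real.exp (u + 1) with hM
  set M' := Real.exp (Y - u + 1) with hM'
  have hMpos : 0 < M := Real.exp_pos _
  have hMpos' : 0 < M' := Real.exp_pos _
  have hMM : M * M' = N := by
    rw [hM, hM', ← Real.exp_add, hY]
    rw [show u + 1 + (Real.log N - 2 - u + 1) = Real.log N by ring, Real.exp_log hN']
  set X := ⌊Real.exp u⌋₊
  set X' := ⌊Real.exp (Y - u)⌋₊
  set T := min ⌊M⌋₊ N
  set T' := min ⌊M'⌋₊ N
  set a : ℕ → ℝ := fun n => hi U muR n with ha
  set b : ℕ → ℝ := fun n => (hi U LaR * zR : ArithmeticFunction ℝ) n with hb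
  have hT : ((T:ℕ):ℝ) ≤ M := (Nat.cast_le.2 (min_le_left _ _)).trans (Nat.floor_le hMpos.le)
  have hT' : ((T':ℕ):ℝ) ≤ M' := (Nat.cast_le.2 (min_le_left _ _)).trans (Nat.floor_le hMpos'.le)
  have e : ∀ q, Bu Y N q u a b = BL q (Finset.Ioc X (X + (T - X))) (Finset.Ioc X' (X' + (T' - X'))) a b := by
    intro q
    rw [Bu, cutI_sum, ← Ioc_sub, ← Ioc_sub, BL]
    apply Finset.sum_congr rfl; intro m _
    rw [cutI_sum, Finset.mul_sum]
    apply Finset.sum_congr rfl; intro k _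
    ring
  have hrhs : 0 ≤ 1 / Q0 * Real.sqrt ((N + 2 * W * N / U + W ^ 2) * N * (Real.log N) ^ 2) := by positivity
  by_cases hMU : M < U
  · have : ∀ q ∈ Ps, |Bu Y N q u a b| = 0 := by
      intro q _
      rw [e, BL, abs_eq_zero]
      apply Finset.sum_eq_zero; intro m hm
      apply Finset.sum_eq_zero; intro k _
      rw [← Ioc_sub, Finset.mem_Ioc] at hm
      have : m ≤ U := by
        have : (m:ℝ) ≤ U := ((Nat.cast_le.2 hm.2).trans hT).trans hMU.le
        exact_mod_cast this
      have : a m = 0 := by rw [ha]; show hi U muR m = 0; rw [hi_apply, if_pos this]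
      rw [this, zero_mul, zero_mul]
    rw [Finset.sum_congr rfl this]; simpa using hrhs
  by_cases hMU' : M' < U
  · have : ∀ q ∈ Ps, |Bu Y N q u a b| = 0 := by
      intro q _
      rw [e, BL, abs_eq_zero]
      apply Finset.sum_eq_zero; intro m hm
      apply Finset.sum_eq_zero; intro k hk
      rw [← Ioc_sub, Finset.mem_Ioc] at hk
      have : k ≤ U := by
        have : (k:ℝ) ≤ U := ((Nat.cast_le.2 hk.2).trans hT').trans hMU'.le
        exact_mod_cast this
      have : b k = 0 := b2_supp U k this
      rw [this, mul_zero, zero_mul]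
    rw [Finset.sum_congr rfl this]; simpa using hrhs
  push Not at hMU hMU'
  have hA := sum_sq_Ioc X (T - X) a 1 (by
    intro n _
    show |hi U muR n| ≤ 1
    rw [hi_apply]; have := muR_abs n; split_ifs <;> simp [this])
  have hB := sum_sq_Ioc X' (T' - X') b (Real.log N) (by
    intro n hn
    rw [← Ioc_sub, Finset.mem_Ioc] at hn
    refine (b2_abs U n).trans (Real.log_le_log (by exact_mod_cast (by omega : 0 < n)) ?_)
    exact_mod_cast hn.2.trans (min_le_right _ _))
  have hK : ((T - X : ℕ) : ℝ) ≤ M := (Nat.cast_le.2 (Nat.sub_le _ _)).trans hT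
  have hK' : ((T' - X' : ℕ) : ℝ) ≤ M' := (Nat.cast_le.2 (Nat.sub_le _ _)).trans hT'
  have h2 := typeII Q Ps hP Q0 hQ0 hQ1 X (T - X) X' (T' - X') a b _ _ hA hB W hW
  rw [Finset.sum_congr rfl (fun q _ => by rw [e q])]
  refine h2.trans (mul_le_mul_of_nonneg_left (Real.sqrt_le_sqrt ?_) (by positivity))
  have hMb : M ≤ N / U := by rw [le_div_iff₀ hU', ← hMM]; exact mul_le_mul_of_nonneg_left hMU' hMpos.le
  have hMb' : M' ≤ N / U := by rw [le_div_iff₀ hU', ← hMM, mul_comm]; exact mul_le_mul_of_nonneg_right hMU hMpos'.le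
  have g1 : (((T - X : ℕ) : ℝ) + W) * (((T - X : ℕ) : ℝ) * 1 ^ 2) ≤ (M + W) * M := by
    rw [one_pow, mul_one]
    exact mul_le_mul (by linarith) hK (by positivity) (by positivity)
  have g2 : (((T' - X' : ℕ) : ℝ) + W) * (((T' - X' : ℕ) : ℝ) * Real.log N ^ 2) ≤ (M' + W) * (M' * Real.log N ^ 2) := 
    mul_le_mul (by linarith) (mul_le_mul_of_nonneg_right hK' (by positivity)) (by positivity) (by positivity)
  refine (mul_le_mul g1 g2 (by positivity) (by positivity)).trans ?_
  have e2 : (M + W) * M * ((M' + W) * (M' * Real.log N ^ 2)) = (M * M' + W * (M + M') + W ^ 2) * (M * M') * Real.log N ^ 2 := by ring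
  rw [e2, hMM]
  have g3 : W * (M + M') ≤ 2 * W * N / U := by
    calc W * (M + M') ≤ W * (N / U + N / U) := mul_le_mul_of_nonneg_left (by linarith) hW0
      _ = _ := by ring
  gcongr

theorem vaughan_bound (N U Q : ℕ) (hN : 0 < N) (hU : 0 < U) (Ps : Finset ℕ) (hP : ∀ q ∈ Ps, q.Prime ∧ q ≤ Q) (Q0 : ℝ) (hQ0 : 0 < Q0) (hQ1 : ∀ q ∈ Ps, Q0 ≤ (q:ℝ) - 1)
    (W : ℝ) (hW0 : 0 ≤ W) (hW : ((Q ^ 2 : ℕ) : ℝ) * (1 + Real.log (Q ^ 2 : ℕ)) ≤ W) :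
    ∑ q ∈ Ps, |Dl (Real.log N - 2) N q (hi U LaR)| ≤ (Ps.card * (U * Real.log N) + Ps.card * (U ^ 2 * Real.log N) + 1 / Q0 * Real.sqrt ((N + 2 * W * N / U + W ^ 2) * N * (Real.log N) ^ 2)) * (Real.log N + 1) := by
  set Y := Real.log N - 2 with hY
  have hYN : Y + 2 ≤ Real.log N := by rw [hY]; linarith
  have hl0 : 0 ≤ Real.log N := Real.log_nonneg (by exact_mod_cast hN)
  have h1 := Dl_bound Y N hYN hN (lo U muR) ArithmeticFunction.log Ps (Ps.card * (U * Real.log N)) (by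
    intro u
    rw [← nsmul_eq_mul]
    apply Finset.sum_le_card_nsmul
    intro q hq
    haveI : Fact q.Prime := ⟨(hP q hq).1⟩
    have := Bu_one Y N q u (lo U muR) ArithmeticFunction.log (fun j => Real.log j - Real.log (j - 1 : ℕ)) U 1 (Real.log N) zero_le_one (by
      intro m _
      rw [lo_apply]; have := muR_abs m; split_ifs <;> simp [this]) (by
      intro m hm; rw [lo_apply, if_neg (by omega)]) log_diff_nonneg (fun k hk => by rw [← log_tele k hk, ArithmeticFunction.log_apply]) (by rw [← log_tele N hN])
    rwa [one_mul] at this)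
  have h2 := Dl_bound Y N hYN hN (lo U muR * lo U LaR) zR Ps (Ps.card * (U ^ 2 * Real.log N)) (by
    intro u
    rw [← nsmul_eq_mul]
    apply Finset.sum_le_card_nsmul
    intro q hq
    haveI : Fact q.Prime := ⟨(hP q hq).1⟩
    have := Bu_one Y N q u (lo U muR * lo U LaR : ArithmeticFunction ℝ) zR (fun j => if j = 1 then (1:ℝ) else 0) (U ^ 2) (Real.log N) 1 hl0 (by
      intro m hm
      refine (a2_abs U m).trans ?_
      rcases Nat.eq_zero_or_pos m with rfl | h
      · simpa using hl0
      · exact Real.log_le_log (by exact_mod_cast h) (by exact_mod_cast hm)) (fun m hm => a2_supp U m hm) (fun j => by split_ifs <;> norm_num) (fun k hk => by rw [← one_tele k hk, zR_apply _ (by omega)]) (by rw [← one_tele N hN])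
    rw [mul_one] at this
    exact_mod_cast this)
  have h3 := Dl_bound Y N hYN hN (hi U muR) (hi U LaR * zR) Ps _ (Bu_two N U Q hN hU Ps hP Q0 hQ0 hQ1 W hW0 hW)
  have hle : ∀ q, |Dl Y N q (hi U LaR)| ≤ |Dl Y N q (lo U muR * ArithmeticFunction.log : ArithmeticFunction ℝ)| + |Dl Y N q (lo U muR * lo U LaR * zR : ArithmeticFunction ℝ)| + |Dl Y N q (hi U muR * (hi U LaR * zR) : ArithmeticFunction ℝ)| := by
    intro q
    have : Dl Y N q (hi U LaR) = Dl Y N q (lo U muR * ArithmeticFunction.log : ArithmeticFunction ℝ) - Dl Y N q (lo U muR * lo U LaR * zR : ArithmeticFunction ℝ) + Dl Y N q (hi U muR * (hi U LaR * zR) : ArithmeticFunction ℝ) := by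
      rw [Dl, Dl, Dl, Dl, ← Finset.sum_sub_distrib, ← Finset.sum_add_distrib]
      apply Finset.sum_congr rfl; intro n _
      have := congrArg (fun f : ArithmeticFunction ℝ => f n) (vaughan U)
      simp only [ArithmeticFunction.add_apply, sub_eq_add_neg, ArithmeticFunction.neg_apply] at this
      rw [this]; ring
    rw [this]
    exact (abs_add_le _ _).trans (by gcongr; exact abs_sub _ _)
  refine (Finset.sum_le_sum fun q _ => hle q).trans ?_
  rw [Finset.sum_add_distrib, Finset.sum_add_distrib, add_mul, add_mul]
  exact add_le_add (add_le_add h1 h2) h3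

end CG

namespace CG

noncomputable def Aq (N U q : ℕ) : ℝ := ∑ n ∈ Finset.Icc 1 N, if (n : ZMod q) = 1 then hi U LaR n * ww (Real.log N - 2) n else 0
noncomputable def Bq (N U q : ℕ) : ℝ := ∑ n ∈ Finset.Icc 1 N, if (n : ZMod q) = 0 then 0 else hi U LaR n * ww (Real.log N - 2) n
noncomputable def pc (N q : ℕ) : Finset ℕ := (Finset.Icc 1 N).filter (fun p => p.Prime ∧ (p : ZMod q) = 1)

lemma Dl_AB (N U q : ℕ) : Dl (Real.log N - 2) N q (hi U LaR) = Aq N U q - Bq N U q / (q - 1) := by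
  rw [Dl, Aq, Bq, Finset.sum_div, ← Finset.sum_sub_distrib]
  apply Finset.sum_congr rfl; intro n _
  rw [DD, Dz]
  split_ifs <;> ring

lemma ww_nonneg (Y : ℝ) (n : ℕ) : 0 ≤ ww Y n := le_max_left _ _
lemma ww_le (Y : ℝ) (n : ℕ) : ww Y n ≤ 1 := max_le zero_le_one (by linarith [abs_nonneg (Real.log n - Y - 1)])

lemma hiLa_nonneg (U n : ℕ) : 0 ≤ hi U LaR n := by
  rw [hi_apply]; have := LaR_nonneg n; split_ifs <;> simp [this]
lemma hiLa_le (U n : ℕ) : hi U LaR n ≤ LaR n := by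
  rw [hi_apply]; have := LaR_nonneg n; split_ifs <;> simp [this]

lemma good_q (N U Q : ℕ) (hQ : 0 < Q) (Ps : Finset ℕ) (hP : ∀ q ∈ Ps, q.Prime ∧ q ≤ Q) (S E : ℝ) (hS : 0 ≤ S) (hB : ∀ q ∈ Ps, S ≤ Bq N U q)
    (hE : ∑ q ∈ Ps, |Dl (Real.log N - 2) N q (hi U LaR)| ≤ E) (hlt : E < Ps.card * (S / (2 * Q))) : ∃ q ∈ Ps, S / (2 * Q) ≤ Aq N U q := by
  by_contra! h
  have hQ' : (0:ℝ) < Q := by exact_mod_cast hQ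
  have h1 : ∀ q ∈ Ps, S / (2 * Q) ≤ |Dl (Real.log N - 2) N q (hi U LaR)| := by
    intro q hq
    have h2 := h q hq
    have h3 := hB q hq
    have hq2 : (2:ℝ) ≤ q := by exact_mod_cast (hP q hq).1.two_le
    have hqQ : (q:ℝ) ≤ Q := by exact_mod_cast (hP q hq).2
    have h4 : S / Q ≤ Bq N U q / (q - 1) := by
      apply div_le_div₀ (hS.trans h3) h3 (by linarith) (by linarith)
    rw [Dl_AB, abs_sub_comm]
    refine le_trans ?_ (le_abs_self _)
    have : S / Q = S / (2 * Q) + S / (2 * Q) := by field_simp; ring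
    linarith
  have := Finset.card_nsmul_le_sum Ps _ _ h1
  rw [nsmul_eq_mul] at this
  linarith

lemma Aq_le (N U q : ℕ) (hN : 1 ≤ N) : Aq N U q ≤ (pc N q).card * Real.log N + 2 * √(N:ℝ) * Real.log N := by
  have hN' : (1:ℝ) ≤ N := by exact_mod_cast hN
  have hl0 : 0 ≤ Real.log N := Real.log_nonneg hN'
  have h1 : Aq N U q ≤ ∑ n ∈ Finset.Icc 1 N, ((if n.Prime ∧ (n : ZMod q) = 1 then Real.log N else 0) + (LaR n - if n.Prime then Real.log n else 0)) := by
    apply Finset.sum_le_sum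
    intro n hn
    rw [Finset.mem_Icc] at hn
    have a0 := hiLa_nonneg U n
    have a1 := hiLa_le U n
    have a2 := LaR_nonneg n
    have hx : hi U LaR n * ww (Real.log N - 2) n ≤ LaR n := (mul_le_of_le_one_right a0 (ww_le _ _)).trans a1
    by_cases hp : n.Prime
    · have e : LaR n = Real.log n := ArithmeticFunction.vonMangoldt_apply_prime hp
      have : Real.log n ≤ Real.log N := Real.log_le_log (by exact_mod_cast hn.1) (by exact_mod_cast hn.2)
      by_cases h : (n : ZMod q) = 1
      · simp only [hp, h, if_true, and_self]; linarith
      · simp only [hp, h, if_true, if_false, and_false]; linarith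
    · by_cases h : (n : ZMod q) = 1
      · simp only [hp, h, if_true, if_false, false_and]; linarith
      · simp only [hp, h, if_true, if_false, false_and]; linarith
  refine h1.trans ?_
  rw [Finset.sum_add_distrib, ← Finset.sum_filter, Finset.sum_const, nsmul_eq_mul]
  apply add_le_add le_rfl
  have h2 := Chebyshev.psi_sub_theta_le hN'
  have h3 : ∑ n ∈ Finset.Icc 1 N, (LaR n - if n.Prime then Real.log n else 0) = Chebyshev.psi N - Chebyshev.theta N := by
    rw [Finset.sum_sub_distrib, ← Finset.sum_filter]
    rw [Chebyshev.psi, Chebyshev.theta, Nat.floor_natCast]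
    rfl
  rw [h3]; exact h2

lemma log6 : Real.log 6 ≤ 1.9 := by
  rw [Real.log_le_iff_le_exp (by norm_num)]
  have h := Real.exp_one_gt_d9
  have h2 : (6:ℝ) ^ 10 ≤ (Real.exp 1.9) ^ 10 := by
    rw [← Real.exp_nat_mul, show ((10:ℕ):ℝ) * 1.9 = ((19:ℕ):ℝ) * 1 by norm_num, Real.exp_nat_mul]
    calc (6:ℝ) ^ 10 ≤ 2.7 ^ 19 := by norm_num
      _ ≤ _ := pow_le_pow_left₀ (by norm_num) (by linarith) _
  exact le_of_pow_le_pow_left₀ (by norm_num) (Real.exp_pos _).le h2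

lemma ww_ge (N n : ℕ) (hN : 0 < N) (h1 : N < 6 * n) (h2 : 2 * n ≤ N) : 1 / 10 ≤ ww (Real.log N - 2) n := by
  refine le_trans ?_ (le_max_right _ _)
  have hn : (0:ℝ) < n := by exact_mod_cast (by omega : 0 < n)
  have hN' : (0:ℝ) < N := by exact_mod_cast hN
  have a1 : Real.log N ≤ Real.log 6 + Real.log n := by
    rw [← Real.log_mul (by norm_num) hn.ne']
    exact Real.log_le_log hN' (by exact_mod_cast h1.le)
  have a2 : Real.log 2 + Real.log n ≤ Real.log N := by
    rw [← Real.log_mul (by norm_num) hn.ne']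
    exact Real.log_le_log (by positivity) (by exact_mod_cast h2)
  have a3 := log6
  have a4 := Real.log_two_gt_d9
  have : |Real.log n - (Real.log N - 2) - 1| ≤ 9 / 10 := by
    rw [abs_le]; constructor <;> linarith
  linarith

lemma theta_diff (x y : ℕ) (h : x ≤ y) : Chebyshev.theta y - Chebyshev.theta x = ∑ p ∈ (Finset.Ioc x y).filter Nat.Prime, Real.log p := by
  rw [Chebyshev.theta, Chebyshev.theta, Nat.floor_natCast, Nat.floor_natCast]
  have : (Finset.Ioc 0 y).filter Nat.Prime = (Finset.Ioc 0 x).filter Nat.Prime ∪ (Finset.Ioc x y).filter Nat.Prime := by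
    rw [← Finset.filter_union, Finset.Ioc_union_Ioc_eq_Ioc (Nat.zero_le _) h]
  rw [this, Finset.sum_union, add_sub_cancel_left]
  apply Finset.disjoint_filter_filter
  rw [Finset.disjoint_left]
  intro a ha hb
  rw [Finset.mem_Ioc] at ha hb; omega

lemma Bq_ge (N U q : ℕ) (hN : 0 < N) (hU : U ≤ N / 6) (hq : q.Prime) (hqN : q ≤ N / 6) :
    (Chebyshev.theta (N / 2 : ℕ) - Chebyshev.theta (N / 6 : ℕ)) / 10 ≤ Bq N U q := by
  rw [theta_diff _ _ (by omega), Bq, Finset.sum_div]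
  have hsub : (Finset.Ioc (N / 6) (N / 2)).filter Nat.Prime ⊆ Finset.Icc 1 N := by
    intro p hp
    rw [Finset.mem_filter, Finset.mem_Ioc] at hp
    rw [Finset.mem_Icc]; omega
  refine le_trans ?_ (Finset.sum_le_sum_of_subset_of_nonneg hsub ?_)
  · apply Finset.sum_le_sum
    intro p hp
    rw [Finset.mem_filter, Finset.mem_Ioc] at hp
    have h0 : (p : ZMod q) ≠ 0 := by
      rw [Ne, ZMod.natCast_eq_zero_iff]
      intro hd
      have := (Nat.prime_dvd_prime_iff_eq hq hp.2).1 hd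
      omega
    rw [if_neg h0, hi_apply, if_neg (by omega), show LaR p = Real.log p from ArithmeticFunction.vonMangoldt_apply_prime hp.2]
    have hlp : 0 ≤ Real.log p := Real.log_natCast_nonneg p
    have := ww_ge N p hN (by omega) (by omega)
    calc Real.log p / 10 = Real.log p * (1 / 10) := by ring
      _ ≤ _ := mul_le_mul_of_nonneg_left this hlp
  · intro n _ _
    split_ifs
    · exact le_rfl
    · exact mul_nonneg (hiLa_nonneg _ _) (ww_nonneg _ _)

lemma card_primes_ge (x y : ℕ) (h : x ≤ y) (hy : 0 < y): Chebyshev.theta y - Chebyshev.theta x ≤ ((Finset.Ioc x y).filter Nat.Prime).card * Real.log y := by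
  rw [theta_diff x y h, ← nsmul_eq_mul]
  apply Finset.sum_le_card_nsmul
  intro p hp
  rw [Finset.mem_filter, Finset.mem_Ioc] at hp
  exact Real.log_le_log (by exact_mod_cast hp.2.pos) (by exact_mod_cast hp.1.2)

end CG

namespace CG

lemma lp (C : ℝ) (k : ℕ) (a : ℝ) (ha : 0 < a) : ∀ᶠ N : ℕ in atTop, C * (Real.log N) ^ k < (N:ℝ) ^ a := by
  have h := (isLittleO_log_rpow_rpow_atTop (k:ℝ) ha).def (c := 1 / (|C| + 1)) (by positivity)
  have h2 := tendsto_natCast_atTop_atTop (R := ℝ) |>.eventually h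
  filter_upwards [h2, eventually_ge_atTop 2] with N hN hN2
  have hN' : (1:ℝ) ≤ N := by exact_mod_cast (by omega : 1 ≤ N)
  have hl0 : 0 ≤ Real.log N := Real.log_nonneg hN'
  have hp : 0 < (N:ℝ) ^ a := Real.rpow_pos_of_pos (by linarith) _
  rw [Real.rpow_natCast, Real.norm_of_nonneg (by positivity), Real.norm_of_nonneg hp.le] at hN
  rw [div_mul_eq_mul_div, one_mul, le_div_iff₀ (by positivity)] at hN
  have hl : 0 < Real.log N := Real.log_pos (by exact_mod_cast hN2)
  have : 0 < (Real.log N) ^ k := by positivity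
  have := le_abs_self C
  nlinarith

lemma theta_lo : ∀ᶠ n : ℕ in atTop, 0.69 * (n:ℝ) ≤ Chebyshev.theta n := by
  filter_upwards [lp 10000 1 (1/2) (by norm_num), eventually_ge_atTop 2] with n h1 h2
  have hn : (2:ℝ) ≤ n := by exact_mod_cast h2
  have h := Chebyshev.theta_ge n
  rw [pow_one, ← Real.sqrt_eq_rpow] at h1
  have hl := Real.log_two_gt_d9
  have hl1 : Real.log (n + 1) ≤ 2 * Real.log n := by
    have : Real.log (n + 1) ≤ Real.log ((n:ℝ)^2) := Real.log_le_log (by positivity) (by nlinarith)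
    rw [Real.log_pow] at this; exact_mod_cast this
  have hs : √(n:ℝ) * √(n:ℝ) = n := Real.mul_self_sqrt (by linarith)
  have hs1 : 1 ≤ √(n:ℝ) := by rw [Real.one_le_sqrt]; linarith
  have hl0 : 0 ≤ Real.log n := Real.log_nonneg (by linarith)
  have a1 : Real.log n * √(n:ℝ) * 10000 ≤ n := by nlinarith
  have a2 : Real.log n ≤ Real.log n * √(n:ℝ) := le_mul_of_one_le_right hl0 hs1
  nlinarith

lemma main_S : ∀ᶠ N : ℕ in atTop, (N:ℝ) / 100 ≤ (Chebyshev.theta (N / 2 : ℕ) - Chebyshev.theta (N / 6 : ℕ)) / 10 := by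
  have h2 : Tendsto (fun N : ℕ => N / 2) atTop atTop := Nat.tendsto_div_const_atTop (by norm_num)
  filter_upwards [h2.eventually theta_lo, eventually_ge_atTop 100] with N h hN
  have hN' : (100:ℝ) ≤ N := by exact_mod_cast hN
  have h3 : ((N:ℝ) - 1) / 2 ≤ ((N / 2 : ℕ) : ℝ) := by
    have : N - 1 ≤ 2 * (N / 2) := by omega
    have : ((N - 1 : ℕ) : ℝ) ≤ ((2 * (N / 2) : ℕ) : ℝ) := by exact_mod_cast this
    rw [Nat.cast_sub (by omega)] at this; push_cast at this ⊢; linarith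
  have h4 : ((N / 6 : ℕ) : ℝ) ≤ N / 6 := by exact_mod_cast Nat.cast_div_le
  have h5 := Chebyshev.theta_le_log4_mul_x (x := ((N / 6 : ℕ) : ℝ)) (by positivity)
  have hl4 : Real.log 4 ≤ 1.3863 := by
    rw [show (4:ℝ) = 2 ^ 2 by norm_num, Real.log_pow]; have := Real.log_two_lt_d9; push_cast; linarith
  have : Real.log 4 * ((N / 6 : ℕ) : ℝ) ≤ 1.3863 * (N / 6) := mul_le_mul hl4 h4 (by positivity) (by norm_num)
  linarith

lemma main_P : ∀ᶠ Q : ℕ in atTop, (Q:ℝ) / 2 ≤ ((Finset.Ioc (Q / 16) Q).filter Nat.Prime).card * Real.log Q := by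
  filter_upwards [theta_lo, eventually_ge_atTop 1] with Q h hQ
  refine le_trans ?_ (card_primes_ge (Q / 16) Q (Nat.div_le_self _ _) hQ)
  have h4 : ((Q / 16 : ℕ) : ℝ) ≤ Q / 16 := by exact_mod_cast Nat.cast_div_le
  have h5 := Chebyshev.theta_le_log4_mul_x (x := ((Q / 16 : ℕ) : ℝ)) (by positivity)
  have hl4 : Real.log 4 ≤ 1.3863 := by
    rw [show (4:ℝ) = 2 ^ 2 by norm_num, Real.log_pow]; have := Real.log_two_lt_d9; push_cast; linarith
  have : Real.log 4 * ((Q / 16 : ℕ) : ℝ) ≤ 1.3863 * (Q / 16) := mul_le_mul hl4 h4 (by positivity) (by norm_num)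
  have hQ0 : (0:ℝ) ≤ Q := by positivity
  linarith

lemma E_bound (s l Q U P : ℝ) (hs : 1 ≤ s) (hl : 1 ≤ l) (hQ1 : s ^ 4 / 2 ≤ Q) (hQ2 : Q ≤ s ^ 7) (hU1 : s ^ 2 ≤ U) (hU2 : U ≤ 2 * s ^ 2) (hP0 : 0 ≤ P) (hP : P ≤ Q) :
    (P * (U * l) + P * (U ^ 2 * l) + 1 / (Q / 32) * Real.sqrt ((s ^ 16 + 2 * (3 * Q ^ 2 * l) * s ^ 16 / U + (3 * Q ^ 2 * l) ^ 2) * s ^ 16 * l ^ 2)) * (l + 1) ≤ 332 * s ^ 15 * l ^ 3 := by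
  have hs0 : 0 < s := by linarith
  have hQ0 : 0 < Q := lt_of_lt_of_le (by positivity) hQ1
  have hU0 : 0 < U := lt_of_lt_of_le (by positivity) hU1
  have hP7 := hP.trans hQ2
  have pw : ∀ i j : ℕ, i ≤ j → s ^ i ≤ s ^ j := fun i j h => pow_le_pow_right₀ hs h
  have t1 : P * (U * l) ≤ 2 * s ^ 15 * l := by
    calc P * (U * l) ≤ s ^ 7 * (2 * s ^ 2 * l) := by gcongr
      _ = 2 * s ^ 9 * l := by ring
      _ ≤ 2 * s ^ 15 * l := by gcongr 2 * ?_ * l; exact pw _ _ (by norm_num)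
  have t2 : P * (U ^ 2 * l) ≤ 4 * s ^ 15 * l := by
    calc P * (U ^ 2 * l) ≤ s ^ 7 * ((2 * s ^ 2) ^ 2 * l) := by gcongr
      _ = 4 * s ^ 11 * l := by ring
      _ ≤ 4 * s ^ 15 * l := by gcongr 4 * ?_ * l; exact pw _ _ (by norm_num)
  have hl2 : 1 ≤ l ^ 2 := one_le_pow₀ hl
  have hll : l ≤ l ^ 2 := le_self_pow₀ hl (by norm_num)
  have hQs : s ^ 8 ≤ 4 * Q ^ 2 := by
    have := pow_le_pow_left₀ (by positivity) hQ1 2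
    have e : (s ^ 4 / 2) ^ 2 = s ^ 8 / 4 := by ring
    rw [e] at this; linarith
  have x1 : s ^ 16 ≤ 4 * (Q ^ 2 * s ^ 14 * l ^ 2) := by
    calc s ^ 16 = s ^ 8 * s ^ 8 := by ring
      _ ≤ (4 * Q ^ 2) * s ^ 14 := mul_le_mul hQs (pw _ _ (by norm_num)) (by positivity) (by positivity)
      _ ≤ (4 * Q ^ 2) * s ^ 14 * l ^ 2 := le_mul_of_one_le_right (by positivity) hl2
      _ = _ := by ring
  have x2 : 2 * (3 * Q ^ 2 * l) * s ^ 16 / U ≤ 6 * (Q ^ 2 * s ^ 14 * l ^ 2) := by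
    rw [div_le_iff₀ hU0]
    calc 2 * (3 * Q ^ 2 * l) * s ^ 16 = 6 * (Q ^ 2 * s ^ 14 * l) * s ^ 2 := by ring
      _ ≤ 6 * (Q ^ 2 * s ^ 14 * l ^ 2) * U := by gcongr
  have x3 : (3 * Q ^ 2 * l) ^ 2 ≤ 9 * (Q ^ 2 * s ^ 14 * l ^ 2) := by
    have := pow_le_pow_left₀ hQ0.le hQ2 2
    calc (3 * Q ^ 2 * l) ^ 2 = 9 * (Q ^ 2 * Q ^ 2 * l ^ 2) := by ring
      _ ≤ 9 * (Q ^ 2 * (s ^ 7) ^ 2 * l ^ 2) := by gcongr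
      _ = _ := by ring
  have x4 : Real.sqrt ((s ^ 16 + 2 * (3 * Q ^ 2 * l) * s ^ 16 / U + (3 * Q ^ 2 * l) ^ 2) * s ^ 16 * l ^ 2) ≤ 5 * Q * s ^ 15 * l ^ 2 := by
    apply Real.sqrt_le_iff.2 ⟨by positivity, ?_⟩
    calc _ ≤ (19 * (Q ^ 2 * s ^ 14 * l ^ 2)) * s ^ 16 * l ^ 2 := by
          gcongr; linarith
      _ = 19 * (Q ^ 2 * s ^ 30 * l ^ 4) := by ring
      _ ≤ 25 * (Q ^ 2 * s ^ 30 * l ^ 4) := by gcongr; norm_num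
      _ = _ := by ring
  have x5 : 1 / (Q / 32) * Real.sqrt ((s ^ 16 + 2 * (3 * Q ^ 2 * l) * s ^ 16 / U + (3 * Q ^ 2 * l) ^ 2) * s ^ 16 * l ^ 2) ≤ 160 * s ^ 15 * l ^ 2 := by
    calc _ ≤ 1 / (Q / 32) * (5 * Q * s ^ 15 * l ^ 2) := mul_le_mul_of_nonneg_left x4 (by positivity)
      _ = _ := by field_simp; norm_num
  have x6 : s ^ 15 * l ≤ s ^ 15 * l ^ 2 := by gcongr
  calc _ ≤ (166 * s ^ 15 * l ^ 2) * (2 * l) := by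
        apply mul_le_mul _ (by linarith) (by linarith) (by positivity)
        linarith
    _ = _ := by ring

noncomputable def rh : ℝ := Real.sqrt 2 - 1
lemma rh_bds : 0.41 < rh ∧ rh < 0.42 := by
  have h1 : (1.41:ℝ) < Real.sqrt 2 := by rw [Real.lt_sqrt (by norm_num)]; norm_num
  have h2 : Real.sqrt 2 < 1.42 := by rw [Real.sqrt_lt' (by norm_num)]; norm_num
  rw [rh]; constructor <;> linarith

end CG

namespace CG

set_option maxHeartbeats 1000000 in
theorem lnt (ε : ℝ) (hε : 0 < ε) : ∀ᶠ N : ℕ in atTop, ∃ q : ℕ, q.Prime ∧ (N:ℝ) ^ (rh - ε) ≤ q ∧ (q:ℝ) ≤ (N:ℝ) ^ rh ∧ (N:ℝ) ^ (1 - rh - ε) ≤ (pc N q).card := by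
  obtain ⟨hr1, hr2⟩ := rh_bds
  have tQ : Tendsto (fun N : ℕ => ⌊(N:ℝ) ^ rh⌋₊) atTop atTop :=
    tendsto_nat_floor_atTop.comp ((tendsto_rpow_atTop (by linarith)).comp tendsto_natCast_atTop_atTop)
  filter_upwards [main_S, tQ.eventually main_P, tQ.eventually (eventually_ge_atTop 100), eventually_ge_atTop 100000, lp 200000 4 (1/16) (by norm_num), lp 1000 1 ε hε] with N hS hP hQ100 hN hlog hlogε
  set t : ℝ := (N:ℝ) with ht
  set l := Real.log t with hl
  set s := t ^ (1/16 : ℝ) with hs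
  set R := t ^ rh with hR
  set Q := ⌊R⌋₊ with hQ
  set U := ⌈s ^ 2⌉₊ with hU
  set Ps := (Finset.Ioc (Q / 16) Q).filter Nat.Prime with hPs
  have ht5 : (100000:ℝ) ≤ t := by rw [ht]; exact_mod_cast hN
  have ht0 : 0 < t := by linarith
  have ht1 : 1 ≤ t := by linarith
  have hl1 : 1 ≤ l := by
    rw [hl, Real.le_log_iff_exp_le ht0]; have := Real.exp_one_lt_d9; linarith
  have hs1 : 1 ≤ s := Real.one_le_rpow ht1 (by norm_num)
  have hs0 : 0 < s := by linarith
  have hst : s ^ 16 = t := by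
    rw [hs, ← Real.rpow_natCast, ← Real.rpow_mul ht0.le]; norm_num
  have hsk : ∀ k : ℕ, s ^ k = t ^ ((k:ℝ) / 16) := by
    intro k
    rw [hs, ← Real.rpow_natCast, ← Real.rpow_mul ht0.le]; congr 1; ring
  have hR4 : s ^ 4 ≤ R := by rw [hsk, hR]; apply Real.rpow_le_rpow_of_exponent_le ht1; norm_num; linarith
  have hR7 : R ≤ s ^ 7 := by rw [hsk, hR]; apply Real.rpow_le_rpow_of_exponent_le ht1; norm_num; linarith
  have hR0 : 0 < R := lt_of_lt_of_le (by positivity) hR4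
  have hQR : (Q:ℝ) ≤ R := Nat.floor_le hR0.le
  have hQc : (100:ℝ) ≤ Q := by exact_mod_cast hQ100
  have hRQ : R / 2 ≤ Q := by have := Nat.lt_floor_add_one R; rw [← hQ] at this; linarith
  have hQ0 : (0:ℝ) < Q := by linarith
  have hU1 : s ^ 2 ≤ U := Nat.le_ceil _
  have hs2 : 1 ≤ s ^ 2 := one_le_pow₀ hs1
  have hU2 : (U:ℝ) ≤ 2 * s ^ 2 := by have := Nat.ceil_lt_add_one (show 0 ≤ s ^ 2 by positivity); rw [← hU] at this; linarith
  have hcardQ : (Ps.card : ℝ) ≤ Q := by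
    have h1 : Ps.card ≤ (Finset.Ioc (Q / 16) Q).card := Finset.card_filter_le _ _
    rw [Nat.card_Ioc] at h1
    exact_mod_cast h1.trans (Nat.sub_le _ _)
  have hPq : ∀ q ∈ Ps, q.Prime ∧ q ≤ Q := by
    intro q hq; rw [hPs, Finset.mem_filter, Finset.mem_Ioc] at hq; exact ⟨hq.2, hq.1.2⟩
  have hPq2 : ∀ q ∈ Ps, (Q:ℝ) / 32 ≤ (q:ℝ) - 1 ∧ (Q:ℝ) / 16 ≤ q := by
    intro q hq; rw [hPs, Finset.mem_filter, Finset.mem_Ioc] at hq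
    have h1 : Q / 16 + 1 ≤ q := hq.1.1
    have h2 : Q < 16 * q := by omega
    have h3 : (Q:ℝ) < 16 * q := by exact_mod_cast h2
    constructor <;> linarith
  have hlogQ : Real.log Q ≤ l := Real.log_le_log hQ0 (hQR.trans (by
    rw [hR]; calc t ^ rh ≤ t ^ (1:ℝ) := Real.rpow_le_rpow_of_exponent_le ht1 (by linarith)
      _ = t := Real.rpow_one t))
  have hW : ((Q ^ 2 : ℕ) : ℝ) * (1 + Real.log (Q ^ 2 : ℕ)) ≤ 3 * (Q:ℝ) ^ 2 * l := by
    push_cast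
    rw [Real.log_pow]; push_cast
    calc (Q:ℝ) ^ 2 * (1 + 2 * Real.log Q) ≤ (Q:ℝ) ^ 2 * (3 * l) := by gcongr; linarith
      _ = _ := by ring
  have hNpos : 0 < N := by omega
  have hU0 : 0 < U := by
    have : (0:ℝ) < U := by linarith
    exact_mod_cast this
  have hV := vaughan_bound N U Q hNpos hU0 Ps hPq ((Q:ℝ) / 32) (by positivity) (fun q hq => (hPq2 q hq).1) (3 * (Q:ℝ) ^ 2 * l) (by positivity) hW
  rw [← ht, ← hl] at hV
  have hE := E_bound s l Q U Ps.card hs1 hl1 (by linarith) (hQR.trans hR7) hU1 hU2 (by positivity) hcardQ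
  rw [hst] at hE
  have hV2 := hV.trans hE
  have hs6 : s ^ 8 * 100 ≤ t := by
    have a : s ^ 16 = s ^ 8 * s ^ 8 := by ring
    have b : 100 ≤ s ^ 8 := by
      by_contra h; push Not at h
      have : s ^ 8 * s ^ 8 < 100 * 100 := mul_lt_mul'' h h (by positivity) (by positivity)
      rw [← a, hst] at this; linarith
    rw [← hst, a]; gcongr
  have hN6 : t / 6 - 1 ≤ ((N / 6 : ℕ) : ℝ) := by
    have : N < 6 * (N / 6) + 6 := by omega
    have : (N:ℝ) < 6 * ((N / 6 : ℕ) : ℝ) + 6 := by exact_mod_cast this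
    rw [ht]; linarith
  have hs7 : s ^ 7 * 100 ≤ t := le_trans (by gcongr <;> norm_num [hs1]) hs6
  have hQN : Q ≤ N / 6 := by
    have : (Q:ℝ) ≤ ((N / 6 : ℕ) : ℝ) := by linarith
    exact_mod_cast this
  have hs22 : s ^ 2 ≤ s ^ 7 := pow_le_pow_right₀ hs1 (by norm_num)
  have hUN : U ≤ N / 6 := by
    have : (U:ℝ) ≤ ((N / 6 : ℕ) : ℝ) := by
      linarith
    exact_mod_cast this
  have hB : ∀ q ∈ Ps, t / 100 ≤ Bq N U q := fun q hq => hS.trans (Bq_ge N U q hNpos hUN (hPq q hq).1 ((hPq q hq).2.trans hQN))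
  have hPl : (Q:ℝ) / 2 ≤ Ps.card * l := hP.trans (mul_le_mul_of_nonneg_left hlogQ (by positivity))
  have hlt : 332 * s ^ 15 * l ^ 3 < Ps.card * (t / 100 / (2 * Q)) := by
    have h1 : t / (400 * l) ≤ Ps.card * (t / 100 / (2 * Q)) := by
      rw [div_le_iff₀ (by positivity)]
      have : (Ps.card:ℝ) * (t / 100 / (2 * Q)) * (400 * l) = (Ps.card * l) * (2 * t / Q) := by field_simp; ring
      rw [this]
      calc t = (Q:ℝ) / 2 * (2 * t / Q) := by field_simp
        _ ≤ _ := mul_le_mul_of_nonneg_right hPl (by positivity)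
    refine lt_of_lt_of_le ?_ h1
    rw [lt_div_iff₀ (by positivity)]
    calc 332 * s ^ 15 * l ^ 3 * (400 * l) = s ^ 15 * (132800 * l ^ 4) := by ring
      _ < s ^ 15 * s := by
        apply mul_lt_mul_of_pos_left _ (by positivity)
        have : 0 < l ^ 4 := by positivity
        linarith
      _ = t := by rw [← hst]; ring
  obtain ⟨q, hq, hA⟩ := good_q N U Q (by omega) Ps hPq (t / 100) _ (by positivity) hB hV2 hlt
  have hA2 := hA.trans (Aq_le N U q hNpos)
  rw [← ht, ← hl] at hA2
  have htr : t ^ (1 - rh) = t / R := by rw [Real.rpow_sub ht0, Real.rpow_one]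
  have hsq : √t = s ^ 8 := by rw [hsk, Real.sqrt_eq_rpow]; norm_num
  have hsqb : 2 * √t * l ≤ t / R / 400 := by
    rw [hsq, div_div, le_div_iff₀ (by positivity)]
    have hl4 : l ≤ l ^ 4 := le_self_pow₀ hl1 (by norm_num)
    calc 2 * s ^ 8 * l * (R * 400) ≤ 2 * s ^ 8 * l * (s ^ 7 * 400) := by gcongr
      _ = s ^ 15 * (800 * l) := by ring
      _ ≤ s ^ 15 * s := by gcongr; linarith
      _ = t := by rw [← hst]; ring
  have hmain : t / R / 200 ≤ t / 100 / (2 * Q) := by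
    rw [div_div, div_div]; apply div_le_div_of_nonneg_left ht0.le (by positivity); nlinarith
  have hc : t / R / 400 ≤ (pc N q).card * l := by
    have : t / R / 200 = t / R / 400 + t / R / 400 := by ring
    linarith
  have htε : 0 < t ^ ε := by positivity
  rw [pow_one] at hlogε
  refine ⟨q, (hPq q hq).1, ?_, ?_, ?_⟩
  · rw [Real.rpow_sub ht0, div_le_iff₀ htε]
    have := (hPq2 q hq).2
    calc R = R / 32 * 32 := by ring
      _ ≤ q * t ^ ε := mul_le_mul (by linarith) (by linarith) (by norm_num) (by positivity)
  · exact le_trans (by exact_mod_cast (hPq q hq).2) hQR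
  · rw [Real.rpow_sub ht0, div_le_iff₀ htε, htr]
    calc t / R = t / R / 400 * 400 := by ring
      _ ≤ ((pc N q).card * l) * 400 := by gcongr
      _ = (pc N q).card * (400 * l) := by ring
      _ ≤ _ := by gcongr; linarith

end CG

namespace CG

section
variable {R : Type*} [CommRing R]

lemma sl_inv_entries (g : SL2 R) : g⁻¹ 0 0 = g 1 1 ∧ g⁻¹ 0 1 = - g 0 1 ∧ g⁻¹ 1 0 = - g 1 0 ∧ g⁻¹ 1 1 = g 0 0 := by
  rw [Matrix.SpecialLinearGroup.SL2_inv_expl]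
  refine ⟨rfl, rfl, rfl, rfl⟩

def Bor (R : Type*) [CommRing R] : Subgroup (SL2 R) where
  carrier := {g | g 1 0 = 0}
  one_mem' := by simp
  mul_mem' := by
    intro a b ha hb
    simp only [Set.mem_setOf_eq] at *
    rw [sl_mul, ha, hb]; ring
  inv_mem' := by
    intro a ha
    simp only [Set.mem_setOf_eq] at *
    rw [(sl_inv_entries a).2.2.1, ha, neg_zero]

lemma mem_Bor {g : SL2 R} : g ∈ Bor R ↔ g 1 0 = 0 := Iff.rfl

lemma Bor_det {g : SL2 R} (h : g ∈ Bor R) : g 0 0 * g 1 1 = 1 := by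
  have := sl_det g; rw [mem_Bor.1 h] at this; simpa using this

def BorU (R : Type*) [CommRing R] : Bor R →* Rˣ where
  toFun g := ⟨g.1 0 0, g.1 1 1, Bor_det g.2, by rw [mul_comm]; exact Bor_det g.2⟩
  map_one' := by ext; simp
  map_mul' a b := by
    ext
    show (a.1 * b.1) 0 0 = a.1 0 0 * b.1 0 0
    rw [sl_mul, mem_Bor.1 b.2]; ring

lemma BorU_surj : Function.Surjective (BorU R) := by
  intro u
  refine ⟨⟨⟨!![(u:R), 0; 0, ((u⁻¹ : Rˣ) : R)], by simp [Matrix.det_fin_two]⟩, ?_⟩, ?_⟩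
  · rfl
  · ext; rfl

open Classical in
noncomputable def P1 {F : Type*} [Field F] (g : SL2 F) : Option F := if g 1 0 = 0 then none else some (g 0 0 / g 1 0)

lemma P1_eq {F : Type*} [Field F] (g h : SL2 F) (e : P1 g = P1 h) : g⁻¹ * h ∈ Bor F := by
  rw [mem_Bor, sl_mul, (sl_inv_entries g).2.2.1, (sl_inv_entries g).2.2.2]
  rw [P1, P1] at e
  split_ifs at e with h1 h2 h2
  · rw [h1, h2]; ring
  · have := Option.some.inj e
    rw [div_eq_div_iff h1 h2] at this
    linear_combination this
end

lemma pi_index {ι : Type*} [Fintype ι] (F : ι → Type*) [∀ i, Field (F i)] [∀ i, Fintype (F i)] :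
    (Subgroup.pi Set.univ (fun i => Bor (F i))).index ≤ ∏ i, (Fintype.card (F i) + 1) := by
  classical
  rw [Subgroup.index]
  have hinj : Function.Injective (fun (c : (∀ i, SL2 (F i)) ⧸ Subgroup.pi Set.univ (fun i => Bor (F i))) => fun i => P1 (c.out i)) := by
    intro c d h
    rw [← QuotientGroup.out_eq' c, ← QuotientGroup.out_eq' d, QuotientGroup.eq, Subgroup.mem_pi]
    intro i _
    exact P1_eq _ _ (congrFun h i)
  refine (Nat.card_le_card_of_injective _ hinj).trans (le_of_eq ?_)
  rw [Nat.card_eq_fintype_card, Fintype.card_pi]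
  simp

lemma char_exists (p q : ℕ) [Fact p.Prime] [Fact q.Prime] (h : (p : ZMod q) = 1) : ∃ f : (ZMod p)ˣ →* Multiplicative (ZMod q), Function.Surjective f := by
  have hcyc : IsCyclic (ZMod p)ˣ := inferInstance
  have hcard : Nat.card (ZMod p)ˣ = p - 1 := by rw [Nat.card_eq_fintype_card, ZMod.card_units]
  have hdvd : q ∣ Nat.card (ZMod p)ˣ := by
    rw [hcard, ← ZMod.natCast_eq_zero_iff, Nat.cast_sub (Fact.out : p.Prime).one_le, h]; simp
  refine ⟨(AddMonoidHom.toMultiplicative (ZMod.castHom hdvd (ZMod q)).toAddMonoidHom).comp (zmodCyclicMulEquiv hcyc).symm.toMonoidHom, ?_⟩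
  intro y
  obtain ⟨z, hz⟩ := ZMod.castHom_surjective hdvd (Multiplicative.toAdd y)
  refine ⟨zmodCyclicMulEquiv hcyc (Multiplicative.ofAdd z), ?_⟩
  simp only [MonoidHom.comp_apply, MulEquiv.coe_toMonoidHom, MulEquiv.symm_apply_apply]
  exact congrArg Multiplicative.ofAdd hz

section
variable {ι : Type*} [Fintype ι] [DecidableEq ι] (q : ℕ) (C : Finset ι)

def linA (A : {i // i ∈ C} → {j // j ∉ C} → ZMod q) : (ι → ZMod q) →+ ({i // i ∈ C} → ZMod q) where
  toFun v i := v i - ∑ j, A i j * v j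
  map_zero' := by funext i; simp
  map_add' v w := by
    funext i
    simp only [Pi.add_apply, mul_add, Finset.sum_add_distrib]; ring

lemma linA_inj (A A' : {i // i ∈ C} → {j // j ∉ C} → ZMod q) (h : ∀ v, linA q C A v = 0 ↔ linA q C A' v = 0) : A = A' := by
  funext i j
  have key : ∀ B : {i // i ∈ C} → {j // j ∉ C} → ZMod q, ∀ i, linA q C B (fun k => if hk : k ∈ C then A ⟨k, hk⟩ j else if k = j.1 then 1 else 0) i = A i j - B i j := by
    intro B i
    show (if hk : i.1 ∈ C then A ⟨i.1, hk⟩ j else if i.1 = j.1 then 1 else 0) - ∑ j', B i j' * (if hk : j'.1 ∈ C then A ⟨j'.1, hk⟩ j else if j'.1 = j.1 then 1 else 0) = _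
    rw [dif_pos i.2]
    congr 1
    rw [Finset.sum_eq_single j]
    · rw [dif_neg j.2, if_pos rfl, mul_one]
    · intro b _ hb
      rw [dif_neg b.2, if_neg (fun h => hb (Subtype.ext h)), mul_zero]
    · intro h; exact absurd (Finset.mem_univ _) h
  have h1 := (h (fun k => if hk : k ∈ C then A ⟨k, hk⟩ j else if k = j.1 then 1 else 0)).1 (by
    funext i; rw [key]; simp)
  have h2 := congrFun h1 i
  rw [key] at h2
  exact sub_eq_zero.1 h2

variable {G : Type*} [Group G] (BB : Subgroup G) (Th : BB →* Multiplicative (ι → ZMod q))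

def HA (A : {i // i ∈ C} → {j // j ∉ C} → ZMod q) : Subgroup G :=
  (((AddMonoidHom.toMultiplicative (linA q C A)).comp Th).ker).map BB.subtype

lemma HA_index [Fact q.Prime] (A) : (HA q C BB Th A).index ≤ q ^ C.card * BB.index := by
  rw [HA, Subgroup.index_map_subtype]
  apply Nat.mul_le_mul_right
  rw [Subgroup.index_ker]
  refine (Nat.card_le_card_of_injective (fun x => Multiplicative.toAdd x.1) (fun x y h => Subtype.ext (Multiplicative.toAdd.injective h))).trans (le_of_eq ?_)
  rw [Nat.card_eq_fintype_card, Fintype.card_fun]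
  simp [ZMod.card]

lemma HA_inj (hT : Function.Surjective Th) : Function.Injective (HA q C BB Th) := by
  intro A A' h
  have h2 := Subgroup.map_injective BB.subtype_injective h
  apply linA_inj
  intro v
  obtain ⟨x, hx⟩ := hT (Multiplicative.ofAdd v)
  have h3 : x ∈ ((AddMonoidHom.toMultiplicative (linA q C A)).comp Th).ker ↔ x ∈ ((AddMonoidHom.toMultiplicative (linA q C A')).comp Th).ker := by rw [h2]
  rw [MonoidHom.mem_ker, MonoidHom.mem_ker, MonoidHom.comp_apply, MonoidHom.comp_apply, hx] at h3
  exact h3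
end

theorem lower_count (S : Finset ℕ) [hS : PSet S] (q c n : ℕ) [Fact q.Prime] (hq : ∀ p ∈ S, (p : ZMod q) = 1) (hc : c ≤ S.card)
    (hn : (∏ p ∈ S, (p + 1)) * q ^ c ≤ n) : q ^ (c * (S.card - c)) ≤ congCount 2 n := by
  classical
  set k : ℕ → ℕ := fun _ => 1 with hk
  haveI : ∀ p, NeZero (k p) := fun p => ⟨one_ne_zero⟩
  haveI hF : ∀ p : S, Fact ((p.1 ^ k p.1).Prime) := fun p => ⟨by rw [hk]; simpa using hS.prime p.1 p.2⟩
  set BB : Subgroup (GS S k) := Subgroup.pi Set.univ (fun p : S => Bor (ZMod (p.1 ^ k p.1))) with hBB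
  have hch : ∀ p : S, ∃ f : (ZMod (p.1 ^ k p.1))ˣ →* Multiplicative (ZMod q), Function.Surjective f := fun p => char_exists _ q (by rw [hk]; simpa using hq p.1 p.2)
  choose f hf using hch
  have hBm : ∀ (x : BB) (p : S), x.1 p ∈ Bor (ZMod (p.1 ^ k p.1)) := fun x p => (Subgroup.mem_pi _).1 x.2 p (Set.mem_univ _)
  let Th : BB →* Multiplicative (S → ZMod q) :=
    { toFun := fun x => Multiplicative.ofAdd (fun p => Multiplicative.toAdd (f p (BorU _ ⟨x.1 p, hBm x p⟩)))
      map_one' := by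
        apply Multiplicative.toAdd.injective
        funext p
        show Multiplicative.toAdd (f p (BorU _ 1)) = 0
        rw [map_one, map_one]; rfl
      map_mul' := by
        intro x y
        apply Multiplicative.toAdd.injective
        funext p
        show Multiplicative.toAdd (f p (BorU _ (⟨x.1 p, hBm x p⟩ * ⟨y.1 p, hBm y p⟩))) = _
        rw [map_mul, map_mul]; rfl }
  have hTh : Function.Surjective Th := by
    intro v
    have h1 : ∀ p : S, ∃ b : Bor (ZMod (p.1 ^ k p.1)), f p (BorU _ b) = Multiplicative.ofAdd (Multiplicative.toAdd v p) := by
      intro p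
      obtain ⟨u, hu⟩ := hf p (Multiplicative.ofAdd (Multiplicative.toAdd v p))
      obtain ⟨b, hb⟩ := BorU_surj u
      exact ⟨b, by rw [hb, hu]⟩
    choose b hb using h1
    refine ⟨⟨fun p => (b p).1, (Subgroup.mem_pi _).2 fun p _ => (b p).2⟩, ?_⟩
    apply Multiplicative.toAdd.injective
    funext p
    show Multiplicative.toAdd (f p (BorU _ (b p))) = _
    rw [hb]; rfl
  have hBi : BB.index ≤ ∏ p ∈ S, (p + 1) := by
    refine (pi_index (fun p : S => ZMod (p.1 ^ k p.1))).trans (le_of_eq ?_)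
    rw [← Finset.prod_coe_sort S (fun p => p + 1)]
    apply Finset.prod_congr rfl
    intro p _
    rw [ZMod.card, hk]; simp
  obtain ⟨C, hCs, hC⟩ := Finset.exists_subset_card_eq (s := (Finset.univ : Finset S)) (n := c) (by simpa using hc)
  have hm1 : 1 ≤ ∏ p ∈ S, p := Nat.one_le_iff_ne_zero.2 (Finset.prod_ne_zero_iff.2 fun p hp => (hS.prime p hp).ne_zero)
  have hcong : ∀ K : Subgroup (GS S k), IsCongruenceSubgroup (K.comap (phi S k)) := by
    intro K
    refine ⟨∏ p ∈ S, p, hm1, ?_⟩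
    intro x hx
    have hx' : x ∈ Gam (∏ p ∈ S, p) := hx
    rw [mem_Gam] at hx'
    have : phi S k x = 1 := by
      funext p
      rw [Pi.one_apply, phi_eq_one]
      intro i j
      refine dvd_trans ?_ (hx' i j)
      rw [hk]
      simp only [pow_one]
      exact_mod_cast Finset.dvd_prod_of_mem (fun p => p) p.2
    rw [Subgroup.mem_comap, this]; exact K.one_mem
  haveI := (finite_cong n).1
  have hcard : Nat.card ({i // i ∈ C} → {j // j ∉ C} → ZMod q) = q ^ (c * (S.card - c)) := by
    rw [Nat.card_eq_fintype_card, Fintype.card_fun, Fintype.card_fun, ZMod.card, ← pow_mul, Fintype.card_subtype_compl]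
    simp [hC, mul_comm]
  rw [← hcard, congCount]
  refine Nat.card_le_card_of_injective (fun A => ⟨(HA q C BB Th A).comap (phi S k), hcong _, ?_⟩) ?_
  · rw [Subgroup.index_comap_of_surjective _ phi_surj]
    refine le_trans (HA_index q C BB Th A) (le_trans ?_ hn)
    rw [hC, mul_comm]
    exact Nat.mul_le_mul_right _ hBi
  · intro A A' h
    apply HA_inj q C BB Th hTh
    exact Subgroup.comap_injective phi_surj (Subtype.mk.inj h)

end CG

namespace CG

lemma rh_sq : rh ^ 2 = 1 - 2 * rh := by
  have : Real.sqrt 2 ^ 2 = 2 := Real.sq_sqrt (by norm_num)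
  rw [rh]; nlinarith

lemma rh_kap : rh ^ 2 = 3 - 2 * Real.sqrt 2 := by
  have : Real.sqrt 2 ^ 2 = 2 := Real.sq_sqrt (by norm_num)
  rw [rh]; nlinarith

noncomputable def XX (τ T : ℝ) : ℕ := ⌈T ^ τ⌉₊
noncomputable def MX (τ T : ℝ) : ℝ := Real.log ((XX τ T : ℝ) + 1)
noncomputable def yL (τ T : ℝ) : ℝ := T / ((1 + rh ^ 2) * MX τ T)
noncomputable def LL (τ T : ℝ) : ℕ := ⌊yL τ T⌋₊

lemma XX_tendsto (τ : ℝ) (hτ : 0 < τ) : Tendsto (XX τ) atTop atTop :=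
  tendsto_nat_ceil_atTop.comp (tendsto_rpow_atTop hτ)

lemma MX_bounds (τ : ℝ) (hτ : 0 < τ) (T : ℝ) (hT : 1 ≤ T) : τ * Real.log T ≤ Real.log (XX τ T) ∧ Real.log (XX τ T) ≤ MX τ T ∧ MX τ T ≤ τ * Real.log T + Real.log 3 := by
  have h1 : 1 ≤ T ^ τ := Real.one_le_rpow hT hτ.le
  have h2 : T ^ τ ≤ XX τ T := Nat.le_ceil _
  have h3 : (XX τ T : ℝ) < T ^ τ + 1 := Nat.ceil_lt_add_one (by linarith)
  have e : Real.log (T ^ τ) = τ * Real.log T := Real.log_rpow (by linarith) _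
  refine ⟨?_, ?_, ?_⟩
  · rw [← e]; exact Real.log_le_log (by linarith) h2
  · exact Real.log_le_log (by linarith) (by linarith)
  · rw [← e, ← Real.log_mul (by linarith) (by norm_num)]
    exact Real.log_le_log (by linarith) (by linarith)

lemma tend_const_log (c : ℝ) : Tendsto (fun T => c / Real.log T) atTop (nhds 0) := Real.tendsto_log_atTop.const_div_atTop c

lemma MX_lim (τ : ℝ) (hτ : 0 < τ) : Tendsto (fun T => MX τ T / Real.log T) atTop (nhds τ) ∧ Tendsto (fun T => Real.log (XX τ T) / Real.log T) atTop (nhds τ) := by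
  have hup : Tendsto (fun T => τ + Real.log 3 / Real.log T) atTop (nhds τ) := by
    simpa using (tendsto_const_nhds (x := τ)).add (tend_const_log (Real.log 3))
  have hev : ∀ᶠ T : ℝ in atTop, τ ≤ Real.log (XX τ T) / Real.log T ∧ Real.log (XX τ T) / Real.log T ≤ MX τ T / Real.log T ∧ MX τ T / Real.log T ≤ τ + Real.log 3 / Real.log T := by
    filter_upwards [eventually_gt_atTop 1] with T hT
    have hl : 0 < Real.log T := Real.log_pos hT
    obtain ⟨a, b, c⟩ := MX_bounds τ hτ T hT.le
    refine ⟨(le_div_iff₀ hl).2 a, by gcongr, ?_⟩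
    rw [div_le_iff₀ hl, add_mul, div_mul_cancel₀ _ hl.ne']; exact c
  exact ⟨tendsto_of_tendsto_of_tendsto_of_le_of_le' tendsto_const_nhds hup (hev.mono fun T h => h.1.trans h.2.1) (hev.mono fun T h => h.2.2),
    tendsto_of_tendsto_of_tendsto_of_le_of_le' tendsto_const_nhds hup (hev.mono fun T h => h.1) (hev.mono fun T h => h.2.1.trans h.2.2)⟩

lemma T_div_log : Tendsto (fun T : ℝ => T / Real.log T) atTop atTop := by
  have h := Real.isLittleO_log_id_atTop.tendsto_div_nhds_zero
  have h2 : Tendsto (fun T : ℝ => Real.log T / T) atTop (nhdsWithin 0 (Set.Ioi 0)) := by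
    rw [tendsto_nhdsWithin_iff]
    refine ⟨h, ?_⟩
    filter_upwards [eventually_gt_atTop 1] with T hT
    have := Real.log_pos hT
    exact div_pos this (by linarith)
  have h3 := tendsto_inv_nhdsGT_zero.comp h2
  refine h3.congr fun T => ?_
  simp

lemma yL_tendsto (τ : ℝ) (hτ : 0 < τ) : Tendsto (yL τ) atTop atTop := by
  have h1 : Tendsto (fun T => (MX τ T / Real.log T)⁻¹ / (1 + rh ^ 2)) atTop (nhds (τ⁻¹ / (1 + rh ^ 2))) := ((MX_lim τ hτ).1.inv₀ hτ.ne').div_const _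
  have h2 := Tendsto.atTop_mul_pos (by positivity) T_div_log h1
  refine h2.congr' ?_
  filter_upwards [eventually_gt_atTop 1] with T hT
  have hl : 0 < Real.log T := Real.log_pos hT
  rw [yL, inv_div]
  field_simp

noncomputable def Flow (ε τ T : ℝ) : ℝ := (rh - 1 / LL τ T) * (1 - rh) * (rh - ε) * (LL τ T : ℝ) ^ 2 * Real.log (XX τ T) * Real.log T / T ^ 2

lemma Flow_lim (ε τ : ℝ) (hτ : 0 < τ) : Tendsto (Flow ε τ) atTop (nhds (rh * (1 - rh) * (rh - ε) / (1 + rh ^ 2) ^ 2 / τ)) := by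
  have hL : Tendsto (LL τ) atTop atTop := tendsto_nat_floor_atTop.comp (yL_tendsto τ hτ)
  have h1 : Tendsto (fun T => 1 / (LL τ T : ℝ)) atTop (nhds 0) := (tendsto_natCast_atTop_atTop.comp hL).const_div_atTop 1
  have h2 : Tendsto (fun T => (LL τ T : ℝ) / yL τ T) atTop (nhds 1) := tendsto_nat_floor_div_atTop.comp (yL_tendsto τ hτ)
  obtain ⟨h3, h4⟩ := MX_lim τ hτ
  have h5 : Tendsto (fun T => (rh - 1 / (LL τ T : ℝ)) * ((1 - rh) * (rh - ε) / (1 + rh ^ 2) ^ 2) * ((LL τ T : ℝ) / yL τ T) ^ 2 * (Real.log (XX τ T) / Real.log T) / (MX τ T / Real.log T) ^ 2) atTop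
      (nhds ((rh - 0) * ((1 - rh) * (rh - ε) / (1 + rh ^ 2) ^ 2) * 1 ^ 2 * τ / τ ^ 2)) :=
    ((((h1.const_sub rh).mul_const _).mul (h2.pow 2)).mul h4).div (h3.pow 2) (by positivity)
  have e : (rh - 0) * ((1 - rh) * (rh - ε) / (1 + rh ^ 2) ^ 2) * 1 ^ 2 * τ / τ ^ 2 = rh * (1 - rh) * (rh - ε) / (1 + rh ^ 2) ^ 2 / τ := by
    field_simp; ring
  rw [e] at h5
  refine h5.congr' ?_
  filter_upwards [eventually_gt_atTop 1] with T hT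
  have hl : 0 < Real.log T := Real.log_pos hT
  have hT0 : 0 < T := by linarith
  obtain ⟨a, b, c⟩ := MX_bounds τ hτ T hT.le
  have hM : 0 < MX τ T := lt_of_lt_of_le (by positivity) (a.trans b)
  rw [Flow, yL]
  generalize (rh - 1 / (LL τ T : ℝ)) = z
  field_simp

set_option maxHeartbeats 2000000 in
lemma low_one (ε : ℝ) (hε : 0 < ε) (hε2 : ε < 0.1) : ∀ᶠ n : ℕ in atTop,
    Flow ε (1 / (1 - rh - ε)) (Real.log n) ≤ Real.log (congCount 2 n) / ((Real.log n)^2 / Real.log (Real.log n)) := by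
  obtain ⟨hr1, hr2⟩ := rh_bds
  set τ := 1 / (1 - rh - ε) with hτd
  have hτ : 0 < τ := by rw [hτd]; apply one_div_pos.2; linarith
  have tT : Tendsto (fun n : ℕ => Real.log n) atTop atTop := Real.tendsto_log_atTop.comp tendsto_natCast_atTop_atTop
  filter_upwards [(((XX_tendsto τ hτ).comp tT).eventually (lnt ε hε)), ((yL_tendsto τ hτ).comp tT).eventually (eventually_ge_atTop 10), tT.eventually (eventually_gt_atTop 3), eventually_ge_atTop 1] with n hq hy hT hn
  simp only [Function.comp] at hq hy
  set T := Real.log n with hTd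
  set N := XX τ T with hN
  set L := LL τ T with hL
  obtain ⟨q, hqp, hq1, hq2, hq3⟩ := hq
  haveI : Fact q.Prime := ⟨hqp⟩
  have hT0 : 0 < T := by linarith
  have hl : 0 < Real.log T := Real.log_pos (by linarith)
  obtain ⟨a, b, c'⟩ := MX_bounds τ hτ T (by linarith)
  rw [← hN] at a b
  have hlN : 0 < Real.log N := lt_of_lt_of_le (by positivity) a
  have hM : 0 < MX τ T := hlN.trans_le b
  have hN0 : (0:ℝ) < N := by
    rcases Nat.eq_zero_or_pos N with h | h
    · rw [h] at hlN; simp at hlN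
    · exact_mod_cast h
  have hLy : (L:ℝ) ≤ yL τ T := Nat.floor_le (by linarith)
  have hL10 : 10 ≤ L := Nat.le_floor (by simpa using hy)
  have hL10' : (10:ℝ) ≤ L := by exact_mod_cast hL10
  have hM1 : 1 ≤ MX τ T := by
    have : 1 ≤ Real.log T := by
      rw [Real.le_log_iff_exp_le hT0]; have := Real.exp_one_lt_d9; linarith
    have h2 : 1 ≤ τ := by rw [hτd, le_div_iff₀ (by linarith)]; linarith
    nlinarith
  have hyM : yL τ T * ((1 + rh ^ 2) * MX τ T) = T := by rw [yL]; field_simp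
  have hLT : (L:ℝ) ≤ T := by
    have : (1:ℝ) ≤ (1 + rh ^ 2) * MX τ T := by nlinarith only [sq_nonneg rh, hM1, mul_nonneg (sq_nonneg rh) hM.le]
    have h5 : (0:ℝ) ≤ yL τ T := by linarith
    have h6 := mul_le_mul_of_nonneg_left this h5
    rw [hyM] at h6
    linarith
  have hTN : T ≤ (N:ℝ) ^ (1 - rh - ε) := by
    have h1 : T ^ τ ≤ N := Nat.le_ceil _
    have h2 := Real.rpow_le_rpow (by positivity) h1 (show 0 ≤ 1 - rh - ε by linarith)
    rw [← Real.rpow_mul hT0.le, hτd, one_div_mul_cancel (by linarith), Real.rpow_one] at h2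
    exact h2
  have hLpc : L ≤ (pc N q).card := by
    have : (L:ℝ) ≤ (pc N q).card := hLT.trans (hTN.trans hq3)
    exact_mod_cast this
  obtain ⟨S, hSs, hSc⟩ := Finset.exists_subset_card_eq hLpc
  haveI : PSet S := ⟨fun p hp => ((Finset.mem_filter.1 (hSs hp)).2).1⟩
  set c := ⌊rh * L⌋₊ with hc
  have hrL : (0.41:ℝ) * 10 ≤ rh * L := mul_le_mul hr1.le hL10' (by norm_num) (by linarith)
  have hc1 : (c:ℝ) ≤ rh * L := Nat.floor_le (by linarith)
  have hc2 : rh * L - 1 < c := Nat.sub_one_lt_floor _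
  have hcL : c ≤ L := by
    have : (c:ℝ) ≤ L := by nlinarith only [hc1, hr2, hL10']
    exact_mod_cast this
  have hq0 : (0:ℝ) < q := by exact_mod_cast hqp.pos
  have hlogq : Real.log q ≤ rh * MX τ T := by
    have := Real.log_le_log hq0 hq2
    rw [Real.log_rpow hN0] at this
    exact this.trans (mul_le_mul_of_nonneg_left b (by linarith))
  have hlogq2 : (rh - ε) * Real.log N ≤ Real.log q := by
    have := Real.log_le_log (by positivity) hq1
    rwa [Real.log_rpow hN0] at this
  have hsize : (∏ p ∈ S, (p + 1)) * q ^ c ≤ n := by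
    have h1 : ∏ p ∈ S, (p + 1) ≤ (N + 1) ^ L := by
      rw [← hSc]
      apply Finset.prod_le_pow_card
      intro p hp
      have := (Finset.mem_Icc.1 (Finset.mem_filter.1 (hSs hp)).1).2
      omega
    have h2 : ((N:ℝ) + 1) ^ L * (q:ℝ) ^ c ≤ n := by
      have hn' : (0:ℝ) < n := by exact_mod_cast hn
      rw [← Real.log_le_log_iff (by positivity) hn', Real.log_mul (by positivity) (by positivity), Real.log_pow, Real.log_pow]
      show (L:ℝ) * MX τ T + c * Real.log q ≤ T
      have g1 : (c:ℝ) * Real.log q ≤ (rh * L) * (rh * MX τ T) := mul_le_mul hc1 hlogq (by have := Real.log_natCast_nonneg q; exact this) (by linarith)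
      have g2 : (L:ℝ) * ((1 + rh ^ 2) * MX τ T) ≤ T := (mul_le_mul_of_nonneg_right hLy (by positivity)).trans_eq hyM
      nlinarith only [g1, g2]
    have h3 : (N + 1) ^ L * q ^ c ≤ n := by exact_mod_cast h2
    exact (Nat.mul_le_mul_right _ h1).trans h3
  have hcount := lower_count S q c n (fun p hp => ((Finset.mem_filter.1 (hSs hp)).2).2) (by rw [hSc]; exact hcL) hsize
  rw [hSc] at hcount
  have hlc : ((c * (L - c) : ℕ) : ℝ) * Real.log q ≤ Real.log (congCount 2 n) := by
    rw [← Real.log_pow]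
    exact Real.log_le_log (by positivity) (by exact_mod_cast hcount)
  rw [Nat.cast_mul, Nat.cast_sub hcL] at hlc
  have hfin : (rh - 1 / L) * (1 - rh) * (rh - ε) * (L:ℝ) ^ 2 * Real.log N ≤ Real.log (congCount 2 n) := by
    refine le_trans ?_ hlc
    have e : (rh - 1 / L) * (1 - rh) * (rh - ε) * (L:ℝ) ^ 2 * Real.log N = ((rh * L - 1) * ((1 - rh) * L)) * ((rh - ε) * Real.log N) := by field_simp
    rw [e]
    have hz : 0 ≤ rh * L - 1 := by linarith
    apply mul_le_mul _ hlogq2 (by have : 0 < rh - ε := by linarith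
                                  positivity) (by
      have : (c:ℝ) ≤ L := by exact_mod_cast hcL
      have : 0 ≤ (L:ℝ) - c := by linarith
      positivity)
    have hLc : (1 - rh) * L ≤ L - c := by linarith
    have : 0 ≤ 1 - rh := by linarith
    apply mul_le_mul hc2.le hLc (by positivity) (by positivity)
  rw [Flow, ← hL, ← hN, le_div_iff₀ (by positivity)]
  calc _ = (rh - 1 / L) * (1 - rh) * (rh - ε) * (L:ℝ) ^ 2 * Real.log N := by field_simp
    _ ≤ _ := hfin

theorem lower_final (δ : ℝ) (hδ : 0 < δ) : ∀ᶠ n : ℕ in atTop, (3 - 2 * Real.sqrt 2) / 4 - δ ≤ Real.log (congCount 2 n) / ((Real.log n)^2 / Real.log (Real.log n)) := by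
  obtain ⟨hr1, hr2⟩ := rh_bds
  have hcont : Tendsto (fun ε : ℝ => rh * (1 - rh) * (rh - ε) / (1 + rh ^ 2) ^ 2 / (1 / (1 - rh - ε))) (nhdsWithin 0 (Set.Ioi 0)) (nhds ((3 - 2 * Real.sqrt 2) / 4)) := by
    have h : Tendsto (fun ε : ℝ => rh * (1 - rh) * (rh - ε) / (1 + rh ^ 2) ^ 2 * (1 - rh - ε)) (nhds 0) (nhds (rh * (1 - rh) * (rh - 0) / (1 + rh ^ 2) ^ 2 * (1 - rh - 0))) := by
      apply Continuous.tendsto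
      fun_prop
    have e : rh * (1 - rh) * (rh - 0) / (1 + rh ^ 2) ^ 2 * (1 - rh - 0) = (3 - 2 * Real.sqrt 2) / 4 := by
      rw [← rh_kap]
      have h1 : 1 + rh ^ 2 = 2 * (1 - rh) := by rw [rh_sq]; ring
      have h2 : 1 - rh ≠ 0 := by linarith
      rw [h1]; field_simp; ring
    rw [e] at h
    refine (h.mono_left nhdsWithin_le_nhds).congr fun ε => ?_
    rw [div_div_eq_mul_div, div_one]
  have hev := hcont.eventually (lt_mem_nhds (show (3 - 2 * Real.sqrt 2) / 4 - δ < (3 - 2 * Real.sqrt 2) / 4 by linarith))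
  have hev2 : ∀ᶠ ε : ℝ in nhdsWithin 0 (Set.Ioi 0), 0 < ε ∧ ε < 0.1 := by
    have : Set.Ioo (0:ℝ) 0.1 ∈ nhdsWithin (0:ℝ) (Set.Ioi 0) := Ioo_mem_nhdsGT (by norm_num)
    filter_upwards [this] with ε h using h
  obtain ⟨ε, h1, h2, h3⟩ := (hev.and hev2).exists
  have tT : Tendsto (fun n : ℕ => Real.log n) atTop atTop := Real.tendsto_log_atTop.comp tendsto_natCast_atTop_atTop
  have hF := (Flow_lim ε (1 / (1 - rh - ε)) (by apply one_div_pos.2; linarith)).comp tT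
  filter_upwards [hF.eventually (lt_mem_nhds h1), low_one ε h2 h3] with n a b
  exact a.le.trans b

end CG

theorem congruence_growth_SL2 :
    Tendsto
      (fun n : ℕ => Real.log (congCount 2 n) / ((Real.log n) ^ 2 / Real.log (Real.log n)))
      atTop (nhds ((3 - 2 * Real.sqrt 2) / 4)) := by
  rw [tendsto_order]
  constructor
  · intro a ha
    filter_upwards [CG.lower_final (((3 - 2 * Real.sqrt 2) / 4 - a) / 2) (by linarith)] with n hn
    linarith
  · intro a ha
    filter_upwards [CG.upper_final ((a - (3 - 2 * Real.sqrt 2) / 4) / 2) (by linarith)] with n hn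
    rw [CG.kap] at hn
    linarith
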